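/- Let h(−2p) denote the class number of the imaginary quadratic field ℚ(√(−2p)). Then the limit as X → ∞ of #{p ≤ X : p prime, p ≡ 15 (mod 32), 8 ∥ h(−2p)} / #{p ≤ X : p prime, p ≡ 15 (mod 32)} equals 1/2, and likewise the limit as X → ∞ of #{p ≤ X : p prime, p ≡ 31 (mod 32), 8 ∥ h(−2p)} / #{p ≤ X : p prime, p ≡ 31 (mod 32)} equals 1/2. -/

import Mathlib

section

open scoped NumberTheorySymbols

/-- Group theory: kernel of a sign character is the squares, when the 2-torsion has two elements. -/
theorem ker_eq_sq {G : Type*} [CommGroup G] [Finite G] (t : G)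
    (ht2 : ∀ g : G, g ^ 2 = 1 → g = 1 ∨ g = t) (χ : G →* ℤˣ) (hχ : ∃ q, χ q = -1)
    (g : G) (hg : χ g = 1) : ∃ k : G, k ^ 2 = g := by
  classical
  let sq : G →* G := powMonoidHom 2
  have h1 : sq.range ≤ χ.ker := by
    rintro _ ⟨y, rfl⟩
    simp [sq, MonoidHom.mem_ker]
  have hk : Nat.card sq.ker ≤ 2 := by
    have : (sq.ker : Set G) ⊆ ({1, t} : Finset G) := by
      intro x hx
      have : x ^ 2 = 1 := hx
      simpa using ht2 x this
    calc Nat.card sq.ker = (sq.ker : Set G).ncard := rfl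
      _ ≤ (({1, t} : Finset G) : Set G).ncard := Set.ncard_le_ncard this (Finset.finite_toSet _)
      _ ≤ 2 := by rw [Set.ncard_coe_finset]; exact Finset.card_le_two
  have hi : χ.ker.index = 2 := by
    rw [Subgroup.index_ker]
    have : χ.range = ⊤ := by
      rw [eq_top_iff]
      intro x _
      obtain ⟨q, hq⟩ := hχ
      rcases Int.units_eq_one_or x with rfl | rfl
      · exact one_mem _
      · exact ⟨q, hq⟩
    rw [this]
    simp
  have e1 : Nat.card sq.range * Nat.card sq.ker = Nat.card G := by
    have := Subgroup.card_mul_index sq.ker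
    rw [Subgroup.index_ker] at this
    rw [mul_comm]; exact this
  have e2 : Nat.card χ.ker * 2 = Nat.card G := by
    rw [← hi]; exact Subgroup.card_mul_index _
  have : Nat.card χ.ker ≤ Nat.card sq.range := by
    have : Nat.card χ.ker * 2 ≤ Nat.card sq.range * 2 := by
      rw [e2, ← e1]; gcongr
    omega
  have h2 : sq.range = χ.ker := Subgroup.eq_of_le_of_card_ge h1 this
  have : g ∈ sq.range := by rw [h2]; exact hg
  exact this

theorem group_crit {G : Type*} [CommGroup G] [Finite G] (t : G) (ht : t ≠ 1) (htt : t ^ 2 = 1)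
    (ht2 : ∀ g : G, g ^ 2 = 1 → g = 1 ∨ g = t) (χ : G →* ℤˣ) (hχ : ∃ q, χ q = -1)
    (g1 g2 : G) (h1 : g1 ^ 2 = t) (h2 : g2 ^ 2 = g1) :
    8 ∣ Nat.card G ∧ (16 ∣ Nat.card G ↔ χ g2 = 1) := by
  have o2 : g2 ^ 8 = 1 := by
    rw [show 8 = 2 * 2 * 2 from rfl, pow_mul, pow_mul, h2, h1, htt]
  have o8 : orderOf g2 = 2 ^ (2 + 1) := by
    apply orderOf_eq_prime_pow
    · rw [show 2 ^ 2 = 2 * 2 from rfl, pow_mul, h2, h1]; exact ht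
    · exact o2
  refine ⟨by have := orderOf_dvd_natCard g2; rw [o8] at this; exact this, ?_, ?_⟩
  · intro h16
    by_contra hne
    have hneg : χ g2 = -1 := (Int.units_eq_one_or _).resolve_left hne
    -- G = ⟨g2⟩ G^(2^j)
    have key : ∀ (j : ℕ) (x : G), ∃ (i : ℕ) (y : G), x = g2 ^ i * y ^ (2 ^ j) := by
      intro j
      induction j with
      | zero => intro x; exact ⟨0, x, by simp⟩
      | succ j ih =>
        intro x
        obtain ⟨i, y, rfl⟩ := ih x
        rcases Int.units_eq_one_or (χ y) with hy | hy
        · obtain ⟨k, rfl⟩ := ker_eq_sq t ht2 χ hχ y hy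
          exact ⟨i, k, by rw [← pow_mul, pow_succ']⟩
        · obtain ⟨k, hk⟩ := ker_eq_sq t ht2 χ hχ (g2⁻¹ * y) (by simp [hneg, hy])
          refine ⟨i + 2 ^ j, k, ?_⟩
          have : y = g2 * k ^ 2 := by rw [hk]; group
          rw [this, mul_pow, pow_add, ← pow_mul, pow_succ', mul_assoc]
    obtain ⟨k, m, hm, hn⟩ := Nat.exists_eq_two_pow_mul_odd (n := Nat.card G) Nat.card_pos.ne'
    let pw : G →* G := powMonoidHom (2 ^ k)
    have hodd : Odd (Nat.card pw.range) := by
      by_contra hev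
      rw [Nat.not_odd_iff_even, even_iff_two_dvd] at hev
      obtain ⟨⟨_, y, rfl⟩, hx⟩ := exists_prime_orderOf_dvd_card' (G := pw.range) 2 hev
      have hx2 : orderOf (pw y) = 2 := by rw [← hx]; exact (Subgroup.orderOf_mk _ _).symm
      have : (pw y) ^ m = 1 := by
        change (y ^ (2 ^ k)) ^ m = 1
        rw [← pow_mul, ← hn]; exact pow_card_eq_one'
      have := orderOf_dvd_of_pow_eq_one this
      rw [hx2] at this
      exact (Nat.not_even_iff_odd.2 hm) (even_iff_two_dvd.2 this)
    have hidx : Nat.card pw.range * pw.range.index = Nat.card G := Subgroup.card_mul_index _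
    have h16i : 16 ∣ pw.range.index := by
      have : Nat.Coprime 16 (Nat.card pw.range) := by
        rw [show 16 = 2 ^ 4 from rfl]
        exact Nat.Coprime.pow_left _ ((Nat.coprime_two_left).2 hodd)
      exact this.dvd_of_dvd_mul_left (by rw [hidx]; exact h16)
    have hle : pw.range.index ≤ 8 := by
      have hs : Function.Surjective (fun i : Fin 8 => (QuotientGroup.mk (g2 ^ (i : ℕ)) : G ⧸ pw.range)) := by
        intro q
        obtain ⟨x, rfl⟩ := QuotientGroup.mk_surjective q
        obtain ⟨i, y, rfl⟩ := key k x
        refine ⟨⟨i % 8, Nat.mod_lt _ (by norm_num)⟩, ?_⟩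
        simp only
        rw [QuotientGroup.eq]
        refine ⟨y, ?_⟩
        change y ^ (2 ^ k) = _
        have : g2 ^ i = g2 ^ (i % 8) := by
          conv_lhs => rw [← Nat.mod_add_div i 8, pow_add, pow_mul, o2, one_pow, mul_one]
        rw [this]; group
      have := Nat.card_le_card_of_surjective _ hs
      simpa [Subgroup.index] using this
    have hpos : 0 < pw.range.index := Nat.pos_of_ne_zero Subgroup.FiniteIndex.index_ne_zero
    have := Nat.le_of_dvd hpos h16i
    omega
  · intro h
    obtain ⟨g3, hg3⟩ := ker_eq_sq t ht2 χ hχ g2 h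
    have o16 : orderOf g3 = 2 ^ (3 + 1) := by
      apply orderOf_eq_prime_pow
      · rw [show 2 ^ 3 = 2 * 2 * 2 from rfl, pow_mul, pow_mul, hg3, h2, h1]; exact ht
      · rw [show 2 ^ (3 + 1) = 2 * 8 from rfl, pow_mul, hg3, o2]
    have := orderOf_dvd_natCard g3; rw [o16] at this; exact this

theorem chi8_of_sq (a b : ℕ) (ha : a % 2 = 1) (hb : b % 2 = 1) (h : (a ^ 2) % 16 = (b ^ 2) % 16) :
    J(2 | a) = J(2 | b) := by
  rw [jacobiSym.at_two (Nat.odd_iff.2 ha), jacobiSym.at_two (Nat.odd_iff.2 hb)]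
  rw [ZMod.χ₈_nat_eq_if_mod_eight, ZMod.χ₈_nat_eq_if_mod_eight]
  rw [Nat.pow_mod, Nat.pow_mod b] at h
  have h1 := Nat.mod_lt a (show 0 < 16 by norm_num)
  have h2 := Nat.mod_lt b (show 0 < 16 by norm_num)
  have e1 : a % 8 = (a % 16) % 8 := by omega
  have e2 : b % 8 = (b % 16) % 8 := by omega
  have e3 : a % 2 = (a % 16) % 2 := by omega
  have e4 : b % 2 = (b % 16) % 2 := by omega
  rw [e1, e2, e3, e4]
  rw [e3] at ha
  rw [e4] at hb
  generalize a % 16 = x at *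
  generalize b % 16 = y at *
  clear e1 e2 e3 e4
  interval_cases x <;> first | omega | (interval_cases y <;> omega)

theorem jac_sq_one {a : ℤ} {n : ℕ} (h : a.gcd n = 1) : J(a | n) * J(a | n) = 1 := by
  rcases jacobiSym.eq_one_or_neg_one h with h | h <;> rw [h] <;> norm_num

theorem jac_natAbs_left {a : ℤ} {n : ℕ} (h : n % 4 = 1) : J((a.natAbs : ℤ) | n) = J(a | n) := by
  rcases Int.natAbs_eq a with h1 | h1
  · rw [← h1]
  · conv_rhs => rw [h1]
    rw [jacobiSym.neg _ (Nat.odd_iff.2 (by omega)), ZMod.χ₄_nat_one_mod_four h, one_mul]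

theorem gcd_one_of_coprime {a b : ℤ} (h : IsCoprime a b) : a.gcd (b.natAbs : ℤ) = 1 := by
  have := Int.isCoprime_iff_gcd_eq_one.1 h
  rw [Int.gcd, Int.natAbs_natCast]; exact this

theorem jac_dvd {a b : ℤ} {n : ℤ} (h : n ∣ a - b) : J(a | n.natAbs) = J(b | n.natAbs) := by
  apply jacobiSym.mod_left'
  apply Int.ModEq.symm
  exact Int.modEq_iff_dvd.2 (Int.natAbs_dvd.2 h)

/-- Number theory core. -/
theorem jac_core (u v s y z : ℤ) (hu : 0 < u) (hu16 : u % 16 = 1) (hv : v % 2 = 1)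
    (h : z ^ 2 = u * s ^ 2 + 4 * v * s * y + 2 * u * y ^ 2) (hsy : IsCoprime s y) (hz : z % 2 = 1)
    (hzu : IsCoprime z u) (huv : IsCoprime u v) :
    J(2 | z.natAbs) = J(v | u.natAbs) := by
  have hs2 : s % 2 = 1 := by
    rcases Int.emod_two_eq_zero_or_one s with hs | hs
    · exfalso
      obtain ⟨s', rfl⟩ := Int.dvd_of_emod_eq_zero hs
      have : z ^ 2 % 2 = 0 := by
        rw [h]; apply Int.emod_eq_zero_of_dvd
        exact ⟨2 * u * s' ^ 2 + 4 * v * s' * y + u * y ^ 2, by ring⟩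
      rw [pow_two, Int.mul_emod, hz] at this; norm_num at this
    · exact hs
  obtain ⟨z', rfl⟩ : ∃ z', z = 2 * z' + 1 := ⟨z / 2, by omega⟩
  obtain ⟨s', rfl⟩ : ∃ s', s = 2 * s' + 1 := ⟨s / 2, by omega⟩
  obtain ⟨v', rfl⟩ : ∃ v', v = 2 * v' + 1 := ⟨v / 2, by omega⟩
  obtain ⟨u', rfl⟩ : ∃ u', u = 16 * u' + 1 := ⟨u / 16, by omega⟩
  have hz8 := Int.even_mul_succ_self z'
  have hs8 := Int.even_mul_succ_self s'
  obtain ⟨z8, hz8⟩ := hz8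
  obtain ⟨s8, hs8⟩ := hs8
  have hy2 : y % 2 = 0 := by
    rcases Int.emod_two_eq_zero_or_one y with hs | hs
    · exact hs
    · exfalso
      obtain ⟨y', rfl⟩ : ∃ s', y = 2 * s' + 1 := ⟨y / 2, by omega⟩
      have : (8 : ℤ) ∣ 6 := by
        refine ⟨z8 - s8 - 2 * u' * (2 * s' + 1) ^ 2 - ((2 * v' + 1) * (2 * s' + 1) * y' + 2 * v' * s' + v' + s') - 4 * u' * (2 * y' + 1) ^ 2 - (y' ^ 2 + y'), ?_⟩
        linear_combination -h + 4 * hz8 - 4 * hs8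
      norm_num at this
  obtain ⟨y', rfl⟩ := Int.dvd_of_emod_eq_zero hy2
  have h16 : (16 : ℤ) ∣ (2 * z' + 1) ^ 2 - (2 * s' + 1) ^ 2 := by
    obtain ⟨k, hk⟩ : Even (y' * (1 + y')) := by
      have := Int.even_mul_succ_self y'; rwa [add_comm] at this
    refine ⟨u' * (2 * s' + 1) ^ 2 + k + v' * y' * (2 * s' + 1) + s' * y' + 8 * u' * y' ^ 2, ?_⟩
    linear_combination h + 8 * hk
  set z := 2 * z' + 1
  set s := 2 * s' + 1
  set v := 2 * v' + 1
  set u := 16 * u' + 1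
  set y := 2 * y'
  have hU4 : u.natAbs % 4 = 1 := by omega
  have hU8 : u.natAbs % 8 = 1 := by omega
  have hS : s.natAbs % 2 = 1 := by omega
  have hUu : (u.natAbs : ℤ) = u := Int.natAbs_of_nonneg hu.le
  have e1 : J(2 | z.natAbs) = J(2 | s.natAbs) := by
    apply chi8_of_sq _ _ (by omega) hS
    have : (z ^ 2) % 16 = (s ^ 2) % 16 := (Int.modEq_iff_dvd.2 h16).symm
    zify
    simpa using this
  have hus : IsCoprime u s := by
    have h1 : IsCoprime u (z ^ 2) := hzu.symm.pow_right
    rw [show z ^ 2 = s * (4 * v * y) + u * (s ^ 2 + 2 * y ^ 2) by rw [h]; ring] at h1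
    exact (IsCoprime.of_add_mul_left_right h1).of_mul_right_left
  have huvy : IsCoprime u (4 * v * s * y) := by
    have h1 : IsCoprime u (z ^ 2) := hzu.symm.pow_right
    rw [show z ^ 2 = 4 * v * s * y + u * (s ^ 2 + 2 * y ^ 2) by rw [h]; ring] at h1
    exact (IsCoprime.of_add_mul_left_right h1)
  have huy : IsCoprime u y := huvy.of_mul_right_right
  have hzs : IsCoprime z s := by
    have c2 : IsCoprime s (2 : ℤ) := ⟨1, -s', by simp [s]; ring⟩
    have h2 : IsCoprime s (2 * u * y ^ 2) := (c2.mul_right hus.symm).mul_right hsy.pow_right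
    have h3 : IsCoprime s (z ^ 2) := by
      rw [show z ^ 2 = 2 * u * y ^ 2 + s * (u * s + 4 * v * y) by rw [h]; ring]
      exact h2.add_mul_left_right _
    exact ((IsCoprime.pow_right_iff (by norm_num)).1 h3).symm
  have e2 : J(2 | s.natAbs) * J(u | s.natAbs) = 1 := by
    have a1 : J(z ^ 2 | s.natAbs) = J(2 * u * y ^ 2 | s.natAbs) :=
      jac_dvd ⟨u * s + 4 * v * y, by rw [h]; ring⟩
    rw [jacobiSym.mul_left, jacobiSym.mul_left, pow_two, pow_two, jacobiSym.mul_left,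
      jacobiSym.mul_left, jac_sq_one (gcd_one_of_coprime hzs),
      jac_sq_one (gcd_one_of_coprime hsy.symm), mul_one] at a1
    exact a1.symm
  have e3 : J(u | s.natAbs) = J(s | u.natAbs) := by
    rw [← jac_natAbs_left hU4]
    conv_lhs => rw [← hUu]
    exact jacobiSym.quadratic_reciprocity_one_mod_four hU4 (Nat.odd_iff.2 hS)
  have h2U : J(2 | u.natAbs) = 1 := by
    rw [jacobiSym.at_two (Nat.odd_iff.2 (by omega)), ZMod.χ₈_nat_eq_if_mod_eight]
    simp [hU8]; omega
  have e4 : J(v | u.natAbs) * J(s | u.natAbs) * J(y | u.natAbs) = 1 := by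
    have a1 : J(z ^ 2 | u.natAbs) = J(2 * 2 * v * s * y | u.natAbs) :=
      jac_dvd ⟨s ^ 2 + 2 * y ^ 2, by rw [h]; ring⟩
    rw [jacobiSym.mul_left, jacobiSym.mul_left, jacobiSym.mul_left, jacobiSym.mul_left, pow_two,
      jacobiSym.mul_left, jac_sq_one (gcd_one_of_coprime hzu), h2U] at a1
    rw [a1]; ring
  have e5 : J(y | u.natAbs) = 1 := by
    rcases eq_or_ne y 0 with hy | hy
    · have : u.natAbs = 1 := by
        rw [hy, isCoprime_zero_right, Int.isUnit_iff_natAbs_eq] at huy; exact huy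
      rw [this]; simp
    · obtain ⟨k, m, hm, hn⟩ := Nat.exists_eq_two_pow_mul_odd (n := y.natAbs) (by simpa using hy)
      have hmy : (m : ℤ) ∣ y := by
        rw [Int.natCast_dvd, hn]; exact dvd_mul_left _ _
      rw [← jac_natAbs_left hU4, hn]
      push_cast
      rw [jacobiSym.mul_left, jacobiSym.pow_left, h2U, one_pow, one_mul]
      rw [← jacobiSym.quadratic_reciprocity_one_mod_four hU4 hm, hUu]
      have a1 : J(z ^ 2 | (m : ℤ).natAbs) = J(u * s ^ 2 | (m : ℤ).natAbs) := by
        apply jac_dvd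
        refine hmy.trans ⟨4 * v * s + 2 * u * y, by rw [h]; ring⟩
      have hsm : IsCoprime s (m : ℤ) := hsy.of_isCoprime_of_dvd_right hmy
      have hzm : IsCoprime z (m : ℤ) := by
        have h3 : IsCoprime y (z ^ 2) := by
          rw [show z ^ 2 = u * s ^ 2 + y * (4 * v * s + 2 * u * y) by rw [h]; ring]
          exact (huy.symm.mul_right hsy.symm.pow_right).add_mul_left_right _
        have := ((IsCoprime.pow_right_iff (by norm_num)).1 h3).symm
        exact this.of_isCoprime_of_dvd_right hmy
      rw [jacobiSym.mul_left, pow_two, pow_two, jacobiSym.mul_left,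
        jacobiSym.mul_left, jac_sq_one (gcd_one_of_coprime hzm),
        jac_sq_one (gcd_one_of_coprime hsm), mul_one] at a1
      simpa using a1.symm
  rw [e5, mul_one] at e4
  rw [e3] at e2
  rw [e1]
  have := jac_sq_one (gcd_one_of_coprime hus.symm)
  calc J(2 | s.natAbs) = J(2 | s.natAbs) * (J(s | u.natAbs) * J(s | u.natAbs)) := by rw [this, mul_one]
    _ = J(v | u.natAbs) * J(s | u.natAbs) * J(s | u.natAbs) := by rw [← mul_assoc, e2, e4]
    _ = _ := by rw [mul_assoc, this, mul_one]

end

section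

open scoped NumberTheorySymbols nonZeroDivisors

namespace CN

/-- Coordinates on `ℤ√d`. -/
def zLin (d : ℤ) : ℤ√d ≃ₗ[ℤ] (Fin 2 → ℤ) where
  toFun x := ![x.re, x.im]
  invFun f := ⟨f 0, f 1⟩
  map_add' x y := by ext i; fin_cases i <;> simp
  map_smul' c x := by ext i; fin_cases i <;> simp
  left_inv x := by ext <;> simp
  right_inv f := by ext i; fin_cases i <;> simp

noncomputable def zBasis (d : ℤ) : Module.Basis (Fin 2) ℤ (ℤ√d) := Module.Basis.ofEquivFun (zLin d)

instance (d : ℤ) : Module.Free ℤ (ℤ√d) := Module.Free.of_basis (zBasis d)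
instance (d : ℤ) : Module.Finite ℤ (ℤ√d) := Module.Finite.of_basis (zBasis d)

theorem algNorm (d : ℤ) (x : ℤ√d) : Algebra.norm ℤ x = x.norm := by
  rw [Algebra.norm_eq_matrix_det (zBasis d), Matrix.det_fin_two]
  have h0 : zBasis d 0 = ⟨1, 0⟩ := by
    ext <;> simp [zBasis, zLin]
  have h1 : zBasis d 1 = ⟨0, 1⟩ := by
    ext <;> simp [zBasis, zLin]
  simp only [Algebra.leftMulMatrix_eq_repr_mul, h0, h1]
  simp [zBasis, zLin, Zsqrtd.norm_def]

theorem oddpart (p : ℕ) (hp : p % 8 = 7) : ∀ (n : ℕ), n ≠ 0 → ∀ x y : ℤ, (n : ℤ) = x ^ 2 + 2 * p * y ^ 2 →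
    ZMod.χ₈ ((ordCompl[2] n : ℕ) : ZMod 8) = 1 := by
  intro n
  induction n using Nat.strong_induction_on with
  | _ n ih =>
  intro hn x y h
  obtain ⟨q, hq⟩ : ∃ q : ℤ, (p : ℤ) = 8 * q + 7 := ⟨p / 8, by omega⟩
  have odd1 : ∀ m : ℕ, (m % 8 = 1 ∨ m % 8 = 7) → ZMod.χ₈ ((ordCompl[2] m : ℕ) : ZMod 8) = 1 := by
    intro m hm
    rw [Nat.factorization_eq_zero_of_not_dvd (by omega), pow_zero, Nat.div_one, ZMod.χ₈_nat_eq_if_mod_eight]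
    rw [if_neg (by omega), if_pos hm]
  have two : ∀ m : ℕ, ordCompl[2] (2 * m) = ordCompl[2] m := by
    intro m
    rw [Nat.ordCompl_mul]
    simp [Nat.Prime.factorization_self Nat.prime_two]
  rcases Int.even_or_odd' x with ⟨x', rfl | rfl⟩
  · rcases Int.even_or_odd' y with ⟨y', rfl | rfl⟩
    · obtain ⟨m, rfl⟩ : ∃ m, n = 2 * (2 * m) := ⟨n / 4, by
        have : (4 : ℤ) ∣ n := ⟨x' ^ 2 + 2 * p * y' ^ 2, by rw [h]; ring⟩
        omega⟩
      rw [two, two]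
      apply ih m (by omega) (by omega) x' y'
      push_cast at h
      linarith
    · obtain ⟨m, rfl⟩ : ∃ m, n = 2 * m := ⟨n / 2, by
        have : (2 : ℤ) ∣ n := ⟨2 * x' ^ 2 + p * (2 * y' + 1) ^ 2, by rw [h]; ring⟩
        omega⟩
      rw [two]
      apply odd1
      have h2 : (m : ℤ) = 2 * x' ^ 2 + p * (2 * y' + 1) ^ 2 := by push_cast at h; linarith
      obtain ⟨k, hk⟩ := Int.even_mul_succ_self y'
      rcases Int.even_or_odd' x' with ⟨x1, rfl | rfl⟩
      · right
        have : (m : ℤ) = 8 * (x1 ^ 2 + q + (8 * q + 7) * k) + 7 := by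
          rw [h2, hq]; linear_combination 4 * (8 * q + 7) * hk
        omega
      · left
        have : (m : ℤ) = 8 * (x1 ^ 2 + x1 + q + 1 + (8 * q + 7) * k) + 1 := by
          rw [h2, hq]; linear_combination 4 * (8 * q + 7) * hk
        omega
  · apply odd1
    obtain ⟨k, hk⟩ := Int.even_mul_succ_self x'
    rcases Int.even_or_odd' y with ⟨y', rfl | rfl⟩
    · left
      have : (n : ℤ) = 8 * (k + p * y' ^ 2) + 1 := by rw [h]; linear_combination 4 * hk
      omega
    · right
      have : (n : ℤ) = 8 * (k + p * (y' ^ 2 + y') + 2 * q + 1) + 7 := by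
        rw [h]; linear_combination 4 * hk + 2 * hq
      omega

section
variable {p : ℕ} (hp : p.Prime) (hp8 : p % 8 = 7) {d : ℤ} (hd : d = -(2 * p : ℤ))
  [IsDedekindDomain (ℤ√d)]

/-- the genus character on ideals -/
noncomputable def cc (I : Ideal (ℤ√d)) : ℤ := ZMod.χ₈ ((ordCompl[2] (Ideal.absNorm I) : ℕ) : ZMod 8)

theorem cc_mul (I J : Ideal (ℤ√d)) : cc (I * J) = cc I * cc J := by
  unfold cc
  rw [map_mul, Nat.ordCompl_mul, Nat.cast_mul, map_mul]

theorem absNorm_span (hd : d = -(2 * p : ℤ)) (x : ℤ√d) : (Ideal.absNorm (Ideal.span {x}) : ℤ) = x.re ^ 2 + 2 * p * x.im ^ 2 := by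
  have e : x.norm = x.re ^ 2 + 2 * p * x.im ^ 2 := by
    rw [Zsqrtd.norm_def]; linear_combination (-x.im * x.im) * hd
  rw [Ideal.absNorm_span_singleton, algNorm, Int.natAbs_of_nonneg, e]
  rw [e]; positivity

theorem cc_span (hp8 : p % 8 = 7) (hd : d = -(2 * p : ℤ)) (x : ℤ√d) (hx : x ≠ 0) : cc (Ideal.span {x}) = 1 := by
  apply oddpart p hp8 _ _ x.re x.im (absNorm_span hd x)
  rw [Ne, Ideal.absNorm_eq_zero_iff, Ideal.span_singleton_eq_bot]; exact hx

theorem cc_unit (I : Ideal (ℤ√d)) (hI : I ≠ ⊥) : IsUnit (cc I) := by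
  have h0 : Ideal.absNorm I ≠ 0 := by rwa [Ne, Ideal.absNorm_eq_zero_iff]
  have h1 : ¬ 2 ∣ ordCompl[2] (Ideal.absNorm I) := Nat.not_dvd_ordCompl Nat.prime_two h0
  unfold cc
  rw [ZMod.χ₈_nat_eq_if_mod_eight, if_neg (by omega)]
  split_ifs <;> simp

noncomputable def FF : (Ideal (ℤ√d))⁰ →* ℤˣ where
  toFun I := (cc_unit I.1 (nonZeroDivisors.coe_ne_zero I)).unit
  map_one' := by
    ext; simp [cc]
  map_mul' I J := by
    ext; simp [cc_mul]

theorem FF_val (I : (Ideal (ℤ√d))⁰) : (FF I : ℤ) = cc I.1 := rfl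

theorem FF_class (hp8 : p % 8 = 7) (hd : d = -(2 * p : ℤ)) {I J : (Ideal (ℤ√d))⁰} (h : ClassGroup.mk0 I = ClassGroup.mk0 J) : FF I = FF J := by
  obtain ⟨x, y, hx, hy, hxy⟩ := ClassGroup.mk0_eq_mk0_iff.1 h
  ext
  rw [FF_val, FF_val]
  have := congrArg cc hxy
  rwa [cc_mul, cc_mul, cc_span hp8 hd x hx, cc_span hp8 hd y hy, one_mul, one_mul] at this

theorem exists_chi (hp8 : p % 8 = 7) (hd : d = -(2 * p : ℤ)) : ∃ χ : ClassGroup (ℤ√d) →* ℤˣ,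
    ∀ I : (Ideal (ℤ√d))⁰, χ (ClassGroup.mk0 I) = FF I := by
  choose r hr using (ClassGroup.mk0_surjective (R := ℤ√d))
  refine ⟨MonoidHom.mk' (fun g => FF (r g)) ?_, ?_⟩
  · intro a b
    rw [← map_mul]
    apply FF_class hp8 hd
    rw [map_mul, hr, hr, hr]
  · intro I
    exact FF_class hp8 hd (hr _)

end
end CN

end

section

set_option linter.unusedSectionVars false
set_option linter.unusedVariables false
set_option linter.unusedSimpArgs false
open scoped NumberTheorySymbols nonZeroDivisors

namespace CN
section
variable {p : ℕ} {d : ℤ} [IsDedekindDomain (ℤ√d)]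

theorem sqrtd_sq (hd : d = -(2 * p : ℤ)) : (Zsqrtd.sqrtd : ℤ√d) * Zsqrtd.sqrtd = -(2 * (p : ℤ√d)) := by
  rw [Zsqrtd.dmuld]
  rw [show ((d : ℤ) : ℤ√d) = ((-(2 * p : ℤ) : ℤ) : ℤ√d) from congrArg _ hd]
  push_cast; ring

/-- the ramified prime over 2 -/
def tt (d : ℤ) : Ideal (ℤ√d) := Ideal.span {2, Zsqrtd.sqrtd}

theorem tt_sq (hd : d = -(2 * p : ℤ)) (hp2 : p % 2 = 1) : tt d * tt d = Ideal.span {2} := by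
  have hw := sqrtd_sq hd
  rw [tt, Ideal.span_pair_mul_span_pair]
  apply le_antisymm
  · rw [Ideal.span_le]
    intro x hx
    simp only [Set.mem_insert_iff, Set.mem_singleton_iff] at hx
    rw [SetLike.mem_coe, Ideal.mem_span_singleton]
    rcases hx with rfl | rfl | rfl | rfl
    · exact dvd_mul_right _ _
    · exact dvd_mul_right _ _
    · exact dvd_mul_left _ _
    · rw [hw]; exact ⟨-p, by ring⟩
  · rw [Ideal.span_singleton_le_iff_mem]
    obtain ⟨q, hq⟩ : ∃ q, p = 2 * q + 1 := ⟨p / 2, by omega⟩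
    have h4 : (2 * 2 : ℤ√d) ∈ Ideal.span {(2 * 2 : ℤ√d), 2 * Zsqrtd.sqrtd, Zsqrtd.sqrtd * 2, Zsqrtd.sqrtd * Zsqrtd.sqrtd} :=
      Ideal.subset_span (by simp)
    have hp : (Zsqrtd.sqrtd * Zsqrtd.sqrtd : ℤ√d) ∈ Ideal.span {(2 * 2 : ℤ√d), 2 * Zsqrtd.sqrtd, Zsqrtd.sqrtd * 2, Zsqrtd.sqrtd * Zsqrtd.sqrtd} :=
      Ideal.subset_span (by simp)
    have := Ideal.add_mem _ (Ideal.mul_mem_left _ (-q : ℤ√d) h4) (Ideal.mul_mem_left _ (-1 : ℤ√d) hp)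
    convert this using 1
    rw [hw, hq]; push_cast; ring

theorem two_ne : (2 : ℤ√d) ≠ 0 := by
  intro h; have := congrArg Zsqrtd.re h; simp at this

theorem natCast_ne {n : ℕ} (hn : n ≠ 0) : (n : ℤ√d) ≠ 0 := by
  intro h; have := congrArg Zsqrtd.re h; simp at this; exact hn this

theorem tt_ne (hd : d = -(2 * p : ℤ)) (hp2 : p % 2 = 1) : tt d ≠ ⊥ := by
  intro h
  have := tt_sq hd hp2
  rw [h, Ideal.mul_bot, eq_comm, Ideal.span_singleton_eq_bot] at this
  exact two_ne this

theorem tt_not_principal (hd : d = -(2 * p : ℤ)) (hp2 : p % 2 = 1) (hp1 : p ≠ 1) : ¬ (tt d).IsPrincipal := by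
  intro ⟨x, hx⟩
  have h1 := tt_sq hd hp2
  have h1 := congrArg Ideal.absNorm h1
  rw [map_mul, hx] at h1
  have h2 := absNorm_span hd x
  have h3 := absNorm_span hd 2
  change Ideal.absNorm (Ideal.span {x}) * Ideal.absNorm (Ideal.span {x}) = _ at h1
  zify at h1
  rw [h2, h3] at h1
  simp at h1
  have h4 : x.re ^ 2 + 2 * p * x.im ^ 2 = 2 := by nlinarith [sq_nonneg x.re, mul_nonneg (Int.natCast_nonneg p) (sq_nonneg x.im)]
  have hp3 : (3 : ℤ) ≤ p := by omega
  have : x.im = 0 := by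
    by_contra h0
    have : 0 < x.im ^ 2 := by positivity
    nlinarith [sq_nonneg x.re]
  rw [this] at h4
  have : x.re ≤ 1 := by nlinarith
  have : -1 ≤ x.re := by nlinarith
  have : x.re = -1 ∨ x.re = 0 ∨ x.re = 1 := by omega
  rcases this with h | h | h <;> rw [h] at h4 <;> norm_num at h4

/-- radical argument -/
theorem rad (hd : d = -(2 * p : ℤ)) {q : ℕ} (hq : q.Prime) (hq2 : ¬ q ∣ 2 * p) (I : Ideal (ℤ√d))
    (h : Ideal.span {(q : ℤ√d)} ∣ I * I) : Ideal.span {(q : ℤ√d)} ∣ I := by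
  have hqi : Prime (q : ℤ) := Nat.prime_iff_prime_int.1 hq
  have hq2' : ¬ (q : ℤ) ∣ 2 * p := by exact_mod_cast hq2
  rw [Ideal.dvd_iff_le] at h ⊢
  intro x hx
  have h2 : x * x ∈ Ideal.span {(q : ℤ√d)} := h (Ideal.mul_mem_mul hx hx)
  rw [Ideal.mem_span_singleton] at h2 ⊢
  rw [show (q : ℤ√d) = ((q : ℤ) : ℤ√d) by simp, Zsqrtd.intCast_dvd] at h2 ⊢
  simp only [Zsqrtd.re_mul, Zsqrtd.im_mul] at h2
  obtain ⟨h3, h4⟩ := h2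
  have e3 : (q : ℤ) ∣ x.re * x.re - 2 * p * (x.im * x.im) := by
    have : x.re * x.re - 2 * p * (x.im * x.im) = x.re * x.re + d * x.im * x.im := by
      linear_combination (-x.im * x.im) * hd
    rw [this]; exact h3
  have e4 : (q : ℤ) ∣ 2 * (x.re * x.im) := by
    have : 2 * (x.re * x.im) = x.re * x.im + x.im * x.re := by ring
    rw [this]; exact h4
  have e5 : (q : ℤ) ∣ x.re * x.im := (hqi.dvd_or_dvd e4).resolve_left (fun h => hq2' (h.mul_right _))
  rcases hqi.dvd_or_dvd e5 with h | h
  · refine ⟨h, ?_⟩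
    have : (q : ℤ) ∣ 2 * p * (x.im * x.im) := by
      have := dvd_sub (h.mul_right x.re) e3
      rwa [sub_sub_cancel] at this
    have := (hqi.dvd_or_dvd this).resolve_left hq2'
    exact (hqi.dvd_or_dvd this).elim id id
  · refine ⟨?_, h⟩
    have : (q : ℤ) ∣ x.re * x.re := by
      have := dvd_add e3 ((h.mul_right x.im).mul_left (2 * p))
      rwa [sub_add_cancel] at this
    exact (hqi.dvd_or_dvd this).elim id id


theorem pdp {I J : Ideal (ℤ√d)} : I ^ 2 ∣ J ^ 2 ↔ I ∣ J := UniqueFactorizationMonoid.pow_dvd_pow_iff_dvd two_ne_zero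

theorem sq_inj {I J : Ideal (ℤ√d)} (h : I * I = J * J) : I = J := by
  have h1 : I ^ 2 ∣ J ^ 2 := by rw [pow_two, pow_two, h]
  have h2 : J ^ 2 ∣ I ^ 2 := by rw [pow_two, pow_two, h]
  exact dvd_antisymm ((CN.pdp).1 h1) ((CN.pdp).1 h2)

theorem ne_bot_of_mul_left {I J K : Ideal (ℤ√d)} (h : I * J = K) (hK : K ≠ ⊥) : I ≠ ⊥ := by
  rintro rfl; apply hK; rw [← h]; simp

theorem span_natCast_dvd {m n : ℕ} (h : Ideal.span {(m : ℤ√d)} ∣ Ideal.span {(n : ℤ√d)}) : m ∣ n := by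
  rw [Ideal.dvd_iff_le, Ideal.span_singleton_le_span_singleton] at h
  rw [show (m : ℤ√d) = ((m : ℤ) : ℤ√d) by simp, Zsqrtd.intCast_dvd] at h
  have := h.1
  simp at this
  exact_mod_cast this

/-- 2-torsion, squarefree rational case -/
theorem tors_sqfree (hd : d = -(2 * p : ℤ)) (hp2 : p % 2 = 1) (hp : p.Prime) (J : Ideal (ℤ√d)) (hJ : J ≠ ⊥)
    (m : ℕ) (hm : Squarefree m) (h : J * J = Ideal.span {(m : ℤ√d)}) :
    J.IsPrincipal ∨ (tt d * J).IsPrincipal := by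
  have hm0 : m ≠ 0 := hm.ne_zero
  have hdiv : m ∣ 2 * p := by
    rw [← Nat.prod_primeFactors_of_squarefree hm]
    have h2p : 2 * p ≠ 0 := by have := hp.pos; omega
    apply dvd_trans _ (Nat.prod_primeFactors_dvd (2 * p))
    apply Finset.prod_dvd_prod_of_subset
    intro q hq
    rw [Nat.mem_primeFactors] at hq
    rw [Nat.mem_primeFactors]
    refine ⟨hq.1, ?_, h2p⟩
    by_contra hcon
    have : Ideal.span {(q : ℤ√d)} ∣ J * J := by
      rw [h]
      obtain ⟨k, hk⟩ := hq.2.1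
      rw [hk, Nat.cast_mul, ← Ideal.span_singleton_mul_span_singleton]
      exact dvd_mul_right _ _
    have h1 := rad hd hq.1 hcon J this
    have h2 := mul_dvd_mul h1 h1
    rw [h, Ideal.span_singleton_mul_span_singleton, ← Nat.cast_mul] at h2
    have := hm q (span_natCast_dvd h2)
    exact hq.1.one_lt.ne' (Nat.isUnit_iff.1 this)
  have hw := sqrtd_sq hd
  have hw2 : Ideal.span {(Zsqrtd.sqrtd : ℤ√d)} * Ideal.span {Zsqrtd.sqrtd} = Ideal.span {((2 * p : ℕ) : ℤ√d)} := by
    rw [Ideal.span_singleton_mul_span_singleton, hw]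
    rw [Ideal.span_singleton_neg]; push_cast; rfl
  have ht := tt_sq hd hp2
  have hcases : m = 1 ∨ m = 2 ∨ m = p ∨ m = 2 * p := by
    rcases (Nat.dvd_mul.1 hdiv) with ⟨a, b, ha, hb, rfl⟩
    rcases (Nat.dvd_prime Nat.prime_two).1 ha with rfl | rfl <;> rcases (Nat.dvd_prime hp).1 hb with rfl | rfl <;> simp
  rcases hcases with rfl | rfl | rfl | rfl
  · left
    have : J = Ideal.span {1} := by
      apply sq_inj; rw [h]; simp [Ideal.span_singleton_mul_span_singleton]
    rw [this]; exact ⟨1, rfl⟩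
  · right
    have : J = tt d := by apply sq_inj; rw [h, ht]; simp
    rw [this, ht]; exact ⟨2, rfl⟩
  · right
    have : tt d * J = Ideal.span {Zsqrtd.sqrtd} := by
      apply sq_inj
      rw [mul_mul_mul_comm, h, ht, hw2, Ideal.span_singleton_mul_span_singleton]; push_cast; rfl
    rw [this]; exact ⟨_, rfl⟩
  · left
    have : J = Ideal.span {Zsqrtd.sqrtd} := by apply sq_inj; rw [h, hw2]
    rw [this]; exact ⟨_, rfl⟩

theorem tors_rat (hd : d = -(2 * p : ℤ)) (hp2 : p % 2 = 1) (hp : p.Prime) (J : Ideal (ℤ√d)) (hJ : J ≠ ⊥)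
    (m : ℤ) (h : J * J = Ideal.span {(m : ℤ√d)}) :
    J.IsPrincipal ∨ (tt d * J).IsPrincipal := by
  have h' : J * J = Ideal.span {((m.natAbs : ℕ) : ℤ√d)} := by
    rw [h]
    rcases Int.natAbs_eq m with e | e
    · conv_lhs => rw [e]
      simp
    · conv_lhs => rw [e]
      rw [Int.cast_neg, Ideal.span_singleton_neg]; simp
  obtain ⟨a, b, hab, ha⟩ := Nat.sq_mul_squarefree m.natAbs
  have hm0 : m.natAbs ≠ 0 := by
    intro h0; rw [h0] at h'; simp at h'; exact hJ h'
  have hb : b ≠ 0 := by rintro rfl; apply hm0; rw [← hab]; simp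
  have hdvd : Ideal.span {(b : ℤ√d)} ∣ J := by
    rw [← CN.pdp, pow_two, pow_two, h', ← hab, Nat.cast_mul, Nat.cast_pow, pow_two,
      ← Ideal.span_singleton_mul_span_singleton, ← Ideal.span_singleton_mul_span_singleton]
    exact dvd_mul_right _ _
  obtain ⟨J0, rfl⟩ := hdvd
  have hsb : Ideal.span {(b : ℤ√d)} ≠ ⊥ := by
    rw [Ne, Ideal.span_singleton_eq_bot]; exact natCast_ne hb
  have hJ0 : J0 ≠ ⊥ := by rintro rfl; apply hJ; simp
  have h0 : J0 * J0 = Ideal.span {(a : ℤ√d)} := by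
    rw [← hab, Nat.cast_mul, Nat.cast_pow, pow_two,
      ← Ideal.span_singleton_mul_span_singleton, ← Ideal.span_singleton_mul_span_singleton, mul_mul_mul_comm] at h'
    exact mul_left_cancel₀ (mul_ne_zero hsb hsb) h'
  rcases tors_sqfree hd hp2 hp J0 hJ0 a ha h0 with ⟨x, hx⟩ | ⟨x, hx⟩
  · left
    exact ⟨b * x, by rw [hx]; exact Ideal.span_singleton_mul_span_singleton _ _⟩
  · right
    refine ⟨b * x, ?_⟩
    rw [mul_left_comm, hx]; exact Ideal.span_singleton_mul_span_singleton _ _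

theorem tors (hd : d = -(2 * p : ℤ)) (hp2 : p % 2 = 1) (hp : p.Prime) (g : ClassGroup (ℤ√d)) (hg : g ^ 2 = 1)
    (ht : tt d ∈ (Ideal (ℤ√d))⁰) : g = 1 ∨ g = ClassGroup.mk0 ⟨tt d, ht⟩ := by
  obtain ⟨⟨I, hI⟩, rfl⟩ := ClassGroup.mk0_surjective g
  have hI0 : I ≠ ⊥ := nonZeroDivisors.ne_zero hI
  have httt : ClassGroup.mk0 ⟨tt d, ht⟩ * ClassGroup.mk0 ⟨tt d, ht⟩ = 1 := by
    rw [← map_mul]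
    exact (ClassGroup.mk0_eq_one_iff _).2 ⟨2, tt_sq hd hp2⟩
  -- reduce to an ideal inverse to `I` with rational square
  have key : ∀ J : Ideal (ℤ√d), J ≠ ⊥ → (∃ m : ℤ, J * J = Ideal.span {(m : ℤ√d)}) → (I * J).IsPrincipal →
      ClassGroup.mk0 ⟨I, hI⟩ = 1 ∨ ClassGroup.mk0 ⟨I, hI⟩ = ClassGroup.mk0 ⟨tt d, ht⟩ := by
    rintro J hJ ⟨m, hm⟩ hIJ
    have hJ' : J ∈ (Ideal (ℤ√d))⁰ := mem_nonZeroDivisors_of_ne_zero hJ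
    have e1 : ClassGroup.mk0 ⟨I, hI⟩ * ClassGroup.mk0 ⟨J, hJ'⟩ = 1 := by
      rw [← map_mul]; exact (ClassGroup.mk0_eq_one_iff _).2 hIJ
    rcases tors_rat hd hp2 hp J hJ m hm with h | h
    · left
      have := (ClassGroup.mk0_eq_one_iff hJ').2 h
      rwa [this, mul_one] at e1
    · right
      have : ClassGroup.mk0 ⟨tt d, ht⟩ * ClassGroup.mk0 ⟨J, hJ'⟩ = 1 := by
        rw [← map_mul]; exact (ClassGroup.mk0_eq_one_iff _).2 h
      exact mul_right_cancel (e1.trans this.symm)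
  have hp' : (I * I).IsPrincipal := by
    rw [pow_two, ← map_mul] at hg
    exact (ClassGroup.mk0_eq_one_iff _).1 hg
  obtain ⟨α, hα⟩ := hp'
  change I * I = Ideal.span {α} at hα
  set n := Ideal.absNorm I with hn
  have hnorm : (n : ℤ) * n = α.norm := by
    have := congrArg Ideal.absNorm hα
    rw [map_mul, Ideal.absNorm_span_singleton, algNorm] at this
    zify at this
    rw [this, abs_of_nonneg]
    rw [Zsqrtd.norm_def]
    have : α.re * α.re - d * α.im * α.im = α.re ^ 2 + 2 * p * α.im ^ 2 := by linear_combination (-α.im * α.im) * hd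
    rw [this]; positivity
  have hnα : (n : ℤ√d) * n = α * star α := by
    rw [← Zsqrtd.norm_eq_mul_conj, ← hnorm]; push_cast; ring
  have hα0 : α ≠ 0 := by
    rintro rfl
    simp at hα; exact hI0 hα
  by_cases hβ : α + n = 0
  · apply key I hI0 ⟨-n, ?_⟩ ⟨α, hα⟩
    rw [hα, eq_neg_of_add_eq_zero_left hβ]; push_cast; rfl
  · have hβ2 : (α + n) * (α + n) = α * ((2 * (α.re + n) : ℤ) : ℤ√d) := by
      have : α + star α = ((2 * α.re : ℤ) : ℤ√d) := by ext <;> simp; ring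
      push_cast
      push_cast at this
      linear_combination hnα + α * this
    have hdv : I ∣ Ideal.span {α + (n : ℤ√d)} := by
      rw [← CN.pdp, pow_two, pow_two, Ideal.span_singleton_mul_span_singleton, hβ2, hα,
        ← Ideal.span_singleton_mul_span_singleton]
      exact dvd_mul_right _ _
    obtain ⟨J, hJ⟩ := hdv
    have hJ0 : J ≠ ⊥ := by
      rintro rfl; rw [Ideal.mul_bot, Ideal.span_singleton_eq_bot] at hJ; exact hβ hJ
    apply key J hJ0 ⟨2 * (α.re + n), ?_⟩ ⟨_, hJ.symm⟩
    have h1 : Ideal.span {α + (n : ℤ√d)} * Ideal.span {α + (n : ℤ√d)} = I * I * (J * J) := by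
      rw [hJ, mul_mul_mul_comm]
    rw [Ideal.span_singleton_mul_span_singleton, hβ2, ← Ideal.span_singleton_mul_span_singleton, ← hα] at h1
    exact (mul_left_cancel₀ (mul_ne_zero hI0 hI0) h1).symm

end
end CN

end

section

set_option linter.unusedSectionVars false
set_option linter.unusedVariables false
open scoped NumberTheorySymbols nonZeroDivisors

namespace CN
section
variable {p : ℕ} {d : ℤ} [IsDedekindDomain (ℤ√d)]

/-- kernel membership -/
theorem span_sub (n : ℕ) (a : ℤ) (h : (n : ℤ) ∣ a ^ 2 - d) (x : ℤ√d)
    (hx : x ∈ Ideal.span {(n : ℤ√d), (⟨a, 1⟩ : ℤ√d)}) : (n : ℤ) ∣ x.re - a * x.im := by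
  have hr : (-(a : ZMod n)) * (-(a : ZMod n)) = (d : ZMod n) := by
    have := (ZMod.intCast_zmod_eq_zero_iff_dvd (a ^ 2 - d) n).2 h
    push_cast at this
    linear_combination this
  let f : ℤ√d →+* ZMod n := Zsqrtd.lift ⟨-(a : ZMod n), hr⟩
  have hf : ∀ x : ℤ√d, f x = x.re + x.im * (-(a : ZMod n)) := fun x => rfl
  have hle : Ideal.span {(n : ℤ√d), (⟨a, 1⟩ : ℤ√d)} ≤ RingHom.ker f := by
    rw [Ideal.span_le]
    intro y hy
    simp only [Set.mem_insert_iff, Set.mem_singleton_iff] at hy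
    rcases hy with rfl | rfl
    · simp
    · change f _ = 0
      rw [hf]; simp
  have h2 : f x = 0 := hle hx
  rw [hf] at h2
  rw [← ZMod.intCast_zmod_eq_zero_iff_dvd]
  push_cast; linear_combination h2

theorem chi_nontriv (hd : d = -(2 * p : ℤ)) (hp : p.Prime) (hp8 : p % 8 = 7) :
    ∃ I : (Ideal (ℤ√d))⁰, FF I = -1 := by
  have hcop : Nat.Coprime 8 p := by
    rw [show 8 = 2 ^ 3 from rfl]
    exact Nat.Coprime.pow_left _ ((Nat.coprime_primes Nat.prime_two hp).2 (by rintro rfl; omega))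
  obtain ⟨c, hc8, hcp⟩ := Nat.chineseRemainder hcop 3 (p - 1)
  have hp0 := hp.pos
  have hcc : Nat.Coprime c (8 * p) := by
    apply Nat.Coprime.mul_right
    · rw [Nat.Coprime, hc8.gcd_eq]; norm_num
    · rw [Nat.Coprime, hcp.gcd_eq]
      have := Nat.coprime_self_sub_right (show 1 ≤ p by omega)
      rw [Nat.gcd_comm]; exact (Nat.coprime_self_sub_right (show 1 ≤ p by omega)).2 (by simp)
  have : NeZero (8 * p) := ⟨by omega⟩
  obtain ⟨q, hqgt, hq, hqc⟩ := Nat.forall_exists_prime_gt_and_eq_mod ((ZMod.isUnit_iff_coprime c (8 * p)).2 hcc) p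
  have hqm : q ≡ c [MOD 8 * p] := (ZMod.natCast_eq_natCast_iff _ _ _).1 hqc
  have hq8 : q % 8 = 3 := (hqm.of_mul_right p).trans hc8
  have hqp : q ≡ p - 1 [MOD p] := (hqm.of_mul_left 8).trans hcp
  have : Fact q.Prime := ⟨hq⟩
  have : Fact p.Prime := ⟨hp⟩
  have hdq : ((d : ℤ) : ZMod q) ≠ 0 := by
    rw [Ne, ZMod.intCast_zmod_eq_zero_iff_dvd, hd, dvd_neg]
    intro h
    have h : q ∣ 2 * p := by exact_mod_cast h
    rcases (Nat.Prime.dvd_mul hq).1 h with h | h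
    · have := Nat.le_of_dvd (by norm_num) h; have := hp.two_le; omega
    · have := Nat.le_of_dvd hp0 h; omega
  have hleg : legendreSym q d = 1 := by
    have hpl : legendreSym q p = 1 := by
      have h1 : legendreSym p q = -1 := by
        have : legendreSym p q = legendreSym p (-1) := by
          rw [legendreSym.mod p q, legendreSym.mod p (-1)]
          congr 1
          apply (Int.modEq_iff_dvd.2 _)
          have := (Nat.modEq_iff_dvd.1 hqp)
          rw [Nat.cast_sub (by omega)] at this
          have h2 := dvd_sub this (dvd_refl (p : ℤ))
          have e : (-1 : ℤ) - q = (p : ℤ) - ((1 : ℕ) : ℤ) - q - p := by push_cast; ring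
          rw [e]; exact h2
        rw [this, legendreSym.at_neg_one (by rintro rfl; omega), ZMod.χ₄_nat_three_mod_four (by omega)]
      have := legendreSym.quadratic_reciprocity_three_mod_four (p := p) (q := q) (by omega) (by omega)
      rw [this, h1]
      norm_num
    have h2 : legendreSym q (-2) = 1 := by
      rw [legendreSym.at_neg_two (by rintro rfl; omega), ZMod.χ₈'_nat_eq_if_mod_eight]
      rw [if_neg (by omega), if_pos (by omega)]
    rw [hd, show -(2 * p : ℤ) = (-2) * p by ring, legendreSym.mul, h2, hpl]; norm_num
  obtain ⟨y, hy⟩ := (legendreSym.eq_one_iff q hdq).1 hleg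
  obtain ⟨a, rfl⟩ := ZMod.intCast_surjective y
  have hqa : (q : ℤ) ∣ a ^ 2 - d := by
    rw [← ZMod.intCast_zmod_eq_zero_iff_dvd]; push_cast; rw [hy]; ring
  set Q : Ideal (ℤ√d) := Ideal.span {(q : ℤ√d), (⟨a, 1⟩ : ℤ√d)} with hQ
  have hqQ : Q ∣ Ideal.span {(q : ℤ√d)} := by
    rw [Ideal.dvd_iff_le, Ideal.span_singleton_le_iff_mem]; exact Ideal.subset_span (by simp)
  have hspan : Ideal.span {(q : ℤ√d)} ≠ ⊥ := by
    rw [Ne, Ideal.span_singleton_eq_bot]; exact natCast_ne hq.ne_zero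
  have hQ0 : Q ≠ ⊥ := by
    intro h; rw [h] at hqQ; exact hspan (zero_dvd_iff.1 hqQ)
  have hN : Ideal.absNorm (Ideal.span {(q : ℤ√d)}) = q ^ 2 := by
    have := absNorm_span hd (q : ℤ√d)
    rw [Zsqrtd.re_natCast, Zsqrtd.im_natCast] at this
    zify; rw [this]; ring
  have hQN : Ideal.absNorm Q = q := by
    have h1 : Ideal.absNorm Q ∣ q ^ 2 := by
      rw [← hN]; exact map_dvd _ hqQ
    obtain ⟨k, hk, hk'⟩ := (Nat.dvd_prime_pow hq).1 h1
    interval_cases k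
    · exfalso
      simp at hk'
      have : (1 : ℤ√d) ∈ Q := by rw [hk']; trivial
      have := span_sub q a hqa 1 this
      simp at this
      have : q ∣ 1 := by exact_mod_cast this
      exact hq.one_lt.ne' (Nat.dvd_one.1 this)
    · simpa using hk'
    · exfalso
      obtain ⟨K, hK⟩ := hqQ
      have : Ideal.absNorm K = 1 := by
        have := congrArg Ideal.absNorm hK
        rw [hN, map_mul, hk'] at this
        have h0 : q ^ 2 ≠ 0 := pow_ne_zero _ hq.ne_zero
        exact (mul_eq_left₀ h0).1 this.symm
      rw [Ideal.absNorm_eq_one_iff] at this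
      rw [this, Ideal.mul_top] at hK
      have : (⟨a, 1⟩ : ℤ√d) ∈ Ideal.span {(q : ℤ√d)} := by
        rw [hK]; exact Ideal.subset_span (by simp)
      rw [Ideal.mem_span_singleton, show (q : ℤ√d) = ((q : ℤ) : ℤ√d) by simp, Zsqrtd.intCast_dvd] at this
      have : (q : ℤ) ∣ 1 := this.2
      have : q ∣ 1 := by exact_mod_cast this
      exact hq.one_lt.ne' (Nat.dvd_one.1 this)
  refine ⟨⟨Q, mem_nonZeroDivisors_of_ne_zero hQ0⟩, ?_⟩
  ext
  rw [FF_val]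
  change cc Q = -1
  unfold cc
  rw [hQN, Nat.factorization_eq_zero_of_not_dvd (by omega), pow_zero, Nat.div_one, ZMod.χ₈_nat_eq_if_mod_eight]
  rw [if_neg (by omega), if_neg (by omega)]

theorem uu_rel (hd : d = -(2 * p : ℤ)) (u v : ℤ) (huv : u ^ 2 - 2 * v ^ 2 = p) (hu2 : u % 2 = 1)
    (hc : IsCoprime u v) :
    tt d * (Ideal.span {(u : ℤ√d), (⟨2 * v, 1⟩ : ℤ√d)} * Ideal.span {(u : ℤ√d), (⟨2 * v, 1⟩ : ℤ√d)})
      = Ideal.span {(⟨2 * v, 1⟩ : ℤ√d)} := by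
  have hw := sqrtd_sq hd
  set w : ℤ√d := Zsqrtd.sqrtd with hwd
  have hth : (⟨2 * v, 1⟩ : ℤ√d) = 2 * (v : ℤ√d) + w := by
    ext <;> simp [hwd]
  rw [hth]
  set θ := 2 * (v : ℤ√d) + w with hθ
  have huv' : (u : ℤ√d) ^ 2 - 2 * (v : ℤ√d) ^ 2 = p := by
    have := congrArg (Int.cast : ℤ → ℤ√d) huv
    push_cast at this; exact this
  set U : Ideal (ℤ√d) := Ideal.span {(u : ℤ√d), θ}
  have hu : (u : ℤ√d) ∈ U := Ideal.subset_span (by simp)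
  have ht : θ ∈ U := Ideal.subset_span (by simp)
  have h2t : (2 : ℤ√d) ∈ tt d := Ideal.subset_span (by simp)
  have hwt : w ∈ tt d := Ideal.subset_span (by simp [hwd])
  have e1 : 2 * (u : ℤ√d) ^ 2 = θ * (2 * v - w) := by rw [hθ]; linear_combination 2 * huv' + hw
  have e2 : w * (u : ℤ√d) ^ 2 = θ * (p + v * w) := by rw [hθ]; linear_combination w * huv' - v * hw
  apply le_antisymm
  · rw [Ideal.span_pair_mul_span_pair, tt, Ideal.span_mul_span', Ideal.span_le]
    rintro _ ⟨x, hx, y, hy, rfl⟩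
    simp only [Set.mem_insert_iff, Set.mem_singleton_iff] at hx hy
    rw [SetLike.mem_coe, Ideal.mem_span_singleton]
    dsimp only
    rcases hy with rfl | rfl | rfl | rfl
    · rcases hx with rfl | rfl
      · exact ⟨_, by rw [← e1]; ring⟩
      · exact ⟨_, by rw [← e2]; ring⟩
    · exact ⟨x * u, by ring⟩
    · exact ⟨x * u, by ring⟩
    · exact ⟨x * θ, by ring⟩
  · rw [Ideal.span_singleton_le_iff_mem]
    obtain ⟨k, hk⟩ : ∃ k, u = 2 * k + 1 := ⟨u / 2, by omega⟩
    have hc8 : IsCoprime u (8 * v) := by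
      have : IsCoprime u 2 := ⟨1, -k, by rw [hk]; ring⟩
      exact (show (8 : ℤ) = 2 ^ 3 by norm_num) ▸ (this.pow_right (n := 3)).mul_right hc
    obtain ⟨A, B, hAB⟩ := hc8
    have hAB' : (A : ℤ√d) * u + B * (8 * v) = 1 := by
      have := congrArg (Int.cast : ℤ → ℤ√d) hAB
      push_cast at this; exact this
    have hk' : (u : ℤ√d) = 2 * k + 1 := by
      have := congrArg (Int.cast : ℤ → ℤ√d) hk
      push_cast at this; exact this
    set P := tt d * (U * U)
    have m1 : θ * (2 * v - w) ∈ P := by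
      rw [← e1, pow_two]; exact Ideal.mul_mem_mul h2t (Ideal.mul_mem_mul hu hu)
    have m2 : θ * (p + v * w) ∈ P := by
      rw [← e2, pow_two]; exact Ideal.mul_mem_mul hwt (Ideal.mul_mem_mul hu hu)
    have m3 : 2 * (u * θ) ∈ P := Ideal.mul_mem_mul h2t (Ideal.mul_mem_mul hu ht)
    have m4 : 2 * (θ * θ) ∈ P := Ideal.mul_mem_mul h2t (Ideal.mul_mem_mul ht ht)
    have m5 : θ * (u : ℤ√d) ^ 2 ∈ P := by
      have := Ideal.add_mem _ m2 (Ideal.mul_mem_left _ (v : ℤ√d) m1)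
      convert this using 1
      linear_combination θ * huv'
    have m6 : θ * u ∈ P := by
      have := Ideal.sub_mem _ m5 (Ideal.mul_mem_left _ (k : ℤ√d) m3)
      convert this using 1
      linear_combination (-θ * u) * hk'
    have m7 : θ * (8 * v) ∈ P := by
      have := Ideal.add_mem _ m4 (Ideal.mul_mem_left _ (2 : ℤ√d) m1)
      convert this using 1
      rw [hθ]; ring
    have := Ideal.add_mem _ (Ideal.mul_mem_left _ (A : ℤ√d) m6) (Ideal.mul_mem_left _ (B : ℤ√d) m7)
    convert this using 1
    linear_combination (-θ) * hAB'

/-- coprime representatives of the inverse class -/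
theorem exists_rep (hd : d = -(2 * p : ℤ)) (g : ClassGroup (ℤ√d)) (k : ℕ) (hk1 : 1 < k) :
    ∃ B : (Ideal (ℤ√d))⁰, ClassGroup.mk0 B = g ∧ Nat.Coprime (Ideal.absNorm B.1) k := by
  have hk : k ≠ 0 := by omega
  obtain ⟨⟨I, hI⟩, hIg⟩ := ClassGroup.mk0_surjective g⁻¹
  have hI0 : I ≠ ⊥ := nonZeroDivisors.ne_zero hI
  have hsk : Ideal.span {(k : ℤ√d)} ≠ ⊥ := by
    rw [Ne, Ideal.span_singleton_eq_bot]; exact natCast_ne hk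
  obtain ⟨a, ha⟩ := IsDedekindDomain.exists_sup_span_eq (I := I * Ideal.span {(k : ℤ√d)}) (J := I)
    Ideal.mul_le_left (mul_ne_zero hI0 hsk)
  have : I ∣ Ideal.span {a} := by rw [Ideal.dvd_iff_le, ← ha]; exact le_sup_right
  obtain ⟨B, hB⟩ := this
  rw [hB, ← Ideal.mul_sup] at ha
  have hcop : Ideal.span {(k : ℤ√d)} ⊔ B = ⊤ := by
    have : I * (Ideal.span {(k : ℤ√d)} ⊔ B) = I * ⊤ := by rw [ha, Ideal.mul_top]
    exact mul_left_cancel₀ (show I ≠ 0 from hI0) this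
  have hB0 : B ≠ ⊥ := by
    rintro rfl
    rw [sup_bot_eq] at hcop
    have h1 : Ideal.span {(k : ℤ√d)} ∣ Ideal.span {((1 : ℕ) : ℤ√d)} := by
      rw [Ideal.dvd_iff_le, hcop]; exact le_top
    have := Nat.dvd_one.1 (span_natCast_dvd h1)
    omega
  refine ⟨⟨B, mem_nonZeroDivisors_of_ne_zero hB0⟩, ?_, ?_⟩
  · have : ClassGroup.mk0 ⟨I, hI⟩ * ClassGroup.mk0 ⟨B, mem_nonZeroDivisors_of_ne_zero hB0⟩ = 1 := by
      rw [← map_mul]; exact (ClassGroup.mk0_eq_one_iff _).2 ⟨a, hB.symm⟩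
    rw [hIg] at this
    exact (inv_mul_eq_one.1 this).symm
  · have hone : (1 : ℤ√d) ∈ Ideal.span {(k : ℤ√d)} ⊔ B := by rw [hcop]; trivial
    obtain ⟨x, hx, b, hb, hxb⟩ := Submodule.mem_sup.1 hone
    obtain ⟨r, rfl⟩ := Ideal.mem_span_singleton.1 hx
    have h1 := Ideal.absNorm_dvd_norm_of_mem hb
    rw [algNorm] at h1
    have h2 : b.norm = 1 + k * (-2 * r.re + k * r.re ^ 2 - d * k * r.im ^ 2) := by
      have : b = 1 - k * r := by rw [← hxb]; ring
      rw [this, Zsqrtd.norm_def]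
      simp
      ring
    rw [h2] at h1
    rw [← Nat.isCoprime_iff_coprime]
    obtain ⟨c, hc⟩ := h1
    refine ⟨c, -(-2 * r.re + k * r.re ^ 2 - d * k * r.im ^ 2), ?_⟩
    linear_combination -hc

set_option maxHeartbeats 1000000 in
/-- The criterion, in the order `ℤ√(-2p)`. -/
theorem crit_zsqrtd [Finite (ClassGroup (ℤ√d))] (hd : d = -(2 * p : ℤ)) (hp : p.Prime) (hp16 : p % 16 = 15)
    (u v : ℤ) (hu : 0 < u) (hu16 : u % 16 = 1) (huv : u ^ 2 - 2 * v ^ 2 = p) :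
    8 ∣ Nat.card (ClassGroup (ℤ√d)) ∧ (16 ∣ Nat.card (ClassGroup (ℤ√d)) ↔ J(v | u.natAbs) = 1) := by
  have hp2 : p % 2 = 1 := by omega
  have hp8 : p % 8 = 7 := by omega
  have hpi : Prime (p : ℤ) := Nat.prime_iff_prime_int.1 hp
  have hv2 : v % 2 = 1 := by
    rcases Int.emod_two_eq_zero_or_one v with h | h
    · exfalso
      obtain ⟨v', rfl⟩ := Int.dvd_of_emod_eq_zero h
      obtain ⟨u', rfl⟩ : ∃ u', u = 16 * u' + 1 := ⟨u / 16, by omega⟩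
      have : (p : ℤ) = 8 * (32 * u' ^ 2 + 4 * u' - v' ^ 2) + 1 := by rw [← huv]; ring
      omega
    · exact h
  have hcuv : IsCoprime u v := by
    rw [Int.isCoprime_iff_gcd_eq_one]
    by_contra hne
    obtain ⟨q, hq, hqd⟩ := Nat.exists_prime_and_dvd hne
    have h1 : (q : ℤ) ∣ u := (Int.natCast_dvd_natCast.2 hqd).trans (Int.gcd_dvd_left _ _)
    have h2 : (q : ℤ) ∣ v := (Int.natCast_dvd_natCast.2 hqd).trans (Int.gcd_dvd_right _ _)
    obtain ⟨a, rfl⟩ := h1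
    obtain ⟨b, rfl⟩ := h2
    have h3 : (q * q : ℤ) ∣ p := ⟨a ^ 2 - 2 * b ^ 2, by rw [← huv]; ring⟩
    have h4 : q * q ∣ p := by exact_mod_cast h3
    have h5 := (Nat.dvd_prime hp).1 ((dvd_mul_right q q).trans h4)
    rcases h5 with h5 | h5
    · exact hq.one_lt.ne' h5
    · rw [h5] at h4
      have := Nat.le_of_dvd hp.pos h4
      have := hp.two_le
      nlinarith
  have htm : tt d ∈ (Ideal (ℤ√d))⁰ := mem_nonZeroDivisors_of_ne_zero (tt_ne hd hp2)
  set t := ClassGroup.mk0 ⟨tt d, htm⟩ with ht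
  have ht1 : t ≠ 1 := by
    rw [Ne, ht, ClassGroup.mk0_eq_one_iff]; exact tt_not_principal hd hp2 hp.one_lt.ne'
  have htt : t ^ 2 = 1 := by
    rw [pow_two, ht, ← map_mul]; exact (ClassGroup.mk0_eq_one_iff _).2 ⟨2, tt_sq hd hp2⟩
  have ht2 : ∀ g : ClassGroup (ℤ√d), g ^ 2 = 1 → g = 1 ∨ g = t := fun g hg => tors hd hp2 hp g hg htm
  obtain ⟨χ, hχ⟩ := exists_chi hp8 hd
  have hχ1 : ∃ q, χ q = -1 := by
    obtain ⟨I, hI⟩ := chi_nontriv hd hp hp8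
    exact ⟨_, (hχ I).trans hI⟩
  have hrel := uu_rel hd u v huv (by omega) hcuv
  set θ : ℤ√d := ⟨2 * v, 1⟩ with hθ
  set U : Ideal (ℤ√d) := Ideal.span {(u : ℤ√d), θ} with hU
  have hθ0 : θ ≠ 0 := by
    intro h; have := congrArg Zsqrtd.im h; simp [hθ] at this
  have hU0 : U ≠ ⊥ := by
    intro h; rw [h] at hrel; rw [Ideal.mul_bot, Ideal.mul_bot, eq_comm, Ideal.span_singleton_eq_bot] at hrel; exact hθ0 hrel
  have hNU : (Ideal.absNorm U : ℤ) = u := by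
    have h1 := congrArg Ideal.absNorm hrel
    have h2 := congrArg Ideal.absNorm (tt_sq hd hp2)
    rw [map_mul] at h1 h2
    rw [map_mul] at h1
    have h3 := absNorm_span hd θ
    have h4 := absNorm_span hd (2 : ℤ√d)
    zify at h1 h2
    rw [h3] at h1
    rw [h4] at h2
    simp [hθ] at h1 h2
    have h5 : (Ideal.absNorm (tt d) : ℤ) = 2 := by nlinarith [Int.natCast_nonneg (Ideal.absNorm (tt d))]
    rw [h5] at h1
    have h6 : (Ideal.absNorm U : ℤ) * (Ideal.absNorm U : ℤ) = u * u := by linarith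
    exact (mul_self_inj (Int.natCast_nonneg _) hu.le).1 h6
  have hUm : U ∈ (Ideal (ℤ√d))⁰ := mem_nonZeroDivisors_of_ne_zero hU0
  set g1 := ClassGroup.mk0 ⟨U, hUm⟩ with hg1
  have h1 : g1 ^ 2 = t := by
    have : t * g1 ^ 2 = 1 := by
      rw [pow_two, ht, hg1, ← map_mul, ← map_mul]
      exact (ClassGroup.mk0_eq_one_iff _).2 ⟨θ, hrel⟩
    have h2 : t * t = 1 := by rw [← pow_two]; exact htt
    exact mul_left_cancel (this.trans h2.symm)
  have hccodd : ∀ I : (Ideal (ℤ√d))⁰, (Ideal.absNorm I.1) % 2 = 1 → ((FF I : ℤˣ) : ℤ) = J(2 | Ideal.absNorm I.1) := by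
    intro I hI
    rw [FF_val, cc, Nat.factorization_eq_zero_of_not_dvd (by omega), pow_zero, Nat.div_one,
      jacobiSym.at_two (Nat.odd_iff.2 hI)]
  have hχU : χ g1 = 1 := by
    rw [hg1, hχ]
    have h8 : (Ideal.absNorm U) % 8 = 1 := by omega
    ext
    rw [hccodd _ (by change Ideal.absNorm U % 2 = 1; omega)]
    change J(2 | Ideal.absNorm U) = 1
    rw [jacobiSym.at_two (Nat.odd_iff.2 (by omega)), ZMod.χ₈_nat_eq_if_mod_eight, if_neg (by omega), if_pos (by omega)]
  obtain ⟨g2, h2⟩ := ker_eq_sq t ht2 χ hχ1 g1 hχU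
  obtain ⟨c1, c2⟩ := group_crit t ht1 htt ht2 χ hχ1 g1 g2 h1 h2
  refine ⟨c1, c2.trans ?_⟩
  -- minimal coprime representative
  have hu2p : 1 < 2 * p * u.natAbs := by
    have := hp.two_le
    have : 0 < u.natAbs := by omega
    nlinarith
  have hex : ∃ n : ℕ, ∃ B : (Ideal (ℤ√d))⁰, ClassGroup.mk0 B = g2⁻¹ ∧
      Nat.Coprime (Ideal.absNorm B.1) (2 * p * u.natAbs) ∧ Ideal.absNorm B.1 = n := by
    obtain ⟨B, hB1, hB2⟩ := exists_rep hd g2⁻¹ _ hu2p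
    exact ⟨_, B, hB1, hB2, rfl⟩
  classical
  obtain ⟨⟨B, hBm⟩, hB1, hB2, hB3⟩ := Nat.find_spec hex
  have hmin := fun n (hn : n < Nat.find hex) => Nat.find_min hex hn
  set z := Nat.find hex with hz
  change Ideal.absNorm B = z at hB3
  change Nat.Coprime (Ideal.absNorm B) _ at hB2
  rw [hB3] at hB2
  have hB0 : B ≠ ⊥ := nonZeroDivisors.ne_zero hBm
  have hzpos : 0 < z := by
    rw [← hB3]; exact Ideal.absNorm_pos_of_nonZeroDivisors ⟨B, hBm⟩
  have hz2 : z % 2 = 1 := by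
    have := (Nat.Coprime.coprime_mul_right_right hB2).coprime_mul_right_right
    exact Nat.odd_iff.1 (Nat.coprime_two_right.1 this)
  have hzu : Nat.Coprime z u.natAbs := Nat.Coprime.coprime_mul_left_right hB2
  have hz2p : Nat.Coprime z (2 * p) := Nat.Coprime.coprime_mul_right_right hB2
  have hprin : (B * B * U).IsPrincipal := by
    have : ClassGroup.mk0 (⟨B, hBm⟩ * ⟨B, hBm⟩ * ⟨U, hUm⟩ : (Ideal (ℤ√d))⁰) = 1 := by
      rw [map_mul, map_mul, hB1, ← hg1, ← h2]; group
    exact (ClassGroup.mk0_eq_one_iff _).1 this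
  obtain ⟨x, hx⟩ := hprin
  change B * B * U = Ideal.span {x} at hx
  have hxU : x ∈ U := by
    have : x ∈ B * B * U := by rw [hx]; exact Ideal.mem_span_singleton_self x
    exact Ideal.mul_le_right this
  have hdvd : u ∣ x.re - 2 * v * x.im := by
    have e : ((u.natAbs : ℕ) : ℤ) = u := Int.natAbs_of_nonneg hu.le
    have e2 : ((u.natAbs : ℕ) : ℤ√d) = (u : ℤ√d) := by rw [← Int.cast_natCast, e]
    have := span_sub (d := d) u.natAbs (2 * v) (by
      rw [e]; exact ⟨2 * u, by linear_combination -hd - 2 * huv⟩) x (by rw [e2]; exact hxU)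
    rwa [e] at this
  obtain ⟨s, hs⟩ := hdvd
  have hnx : (z : ℤ) * z * u = x.re ^ 2 + 2 * p * x.im ^ 2 := by
    have := congrArg Ideal.absNorm hx
    rw [map_mul, map_mul, hB3] at this
    zify at this
    rw [hNU, absNorm_span hd] at this
    exact this
  have heq : (z : ℤ) ^ 2 = u * s ^ 2 + 4 * v * s * x.im + 2 * u * x.im ^ 2 := by
    have hre : x.re = 2 * v * x.im + u * s := by linarith
    rw [hre] at hnx
    have : u * (z : ℤ) ^ 2 = u * (u * s ^ 2 + 4 * v * s * x.im + 2 * u * x.im ^ 2) := by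
      linear_combination hnx - 2 * x.im ^ 2 * huv
    exact mul_left_cancel₀ hu.ne' this
  have hsy : IsCoprime s x.im := by
    rw [Int.isCoprime_iff_gcd_eq_one]
    by_contra hne
    obtain ⟨q, hq, hqd⟩ := Nat.exists_prime_and_dvd hne
    have hqs : (q : ℤ) ∣ s := (Int.natCast_dvd_natCast.2 hqd).trans (Int.gcd_dvd_left _ _)
    have hqy : (q : ℤ) ∣ x.im := (Int.natCast_dvd_natCast.2 hqd).trans (Int.gcd_dvd_right _ _)
    have hqz : q ∣ z := by
      have : (q : ℤ) ∣ (z : ℤ) ^ 2 := by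
        rw [heq]
        refine dvd_add (dvd_add ?_ ?_) ?_
        · exact (dvd_pow hqs two_ne_zero).mul_left _
        · exact hqy.mul_left _
        · exact (dvd_pow hqy two_ne_zero).mul_left _
      exact hq.dvd_of_dvd_pow (n := 2) (by exact_mod_cast this)
    have hq2p : ¬ q ∣ 2 * p := fun h => hq.one_lt.ne' (Nat.dvd_one.1 (hz2p ▸ Nat.dvd_gcd hqz h))
    have hqu : Nat.Coprime q u.natAbs := Nat.Coprime.coprime_dvd_left hqz hzu
    have hqx : Ideal.span {(q : ℤ√d)} ∣ B * B * U := by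
      rw [hx, Ideal.dvd_iff_le, Ideal.span_singleton_le_span_singleton,
        show (q : ℤ√d) = ((q : ℤ) : ℤ√d) by simp, Zsqrtd.intCast_dvd]
      refine ⟨?_, hqy⟩
      have hre : x.re = 2 * v * x.im + u * s := by linarith
      rw [hre]
      exact dvd_add (hqy.mul_left _) (hqs.mul_left _)
    have hcop : IsCoprime (Ideal.span {(q : ℤ√d)}) U := by
      rw [Ideal.isCoprime_iff_exists]
      have := Nat.isCoprime_iff_coprime.2 hqu
      obtain ⟨a, b, hab⟩ := this
      rw [Int.natAbs_of_nonneg hu.le] at hab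
      refine ⟨a * q, Ideal.mul_mem_left _ _ (Ideal.mem_span_singleton_self _), b * u,
        Ideal.mul_mem_left _ _ (Ideal.subset_span (by simp)), ?_⟩
      have := congrArg (Int.cast : ℤ → ℤ√d) hab
      push_cast at this; exact this
    have hqB := rad hd hq hq2p B (hcop.dvd_of_dvd_mul_right hqx)
    obtain ⟨B', hB'⟩ := hqB
    have hB'0 : B' ≠ ⊥ := by rintro rfl; apply hB0; rw [hB']; simp
    have hB'm : B' ∈ (Ideal (ℤ√d))⁰ := mem_nonZeroDivisors_of_ne_zero hB'0
    have hN : Ideal.absNorm (Ideal.span {(q : ℤ√d)}) = q ^ 2 := by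
      have := absNorm_span hd (q : ℤ√d)
      rw [Zsqrtd.re_natCast, Zsqrtd.im_natCast] at this
      zify; rw [this]; ring
    have hNB : z = q ^ 2 * Ideal.absNorm B' := by rw [← hB3, hB', map_mul, hN]
    have hpos : 0 < Ideal.absNorm B' := Ideal.absNorm_pos_of_nonZeroDivisors ⟨B', hB'm⟩
    apply hmin (Ideal.absNorm B')
    · rw [hNB]
      exact lt_mul_of_one_lt_left hpos (Nat.one_lt_pow two_ne_zero hq.one_lt)
    · refine ⟨⟨B', hB'm⟩, ?_, ?_, rfl⟩
      · rw [← hB1]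
        rw [ClassGroup.mk0_eq_mk0_iff]
        refine ⟨q, 1, natCast_ne hq.ne_zero, one_ne_zero, ?_⟩
        simp only
        rw [← hB']; simp
      · exact Nat.Coprime.coprime_dvd_left ⟨q ^ 2, by rw [hNB]; ring⟩ hB2
  have hfin := jac_core u v s x.im z hu hu16 hv2 heq hsy (by omega)
    (by
      have := Nat.isCoprime_iff_coprime.2 hzu
      rwa [Int.natAbs_of_nonneg hu.le] at this) hcuv
  rw [← hfin]
  have hc2 : χ g2 = χ (g2⁻¹) := by
    rw [map_inv]
    rcases Int.units_eq_one_or (χ g2) with h | h <;> rw [h] <;> rfl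
  rw [hc2, ← hB1, hχ, Units.ext_iff, hccodd _ (by change Ideal.absNorm B % 2 = 1; rw [hB3]; exact hz2)]
  change J(2 | Ideal.absNorm B) = 1 ↔ _
  rw [hB3]
  rfl

end
end CN

end

section

open scoped NumberTheorySymbols nonZeroDivisors
open Polynomial NumberField

namespace CN

/-- a rational number whose square is an integer is an integer -/
theorem rat_sq_int (c : ℚ) (n : ℤ) (h : c ^ 2 = n) : ∃ m : ℤ, c = m := by
  have : IsIntegral ℤ c := ⟨X ^ 2 - C n, monic_X_pow_sub_C n two_ne_zero, by
    rw [eval₂_sub, eval₂_pow, eval₂_X, eval₂_C, h]; simp⟩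
  obtain ⟨m, hm⟩ := IsIntegrallyClosed.isIntegral_iff.1 this
  exact ⟨m, by rw [← hm]; simp⟩

theorem ints (p : ℕ) (hp : p.Prime) (hp2 : p % 2 = 1) (a b : ℚ) (A N : ℤ) (hA : 2 * a = A)
    (hN : a ^ 2 + 2 * p * b ^ 2 = N) : ∃ m n : ℤ, a = m ∧ b = n := by
  have hp0 : (p : ℚ) ≠ 0 := by exact_mod_cast hp.ne_zero
  have hc : (4 * p * b) ^ 2 = ((2 * p * (4 * N - A ^ 2) : ℤ) : ℚ) := by
    push_cast; rw [← hA, ← hN]; ring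
  obtain ⟨c, hc1⟩ := rat_sq_int _ _ hc
  rw [hc1] at hc
  have hc2 : c ^ 2 = 2 * p * (4 * N - A ^ 2) := by exact_mod_cast hc
  have h2 : (2 : ℤ) ∣ c := Int.prime_two.dvd_of_dvd_pow (n := 2) ⟨p * (4 * N - A ^ 2), by rw [hc2]; ring⟩
  have h3 : (p : ℤ) ∣ c := (Nat.prime_iff_prime_int.1 hp).dvd_of_dvd_pow (n := 2) ⟨2 * (4 * N - A ^ 2), by rw [hc2]; ring⟩
  have hcop : IsCoprime (2 : ℤ) p := by
    have := (Nat.isCoprime_iff_coprime (m := 2) (n := p)).2 (Nat.coprime_two_left.2 (Nat.odd_iff.2 hp2))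
    exact_mod_cast this
  obtain ⟨e, rfl⟩ := hcop.mul_dvd h2 h3
  have hb : 2 * b = e := by
    push_cast at hc1
    have : (2 * p : ℚ) * (2 * b) = 2 * p * e := by rw [← hc1]; ring
    exact mul_left_cancel₀ (by positivity) this
  have h4 : A ^ 2 + 2 * p * e ^ 2 = 4 * N := by
    have : (A : ℚ) ^ 2 + 2 * p * (e : ℚ) ^ 2 = 4 * N := by rw [← hA, ← hN, ← hb]; ring
    exact_mod_cast this
  have hAe : (2 : ℤ) ∣ A := Int.prime_two.dvd_of_dvd_pow (n := 2) ⟨2 * N - p * e ^ 2, by linarith⟩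
  obtain ⟨A', rfl⟩ := hAe
  have hee : (2 : ℤ) ∣ e := by
    have : (2 : ℤ) ∣ p * e ^ 2 := ⟨N - A' ^ 2, by linarith⟩
    exact Int.prime_two.dvd_of_dvd_pow (n := 2) (hcop.dvd_of_dvd_mul_left this)
  obtain ⟨e', rfl⟩ := hee
  refine ⟨A', e', ?_, ?_⟩
  · push_cast at hA; linarith
  · push_cast at hb; linarith

theorem zs_of_field (K : Type) [Field K] [NumberField K] (p : ℕ) (hp : p.Prime) (hp2 : p % 2 = 1)
    (d : ℤ) (hd : d = -(2 * p : ℤ)) (ω : K) (hω : ω * ω = ((d : ℤ) : K)) (σ : K →+* K) (hσ : σ ω = -ω)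
    (hrep : ∀ x : K, ∃ a b : ℚ, x = (a : K) + (b : K) * ω) :
    ∃ _ : IsDedekindDomain (ℤ√d), Finite (ClassGroup (ℤ√d)) ∧
      classNumber K = Nat.card (ClassGroup (ℤ√d)) := by
  let φ : ℤ√d →+* K := Zsqrtd.lift ⟨ω, hω⟩
  have hφ : ∀ x : ℤ√d, φ x = x.re + x.im * ω := fun x => rfl
  let alg : Algebra (ℤ√d) K := φ.toAlgebra
  have hinj : Function.Injective φ := by
    rw [injective_iff_map_eq_zero]
    intro x hx
    rw [hφ] at hx
    have h3 : (x.re : K) * x.re + 2 * p * (x.im * x.im) = 0 := by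
      have : (x.re : K) * x.re - x.im * x.im * (ω * ω) = 0 := by linear_combination (x.re + x.im * (-ω)) * hx
      have h7 : ((d : ℤ) : K) = -(2 * p) := by
        have h8 := congrArg (Int.cast : ℤ → K) hd
        push_cast at h8
        exact h8
      rw [hω, h7] at this
      linear_combination this
    have h4 : x.re * x.re + 2 * p * (x.im * x.im) = 0 := by exact_mod_cast h3
    have hp0' : (0 : ℤ) < p := by exact_mod_cast hp.pos
    have h5 : x.re = 0 := by
      have := mul_nonneg hp0'.le (mul_self_nonneg x.im)
      exact mul_self_eq_zero.1 (by nlinarith [mul_self_nonneg x.re])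
    have h6 : x.im = 0 := by
      rw [h5] at h4
      have : (p : ℤ) * (x.im * x.im) = 0 := by linarith
      exact mul_self_eq_zero.1 ((mul_eq_zero.1 this).resolve_left hp0'.ne')
    ext <;> simp [h5, h6]
  have hic : IsIntegralClosure (ℤ√d) ℤ K := by
    refine ⟨hinj, ?_⟩
    intro x
    constructor
    · intro hx
      obtain ⟨a, b, rfl⟩ := hrep x
      have hs : IsIntegral ℤ (σ (a + b * ω)) := hx.map σ.toIntAlgHom
      have e1 : σ (a + b * ω) = a - b * ω := by
        rw [map_add, map_mul, hσ, map_ratCast, map_ratCast]; ring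
      rw [e1] at hs
      have i1 : IsIntegral ℤ (algebraMap ℚ K (2 * a)) := by
        have h1 := hx.add hs
        have h2 : algebraMap ℚ K (2 * a) = (a + b * ω) + (a - b * ω) := by
          rw [map_mul]; simp; ring
        rw [h2]; exact h1
      have i2 : IsIntegral ℤ (algebraMap ℚ K (a ^ 2 + 2 * p * b ^ 2)) := by
        have h1 := hx.mul hs
        have h2 : algebraMap ℚ K (a ^ 2 + 2 * p * b ^ 2) = (a + b * ω) * (a - b * ω) := by
          have h3 := hω
          rw [hd] at h3
          simp only [map_add, map_mul, map_pow, map_ofNat, map_natCast, eq_ratCast]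
          push_cast at h3
          linear_combination (b : K) ^ 2 * h3
        rw [h2]; exact h1
      rw [isIntegral_algebraMap_iff (algebraMap ℚ K).injective] at i1 i2
      obtain ⟨A, hA⟩ := IsIntegrallyClosed.isIntegral_iff.1 i1
      obtain ⟨N, hN⟩ := IsIntegrallyClosed.isIntegral_iff.1 i2
      obtain ⟨m, n, rfl, rfl⟩ := ints p hp (by omega) a b A N (by rw [← hA]; simp) (by rw [← hN]; simp)
      exact ⟨⟨m, n⟩, by
        change φ _ = _
        rw [hφ]; simp⟩
    · rintro ⟨y, rfl⟩
      change IsIntegral ℤ (φ y)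
      rw [hφ]
      have hωi : IsIntegral ℤ ω := ⟨X ^ 2 - C d, monic_X_pow_sub_C _ two_ne_zero, by
        rw [eval₂_sub, eval₂_pow, eval₂_X, eval₂_C, pow_two, hω]; simp⟩
      have hz : ∀ n : ℤ, IsIntegral ℤ (n : K) := fun n => by
        have := isIntegral_algebraMap (R := ℤ) (A := K) (x := n)
        simpa using this
      exact (hz _).add ((hz _).mul hωi)
  have : IsScalarTower ℤ (ℤ√d) K := IsScalarTower.of_algebraMap_eq (fun x => by simp)
  have : IsDomain (ℤ√d) := hinj.isDomain φ
  have hdd : IsDedekindDomain (ℤ√d) := IsIntegralClosure.isDedekindDomain ℤ ℚ K (ℤ√d)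
  let e : 𝓞 K ≃+* ℤ√d := RingOfIntegers.equiv (K := K) (ℤ√d)
  let ec : ClassGroup (𝓞 K) ≃* ClassGroup (ℤ√d) := ClassGroup.mulEquiv e
  refine ⟨hdd, Finite.of_equiv _ ec.toEquiv, ?_⟩
  rw [classNumber, ← Nat.card_eq_fintype_card]
  exact Nat.card_congr ec.toEquiv

theorem crit_h (h : ℕ → ℕ)
    (hclass : ∀ p : ℕ, p.Prime → p % 8 = 7 →
      ∀ (F : Type) [Field F] [NumberField F],
        Nonempty (F ≃ₐ[ℚ] AdjoinRoot (X ^ 2 + C (2 * p : ℚ))) → h p = classNumber F)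
    (p : ℕ) (hp : p.Prime) (hp16 : p % 16 = 15)
    (u v : ℤ) (hu : 0 < u) (hu16 : u % 16 = 1) (huv : u ^ 2 - 2 * v ^ 2 = p) :
    8 ∣ h p ∧ (16 ∣ h p ↔ J(v | u.natAbs) = 1) := by
  obtain ⟨f, hf⟩ : ∃ f : ℚ[X], f = X ^ 2 + C (2 * p : ℚ) := ⟨_, rfl⟩
  have hmon : f.Monic := by rw [hf]; exact monic_X_pow_add_C _ two_ne_zero
  have hdeg : f.natDegree = 2 := by rw [hf]; exact natDegree_X_pow_add_C
  have hp0 : (0 : ℚ) < p := by exact_mod_cast hp.pos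
  have hirr : Irreducible f := by
    apply Polynomial.irreducible_of_degree_le_three_of_not_isRoot
    · rw [hdeg]; simp
    · intro x hx
      rw [IsRoot, hf] at hx
      simp at hx
      nlinarith [sq_nonneg x]
  have : Fact (Irreducible f) := ⟨hirr⟩
  have hfin : Module.Finite ℚ (AdjoinRoot f) := hmon.finite_adjoinRoot
  have hcz : CharZero (AdjoinRoot f) := algebraRat.charZero _
  have hnf : NumberField (AdjoinRoot f) :=
    { to_charZero := hcz
      to_finiteDimensional := by convert hfin }
  have hh : h p = classNumber (AdjoinRoot f) :=
    hclass p hp (by omega) (AdjoinRoot f) ⟨by rw [← hf]; exact AlgEquiv.ofRingEquiv (f := RingEquiv.refl _) (fun x => by simp)⟩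
  obtain ⟨ω, hωd⟩ : ∃ ω : AdjoinRoot f, ω = AdjoinRoot.root f := ⟨_, rfl⟩
  have hev : ∀ y : AdjoinRoot f, Polynomial.eval₂ (AdjoinRoot.of f) y f = y * y + 2 * p := by
    intro y
    have : ∀ g : ℚ[X], g = X ^ 2 + C (2 * p : ℚ) → Polynomial.eval₂ (AdjoinRoot.of f) y g = y * y + 2 * p := by
      intro g hg
      rw [hg, eval₂_add, eval₂_pow, eval₂_X, eval₂_C]
      simp
      ring
    exact this f hf
  have hω : ω * ω = ((-(2 * p : ℤ) : ℤ) : AdjoinRoot f) := by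
    have h1 := AdjoinRoot.eval₂_root f
    rw [hev, ← hωd] at h1
    push_cast
    linear_combination h1
  have hrep : ∀ x : AdjoinRoot f, ∃ a b : ℚ, x = (a : AdjoinRoot f) + (b : AdjoinRoot f) * ω := by
    intro x
    obtain ⟨g, rfl⟩ := AdjoinRoot.mk_surjective x
    have h1 : AdjoinRoot.mk f g = AdjoinRoot.mk f (g %ₘ f) := by
      rw [AdjoinRoot.mk_eq_mk]
      exact ⟨g /ₘ f, by rw [sub_eq_iff_eq_add, add_comm]; exact (modByMonic_add_div g f).symm⟩
    have h2 : (g %ₘ f).natDegree ≤ 1 := by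
      have := natDegree_modByMonic_lt g hmon (by intro h1; rw [h1] at hdeg; simp at hdeg)
      omega
    obtain ⟨b, a, hab⟩ := exists_eq_X_add_C_of_natDegree_le_one h2
    refine ⟨a, b, ?_⟩
    rw [h1, hab, map_add, map_mul, add_comm, AdjoinRoot.mk_C, AdjoinRoot.mk_C, AdjoinRoot.mk_X, eq_ratCast, eq_ratCast, hωd]
  obtain ⟨σ, hσ⟩ : ∃ σ : AdjoinRoot f →+* AdjoinRoot f, σ ω = -ω := by
    refine ⟨AdjoinRoot.lift (AdjoinRoot.of f) (-ω) ?_, ?_⟩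
    · rw [hev]
      push_cast at hω
      linear_combination hω
    · subst hωd; exact AdjoinRoot.lift_root _
  obtain ⟨h1, h2, h3⟩ := zs_of_field (AdjoinRoot f) p hp (by omega) _ rfl ω hω σ hσ hrep
  rw [hh, h3]
  exact crit_zsqrtd rfl hp hp16 u v hu hu16 huv

end CN

end

section

open scoped NumberTheorySymbols
open Finset

namespace QB

/-- the fundamental totally positive unit of `ℤ[√2]` -/
def E : ℤ√2 := ⟨3, 2⟩

/-- reduced elements -/
def Red (w : ℤ√2) : Prop := 2 * |w.im| < w.re

instance : DecidablePred Red := fun w => by unfold Red; infer_instance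

theorem nrm (w : ℤ√2) : w.norm = w.re ^ 2 - 2 * w.im ^ 2 := by rw [Zsqrtd.norm_def]; ring

theorem Red.sq {w : ℤ√2} (h : Red w) : 4 * w.im ^ 2 < w.re ^ 2 ∧ 0 < w.re := by
  unfold Red at h
  have h0 := abs_nonneg w.im
  refine ⟨?_, by linarith⟩
  rw [← sq_abs w.im]
  nlinarith

theorem Red.norm_pos {w : ℤ√2} (h : Red w) : 0 < w.norm := by
  rw [nrm]; have := h.sq; nlinarith [sq_nonneg w.im]

/-- the reduced elements of norm `n` -/
noncomputable def fset (n : ℕ) : Finset (ℤ√2) :=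
  ((Icc (0 : ℤ) (2 * n) ×ˢ Icc (-(n : ℤ)) n).image (fun p => (⟨p.1, p.2⟩ : ℤ√2))).filter
    (fun w => w.norm = n ∧ Red w)

theorem mem_fset {n : ℕ} {w : ℤ√2} : w ∈ fset n ↔ w.norm = n ∧ Red w := by
  unfold fset
  rw [mem_filter, and_iff_right_iff_imp]
  rintro ⟨h1, h2⟩
  rw [mem_image]
  refine ⟨(w.re, w.im), ?_, rfl⟩
  have h3 := h2.sq
  rw [nrm] at h1
  rw [mem_product, mem_Icc, mem_Icc]
  have hn : (0 : ℤ) ≤ n := by positivity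
  refine ⟨⟨h3.2.le, ?_⟩, ?_, ?_⟩ <;> dsimp only <;> nlinarith [sq_nonneg w.im, h3.1, h3.2]

theorem red_eq {n : ℤ} {z z' : ℤ√2} (hz : z.norm = n) (hz' : z'.norm = n) (h : Red z) (h' : Red z')
    (hd : n ∣ z.im * z'.re - z.re * z'.im) : z = z' := by
  have hn : 0 < n := hz ▸ h.norm_pos
  obtain ⟨h1, h2⟩ := h.sq
  obtain ⟨h1', h2'⟩ := h'.sq
  unfold Red at h h'
  rw [nrm] at hz hz'
  obtain ⟨c, d⟩ := z
  obtain ⟨c', d'⟩ := z'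
  dsimp only at *
  obtain ⟨B, hB⟩ := hd
  have hA : (c * c' - 2 * d * d') ^ 2 = n ^ 2 * (1 + 2 * B ^ 2) := by
    have : (d * c' - c * d') ^ 2 = n ^ 2 * B ^ 2 := by rw [hB]; ring
    have h3 : n ^ 2 = (c ^ 2 - 2 * d ^ 2) * (c' ^ 2 - 2 * d' ^ 2) := by rw [hz, hz']; ring
    linear_combination (1 : ℤ) * h3.symm + 2 * this
  have hAp : 0 < c * c' - 2 * d * d' := by
    have : |d * d'| * 4 < c * c' := by
      rw [abs_mul]; nlinarith [abs_nonneg d, abs_nonneg d']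
    have := le_abs_self (d * d')
    nlinarith [abs_nonneg (d * d')]
  have hlt : n ^ 2 * B ^ 2 < n ^ 2 * 4 := by
    have e1 : (d * c' - c * d') ^ 2 = n ^ 2 * B ^ 2 := by rw [hB]; ring
    have h3 : n ^ 2 = (c ^ 2 - 2 * d ^ 2) * (c' ^ 2 - 2 * d' ^ 2) := by rw [hz, hz']; ring
    rw [← e1, h3]
    have a1 : |d * c' - c * d'| < c * c' := by
      calc |d * c' - c * d'| ≤ |d * c'| + |c * d'| := abs_sub _ _
        _ = |d| * c' + c * |d'| := by rw [abs_mul, abs_mul, abs_of_pos h2, abs_of_pos h2']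
        _ < c * c' := by nlinarith
    have a2 : (d * c' - c * d') ^ 2 < (c * c') ^ 2 := by
      rw [← sq_abs]; exact pow_lt_pow_left₀ a1 (abs_nonneg _) two_ne_zero
    have a3 : c ^ 2 * c' ^ 2 < (2 * (c ^ 2 - 2 * d ^ 2)) * (2 * (c' ^ 2 - 2 * d' ^ 2)) :=
      mul_lt_mul'' (by linarith) (by linarith) (by positivity) (by positivity)
    nlinarith
  have hB4 : B ^ 2 < 4 := lt_of_mul_lt_mul_left hlt (by positivity)
  have hB1 : -2 < B ∧ B < 2 := ⟨by nlinarith, by nlinarith⟩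
  have hB0 : B = 0 := by
    by_contra hne
    have : B ^ 2 = 1 := by
      obtain ⟨h5, h6⟩ := hB1
      interval_cases B <;> simp_all
    rw [this] at hA
    have hdv : n ^ 2 ∣ (c * c' - 2 * d * d') ^ 2 := ⟨_, hA⟩
    rw [Int.pow_dvd_pow_iff two_ne_zero] at hdv
    obtain ⟨k, hk⟩ := hdv
    rw [hk] at hA
    have : k ^ 2 = 3 := by
      have h7 : n ^ 2 * k ^ 2 = n ^ 2 * 3 := by linear_combination hA
      exact mul_left_cancel₀ (by positivity) h7
    have k1 : k < 2 := by nlinarith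
    have k2 : -2 < k := by nlinarith
    interval_cases k <;> omega
  subst hB0
  have hAn : c * c' - 2 * d * d' = n := by
    have : (c * c' - 2 * d * d') ^ 2 = n ^ 2 := by rw [hA]; ring
    exact (pow_left_inj₀ hAp.le hn.le two_ne_zero).1 this
  have r1 : n * c = n * c' := by linear_combination c' * hAn + 2 * d' * hB - c * hz'
  have r2 : n * d = n * d' := by linear_combination d' * hAn + c' * hB - d * hz'
  rw [mul_left_cancel₀ hn.ne' r1, mul_left_cancel₀ hn.ne' r2]

/-- unit equivalence -/
theorem red_eq_of_unit {z z' e : ℤ√2} (he : e.norm = 1) (h : Red z) (h' : Red z') (hh : z = e * z') :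
    z = z' := by
  have hn : z.norm = z'.norm := by rw [hh, Zsqrtd.norm_mul, he, one_mul]
  refine red_eq hn rfl h h' ⟨e.im, ?_⟩
  rw [hh, nrm]
  simp only [Zsqrtd.re_mul, Zsqrtd.im_mul]
  ring

theorem reduce_aux (N : ℕ) : ∀ w : ℤ√2, w.im.natAbs ≤ N → 0 ≤ w.im → 0 < w.re → 0 < w.norm →
    w.norm % 2 = 1 → ∃ k : ℕ, ∃ w', Red w' ∧ w = E ^ k * w' := by
  induction N with
  | zero =>
    intro w h1 h2 h3 _ _
    have : w.im = 0 := by omega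
    exact ⟨0, w, by unfold Red; rw [this]; simpa using h3, by simp⟩
  | succ N ih =>
    intro w h1 h2 h3 h4 h5
    by_cases hr : Red w
    · exact ⟨0, w, hr, by simp⟩
    have hr0 := hr
    unfold Red at hr
    rw [abs_of_nonneg h2] at hr
    have hlt : w.re < 2 * w.im := by
      rcases lt_or_eq_of_le (not_lt.1 hr) with h | h
      · exact h
      · rw [nrm, h] at h5
        have : (2 * w.im) ^ 2 - 2 * w.im ^ 2 = 2 * w.im ^ 2 := by ring
        omega
    set w1 : ℤ√2 := ⟨3 * w.re - 4 * w.im, 3 * w.im - 2 * w.re⟩ with hw1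
    have e1 : w = E * w1 := by
      ext
      · simp [E, hw1]; ring
      · simp [E, hw1]; ring
    have n1 : w1.norm = w.norm := by rw [nrm, nrm]; simp only [hw1]; ring
    have hu : 4 * w.im < 3 * w.re := by
      rw [nrm] at h4; nlinarith
    by_cases hv : 0 ≤ w1.im
    · have hre : 0 < w1.re := by simp only [hw1]; linarith
      obtain ⟨k, w', hw', hk⟩ := ih w1 (by simp only [hw1] at hv ⊢; omega) hv hre (by rw [n1]; exact h4)
        (by rw [n1]; exact h5)
      exact ⟨k + 1, w', hw', by rw [e1, hk, pow_succ]; ring⟩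
    · refine ⟨1, w1, ?_, by rw [e1, pow_one]⟩
      unfold Red
      rw [abs_of_neg (not_le.1 hv)]
      simp only [hw1]
      linarith

theorem normE : E.norm = 1 := by decide

theorem starE : star E * E = 1 := by decide

theorem norm_E_pow (k : ℕ) : (E ^ k).norm = 1 := by
  have := map_pow (Zsqrtd.normMonoidHom (d := 2)) E k
  simp only [Zsqrtd.normMonoidHom] at this
  simpa [normE] using this

theorem Red.star {w : ℤ√2} (h : Red w) : Red (star w) := by
  unfold Red at *; simpa using h

theorem reduce (w : ℤ√2) (h3 : 0 < w.re) (h4 : 0 < w.norm) (h5 : w.norm % 2 = 1) :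
    ∃ w', Red w' ∧ w'.norm = w.norm ∧ (∃ e : ℤ√2, e.norm = 1 ∧ w' = e * w) ∧
      ∃ k : ℕ, w = E ^ k * w' ∨ w' = E ^ k * w := by
  rcases le_total 0 w.im with h | h
  · obtain ⟨k, w', h1, h2⟩ := reduce_aux _ w le_rfl h h3 h4 h5
    refine ⟨w', h1, by rw [h2, Zsqrtd.norm_mul, norm_E_pow, one_mul], ⟨(Star.star E) ^ k, ?_, ?_⟩, k, Or.inl h2⟩
    · rw [← star_pow, Zsqrtd.norm_conj, norm_E_pow]
    · rw [h2, ← mul_assoc, ← mul_pow, starE, one_pow, one_mul]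
  · obtain ⟨k, w', h1, h2⟩ := reduce_aux _ (star w) le_rfl (by simpa using h) (by simpa using h3)
      (by rwa [Zsqrtd.norm_conj]) (by rwa [Zsqrtd.norm_conj])
    have h6 : star w' = E ^ k * w := by
      have : w = star E ^ k * star w' := by
        rw [← star_star w, h2]; simp
      rw [this, ← mul_assoc, ← mul_pow, mul_comm E, starE, one_pow, one_mul]
    exact ⟨star w', h1.star, by rw [h6, Zsqrtd.norm_mul, norm_E_pow, one_mul], ⟨E ^ k, norm_E_pow k, h6⟩, k,
      Or.inr h6⟩

theorem dvd_iff {m : ℕ} (hm : m.Prime) {π : ℤ√2} (hπ : π.norm = m) (x : ℤ√2) :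
    π ∣ x ↔ (m : ℤ) ∣ x.im * π.re - x.re * π.im := by
  have hmp := Nat.prime_iff_prime_int.1 hm
  rw [nrm] at hπ
  constructor
  · rintro ⟨y, rfl⟩
    simp only [Zsqrtd.re_mul, Zsqrtd.im_mul]
    exact ⟨y.im, by rw [← hπ]; ring⟩
  · rintro ⟨B, hB⟩
    have h1 : (m : ℤ) ∣ (x.re * π.re - 2 * x.im * π.im) ^ 2 :=
      ⟨x.re ^ 2 - 2 * x.im ^ 2 + 2 * m * B ^ 2, by
        linear_combination (x.re ^ 2 - 2 * x.im ^ 2) * hπ + 2 * (x.im * π.re - x.re * π.im + m * B) * hB⟩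
    obtain ⟨A, hA⟩ := hmp.dvd_of_dvd_pow h1
    refine ⟨⟨A, B⟩, ?_⟩
    have hm0 : (m : ℤ) ≠ 0 := by exact_mod_cast hm.ne_zero
    ext
    · simp only [Zsqrtd.re_mul]
      apply mul_left_cancel₀ hm0
      linear_combination π.re * hA + 2 * π.im * hB - x.re * hπ
    · simp only [Zsqrtd.im_mul]
      apply mul_left_cancel₀ hm0
      linear_combination π.re * hB + π.im * hA - x.im * hπ

theorem prime_of_norm {m : ℕ} (hm : m.Prime) {π : ℤ√2} (hπ : π.norm = m) : Prime π := by
  have hmp := Nat.prime_iff_prime_int.1 hm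
  refine ⟨?_, ?_, ?_⟩
  · rintro rfl
    rw [Zsqrtd.norm_zero] at hπ
    exact hm.ne_zero (by exact_mod_cast hπ.symm)
  · intro h
    rw [← Zsqrtd.norm_eq_one_iff, hπ] at h
    exact hm.one_lt.ne' (by simpa using h)
  · intro x y hxy
    rw [dvd_iff hm hπ] at *
    rw [dvd_iff hm hπ]
    simp only [Zsqrtd.re_mul, Zsqrtd.im_mul] at hxy
    rw [nrm] at hπ
    obtain ⟨k, hk⟩ := hxy
    exact hmp.dvd_or_dvd ⟨-π.im * k + x.im * y.im, by linear_combination (-π.im) * hk + x.im * y.im * hπ⟩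

theorem cancel_left {π x y : ℤ√2} (hπ : π.norm ≠ 0) (h : π * x = π * y) : x = y := by
  have h1 : (π.norm : ℤ√2) * x = π.norm * y := by
    rw [Zsqrtd.norm_eq_mul_conj]; linear_combination star π * h
  have h2 := congrArg Zsqrtd.re h1
  have h3 := congrArg Zsqrtd.im h1
  simp at h2 h3
  ext
  · exact h2.resolve_right hπ
  · exact h3.resolve_right hπ

open Classical in
theorem half_sum {α : Type*} [AddCommMonoid α] {m n : ℕ} (hm0 : 0 < m) (hn0 : 0 < n) (hodd : (m * n) % 2 = 1)
    {π : ℤ√2} (hπ : π.norm = m)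
    (hre : 0 < π.re) (g : ℤ√2 → α)
    (hg : ∀ w : ℤ√2, w.norm = (m * n : ℕ) → 0 < w.re → g (E * w) = g w) :
    ∑ w ∈ (fset (m * n)).filter (fun w => π ∣ w), g w = ∑ z ∈ fset n, g (π * z) := by
  have hpow : ∀ (k : ℕ) (w : ℤ√2), w.norm = (m * n : ℕ) → 0 < w.re → g (E ^ k * w) = g w := by
    intro k
    have key : ∀ w : ℤ√2, w.norm = (m * n : ℕ) → 0 < w.re →
        (E * w).norm = (m * n : ℕ) ∧ 0 < (E * w).re := by
      intro w h1 h2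
      refine ⟨by rw [Zsqrtd.norm_mul, normE, one_mul, h1], ?_⟩
      rw [nrm] at h1
      have h3 : 2 * w.im ^ 2 ≤ w.re ^ 2 := by
        have : (0 : ℤ) ≤ (m * n : ℕ) := by positivity
        linarith
      simp only [E, Zsqrtd.re_mul]
      have := abs_le_of_sq_le_sq (a := 4 * w.im) (b := 3 * w.re) (by nlinarith) (by positivity)
      rcases eq_or_lt_of_le (abs_le.1 this).1 with h | h
      · exfalso; have h5 : w.re ^ 2 * 9 = 16 * w.im ^ 2 := by linear_combination (- 3 * w.re + 4 * w.im) * h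
        nlinarith
      · linarith
    induction k with
    | zero => intro w _ _; simp
    | succ k ih =>
      intro w h1 h2
      rw [pow_succ, mul_assoc, ih _ (key w h1 h2).1 (key w h1 h2).2, hg w h1 h2]
  have hpz : ∀ z : ℤ√2, z.norm = n → 0 < z.re → 0 < (π * z).re ∧ (π * z).norm = (m * n : ℕ) := by
    intro z h1 h2
    refine ⟨?_, by rw [Zsqrtd.norm_mul, h1, hπ]; push_cast; ring⟩
    rw [nrm] at h1 hπ
    have a1 : 2 * π.im ^ 2 < π.re ^ 2 := by
      have : (0 : ℤ) < m := by exact_mod_cast hm0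
      linarith
    have a2 : 2 * z.im ^ 2 < z.re ^ 2 := by
      have : (0 : ℤ) < n := by exact_mod_cast hn0
      linarith
    have a3 : (2 * (π.im * z.im)) ^ 2 < (π.re * z.re) ^ 2 := by
      have := mul_lt_mul'' a1 a2 (by positivity) (by positivity)
      nlinarith
    have := (abs_lt.1 (abs_lt_of_sq_lt_sq a3 (by positivity))).1
    simp only [Zsqrtd.re_mul]; linarith
  have hred : ∀ z : ℤ√2, z.norm = n → 0 < z.re → ∃ w', Red w' ∧ w'.norm = (m * n : ℕ) ∧
      (∃ e : ℤ√2, e.norm = 1 ∧ w' = e * (π * z)) ∧ g w' = g (π * z) := by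
    intro z h1 h2
    obtain ⟨h3, h4⟩ := hpz z h1 h2
    obtain ⟨w', r1, r2, r3, k, r4⟩ := reduce (π * z) h3 (by rw [h4]; exact_mod_cast Nat.mul_pos hm0 hn0)
      (by rw [h4]; exact_mod_cast hodd)
    refine ⟨w', r1, by rw [r2, h4], r3, ?_⟩
    rcases r4 with r4 | r4
    · rw [r4, hpow k w' (by rw [r2, h4]) r1.sq.2]
    · rw [r4, hpow k _ h4 h3]
  have hπ0 : π.norm ≠ 0 := by
    rw [hπ]; exact_mod_cast hm0.ne'
  choose! F F1 F2 F3 F4 using hred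
  symm
  refine Finset.sum_bij (fun z _ => F z) ?_ ?_ ?_ ?_
  · intro z hz
    obtain ⟨h1, h2⟩ := mem_fset.1 hz
    rw [mem_filter, mem_fset]
    refine ⟨⟨F2 z h1 h2.sq.2, F1 z h1 h2.sq.2⟩, ?_⟩
    obtain ⟨e, _, he⟩ := F3 z h1 h2.sq.2
    exact ⟨e * z, by rw [he]; ring⟩
  · intro z hz z' hz' heq
    obtain ⟨h1, h2⟩ := mem_fset.1 hz
    obtain ⟨h1', h2'⟩ := mem_fset.1 hz'
    obtain ⟨e, he1, he⟩ := F3 z h1 h2.sq.2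
    obtain ⟨e', he1', he'⟩ := F3 z' h1' h2'.sq.2
    have h5 : e * z = e' * z' := by
      apply cancel_left hπ0
      have : F z = F z' := heq
      rw [he, he'] at this
      linear_combination this
    refine red_eq_of_unit (e := star e * e') ?_ h2 h2' ?_
    · rw [Zsqrtd.norm_mul, Zsqrtd.norm_conj, he1, he1', one_mul]
    · rw [mul_assoc, ← h5, ← mul_assoc, mul_comm (star e), ← Zsqrtd.norm_eq_mul_conj, he1]; simp
  · intro w hw
    rw [mem_filter, mem_fset] at hw
    obtain ⟨⟨h1, h2⟩, z1, h3⟩ := hw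
    have n1 : z1.norm = n := by
      rw [h3, Zsqrtd.norm_mul, hπ] at h1
      push_cast at h1
      exact mul_left_cancel₀ (by exact_mod_cast hm0.ne') h1
    have p1 : 0 < z1.re := by
      rcases lt_trichotomy z1.re 0 with h | h | h
      · exfalso
        have := (hpz (-z1) (by rw [Zsqrtd.norm_neg, n1]) (by simpa using h)).1
        have h5 := h2.sq.2
        rw [h3] at h5
        simp at this h5
        linarith
      · exfalso
        rw [nrm, h] at n1
        have : (0 : ℤ) < n := by exact_mod_cast hn0
        nlinarith [sq_nonneg z1.im]
      · exact h
    obtain ⟨z, r1, r2, ⟨e, re1, re2⟩, _⟩ := reduce z1 p1 (by rw [n1]; exact_mod_cast hn0) (by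
      rw [n1]; have := Nat.odd_mul.1 (Nat.odd_iff.2 hodd); exact_mod_cast Nat.odd_iff.1 this.2)
    refine ⟨z, mem_fset.2 ⟨by rw [r2, n1], r1⟩, ?_⟩
    obtain ⟨e', he1', he'⟩ := F3 z (by rw [r2, n1]) r1.sq.2
    refine red_eq_of_unit (e := e' * e) ?_ (F1 z (by rw [r2, n1]) r1.sq.2) h2 ?_
    · rw [Zsqrtd.norm_mul, re1, he1', one_mul]
    · rw [he', re2, h3]; ring
  · intro z hz
    obtain ⟨h1, h2⟩ := mem_fset.1 hz
    exact (F4 z h1 h2.sq.2).symm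

open Classical in
theorem orbit_sum {α : Type*} [AddCommMonoid α] {m n : ℕ} (hm : m.Prime) (hn0 : 0 < n)
    (hodd : (m * n) % 2 = 1) (hmn : ¬ m ∣ n)
    {π : ℤ√2} (hπ : π ∈ fset m) (g : ℤ√2 → α)
    (hg : ∀ w : ℤ√2, w.norm = (m * n : ℕ) → 0 < w.re → g (E * w) = g w) :
    ∑ w ∈ fset (m * n), g w = ∑ z ∈ fset n, g (π * z) + ∑ z ∈ fset n, g (star π * z) := by
  obtain ⟨h1, h2⟩ := mem_fset.1 hπ
  have h1' : (star π).norm = m := by rw [Zsqrtd.norm_conj, h1]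
  have hP := prime_of_norm hm h1
  have hmp := Nat.prime_iff_prime_int.1 hm
  rw [← half_sum hm.pos hn0 hodd h1 h2.sq.2 g hg, ← half_sum hm.pos hn0 hodd h1' (by simpa using h2.sq.2) g hg,
    ← Finset.sum_filter_add_sum_filter_not (fset (m * n)) (fun w => π ∣ w)]
  congr 1
  apply Finset.sum_congr _ (fun _ _ => rfl)
  apply Finset.filter_congr
  intro w hw
  obtain ⟨h3, h4⟩ := mem_fset.1 hw
  constructor
  · intro h
    have : π ∣ w * star w := by
      rw [← Zsqrtd.norm_eq_mul_conj, h3]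
      refine Dvd.intro (star π * n) ?_
      rw [← mul_assoc, ← Zsqrtd.norm_eq_mul_conj, h1]; push_cast; ring
    have := (hP.dvd_or_dvd this).resolve_left h
    obtain ⟨y, hy⟩ := this
    exact ⟨star y, by rw [← star_star w, hy, star_mul, mul_comm]⟩
  · rintro ⟨y, rfl⟩ h
    rcases hP.dvd_or_dvd h with h | h
    · rw [dvd_iff hm h1] at h
      simp only [Zsqrtd.re_star, Zsqrtd.im_star] at h
      have h5 : (m : ℤ) ∣ 2 * (π.re * π.im) := by
        obtain ⟨k, hk⟩ := h
        exact ⟨-k, by linear_combination -hk⟩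
      rw [nrm] at h1
      have hm2 : ¬ (m : ℤ) ∣ 2 := by
        intro h6
        have : m ∣ 2 := by exact_mod_cast h6
        have := (Nat.prime_dvd_prime_iff_eq hm Nat.prime_two).1 this
        subst this; omega
      have hpos : (0 : ℤ) < m := by exact_mod_cast hm.pos
      have h7 := h2.sq
      rcases hmp.dvd_or_dvd ((hmp.dvd_or_dvd h5).resolve_left hm2) with h6 | h6
      · have h8 : (m : ℤ) ∣ 2 * π.im ^ 2 := by
          have : 2 * π.im ^ 2 = π.re * π.re - m := by linear_combination -h1
          rw [this]; exact dvd_sub (h6.mul_right _) dvd_rfl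
        have h9 := hmp.dvd_of_dvd_pow ((hmp.dvd_or_dvd h8).resolve_left hm2)
        obtain ⟨A, hA⟩ := h6
        obtain ⟨B, hB⟩ := h9
        rw [hA, hB] at h1
        have : (m : ℤ) * 1 = m * (m * (A ^ 2 - 2 * B ^ 2)) := by linear_combination -h1
        exact hmp.not_isUnit (IsUnit.of_mul_eq_one _ (mul_left_cancel₀ hpos.ne' this).symm)
      · have h8 : (m : ℤ) ∣ π.re ^ 2 := by
          have : π.re ^ 2 = 2 * (π.im * π.im) + m := by linear_combination h1
          rw [this]; exact dvd_add ((h6.mul_right _).mul_left _) dvd_rfl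
        have h9 := hmp.dvd_of_dvd_pow h8
        obtain ⟨A, hA⟩ := h9
        obtain ⟨B, hB⟩ := h6
        rw [hA, hB] at h1
        have : (m : ℤ) * 1 = m * (m * (A ^ 2 - 2 * B ^ 2)) := by linear_combination -h1
        exact hmp.not_isUnit (IsUnit.of_mul_eq_one _ (mul_left_cancel₀ hpos.ne' this).symm)
    · obtain ⟨x, rfl⟩ := h
      rw [Zsqrtd.norm_mul, Zsqrtd.norm_mul, h1', h1] at h3
      push_cast at h3
      have := mul_left_cancel₀ (hmp.ne_zero) h3
      exact hmn (by exact_mod_cast (Dvd.intro _ this : (m : ℤ) ∣ n))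

end QB

end

section

open scoped NumberTheorySymbols
open Finset

namespace QB

theorem cop_of_prim {n c d : ℤ} (hn : n % 2 = 1) (hcd : IsCoprime c d) (h : c ^ 2 - 2 * d ^ 2 = n) :
    IsCoprime c n ∧ IsCoprime d n := by
  have h2 : IsCoprime c 2 := by
    have : c % 2 = 1 := by
      rcases Int.emod_two_eq_zero_or_one c with h0 | h0
      · exfalso
        obtain ⟨k, hk⟩ := Int.dvd_of_emod_eq_zero h0
        have : n = 2 * (2 * k ^ 2 - d ^ 2) := by rw [← h, hk]; ring
        omega
      · exact h0
    exact ⟨1, -(c / 2), by omega⟩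
  constructor
  · have : IsCoprime c (2 * d ^ 2) := h2.mul_right hcd.pow_right
    obtain ⟨a, b, hab⟩ := this
    exact ⟨a + b * c, -b, by rw [← h]; linear_combination hab⟩
  · have : IsCoprime d (c ^ 2) := hcd.symm.pow_right
    obtain ⟨a, b, hab⟩ := this
    exact ⟨a + 2 * b * d, b, by rw [← h]; linear_combination hab⟩

theorem prim_dvd {n c d c0 d0 c' d' : ℤ} (hn : n % 2 = 1) (h : c ^ 2 - 2 * d ^ 2 = n)
    (h0 : c0 ^ 2 - 2 * d0 ^ 2 = n) (h' : c' ^ 2 - 2 * d' ^ 2 = n) (p : IsCoprime c d) (p0 : IsCoprime c0 d0)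
    (p' : IsCoprime c' d')
    (hg : Int.gcd n (c * d0 - c0 * d) = Int.gcd n (c' * d0 - c0 * d')) : n ∣ c * d' - c' * d := by
  have hn0 : n ≠ 0 := by omega
  obtain ⟨e, he⟩ : ∃ e : ℤ, e = Int.gcd n (c * d0 - c0 * d) := ⟨_, rfl⟩
  have he' : e = Int.gcd n (c' * d0 - c0 * d') := by rw [he, hg]
  have hen : e ∣ n := he ▸ Int.gcd_dvd_left _ _
  have hex : e ∣ c * d0 - c0 * d := he ▸ Int.gcd_dvd_right _ _
  have hex' : e ∣ c' * d0 - c0 * d' := he' ▸ Int.gcd_dvd_right _ _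
  obtain ⟨k, hk⟩ := hen
  have he0 : e ≠ 0 := by rintro rfl; simp at hk; exact hn0 hk
  have hyk : ∀ c d : ℤ, c ^ 2 - 2 * d ^ 2 = n → e = Int.gcd n (c * d0 - c0 * d) → k ∣ c * d0 + c0 * d := by
    intro c d h he
    have h1 : n ∣ (c * d0 - c0 * d) * (c * d0 + c0 * d) :=
      ⟨d0 ^ 2 - d ^ 2, by linear_combination d0 ^ 2 * h - d ^ 2 * h0⟩
    have h2 : n ∣ e * (c * d0 + c0 * d) := by
      have := Int.dvd_coe_gcd (Dvd.intro _ rfl : n ∣ n * (c * d0 + c0 * d)) h1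
      rw [Int.gcd_mul_right] at this
      push_cast at this
      rw [← he] at this
      have h3 := this.trans (mul_dvd_mul_left e (abs_dvd (c * d0 + c0 * d) (c * d0 + c0 * d) |>.2 dvd_rfl))
      exact h3
    rw [hk] at h2
    exact (mul_dvd_mul_iff_left he0).1 h2
  have hy := hyk c d h he
  have hy' := hyk c' d' h' he'
  have c0n := (cop_of_prim hn p0 h0).1
  have hek : n ∣ n * 1 := by simp
  have cop0e : IsCoprime e c0 := (c0n.of_isCoprime_of_dvd_right ⟨k, hk⟩).symm
  have cop0k : IsCoprime k c0 := (c0n.of_isCoprime_of_dvd_right ⟨e, by rw [hk]; ring⟩).symm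
  have e1 : e ∣ c * d' - c' * d := by
    apply cop0e.dvd_of_dvd_mul_left
    have := dvd_sub (hex.mul_left c') (hex'.mul_left c)
    convert this using 1; ring
  have e2 : k ∣ c * d' - c' * d := by
    apply cop0k.dvd_of_dvd_mul_left
    have := dvd_sub (hy'.mul_left c) (hy.mul_left c')
    convert this using 1; ring
  have hcop : IsCoprime e k := by
    -- a common divisor divides `2 c₀ d`
    rw [Int.isCoprime_iff_gcd_eq_one]
    by_contra hne
    obtain ⟨q, hq, hqd⟩ := Nat.exists_prime_and_dvd hne
    have hqi := Nat.prime_iff_prime_int.1 hq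
    have q1 : (q : ℤ) ∣ e := (Int.natCast_dvd_natCast.2 hqd).trans (Int.gcd_dvd_left _ _)
    have q2 : (q : ℤ) ∣ k := (Int.natCast_dvd_natCast.2 hqd).trans (Int.gcd_dvd_right _ _)
    have qn : (q : ℤ) ∣ n := hk ▸ q1.mul_right k
    have q3 : (q : ℤ) ∣ 2 * (c0 * d) := by
      have e3 : 2 * (c0 * d) = (c * d0 + c0 * d) - (c * d0 - c0 * d) := by ring
      rw [e3]
      exact dvd_sub (q2.trans hy) (q1.trans hex)
    have hq2 : ¬ (q : ℤ) ∣ 2 := by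
      intro h6
      have : q ∣ 2 := by exact_mod_cast h6
      have := (Nat.prime_dvd_prime_iff_eq hq Nat.prime_two).1 this
      subst this
      omega
    rcases hqi.dvd_or_dvd ((hqi.dvd_or_dvd q3).resolve_left hq2) with h5 | h5
    · exact hqi.not_isUnit (c0n.isUnit_of_dvd' h5 qn)
    · exact hqi.not_isUnit ((cop_of_prim hn p h).2.isUnit_of_dvd' h5 qn)
  rw [hk]
  exact hcop.mul_dvd e1 e2

theorem card_fset_le {n : ℕ} (hn : n % 2 = 1) : (fset n).card ≤ n.divisors.card ^ 2 := by
  have hn0 : n ≠ 0 := by omega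
  have hsub : fset n ⊆ n.divisors.biUnion (fun g => (fset n).filter (fun z => Int.gcd z.re z.im = g)) := by
    intro z hz
    rw [mem_biUnion]
    refine ⟨Int.gcd z.re z.im, ?_, by simp [hz]⟩
    rw [Nat.mem_divisors]
    refine ⟨?_, hn0⟩
    have h1 := (mem_fset.1 hz).1
    rw [nrm] at h1
    have : ((Int.gcd z.re z.im : ℕ) : ℤ) ∣ n := by
      rw [← h1]
      exact dvd_sub ((Int.gcd_dvd_left _ _).trans (dvd_pow_self _ two_ne_zero))
        (((Int.gcd_dvd_right _ _).trans (dvd_pow_self _ two_ne_zero)).mul_left _)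
    exact_mod_cast this
  refine (card_le_card hsub).trans ?_
  rw [sq]
  refine card_biUnion_le_card_mul _ _ _ ?_
  intro g hg
  rcases ((fset n).filter (fun z => Int.gcd z.re z.im = g)).eq_empty_or_nonempty with h | ⟨z0, h0⟩
  · rw [h]; simp
  have hfac : ∀ z ∈ (fset n).filter (fun z => Int.gcd z.re z.im = g), ∃ c d : ℤ, z.re = g * c ∧ z.im = g * d ∧
      IsCoprime c d ∧ (g : ℤ) ^ 2 * (c ^ 2 - 2 * d ^ 2) = n := by
    intro z hz
    rw [mem_filter, mem_fset] at hz
    have hpos : 0 < Int.gcd z.re z.im := Int.gcd_pos_of_ne_zero_left _ hz.1.2.sq.2.ne'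
    obtain ⟨c, d, h1, h2, h3⟩ := Int.exists_gcd_one hpos
    rw [hz.2] at h2 h3
    have h4 := hz.1.1
    rw [nrm] at h4
    exact ⟨c, d, by rw [h2]; ring, by rw [h3]; ring, Int.isCoprime_iff_gcd_eq_one.2 h1, by rw [← h4, h2, h3]; ring⟩
  refine card_le_card_of_injOn (fun z => Int.gcd n (z.re * z0.im - z0.re * z.im)) ?_ ?_
  · intro z hz
    rw [Finset.mem_coe, Nat.mem_divisors]
    refine ⟨?_, hn0⟩
    have := Int.gcd_dvd_left (n : ℤ) (z.re * z0.im - z0.re * z.im)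
    exact_mod_cast this
  · intro z hz z' hz' heq
    obtain ⟨c0, d0, a0, b0, cop0, n0⟩ := hfac z0 h0
    obtain ⟨c, d, a, b, cop, nz⟩ := hfac z hz
    obtain ⟨c', d', a', b', cop', nz'⟩ := hfac z' hz'
    have hzf := mem_fset.1 (mem_filter.1 hz).1
    have hzf' := mem_fset.1 (mem_filter.1 hz').1
    have hg0 : (g : ℤ) ^ 2 ≠ 0 := by
      intro h; rw [h, zero_mul] at nz; exact hn0 (by exact_mod_cast nz.symm)
    obtain ⟨n1, hn1⟩ : ∃ n1, n1 = c ^ 2 - 2 * d ^ 2 := ⟨_, rfl⟩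
    have hnn : (n : ℤ) = g ^ 2 * n1 := by rw [hn1, nz]
    have hodd : n1 % 2 = 1 := by
      have h1 : (n : ℤ) % 2 = 1 := by omega
      rw [hnn] at h1
      rcases Int.emod_two_eq_zero_or_one n1 with h2 | h2
      · rw [Int.mul_emod, h2] at h1; simp at h1
      · exact h2
    have e0 : c0 ^ 2 - 2 * d0 ^ 2 = n1 := mul_left_cancel₀ hg0 (by rw [n0, hnn])
    have e' : c' ^ 2 - 2 * d' ^ 2 = n1 := mul_left_cancel₀ hg0 (by rw [nz', hnn])
    have hgg : ∀ x y : ℤ, Int.gcd n (g * x * (g * d0) - g * c0 * (g * y)) = g ^ 2 * Int.gcd n1 (x * d0 - c0 * y) := by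
      intro x y
      have : (g * x * (g * d0) - g * c0 * (g * y) : ℤ) = (g ^ 2 : ℤ) * (x * d0 - c0 * y) := by ring
      rw [this, hnn, Int.gcd_mul_left]
      congr 1
    dsimp only at heq
    rw [a, b, a', b', a0, b0, hgg, hgg] at heq
    have hgn : 0 < g ^ 2 := Nat.pos_of_ne_zero (fun h => hg0 (by exact_mod_cast h))
    have key := prim_dvd hodd hn1.symm e0 e' cop cop0 cop' (Nat.eq_of_mul_eq_mul_left hgn heq)
    refine red_eq hzf.1 hzf'.1 hzf.2 hzf'.2 ?_
    rw [hnn, a, b, a', b']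
    obtain ⟨t, ht⟩ := key
    exact ⟨-t, by linear_combination (-(g : ℤ) ^ 2) * ht⟩

/-- divisor bound -/
theorem divisor_bound (ε : ℝ) (hε : 0 < ε) : ∃ C : ℝ, 1 ≤ C ∧ ∀ n : ℕ, 0 < n → (n.divisors.card : ℝ) ≤ C * (n : ℝ) ^ ε := by
  obtain ⟨P, hP⟩ := exists_nat_gt ((2 : ℝ) ^ (1 / ε))
  obtain ⟨c, hc⟩ : ∃ c : ℝ, c = 1 + 1 / (ε * Real.log 2) := ⟨_, rfl⟩
  have hl2 : 0 < Real.log 2 := Real.log_pos (by norm_num)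
  have hc1 : 1 ≤ c := by rw [hc]; have : 0 ≤ 1 / (ε * Real.log 2) := by positivity
                         linarith
  refine ⟨c ^ P, one_le_pow₀ hc1, ?_⟩
  intro n hn
  have h1 : (n : ℝ) ^ ε = ∏ p ∈ n.primeFactors, ((p : ℝ) ^ ε) ^ (n.factorization p) := by
    conv_lhs => rw [← Nat.prod_factorization_pow_eq_self hn.ne']
    rw [Finsupp.prod, Nat.support_factorization]
    push_cast
    rw [← Real.finsetProd_rpow _ _ (fun i _ => by positivity)]
    refine Finset.prod_congr rfl fun p _ => ?_
    rw [← Real.rpow_natCast, ← Real.rpow_natCast, ← Real.rpow_mul (by positivity), ← Real.rpow_mul (by positivity), mul_comm]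
  have h2 : c ^ P ≥ ∏ p ∈ n.primeFactors, (if p < P then c else 1) := by
    rw [Finset.prod_ite, Finset.prod_const, Finset.prod_const_one, mul_one]
    refine pow_le_pow_right₀ hc1 ?_
    calc _ ≤ (range P).card := card_le_card (by intro p hp; rw [mem_filter] at hp; exact mem_range.2 hp.2)
      _ = P := card_range P
  rw [Nat.card_divisors hn.ne', h1]
  push_cast
  refine le_trans ?_ (mul_le_mul_of_nonneg_right h2 (by positivity))
  rw [← Finset.prod_mul_distrib]
  refine Finset.prod_le_prod (fun _ _ => by positivity) ?_
  intro p hp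
  have hpp := Nat.prime_of_mem_primeFactors hp
  obtain ⟨a, ha⟩ : ∃ a, a = n.factorization p := ⟨_, rfl⟩
  rw [← ha]
  split_ifs with h
  · have h3 : (2 : ℝ) ^ ε ≤ (p : ℝ) ^ ε := Real.rpow_le_rpow (by norm_num) (by exact_mod_cast hpp.two_le) hε.le
    have h4 : 1 + a * (ε * Real.log 2) ≤ ((2 : ℝ) ^ ε) ^ a := by
      have h5 : 1 + ε * Real.log 2 ≤ (2 : ℝ) ^ ε := by
        rw [Real.rpow_def_of_pos (by norm_num), mul_comm (Real.log 2), add_comm]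
        exact Real.add_one_le_exp _
      calc _ ≤ (1 + ε * Real.log 2) ^ a := one_add_mul_le_pow (by have : 0 ≤ ε * Real.log 2 := by positivity
                                                                  linarith) a
        _ ≤ _ := pow_le_pow_left₀ (by positivity) h5 a
    calc (a : ℝ) + 1 ≤ c * (1 + a * (ε * Real.log 2)) := by
          rw [hc]
          have : (1 + 1 / (ε * Real.log 2)) * (1 + a * (ε * Real.log 2)) = 1 + a + 1 / (ε * Real.log 2) + a * (ε * Real.log 2) := by
            field_simp; ring
          rw [this]
          have : 0 ≤ 1 / (ε * Real.log 2) := by positivity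
          have : 0 ≤ a * (ε * Real.log 2) := by positivity
          linarith
      _ ≤ c * ((2 : ℝ) ^ ε) ^ a := by gcongr
      _ ≤ _ := by gcongr
  · have h3 : (2 : ℝ) ≤ (p : ℝ) ^ ε := by
      have : (2 : ℝ) = ((2 : ℝ) ^ (1 / ε)) ^ ε := by
        rw [← Real.rpow_mul (by norm_num), one_div, inv_mul_cancel₀ hε.ne', Real.rpow_one]
      rw [this]
      refine Real.rpow_le_rpow (by positivity) ?_ hε.le
      exact hP.le.trans (by exact_mod_cast not_lt.1 h)
    rw [one_mul]
    calc (a : ℝ) + 1 ≤ 2 ^ a := by exact_mod_cast Nat.lt_two_pow_self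
      _ ≤ _ := by gcongr

end QB

end

section

open scoped NumberTheorySymbols
open Finset

namespace QB

theorem two_ns (n : ℤ) : (2 : ℤ) ≠ n * n := by
  intro h
  have h1 : n < 2 := by nlinarith
  have h2 : -2 < n := by nlinarith
  interval_cases n <;> omega

theorem fset_nonempty {p : ℕ} (hp : p.Prime) (h8 : p % 8 = 1 ∨ p % 8 = 7) : (fset p).Nonempty := by
  have : Fact p.Prime := ⟨hp⟩
  have hp2 : p ≠ 2 := by rintro rfl; omega
  obtain ⟨s, hs⟩ := (ZMod.exists_sq_eq_two_iff hp2).2 h8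
  let k := Nat.sqrt p
  have hcard : (univ : Finset (ZMod p)).card < (range (k + 1) ×ˢ range (k + 1)).card := by
    rw [card_univ, ZMod.card, card_product, card_range]
    exact Nat.lt_succ_sqrt p
  obtain ⟨a, ha, b, hb, hab, hf⟩ := exists_ne_map_eq_of_card_lt_of_maps_to hcard
    (f := fun q : ℕ × ℕ => (q.1 : ZMod p) - s * q.2) (fun _ _ => mem_coe.2 (mem_univ _))
  obtain ⟨a1, a2⟩ := a
  obtain ⟨b1, b2⟩ := b
  simp only [mem_product, mem_range] at ha hb
  dsimp only at hf
  set x : ℤ := (a1 : ℤ) - b1 with hx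
  set y : ℤ := (a2 : ℤ) - b2 with hy
  have hxy : ((x : ℤ) : ZMod p) = s * (y : ℤ) := by
    rw [hx, hy]; push_cast; linear_combination hf
  have hdvd : (p : ℤ) ∣ x ^ 2 - 2 * y ^ 2 := by
    rw [← ZMod.intCast_zmod_eq_zero_iff_dvd]
    push_cast
    rw [hxy]
    linear_combination (-(y : ZMod p) ^ 2) * hs
  have hkk : k * k ≤ p := Nat.sqrt_le p
  have hne : k * k ≠ p := by
    intro h
    have h1 : k ≠ 1 := by rintro h1; rw [h1] at h; exact hp.one_lt.ne h
    exact Nat.not_prime_mul h1 h1 (h ▸ hp)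
  have hklt : (k : ℤ) * k < p := by exact_mod_cast lt_of_le_of_ne hkk hne
  have hx2 : x ^ 2 < p := by
    have h1 : x ≤ k := by omega
    have h2 : -(k : ℤ) ≤ x := by omega
    nlinarith
  have hy2 : y ^ 2 < p := by
    have h1 : y ≤ k := by omega
    have h2 : -(k : ℤ) ≤ y := by omega
    nlinarith
  obtain ⟨t, ht⟩ := hdvd
  have hp0 : (0 : ℤ) < p := by exact_mod_cast hp.pos
  have t1 : t < 1 := by
    by_contra h; push Not at h
    nlinarith [sq_nonneg y]
  have t2 : -2 < t := by
    by_contra h; push Not at h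
    nlinarith [sq_nonneg x]
  have t3 : t ≠ 0 := by
    rintro rfl
    have h0 : (⟨x, y⟩ : ℤ√2).norm = 0 := by rw [nrm]; dsimp only; rw [ht]; ring
    rw [Zsqrtd.norm_eq_zero two_ns] at h0
    have h1 := congrArg Zsqrtd.re h0
    have h2 := congrArg Zsqrtd.im h0
    simp at h1 h2
    apply hab
    ext <;> simp <;> omega
  have t4 : t = -1 := by omega
  subst t4
  have hN : ∀ σ : ℤ, σ ^ 2 = 1 → (⟨σ * (x + 2 * y), σ * (x + y)⟩ : ℤ√2).norm = p := by
    intro σ hσ; rw [nrm]; dsimp only; linear_combination ((x + 2 * y) ^ 2 - 2 * (x + y) ^ 2) * hσ - ht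
  have key : ∃ w : ℤ√2, w.norm = p ∧ 0 < w.re := by
    rcases lt_trichotomy (x + 2 * y) 0 with h | h | h
    · exact ⟨_, hN (-1) (by norm_num), by dsimp only; linarith⟩
    · exfalso
      have := hN 1 (by norm_num)
      rw [nrm] at this; dsimp only at this
      rw [h] at this
      nlinarith [sq_nonneg (x + y)]
    · exact ⟨_, hN 1 (by norm_num), by dsimp only; linarith⟩
  obtain ⟨w, hw1, hw2⟩ := key
  obtain ⟨w', h1, h2, _⟩ := reduce w hw2 (by rw [hw1]; exact hp0) (by rw [hw1]; omega)
  exact ⟨w', mem_fset.2 ⟨by rw [h2, hw1], h1⟩⟩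

theorem fset_one : fset 1 = {1} := by
  ext w
  rw [mem_fset, mem_singleton, nrm]
  constructor
  · rintro ⟨h1, h2⟩
    have h3 := h2.sq
    push_cast at h1
    have hv : w.im = 0 := by
      have : w.im ^ 2 < 1 := by nlinarith
      have : w.im ^ 2 = 0 := by nlinarith [sq_nonneg w.im]
      exact pow_eq_zero_iff two_ne_zero |>.1 this
    have hu : w.re = 1 := by
      rw [hv] at h1
      nlinarith [h3.2]
    ext <;> simp [hv, hu]
  · rintro rfl
    simp [Red]

/-- the sign correction -/
def kap (u v : ℤ) : ℤ :=
  if u % 8 = 1 then (if u % 16 = 1 then 1 else -1) else (if (3 * u + 4 * v) % 16 = 1 then 1 else -1)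

/-- the governing symbol -/
def sym (w : ℤ√2) : ℤ := kap w.re w.im * J(w.im | w.re.natAbs)

theorem mod_facts {u v : ℤ} (h : (u ^ 2 - 2 * v ^ 2) % 16 = 15) : v % 2 = 1 ∧ (u % 8 = 1 ∨ u % 8 = 7) := by
  have h1 : ((u % 16) ^ 2 - 2 * (v % 16) ^ 2) % 16 = 15 := by
    rw [← h]; simp [Int.sub_emod, Int.mul_emod, pow_two]
  have hu0 := Int.emod_nonneg u (by norm_num : (16 : ℤ) ≠ 0)
  have hu1 := Int.emod_lt_of_pos u (by norm_num : (0 : ℤ) < 16)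
  have hv0 := Int.emod_nonneg v (by norm_num : (16 : ℤ) ≠ 0)
  have hv1 := Int.emod_lt_of_pos v (by norm_num : (0 : ℤ) < 16)
  have e1 : v % 2 = (v % 16) % 2 := by omega
  have e2 : u % 8 = (u % 16) % 8 := by omega
  rw [e1, e2]
  generalize u % 16 = a at *
  generalize v % 16 = b at *
  have hb : b % 2 = 1 := by
    interval_cases b <;> first | rfl | (exfalso; revert h1; interval_cases a <;> decide)
  refine ⟨hb, ?_⟩
  have hbb : (2 * b ^ 2) % 16 = 2 := by interval_cases b <;> simp_all
  interval_cases a <;> first | decide | (exfalso; omega)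

theorem sym_E {w : ℤ√2} (h : w.norm % 16 = 15) (hn : 0 < w.norm) (hu : 0 < w.re) : sym (E * w) = sym w := by
  obtain ⟨u, v⟩ := w
  rw [nrm] at h hn
  dsimp only at *
  obtain ⟨hv, h8⟩ := mod_facts h
  have hre : (E * (⟨u, v⟩ : ℤ√2)) = ⟨3 * u + 4 * v, 2 * u + 3 * v⟩ := by
    ext <;> simp [E] <;> ring
  rw [hre]
  unfold sym
  dsimp only
  have hu' : 0 < 3 * u + 4 * v := by
    by_contra hc
    push Not at hc
    nlinarith
  obtain ⟨v', hv'⟩ : ∃ v', v' = 2 * u + 3 * v := ⟨_, rfl⟩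
  obtain ⟨u', hu''⟩ : ∃ u', u' = 3 * u + 4 * v := ⟨_, rfl⟩
  rw [← hv', ← hu'']
  rw [← hu''] at hu'
  have ou : u'.natAbs % 2 = 1 := by omega
  have ou2 : u.natAbs % 2 = 1 := by omega
  have r1 : J(u | u'.natAbs) = J(-v' | u'.natAbs) := by
    rw [jac_dvd (a := u) (b := 4 * -v') ⟨3, by rw [hu'', hv']; ring⟩, jacobiSym.mul_left, jacobiSym.at_four (Nat.odd_iff.2 ou), one_mul]
  have r2 : J(u' | u.natAbs) = J(v | u.natAbs) := by
    rw [jac_dvd (a := u') (b := 4 * v) ⟨3, by rw [hu'']; ring⟩, jacobiSym.mul_left, jacobiSym.at_four (Nat.odd_iff.2 ou2), one_mul]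
  have ea : ((u.natAbs : ℕ) : ℤ) = u := by omega
  have ea' : ((u'.natAbs : ℕ) : ℤ) = u' := by omega
  rcases h8 with h8 | h8
  · have q := jacobiSym.quadratic_reciprocity_one_mod_four (a := u.natAbs) (b := u'.natAbs) (by omega) (Nat.odd_iff.2 ou)
    rw [ea, ea', r1, r2, jacobiSym.neg _ (Nat.odd_iff.2 ou), ZMod.χ₄_nat_three_mod_four (by omega)] at q
    have k : kap u' v' = - kap u v := by
      unfold kap
      split_ifs <;> first | rfl | omega
    rw [k, ← q]; ring
  · have q := jacobiSym.quadratic_reciprocity_one_mod_four (a := u'.natAbs) (b := u.natAbs) (by omega) (Nat.odd_iff.2 ou2)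
    rw [ea, ea', r1, r2, jacobiSym.neg _ (Nat.odd_iff.2 ou), ZMod.χ₄_nat_one_mod_four (by omega)] at q
    have k : kap u' v' = kap u v := by
      unfold kap
      split_ifs <;> first | rfl | omega
    rw [k, q]; ring

theorem E_mul (w : ℤ√2) : E * w = ⟨3 * w.re + 4 * w.im, 2 * w.re + 3 * w.im⟩ := by
  ext <;> simp [E] <;> ring

theorem E_re_pos {w : ℤ√2} (hn : 0 < w.norm) (hu : 0 < w.re) : 0 < (E * w).re := by
  rw [E_mul]; rw [nrm] at hn
  dsimp only
  by_contra hc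
  push Not at hc
  nlinarith

theorem norm_E_mul (w : ℤ√2) : (E * w).norm = w.norm := by
  rw [Zsqrtd.norm_mul, normE, one_mul]

section crit
open Polynomial NumberField

variable (h : ℕ → ℕ)

/-- the property to be transported along the unit orbit -/
def SymCrit (h : ℕ → ℕ) (p : ℕ) (s : ℤ) : Prop := (s = 1 ∨ s = -1) ∧ 8 ∣ h p ∧ (16 ∣ h p ↔ s = 1)

theorem sym_crit
    (hclass : ∀ p : ℕ, p.Prime → p % 8 = 7 →
      ∀ (F : Type) [Field F] [NumberField F],
        Nonempty (F ≃ₐ[ℚ] AdjoinRoot (X ^ 2 + C (2 * p : ℚ))) → h p = classNumber F)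
    {p : ℕ} (hp : p.Prime) (hp16 : p % 16 = 15) {w : ℤ√2} (hw : w.norm = p) (hu : 0 < w.re) :
    SymCrit h p (sym w) := by
  have hp0 : (0 : ℤ) < p := by exact_mod_cast hp.pos
  have c0 : ∀ w : ℤ√2, w.norm = p → 0 < w.re → w.re % 16 = 1 → SymCrit h p (sym w) := by
    intro w hw hu h16
    have hs : sym w = J(w.im | w.re.natAbs) := by
      unfold sym kap
      rw [if_pos (by omega), if_pos h16, one_mul]
    have hc := CN.crit_h h hclass p hp hp16 w.re w.im hu h16 (by rw [← nrm, hw])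
    rw [hs]
    refine ⟨?_, hc⟩
    apply jacobiSym.eq_one_or_neg_one
    rw [nrm] at hw
    have hcop : IsCoprime w.im w.re := by
      rw [Int.isCoprime_iff_gcd_eq_one]
      by_contra hg
      obtain ⟨l, hl, hd⟩ := Nat.exists_prime_and_dvd hg
      have h1 : (l : ℤ) ∣ w.im := (Int.natCast_dvd_natCast.2 hd).trans (Int.gcd_dvd_left _ _)
      have h2 : (l : ℤ) ∣ w.re := (Int.natCast_dvd_natCast.2 hd).trans (Int.gcd_dvd_right _ _)
      have h3 : ((l * l : ℕ) : ℤ) ∣ (p : ℤ) := by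
        rw [← hw]
        obtain ⟨x, hx⟩ := h1
        obtain ⟨y, hy⟩ := h2
        exact ⟨y ^ 2 - 2 * x ^ 2, by rw [hx, hy]; push_cast; ring⟩
      have h4 : l * l ∣ p := Int.natCast_dvd_natCast.1 h3
      rcases (Nat.dvd_prime hp).1 h4 with h5 | h5
      · exact hl.one_lt.ne' (Nat.eq_one_of_mul_eq_one_right h5)
      · exact Nat.not_prime_mul hl.one_lt.ne' hl.one_lt.ne' (h5 ▸ hp)
    exact gcd_one_of_coprime hcop
  have step : ∀ w : ℤ√2, w.norm = p → 0 < w.re → SymCrit h p (sym (E * w)) → SymCrit h p (sym w) := by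
    intro w hw hu hs
    rwa [sym_E (by rw [hw]; omega) (by rw [hw]; exact hp0) hu] at hs
  have hodd : ∀ w : ℤ√2, w.norm = p → w.im % 2 = 1 ∧ (w.re % 8 = 1 ∨ w.re % 8 = 7) := by
    intro w hw
    rw [nrm] at hw
    exact mod_facts (by rw [hw]; omega)
  have c1 : ∀ w : ℤ√2, w.norm = p → 0 < w.re → w.re % 8 = 1 → SymCrit h p (sym w) := by
    intro w hw hu h8
    by_cases h16 : w.re % 16 = 1
    · exact c0 w hw hu h16
    · have hw1 : (E * w).norm = p := by rw [norm_E_mul, hw]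
      have hu1 := E_re_pos (by rw [hw]; exact hp0) hu
      have hw2 : (E * (E * w)).norm = p := by rw [norm_E_mul, hw1]
      have hu2 := E_re_pos (by rw [hw1]; exact hp0) hu1
      refine step w hw hu (step _ hw1 hu1 (c0 _ hw2 hu2 ?_))
      have := (hodd w hw).1
      simp only [E_mul]
      omega
  rcases (hodd w hw).2 with h8 | h8
  · exact c1 w hw hu h8
  · have hw1 : (E * w).norm = p := by rw [norm_E_mul, hw]
    have hu1 := E_re_pos (by rw [hw]; exact hp0) hu
    refine step w hw hu (c1 _ hw1 hu1 ?_)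
    have := (hodd w hw).1
    simp only [E_mul]
    omega

/-- the arithmetic function -/
noncomputable def F (r n : ℕ) : ℝ := if n % 32 = r then ((∑ w ∈ fset n, sym w : ℤ) : ℝ) else 0

theorem F_prime
    (hclass : ∀ p : ℕ, p.Prime → p % 8 = 7 →
      ∀ (F : Type) [Field F] [NumberField F],
        Nonempty (F ≃ₐ[ℚ] AdjoinRoot (X ^ 2 + C (2 * p : ℚ))) → h p = classNumber F)
    {p r : ℕ} (hp : p.Prime) (hp16 : p % 32 = r) (hr : r % 16 = 15) :
    8 ∣ h p ∧ F r p = if 16 ∣ h p then 2 else -2 := by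
  have h16 : p % 16 = 15 := by omega
  obtain ⟨π, hπ⟩ := fset_nonempty hp (by omega)
  have hπ' := mem_fset.1 hπ
  have os := orbit_sum (n := 1) hp one_pos (by omega) (by simpa using hp.one_lt.ne') hπ sym (by
    intro w hw hu
    exact sym_E (by rw [hw]; push_cast; omega) (by rw [hw]; exact_mod_cast Nat.mul_pos hp.pos one_pos) hu)
  rw [fset_one, sum_singleton, sum_singleton, mul_one, mul_one, mul_one] at os
  have k1 := sym_crit h hclass hp h16 hπ'.1 hπ'.2.sq.2
  have k2 := sym_crit h hclass hp h16 (w := star π) (by rw [Zsqrtd.norm_conj, hπ'.1]) hπ'.2.star.sq.2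
  refine ⟨k1.2.1, ?_⟩
  unfold F
  rw [if_pos hp16, os]
  obtain ⟨a1, -, a2⟩ := k1
  obtain ⟨b1, -, b2⟩ := k2
  split_ifs with hh
  · rw [a2.1 hh, b2.1 hh]; norm_num
  · have : sym π = -1 := by rcases a1 with a | a; exact absurd (a2.2 a) hh; exact a
    have : sym (star π) = -1 := by rcases b1 with a | a; exact absurd (b2.2 a) hh; exact a
    simp [*]

end crit

end QB

end

section

open scoped NumberTheorySymbols
open Finset

namespace QB

/-- reciprocity sign -/
def sg (x y : ℤ) : ℤ := if x % 4 = 3 ∧ y % 4 = 3 then -1 else 1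
/-- (2/x) -/
def ch (x : ℤ) : ℤ := if x % 8 = 1 ∨ x % 8 = 7 then 1 else -1
/-- (±1/x) -/
def ss (s : Bool) (x : ℤ) : ℤ := if s = true ∧ x % 4 = 3 then -1 else 1

theorem sg_recip {x y : ℕ} (hx : x % 2 = 1) (hy : y % 2 = 1) : J(x | y) = sg x y * J(y | x) := by
  unfold sg
  split_ifs with h
  · rw [jacobiSym.quadratic_reciprocity_three_mod_four (by omega) (by omega)]; ring
  · rw [not_and_or] at h
    by_cases h1 : x % 4 = 1
    · rw [jacobiSym.quadratic_reciprocity_one_mod_four h1 (Nat.odd_iff.2 hy), one_mul]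
    · rw [← jacobiSym.quadratic_reciprocity_one_mod_four (a := y) (b := x) (by omega) (Nat.odd_iff.2 hx), one_mul]

theorem ch_eq {x : ℕ} (hx : x % 2 = 1) : J(2 | x) = ch x := by
  rw [jacobiSym.at_two (Nat.odd_iff.2 hx), ZMod.χ₈_nat_eq_if_mod_eight, if_neg (by omega)]
  unfold ch
  split_ifs <;> first | rfl | omega

/-- the sign as an integer -/
def sgn (s : Bool) : ℤ := if s then -1 else 1

theorem ss_eq {x : ℕ} (hx : x % 2 = 1) (s : Bool) : J(sgn s | x) = ss s x := by
  unfold ss sgn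
  cases s
  · simp
  · simp only [if_true, true_and]
    rw [jacobiSym.at_neg_one (Nat.odd_iff.2 hx), ZMod.χ₄_nat_eq_if_mod_four, if_neg (by omega)]
    split_ifs <;> first | rfl | omega

theorem sg_three {c u b g : ℕ} (hc : c % 2 = 1) (hu : u % 2 = 1) (hb : b % 2 = 1) (hg : g % 2 = 1) :
    sg c u * sg b u * sg c b = sg (c * g : ℕ) (u * g : ℕ) * sg (b * g : ℕ) (u * g : ℕ) * sg (c * g : ℕ) (b * g : ℕ) * ss true g := by
  have aux : ∀ x y : ℕ, ((x * y : ℕ) : ℤ) % 4 = ((x : ℤ) % 4 * ((y : ℤ) % 4)) % 4 := by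
    intro x y; push_cast; exact Int.mul_emod _ _ _
  unfold sg ss
  rw [aux c g, aux u g, aux b g]
  have h1 : (c : ℤ) % 4 = 1 ∨ (c : ℤ) % 4 = 3 := by omega
  have h2 : (u : ℤ) % 4 = 1 ∨ (u : ℤ) % 4 = 3 := by omega
  have h3 : (b : ℤ) % 4 = 1 ∨ (b : ℤ) % 4 = 3 := by omega
  have h4 : (g : ℤ) % 4 = 1 ∨ (g : ℤ) % 4 = 3 := by omega
  rcases h1 with h1 | h1 <;> rcases h2 with h2 | h2 <;> rcases h3 with h3 | h3 <;> rcases h4 with h4 | h4 <;>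
    rw [h1, h2, h3, h4] <;> decide

theorem sgn_sq (s : Bool) : sgn s * sgn s = 1 := by cases s <;> rfl

/-- The main reciprocity computation. -/
theorem core_rec {a c u be : ℕ} {d n v : ℤ} {s : Bool} (hc : c % 2 = 1) (hb : be % 2 = 1)
    (hu : u % 2 = 1) (hcd : IsCoprime (c : ℤ) d) (hue : (u : ℤ) = a * c + 2 * (sgn s * be) * d)
    (hn : n = (c : ℤ) ^ 2 - 2 * d ^ 2) (hv : v = a * d + sgn s * be * c) :
    J(v | u) = sg c u * sg be u * sg c be * ch c * ss s c * ss s u * (J(a | be) * J(d | c) * J(n | u)) := by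
  obtain ⟨g, b1, c1, hg0, hcop, hb1, hc1⟩ : ∃ g b1 c1 : ℕ, 0 < g ∧ Nat.Coprime b1 c1 ∧ be = b1 * g ∧ c = c1 * g :=
    Nat.exists_coprime' (Nat.gcd_pos_of_pos_left _ (by omega))
  have hgu : (g : ℤ) ∣ u := by
    rw [hue, hb1, hc1]; push_cast
    exact ⟨a * c1 + 2 * (sgn s * b1) * d, by ring⟩
  obtain ⟨u1, hu1⟩ := Int.natCast_dvd_natCast.1 hgu
  rw [mul_comm] at hu1
  have og : g % 2 = 1 := by
    rcases Nat.mod_two_eq_zero_or_one g with h | h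
    · rw [hu1, Nat.mul_mod, h] at hu; simp at hu
    · exact h
  have odd_of : ∀ {x y : ℕ}, (x * y) % 2 = 1 → x % 2 = 1 := by
    intro x y h
    rcases Nat.mod_two_eq_zero_or_one x with h' | h'
    · rw [Nat.mul_mod, h'] at h; simp at h
    · exact h'
  have ou1 : u1 % 2 = 1 := odd_of (hu1 ▸ hu)
  have ob1 : b1 % 2 = 1 := odd_of (hb1 ▸ hb)
  have oc1 : c1 % 2 = 1 := odd_of (hc1 ▸ hc)
  have gz : (g : ℤ) ≠ 0 := by exact_mod_cast hg0.ne'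
  have hu1e : (u1 : ℤ) = a * c1 + 2 * (sgn s * b1) * d := by
    have : (u1 : ℤ) * g = (a * c1 + 2 * (sgn s * b1) * d) * g := by
      have : (u : ℤ) = u1 * g := by rw [hu1]; push_cast; rfl
      rw [← this, hue, hb1, hc1]; push_cast; ring
    exact mul_right_cancel₀ gz this
  have hcv : (c1 : ℤ) * v = u1 * d + sgn s * b1 * n := by
    have : (c1 : ℤ) * v * g = (u1 * d + sgn s * b1 * n) * g := by
      rw [hu1e, hv, hn, hb1, hc1]; push_cast; ring
    exact mul_right_cancel₀ gz this
  have hcz : (c : ℤ) = c1 * g := by rw [hc1]; push_cast; rfl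
  have cop1 : IsCoprime (c1 : ℤ) d := (hcz ▸ hcd).of_mul_left_left
  have copg : IsCoprime (g : ℤ) d := (hcz ▸ hcd).of_mul_left_right
  have sq1 : ∀ {x : ℤ} {y : ℕ}, IsCoprime x (y : ℤ) → J(x | y) * J(x | y) = 1 := by
    intro x y h
    exact jac_sq_one (by simpa using gcd_one_of_coprime h)
  have c2 : IsCoprime (2 : ℤ) (c1 : ℤ) := by
    have : Nat.Coprime 2 c1 := (Nat.coprime_two_left).2 (Nat.odd_iff.2 oc1)
    exact_mod_cast Nat.isCoprime_iff_coprime.2 this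
  have g2 : IsCoprime (2 : ℤ) (g : ℤ) := by
    have : Nat.Coprime 2 g := (Nat.coprime_two_left).2 (Nat.odd_iff.2 og)
    exact_mod_cast Nat.isCoprime_iff_coprime.2 this
  have cb : IsCoprime (b1 : ℤ) (c1 : ℤ) := Nat.isCoprime_iff_coprime.2 hcop
  have csg : IsCoprime (sgn s) (c1 : ℤ) := ⟨sgn s, 0, by rw [sgn_sq]; ring⟩
  have csu : IsCoprime (sgn s) (u1 : ℤ) := ⟨sgn s, 0, by rw [sgn_sq]; ring⟩
  have csgg : IsCoprime (sgn s) (g : ℤ) := ⟨sgn s, 0, by rw [sgn_sq]; ring⟩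
  have cuc : IsCoprime (c1 : ℤ) (u1 : ℤ) := by
    rw [hu1e]
    have : IsCoprime (c1 : ℤ) (2 * (sgn s * b1) * d) := by
      exact ((c2.symm.mul_right (csg.symm.mul_right cb.symm)).mul_right cop1)
    have h3 := this.add_mul_left_right (a : ℤ)
    rwa [add_comm, mul_comm (c1 : ℤ) (a : ℤ)] at h3
  have jd : ∀ {x y : ℤ} {k : ℕ}, (k : ℤ) ∣ x - y → J(x | k) = J(y | k) := by
    intro x y k h
    simpa using jac_dvd h
  -- steps
  have z1 : J(v | u) = J(v | u1) * J(v | g) := by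
    rw [hu1]; exact jacobiSym.mul_right' _ (by omega) (by omega)
  have z2 : J(v | g) = J(a | g) * J(d | g) := by
    rw [← jacobiSym.mul_left]
    apply jd
    rw [hv, hcz]; exact ⟨sgn s * be * c1, by ring⟩
  have z3 : J(c1 | u1) * J(v | u1) = J(sgn s | u1) * J(b1 | u1) * J(n | u1) := by
    rw [← jacobiSym.mul_left, ← jacobiSym.mul_left, ← jacobiSym.mul_left, hcv]
    apply jd
    exact ⟨d, by ring⟩
  have z4 : J(u1 | c1) = J(2 | c1) * (J(sgn s | c1) * J(b1 | c1)) * J(d | c1) := by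
    rw [← jacobiSym.mul_left, ← jacobiSym.mul_left, ← jacobiSym.mul_left, hu1e]
    apply jd
    exact ⟨a, by ring⟩
  have z5 : J(u1 | b1) = J(a | b1) * J(c1 | b1) := by
    rw [← jacobiSym.mul_left, hu1e]
    apply jd
    exact ⟨2 * sgn s * d, by ring⟩
  have z6 : J(n | g) = J(sgn true | g) * J(2 | g) := by
    have : J(n | g) = J(sgn true * 2 * (d * d) | g) := by
      apply jd
      rw [hn, hcz]; exact ⟨c1 ^ 2 * g, by simp [sgn]; ring⟩
    rw [this, jacobiSym.mul_left, jacobiSym.mul_left, jacobiSym.mul_left, sq1 copg.symm, mul_one]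
  have w1 : J(a | be) = J(a | b1) * J(a | g) := by
    rw [hb1]; exact jacobiSym.mul_right' _ (by omega) (by omega)
  have w2 : J(d | c) = J(d | c1) * J(d | g) := by
    rw [hc1]; exact jacobiSym.mul_right' _ (by omega) (by omega)
  have w3 : J(n | u) = J(n | u1) * J(n | g) := by
    rw [hu1]; exact jacobiSym.mul_right' _ (by omega) (by omega)
  have w4 : ch c = J(2 | c1) * J(2 | g) := by
    rw [← ch_eq hc, hc1]; exact jacobiSym.mul_right' _ (by omega) (by omega)
  have w5 : ss s c = J(sgn s | c1) * J(sgn s | g) := by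
    rw [← ss_eq hc, hc1]; exact jacobiSym.mul_right' _ (by omega) (by omega)
  have w6 : ss s u = J(sgn s | u1) * J(sgn s | g) := by
    rw [← ss_eq hu, hu1]; exact jacobiSym.mul_right' _ (by omega) (by omega)
  have r1 := sg_recip oc1 ou1
  have r2 := sg_recip ob1 ou1
  have r3 := sg_recip oc1 ob1
  have hs := sg_three oc1 ou1 ob1 og
  rw [← hc1, ← hu1, ← hb1, ← ss_eq og] at hs
  have q1 := sq1 cuc
  have q2 := sq1 cb
  have q3 := sq1 g2
  have q4 := sq1 csgg
  have q5 : J(sgn true | g) * J(sgn true | g) = 1 := sq1 ⟨sgn true, 0, by rw [sgn_sq]; ring⟩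
  have e1 : J(v | u1) = J(c1 | u1) * (J(sgn s | u1) * J(b1 | u1) * J(n | u1)) := by
    rw [← z3, ← mul_assoc, q1, one_mul]
  rw [z1, z2, e1, w1, w2, w3, w4, w5, w6, z6, r1, r2, z4, z5, r3]
  generalize J(sgn true | g) = x1 at *
  generalize J(sgn s | g) = x2 at *
  generalize J(2 | g) = x3 at *
  generalize J(b1 | c1) = x4 at *
  have hs' : sg c u * sg be u * sg c be = sg c1 u1 * sg b1 u1 * sg c1 b1 * x1 := by
    rw [hs]; linear_combination (-(sg c u * sg be u * sg c be)) * q5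
  rw [hs']
  generalize sg c1 u1 = y1
  generalize sg b1 u1 = y2
  generalize sg c1 b1 = y3
  generalize J(2 | c1) = t1
  generalize J(sgn s | c1) = t2
  generalize J(d | c1) = t3
  generalize J(sgn s | u1) = t4
  generalize J(n | u1) = t5
  generalize J(a | g) = t6
  generalize J(d | g) = t7
  generalize J(a | b1) = t8
  have e : y1 * y2 * y3 * x1 * (t1 * x3) * (t2 * x2) * (t4 * x2) * (t8 * t6 * (t3 * t7) * (t5 * (x1 * x3)))
    = y1 * y2 * y3 * t1 * t2 * t4 * t8 * t6 * t3 * t7 * t5 * ((x1 * x1) * (x2 * x2) * (x3 * x3)) := by ring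
  rw [e, q5, q4, q3]
  linear_combination (y1 * y2 * y3 * t1 * t2 * t3 * t4 * t5 * t6 * t7 * t8) * q2


/-- total sign, case `b` odd, `d` even -/
def T1 (a b c d : ℤ) (s : Bool) : ℤ :=
  kap (a * c + 2 * b * d) (a * d + b * c) *
    (sg c (a * c + 2 * b * d) * sg (sgn s * b) (a * c + 2 * b * d) * sg c (sgn s * b) * ch c * ss s c * ss s (a * c + 2 * b * d))
    * (sg a (sgn s * b) * ss s a)

theorem mul_eq' (π z : ℤ√2) : π * z = ⟨π.re * z.re + 2 * π.im * z.im, π.re * z.im + π.im * z.re⟩ := by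
  ext <;> simp

theorem mul_re_pos {π z : ℤ√2} (hπ : Red π) (hz : Red z) : 0 < (π * z).re := by
  rw [mul_eq']
  dsimp only
  have h1 := hπ.sq.2
  have h2 := hz.sq.2
  unfold Red at hπ hz
  have h3 : |π.im * z.im| = |π.im| * |z.im| := abs_mul _ _
  have h4 := neg_abs_le (π.im * z.im)
  have h5 : 4 * (|π.im| * |z.im|) ≤ π.re * z.re := by
    nlinarith [abs_nonneg π.im, abs_nonneg z.im]
  nlinarith [mul_pos h1 h2]

theorem norm_odd_re {w : ℤ√2} (h : w.norm % 2 = 1) : w.re % 2 = 1 := by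
  rw [nrm] at h
  rcases Int.emod_two_eq_zero_or_one w.re with h1 | h1
  · have : w.re ^ 2 % 2 = 0 := by rw [pow_two, Int.mul_emod, h1]; rfl
    omega
  · exact h1

theorem sq_mod8 {x : ℤ} (h : x % 2 = 1) : x ^ 2 % 8 = 1 := by
  have := Int.emod_emod_of_dvd x (by norm_num : (2 : ℤ) ∣ 8)
  have h3 : x % 8 = 1 ∨ x % 8 = 3 ∨ x % 8 = 5 ∨ x % 8 = 7 := by omega
  rcases h3 with h | h | h | h <;> rw [pow_two, Int.mul_emod, h] <;> rfl

theorem jac_zero {l : ℕ} (hl : l.Prime) {x : ℤ} {k : ℕ} (hk : k ≠ 0) (h1 : (l : ℤ) ∣ x) (h2 : (l : ℤ) ∣ k) : J(x | k) = 0 := by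
  rw [jacobiSym.eq_zero_iff]
  refine ⟨hk, ?_⟩
  intro h
  have h3 : l ∣ x.gcd k := Int.dvd_gcd h1 h2 |> fun h => by exact_mod_cast h
  rw [h] at h3
  exact hl.one_lt.ne' (Nat.dvd_one.1 h3)

theorem exists_prime_of_not_coprime {x y : ℤ} (h : ¬ IsCoprime x y) : ∃ l : ℕ, l.Prime ∧ (l : ℤ) ∣ x ∧ (l : ℤ) ∣ y := by
  rw [Int.isCoprime_iff_gcd_eq_one] at h
  obtain ⟨l, hl, hd⟩ := Nat.exists_prime_and_dvd h
  exact ⟨l, hl, (Int.natCast_dvd_natCast.2 hd).trans (Int.gcd_dvd_left _ _),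
    (Int.natCast_dvd_natCast.2 hd).trans (Int.gcd_dvd_right _ _)⟩

theorem sym_mul1 {π z : ℤ√2} (hπ : Red π) (hz : Red z) (hN : (π.norm * z.norm) % 16 = 15) (hb : π.im % 2 = 1) :
    z.norm % 8 = 1 ∧
    sym (π * z) = T1 π.re π.im z.re z.im (decide (π.im < 0)) *
      (J(π.im | π.re.natAbs) * J(z.im | z.re.natAbs) * J((π * z).re | z.norm.natAbs)) := by
  have hup := mul_re_pos hπ hz
  have hodd : (π * z).norm % 2 = 1 := by rw [Zsqrtd.norm_mul]; omega
  have huo := norm_odd_re hodd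
  have hzn := hz.norm_pos
  have ha0 := hπ.sq.2
  have hc0 := hz.sq.2
  have ho1 : π.norm % 2 = 1 := by
    rcases Int.emod_two_eq_zero_or_one π.norm with h | h
    · exfalso; have : (π.norm * z.norm) % 2 = 0 := by rw [Int.mul_emod, h]; simp
      omega
    · exact h
  have ho2 : z.norm % 2 = 1 := by
    rcases Int.emod_two_eq_zero_or_one z.norm with h | h
    · exfalso; have : (π.norm * z.norm) % 2 = 0 := by rw [Int.mul_emod, h]; simp
      omega
    · exact h
  have hao := norm_odd_re ho1
  have hco := norm_odd_re ho2
  have hm8 : π.norm % 8 = 7 := by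
    rw [nrm]; have := sq_mod8 hao; have := sq_mod8 hb; omega
  have hn8 : z.norm % 8 = 1 := by
    have h3 : (π.norm * z.norm) % 8 = (π.norm % 8 * (z.norm % 8)) % 8 := Int.mul_emod _ _ _
    rw [hm8] at h3
    omega
  refine ⟨hn8, ?_⟩
  rw [mul_eq'] at hup huo ⊢
  have hzn' := nrm z
  generalize hnn : z.norm = n at *
  obtain ⟨a, b⟩ := π
  obtain ⟨c, d⟩ := z
  dsimp only at *
  obtain ⟨u, hu⟩ : ∃ u, u = a * c + 2 * b * d := ⟨_, rfl⟩
  obtain ⟨v, hv⟩ : ∃ v, v = a * d + b * c := ⟨_, rfl⟩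
  unfold sym T1
  dsimp only
  rw [← hu, ← hv]
  rw [← hu] at hup huo
  by_cases hcd : IsCoprime c d
  · obtain ⟨s, hs⟩ : ∃ s, s = decide (b < 0) := ⟨_, rfl⟩
    rw [← hs]
    have hbs : b = sgn s * (b.natAbs : ℤ) ∧ sgn s * b = b.natAbs := by
      rw [hs]; unfold sgn
      by_cases h : b < 0
      · simp only [h, decide_true, if_true]; omega
      · simp only [h, decide_false, Bool.false_eq_true, if_false]; omega
    have ea : (a.natAbs : ℤ) = a := by omega
    have ec : (c.natAbs : ℤ) = c := by omega
    have eu : (u.natAbs : ℤ) = u := by omega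
    have en : (n.natAbs : ℤ) = n := by omega
    have k := core_rec (a := a.natAbs) (c := c.natAbs) (u := u.natAbs) (be := b.natAbs) (d := d) (n := n) (v := v) (s := s)
      (by omega) (by omega) (by omega) (by rw [ec]; exact hcd) (by rw [eu, ea, ec, ← hbs.1, hu]) (by rw [ec]; exact hzn')
      (by rw [ea, ec, ← hbs.1, hv])
    rw [k, hbs.2]
    have r1 : J((a.natAbs : ℤ) | b.natAbs) = sg a b.natAbs * (ss s a * J(b | a.natAbs)) := by
      rw [sg_recip (by omega) (by omega), ea]
      nth_rewrite 4 [hbs.1]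
      rw [jacobiSym.mul_left, ss_eq (by omega), ea, ← mul_assoc (ss s a)]
      have : ss s a * ss s a = 1 := by unfold ss; split_ifs <;> rfl
      rw [this, one_mul]
    have r2 : J(n | u.natAbs) = J(u | n.natAbs) := by
      have := jacobiSym.quadratic_reciprocity_one_mod_four (a := n.natAbs) (b := u.natAbs) (by omega) (Nat.odd_iff.2 (by omega))
      rwa [en, eu] at this
    rw [r1, r2, ec, eu]
    ring
  · obtain ⟨l, hl, h1, h2⟩ := exists_prime_of_not_coprime hcd
    rw [jac_zero hl (by omega) h2 (Int.dvd_natAbs.2 h1)]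
    rw [jac_zero hl (x := v) (k := u.natAbs) (by omega) (by rw [hv]; exact dvd_add (h2.mul_left _) (h1.mul_left _))
      (Int.dvd_natAbs.2 (by rw [hu]; exact dvd_add (h1.mul_left _) (h2.mul_left _)))]
    ring

theorem l_dvd {π z : ℤ√2} {l : ℕ} (hl : l.Prime) (h1 : IsCoprime π.re π.im) (h2 : IsCoprime z.re z.im)
    (hu : (l : ℤ) ∣ (π * z).re) (hv : (l : ℤ) ∣ (π * z).im) : (l : ℤ) ∣ z.norm := by
  rw [mul_eq'] at hu hv
  dsimp only at hu hv
  have h3 : (l : ℤ) ∣ π.im * z.norm := by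
    have e : π.im * z.norm = z.re * (π.re * z.im + π.im * z.re) - z.im * (π.re * z.re + 2 * π.im * z.im) := by
      rw [nrm]; ring
    rw [e]; exact dvd_sub (hv.mul_left _) (hu.mul_left _)
  rcases Int.Prime.dvd_mul' hl h3 with h4 | h4
  · exfalso
    have hnu : ¬ IsUnit (l : ℤ) := by
      intro h; rw [Int.isUnit_iff] at h; have := hl.two_le; omega
    have ha : ¬ (l : ℤ) ∣ π.re := fun h => hnu (h1.isUnit_of_dvd' h h4)
    have h5 : (l : ℤ) ∣ π.re * z.im := by
      have := dvd_sub hv (h4.mul_right z.re)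
      simpa using this
    have h6 : (l : ℤ) ∣ π.re * z.re := by
      have := dvd_sub hu (h4.mul_right (2 * z.im))
      have e : π.re * z.re + 2 * π.im * z.im - π.im * (2 * z.im) = π.re * z.re := by ring
      rwa [e] at this
    have h7 := (Int.Prime.dvd_mul' hl h5).resolve_left ha
    have h8 := (Int.Prime.dvd_mul' hl h6).resolve_left ha
    exact hnu (h2.isUnit_of_dvd' h8 h7)
  · exact h4

/-- total sign -/
def T (a b : ℤ) (s : Bool) (c d : ℤ) (t : Bool) : ℤ :=
  if b % 2 = 1 then T1 a b c d s else T1 c d a b t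

theorem sym_mul {π z : ℤ√2} (hπ : Red π) (hz : Red z) (hN : (π.norm * z.norm) % 16 = 15)
    (hcop : IsCoprime π.norm z.norm) :
    sym (π * z) = T π.re π.im (decide (π.im < 0)) z.re z.im (decide (z.im < 0)) *
      (J(π.im | π.re.natAbs) * J(z.im | z.re.natAbs) * J((π * z).re | z.norm.natAbs)) := by
  unfold T
  split_ifs with hb
  · exact (sym_mul1 hπ hz hN hb).2
  · have hN' : (z.norm * π.norm) % 16 = 15 := by rw [mul_comm]; exact hN
    have hd : z.im % 2 = 1 := by
      by_contra hd
      have hp : (π * z).norm % 16 = 15 := by rw [Zsqrtd.norm_mul]; exact hN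
      rw [nrm] at hp
      have := (mod_facts hp).1
      rw [mul_eq'] at this; dsimp only at this
      have h1 : π.im % 2 = 0 := by omega
      have h2 : z.im % 2 = 0 := by omega
      rw [Int.add_emod, Int.mul_emod, Int.mul_emod π.im, h1, h2] at this
      simp at this
    obtain ⟨hm8, k⟩ := sym_mul1 hz hπ hN' hd
    rw [mul_comm π z, k]
    by_cases hab : IsCoprime π.re π.im
    swap
    · obtain ⟨l, hl, h1, h2⟩ := exists_prime_of_not_coprime hab
      rw [jac_zero hl (x := π.im) (k := π.re.natAbs) (by have := hπ.sq.2; omega) h2 (Int.dvd_natAbs.2 h1)]; ring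
    by_cases hcd : IsCoprime z.re z.im
    swap
    · obtain ⟨l, hl, h1, h2⟩ := exists_prime_of_not_coprime hcd
      rw [jac_zero hl (x := z.im) (k := z.re.natAbs) (by have := hz.sq.2; omega) h2 (Int.dvd_natAbs.2 h1)]; ring
    have huv : IsCoprime (z * π).re (z * π).im := by
      by_contra hc
      obtain ⟨l, hl, h1, h2⟩ := exists_prime_of_not_coprime hc
      have h3 := l_dvd hl hcd hab h1 h2
      rw [mul_comm] at h1 h2
      have h4 := l_dvd hl hab hcd h1 h2
      have := hcop.isUnit_of_dvd' h3 h4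
      rw [Int.isUnit_iff] at this
      have := hl.two_le
      omega
    have hup := mul_re_pos hz hπ
    have hnp := hz.norm_pos
    have hmp := hπ.norm_pos
    have hp : (z * π).norm % 16 = 15 := by rw [Zsqrtd.norm_mul]; exact hN'
    have hw : (z * π).norm = z.norm * π.norm := Zsqrtd.norm_mul _ _
    have hw2 := nrm (z * π)
    have hp' := hp
    rw [nrm] at hp'
    have hu8 := (mod_facts hp').2
    generalize (z * π).re = u at *
    generalize (z * π).im = v at *
    generalize z.norm = n at *
    generalize π.norm = m at *
    have key : J(u | m.natAbs) = J(u | n.natAbs) := by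
      have eu : (u.natAbs : ℤ) = u := by omega
      have en : (n.natAbs : ℤ) = n := by omega
      have em : (m.natAbs : ℤ) = m := by omega
      have hn8 : n % 8 = 7 := by
        have h3 : (n * m) % 8 = (n % 8 * (m % 8)) % 8 := Int.mul_emod _ _ _
        rw [hm8] at h3
        omega
      have r1 := jacobiSym.quadratic_reciprocity_one_mod_four (a := m.natAbs) (b := u.natAbs) (by omega) (Nat.odd_iff.2 (by omega))
      have r2 := sg_recip (x := n.natAbs) (y := u.natAbs) (by omega) (by omega)
      rw [eu, em] at r1
      rw [eu, en] at r2
      · have h1 : J(n | u.natAbs) * J(m | u.natAbs) = J(sgn true | u.natAbs) * J(2 | u.natAbs) := by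
          rw [← jacobiSym.mul_left, ← jacobiSym.mul_left, ← hw, hw2]
          rw [jac_dvd (a := u ^ 2 - 2 * v ^ 2) (b := sgn true * 2 * (v * v)) ⟨u, by simp [sgn]; ring⟩,
            jacobiSym.mul_left _ (v * v), jacobiSym.mul_left v v, jac_sq_one (gcd_one_of_coprime huv.symm), mul_one]
        rw [ss_eq (by omega), ch_eq (by omega), r2, r1, eu] at h1
        have hsm : J(u | m.natAbs) * J(u | m.natAbs) = 1 := by
          apply jac_sq_one
          apply gcd_one_of_coprime
          by_contra hc
          obtain ⟨l, hl, h3, h4⟩ := exists_prime_of_not_coprime hc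
          have h5 : (l : ℤ) ∣ 2 * (v * v) := by
            have : 2 * (v * v) = u * u - n * m := by rw [← hw, hw2]; ring
            rw [this]; exact dvd_sub (h3.mul_left _) (h4.mul_left _)
          rcases Int.Prime.dvd_mul' hl h5 with h6 | h6
          · have := Int.emod_emod_of_dvd m h6
            have h7 : l ≤ 2 := Nat.le_of_dvd (by norm_num) (by exact_mod_cast h6)
            have h8 : l = 2 := le_antisymm h7 hl.two_le
            subst h8
            omega
          · have h7 : (l : ℤ) ∣ v := by rcases Int.Prime.dvd_mul' hl h6 with h | h <;> exact h
            have := huv.isUnit_of_dvd' h3 h7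
            rw [Int.isUnit_iff] at this
            have := hl.two_le
            omega
        have hsn : J(u | n.natAbs) = J(u | n.natAbs) * (J(u | m.natAbs) * J(u | m.natAbs)) := by rw [hsm, mul_one]
        have hsg : sg n u * (ss true u * ch u) = 1 := by
          unfold sg ss ch
          rcases hu8 with h | h
          · rw [if_neg (by omega), if_neg (by omega), if_pos (by omega)]; rfl
          · rw [if_pos (by omega), if_pos ⟨rfl, by omega⟩, if_pos (by omega)]; rfl
        have hsg2 : sg n u * sg n u = 1 := by unfold sg; split_ifs <;> rfl
        linear_combination (- (J(u | m.natAbs) * sg n u)) * h1 - J(u | m.natAbs) * hsg + J(u | n.natAbs) * J(u | m.natAbs) * J(u | m.natAbs) * hsg2 + J(u | n.natAbs) * hsm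
    rw [key]; ring

theorem T1_mod (a b c d : ℤ) (s : Bool) : T1 (a % 16) (b % 16) (c % 16) (d % 16) s = T1 a b c d s := by
  have hu : (a % 16 * (c % 16) + 2 * (b % 16) * (d % 16)) % 16 = (a * c + 2 * b * d) % 16 := by
    simp [Int.add_emod, Int.mul_emod]
  have hv : (a % 16 * (d % 16) + b % 16 * (c % 16)) % 16 = (a * d + b * c) % 16 := by
    simp [Int.add_emod, Int.mul_emod]
  have hs : (sgn s * (b % 16)) % 16 = (sgn s * b) % 16 := by simp [Int.mul_emod]
  unfold T1
  generalize (a % 16 * (c % 16) + 2 * (b % 16) * (d % 16)) = u' at *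
  generalize (a * c + 2 * b * d) = u at *
  generalize (a % 16 * (d % 16) + b % 16 * (c % 16)) = v' at *
  generalize (a * d + b * c) = v at *
  generalize sgn s * (b % 16) = e' at *
  generalize sgn s * b = e at *
  have hk : kap u' v' = kap u v := by
    unfold kap
    rw [show u' % 8 = u % 8 by omega, hu, show (3 * u' + 4 * v') % 16 = (3 * u + 4 * v) % 16 by omega]
  unfold sg ch ss
  rw [hk, show u' % 4 = u % 4 by omega, show e' % 4 = e % 4 by omega, show c % 16 % 4 = c % 4 by omega,
    show c % 16 % 8 = c % 8 by omega, show a % 16 % 4 = a % 4 by omega]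

theorem T_mod (a b c d : ℤ) (s t : Bool) : T (a % 16) (b % 16) s (c % 16) (d % 16) t = T a b s c d t := by
  unfold T
  rw [T1_mod, T1_mod, show b % 16 % 2 = b % 2 by omega]

theorem T_abs (a b c d : ℤ) (s t : Bool) : |T a b s c d t| ≤ 1 := by
  have k : ∀ u v, |kap u v| = 1 := by intro u v; unfold kap; split_ifs <;> rfl
  have g : ∀ u v, |sg u v| = 1 := by intro u v; unfold sg; split_ifs <;> rfl
  have c : ∀ u, |ch u| = 1 := by intro u; unfold ch; split_ifs <;> rfl
  have e : ∀ u v, |ss u v| = 1 := by intro u v; unfold ss; split_ifs <;> rfl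
  unfold T T1
  split_ifs <;> simp only [abs_mul, k, g, c, e] <;> norm_num

/-- residue and sign class of an element -/
noncomputable def cls (w : ℤ√2) : ℤ × ℤ × Bool := (w.re % 16, w.im % 16, decide (w.im < 0))

/-- all classes -/
noncomputable def Cls : Finset (ℤ × ℤ × Bool) := Ico 0 16 ×ˢ Ico 0 16 ×ˢ univ

theorem cls_mem (w : ℤ√2) : cls w ∈ Cls := by
  unfold cls Cls
  simp only [mem_product, mem_Ico, mem_univ, and_true]
  omega

/-- class coefficient, with the congruence condition included -/
noncomputable def rho (r : ℕ) (k l : ℤ × ℤ × Bool) : ℤ :=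
  if ((k.1 ^ 2 - 2 * k.2.1 ^ 2) * (l.1 ^ 2 - 2 * l.2.1 ^ 2)) % 32 = r then T k.1 k.2.1 k.2.2 l.1 l.2.1 l.2.2 else 0

theorem rho_abs (r : ℕ) (k l : ℤ × ℤ × Bool) : |rho r k l| ≤ 1 := by
  unfold rho; split_ifs
  · exact T_abs _ _ _ _ _ _
  · simp

theorem nrm_mod (a b : ℤ) : ((a % 16) ^ 2 - 2 * (b % 16) ^ 2) % 32 = (a ^ 2 - 2 * b ^ 2) % 32 := by
  have ha := Int.emod_add_mul_ediv a 16
  have hb := Int.emod_add_mul_ediv b 16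
  generalize a % 16 = x at *
  generalize b % 16 = y at *
  generalize a / 16 = q at *
  generalize b / 16 = t at *
  rw [← ha, ← hb]
  have e : (x + 16 * q) ^ 2 - 2 * (y + 16 * t) ^ 2 = x ^ 2 - 2 * y ^ 2 + 32 * (x * q + 8 * q ^ 2 - 2 * y * t - 16 * t ^ 2) := by ring
  rw [e, Int.add_mul_emod_self_left]

/-- Twisted multiplicativity. -/
theorem sym_mul_rho {π z : ℤ√2} {r : ℕ} (hr : r % 16 = 15) (hπ : Red π) (hz : Red z)
    (hcop : IsCoprime π.norm z.norm) :
    (if (π.norm * z.norm) % 32 = r then sym (π * z) else 0) = rho r (cls π) (cls z) *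
      (J(π.im | π.re.natAbs) * J(z.im | z.re.natAbs) * J((π * z).re | z.norm.natAbs)) := by
  unfold rho cls
  dsimp only
  have e : ((π.re % 16) ^ 2 - 2 * (π.im % 16) ^ 2) * ((z.re % 16) ^ 2 - 2 * (z.im % 16) ^ 2) % 32 = (π.norm * z.norm) % 32 := by
    rw [Int.mul_emod, nrm_mod, nrm_mod, ← nrm, ← nrm, ← Int.mul_emod]
  rw [e]
  split_ifs with h
  · rw [T_mod]
    exact sym_mul hπ hz (by omega) hcop
  · ring

end QB

end

section

open scoped NumberTheorySymbols
open Finset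

namespace QB

theorem exists_jac_neg {q a b p : ℕ} (hq : q % 2 = 1) (hqe : q = b ^ 2 * a) (ha : Squarefree a) (hp : p.Prime) (hpa : p ∣ a) :
    ∃ t : ℤ, J(t | q) = -1 ∧ ∀ g : ℕ, g ∣ q → ¬ p ∣ g → (g : ℤ) ∣ t - 1 := by
  have : Fact p.Prime := ⟨hp⟩
  have hq0 : q ≠ 0 := by omega
  have ha0 : a ≠ 0 := ha.ne_zero
  have hb0 : b ≠ 0 := by rintro rfl; simp at hqe; omega
  have hp2 : p ≠ 2 := by
    rintro rfl
    have : 2 ∣ q := hqe ▸ (hpa.mul_left _)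
    omega
  obtain ⟨k, q', hq', hk⟩ := Nat.exists_eq_pow_mul_and_not_dvd hq0 p hp.ne_one
  have hkodd : k % 2 = 1 := by
    have h1 : q.factorization p = k := by
      rw [hk, Nat.factorization_mul (pow_ne_zero _ hp.ne_zero) (by rintro rfl; simp at hq'), hp.factorization_pow]
      simp [Nat.factorization_eq_zero_of_not_dvd hq']
    have h2 : q.factorization p = 2 * b.factorization p + 1 := by
      rw [hqe, Nat.factorization_mul (pow_ne_zero _ hb0) ha0, Nat.factorization_pow]
      have : a.factorization p = 1 := by
        have h3 := ha.natFactorization_le_one p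
        have h4 := hp.factorization_pos_of_dvd ha0 hpa
        omega
      simp [this]
    omega
  obtain ⟨x, hx⟩ := FiniteField.exists_nonsquare (F := ZMod p) (by rw [ZMod.ringChar_zmod_n]; exact hp2)
  have hcop : Nat.Coprime p q' := (Nat.Prime.coprime_iff_not_dvd hp).2 hq'
  obtain ⟨t, ht1, ht2⟩ := Nat.chineseRemainder hcop x.val 1
  have ht2' : (q' : ℤ) ∣ (t : ℤ) - 1 := by
    have := (Nat.modEq_iff_dvd.1 ht2.symm); simpa using this
  refine ⟨t, ?_, ?_⟩
  · rw [hk, jacobiSym.mul_right' _ (pow_ne_zero _ hp.ne_zero) (by rintro rfl; simp at hq'), jacobiSym.pow_right]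
    have h1 : J((t : ℤ) | q') = 1 := by
      have := jac_dvd (a := (t : ℤ)) (b := 1) ht2'
      simpa using this
    have h2 : J((t : ℤ) | p) = -1 := by
      rw [← jacobiSym.legendreSym.to_jacobiSym, legendreSym.eq_neg_one_iff]
      have : ((t : ℤ) : ZMod p) = x := by
        have h3 := (ZMod.natCast_eq_natCast_iff _ _ _).2 ht1
        push_cast
        rw [h3, ZMod.natCast_zmod_val]
      rw [this]; exact hx
    rw [h1, h2, mul_one, Odd.neg_one_pow (Nat.odd_iff.2 hkodd)]
  · intro g hg hpg
    have h1 : Nat.Coprime g (p ^ k) := Nat.Coprime.pow_right _ ((Nat.Prime.coprime_iff_not_dvd hp).2 hpg).symm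
    rw [hk] at hg
    have h2 : g ∣ q' := h1.dvd_of_dvd_mul_left hg
    exact (Int.natCast_dvd_natCast.2 h2).trans ht2'

theorem exists_jac_neg_of_nonsq {q : ℕ} (hq : q % 2 = 1) (hs : ¬ IsSquare q) : ∃ t : ℤ, J(t | q) = -1 := by
  obtain ⟨a, b, h1, h2⟩ := Nat.sq_mul_squarefree q
  by_cases ha : a = 1
  · exact absurd ⟨b, by rw [← h1, ha]; ring⟩ hs
  · obtain ⟨p, hp, hpa⟩ := Nat.exists_prime_and_dvd ha
    obtain ⟨t, ht, -⟩ := exists_jac_neg hq h1.symm h2 hp hpa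
    exact ⟨t, ht⟩

/-- one dimensional periodic sums -/
theorem sum_range_periodic {q : ℕ} {g : ℕ → ℝ} (hg : ∀ x, g (x + q) = g x) (k : ℕ) :
    ∑ x ∈ range (q * k), g x = k * ∑ x ∈ range q, g x := by
  have hg' : ∀ k x, g (q * k + x) = g x := by
    intro k x
    induction k with
    | zero => simp
    | succ k ih => rw [show q * (k + 1) + x = q * k + x + q by ring, hg, ih]
  induction k with
  | zero => simp
  | succ k ih =>
    rw [mul_add, mul_one, sum_range_add, ih, sum_congr rfl (fun x _ => hg' k x)]
    push_cast; ring

theorem box_sum {q : ℕ} (hq : 0 < q) {f : ℕ → ℕ → ℝ} (h1 : ∀ x y, f (x + q) y = f x y) (h2 : ∀ x y, f x (y + q) = f x y)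
    (hf : ∀ x y, |f x y| ≤ 1) (h0 : ∑ x ∈ range q, ∑ y ∈ range q, f x y = 0) (l : ℕ) :
    |∑ x ∈ range l, ∑ y ∈ range l, f x y| ≤ 2 * q * l := by
  set k := l / q
  have hl : l = q * k + l % q := (Nat.div_add_mod l q).symm
  have hm : l % q < q := Nat.mod_lt _ hq
  have hmR : ((l % q : ℕ) : ℝ) ≤ q := by exact_mod_cast hm.le
  have hin : ∀ x, ∑ y ∈ range l, f x y = ∑ y ∈ range (q * k), f x y + ∑ y ∈ range (l % q), f x (q * k + y) := by
    intro x
    conv_lhs => rw [hl, sum_range_add]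
  have e1 : ∑ x ∈ range l, ∑ y ∈ range l, f x y =
      ∑ x ∈ range (q * k), ∑ y ∈ range (q * k), f x y + ∑ x ∈ range (l % q), ∑ y ∈ range (q * k), f (q * k + x) y
        + ∑ x ∈ range l, ∑ y ∈ range (l % q), f x (q * k + y) := by
    rw [sum_congr rfl (fun x _ => hin x), sum_add_distrib]
    congr 1
    conv_lhs => rw [hl, sum_range_add]
  have e2 : ∑ x ∈ range (q * k), ∑ y ∈ range (q * k), f x y = 0 := by
    rw [sum_congr rfl (fun x _ => sum_range_periodic (h2 x) k), ← mul_sum,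
      sum_range_periodic (g := fun x => ∑ y ∈ range q, f x y) (fun x => sum_congr rfl (fun y _ => h1 x y)), h0]
    ring
  have tb : ∀ (s t : Finset ℕ) (g : ℕ → ℕ → ℝ), (∀ x y, |g x y| ≤ 1) → |∑ x ∈ s, ∑ y ∈ t, g x y| ≤ s.card * t.card := by
    intro s t g hg
    refine (abs_sum_le_sum_abs _ _).trans ?_
    calc ∑ x ∈ s, |∑ y ∈ t, g x y| ≤ ∑ x ∈ s, (t.card : ℝ) := by
          refine sum_le_sum fun x _ => (abs_sum_le_sum_abs _ _).trans ?_
          calc ∑ y ∈ t, |g x y| ≤ ∑ y ∈ t, (1 : ℝ) := sum_le_sum fun y _ => hg x y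
            _ = t.card := by simp
      _ = _ := by simp
  rw [e1, e2, zero_add]
  have b1 := tb (range (l % q)) (range (q * k)) (fun x y => f (q * k + x) y) (fun x y => hf _ _)
  have b2 := tb (range l) (range (l % q)) (fun x y => f x (q * k + y)) (fun x y => hf _ _)
  rw [card_range, card_range] at b1 b2
  have hqk : ((q * k : ℕ) : ℝ) ≤ l := by exact_mod_cast (by omega)
  have hl0 : (0 : ℝ) ≤ l := Nat.cast_nonneg _
  calc _ ≤ _ := abs_add_le _ _
    _ ≤ ((l % q : ℕ) : ℝ) * ((q * k : ℕ) : ℝ) + l * ((l % q : ℕ) : ℝ) := add_le_add b1 b2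
    _ ≤ q * l + l * q := by gcongr
    _ = _ := by ring

theorem jac_abs (x : ℤ) (k : ℕ) : |(J(x | k) : ℝ)| ≤ 1 := by
  rcases jacobiSym.trichotomy x k with h | h | h <;> rw [h] <;> simp

theorem sum_range_zmod {q : ℕ} [NeZero q] (g : ZMod q → ℝ) : ∑ x ∈ range q, g ((x : ℕ) : ZMod q) = ∑ x : ZMod q, g x :=
  sum_bij' (fun x _ => ((x : ℕ) : ZMod q)) (fun x _ => x.val) (fun _ _ => mem_univ _)
    (fun x _ => mem_range.2 (ZMod.val_lt x)) (fun x hx => ZMod.val_natCast_of_lt (mem_range.1 hx))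
    (fun x _ => ZMod.natCast_zmod_val x) (fun _ _ => rfl)

theorem isUnit_of_coprime_int {q : ℕ} {t : ℤ} (h : IsCoprime t (q : ℤ)) : IsUnit (t : ZMod q) := by
  obtain ⟨a, b, hab⟩ := h
  have := congrArg (Int.cast : ℤ → ZMod q) hab
  push_cast at this
  rw [ZMod.natCast_self, mul_zero, add_zero] at this
  exact IsUnit.of_mul_eq_one_right _ this

/-- complete sums vanish -/
theorem complete_zero {n n' : ℕ} (hn : n % 2 = 1) (hn' : n' % 2 = 1) (hs : ¬ IsSquare (n * n')) (θ θ' A B : ℤ) :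
    ∑ x ∈ range (n * n'), ∑ y ∈ range (n * n'),
      ((J((A + x) + (B + y) * θ | n) : ℝ) * J((A + x) + (B + y) * θ' | n')) = 0 := by
  set q := n * n' with hqd
  have hq1 : q % 2 = 1 := by rw [hqd, Nat.mul_mod, hn, hn']
  have : NeZero q := ⟨by omega⟩
  obtain ⟨t, ht⟩ := exists_jac_neg_of_nonsq hq1 hs
  have hnd : (n : ℤ) ∣ (q : ℤ) := by rw [hqd]; push_cast; exact dvd_mul_right _ _
  have hnd' : (n' : ℤ) ∣ (q : ℤ) := by rw [hqd]; push_cast; exact dvd_mul_left _ _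
  let G : ZMod q → ZMod q → ℝ := fun x y => (J((x.val : ℤ) + (y.val : ℤ) * θ | n) : ℝ) * J((x.val : ℤ) + (y.val : ℤ) * θ' | n')
  have hG : ∀ x y : ℤ, G (x : ZMod q) (y : ZMod q) = (J(x + y * θ | n) : ℝ) * J(x + y * θ' | n') := by
    intro x y
    have hx : (q : ℤ) ∣ ((x : ZMod q).val : ℤ) - x := by
      rw [← ZMod.intCast_zmod_eq_zero_iff_dvd]; push_cast; rw [ZMod.natCast_zmod_val, sub_self]
    have hy : (q : ℤ) ∣ ((y : ZMod q).val : ℤ) - y := by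
      rw [← ZMod.intCast_zmod_eq_zero_iff_dvd]; push_cast; rw [ZMod.natCast_zmod_val, sub_self]
    have key : ∀ (k : ℕ) (θ : ℤ), (k : ℤ) ∣ q →
        J(((x : ZMod q).val : ℤ) + ((y : ZMod q).val : ℤ) * θ | k) = J(x + y * θ | k) := by
      intro k θ hk
      have := jac_dvd (a := ((x : ZMod q).val : ℤ) + ((y : ZMod q).val : ℤ) * θ) (b := x + y * θ) (n := (k : ℤ)) (by
        have e : ((x : ZMod q).val : ℤ) + ((y : ZMod q).val : ℤ) * θ - (x + y * θ) =
          (((x : ZMod q).val : ℤ) - x) + (((y : ZMod q).val : ℤ) - y) * θ := by ring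
        rw [e]
        exact dvd_add (hk.trans hx) ((hk.trans hy).mul_right _))
      simpa using this
    show (J(((x : ZMod q).val : ℤ) + ((y : ZMod q).val : ℤ) * θ | n) : ℝ) * J(((x : ZMod q).val : ℤ) + ((y : ZMod q).val : ℤ) * θ' | n') = _
    rw [key n θ hnd, key n' θ' hnd']
  have hrange : ∀ g : ZMod q → ℝ, ∑ x ∈ range q, g ((x : ℕ) : ZMod q) = ∑ x : ZMod q, g x := sum_range_zmod
  have tot : ∑ x ∈ range q, ∑ y ∈ range q,
      ((J((A + x) + (B + y) * θ | n) : ℝ) * J((A + x) + (B + y) * θ' | n')) = ∑ x : ZMod q, ∑ y : ZMod q, G x y := by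
    have : ∀ x y : ℕ, ((J((A + x) + (B + y) * θ | n) : ℝ) * J((A + x) + (B + y) * θ' | n')) = G ((A : ZMod q) + (x : ZMod q)) ((B : ZMod q) + (y : ZMod q)) := by
      intro x y
      rw [← hG]; push_cast; rfl
    simp_rw [this]
    rw [hrange (fun x => ∑ y ∈ range q, G ((A : ZMod q) + x) ((B : ZMod q) + (y : ZMod q)))]
    rw [Fintype.sum_equiv (Equiv.addLeft (A : ZMod q)) _ (fun x => ∑ y : ZMod q, G x y)]
    intro x
    rw [hrange (fun y => G ((A : ZMod q) + x) ((B : ZMod q) + y))]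
    exact Fintype.sum_equiv (Equiv.addLeft (B : ZMod q)) _ _ (fun y => rfl)
  rw [tot]
  have hq0 : q ≠ 0 := by omega
  have htu : IsUnit (t : ZMod q) := by
    have h1 : IsCoprime t (q : ℤ) := by
      by_contra hc
      obtain ⟨l, hl, h1, h2⟩ := exists_prime_of_not_coprime hc
      rw [jac_zero hl hq0 h1 h2] at ht
      norm_num at ht
    exact isUnit_of_coprime_int h1
  have hGt : ∀ x y : ZMod q, G (t * x) (t * y) = - G x y := by
    intro x y
    obtain ⟨x, rfl⟩ := ZMod.intCast_surjective x
    obtain ⟨y, rfl⟩ := ZMod.intCast_surjective y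
    have e : G ((t : ZMod q) * (x : ZMod q)) ((t : ZMod q) * (y : ZMod q)) = G ((t * x : ℤ) : ZMod q) ((t * y : ℤ) : ZMod q) := by push_cast; rfl
    rw [e, hG, hG, show t * x + t * y * θ = t * (x + y * θ) by ring, show t * x + t * y * θ' = t * (x + y * θ') by ring,
      jacobiSym.mul_left, jacobiSym.mul_left]
    have h3 : J(t | n) * J(t | n') = -1 := by rw [← ht, hqd, jacobiSym.mul_right' _ (by omega) (by omega)]
    have h4 : (J(t | n) : ℝ) * (J(t | n') : ℝ) = -1 := by exact_mod_cast h3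
    push_cast
    linear_combination ((J(x + y * θ | n) : ℝ) * J(x + y * θ' | n')) * h4
  have hneg : ∑ x : ZMod q, ∑ y : ZMod q, G x y = - ∑ x : ZMod q, ∑ y : ZMod q, G x y := by
    conv_lhs => rw [← Fintype.sum_equiv (htu.unit.mulLeft) (fun x => ∑ y, G (t * x) y) (fun x => ∑ y, G x y) (fun x => rfl)]
    rw [← sum_neg_distrib]
    refine sum_congr rfl fun x _ => ?_
    rw [← Fintype.sum_equiv (htu.unit.mulLeft) (fun y => G (t * x) (t * y)) (fun y => G (t * x) y) (fun x => rfl), ← sum_neg_distrib]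
    exact sum_congr rfl fun y _ => hGt x y
  linarith

end QB

end

section

open scoped NumberTheorySymbols
open Finset

namespace QB

/-- Hölder + Cauchy step of the bilinear estimate. -/
theorem holder_step {ι A : Type*} [CommMonoid A] [DecidableEq A] (Z : Finset ι) (Ψ : ι → (A →* ℝ)) (P : Finset A) (α : A → ℝ) (hα : ∀ π ∈ P, |α π| ≤ 1)
    (k : ℕ) (R : ℕ) (B : Finset A)
    (hB : ∀ t ∈ Fintype.piFinset (fun _ : Fin (2 * (k + 1)) => P), ∏ i, t i ∈ B)
    (hR : ∀ W, ((Fintype.piFinset (fun _ : Fin (2 * (k + 1)) => P)).filter (fun t => ∏ i, t i = W)).card ≤ R) :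
    (∑ z ∈ Z, |∑ π ∈ P, α π * Ψ z π|) ^ (4 * (k + 1)) ≤
      (Z.card : ℝ) ^ (2 * (2 * k + 1)) * ((P.card : ℝ) ^ (2 * (k + 1)) * (R * ∑ z ∈ Z, ∑ z' ∈ Z, ∑ W ∈ B, Ψ z W * Ψ z' W)) := by
  set TT := Fintype.piFinset (fun _ : Fin (2 * (k + 1)) => P) with hTT
  have hcard : (TT.card : ℝ) = (P.card : ℝ) ^ (2 * (k + 1)) := by
    rw [hTT, Fintype.card_piFinset]; simp
  -- Hölder
  have h1 : (∑ z ∈ Z, |∑ π ∈ P, α π * Ψ z π|) ^ (2 * (k + 1)) ≤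
      (Z.card : ℝ) ^ (2 * k + 1) * ∑ z ∈ Z, (∑ π ∈ P, α π * Ψ z π) ^ (2 * (k + 1)) := by
    have := pow_sum_div_card_le_sum_pow (s := Z) (f := fun z => |∑ π ∈ P, α π * Ψ z π|) (fun _ _ => abs_nonneg _) (2 * k + 1)
    rcases Z.eq_empty_or_nonempty with hZ | hZ
    · subst hZ; simp
    · have hc : (0 : ℝ) < (Z.card : ℝ) ^ (2 * k + 1) := by
        have : (0 : ℝ) < Z.card := by exact_mod_cast card_pos.2 hZ
        positivity
      have this2 := (div_le_iff₀ hc).1 this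
      have e : 2 * (k + 1) = 2 * k + 1 + 1 := by ring
      rw [e]
      refine this2.trans (le_of_eq ?_)
      rw [mul_comm]
      congr 1
      refine sum_congr rfl fun z _ => ?_
      exact Even.pow_abs ⟨k + 1, by ring⟩ _
  have h2 : ∑ z ∈ Z, (∑ π ∈ P, α π * Ψ z π) ^ (2 * (k + 1)) =
      ∑ t ∈ TT, (∏ i, α (t i)) * ∑ z ∈ Z, Ψ z (∏ i, t i) := by
    have e : ∀ z, (∑ π ∈ P, α π * Ψ z π) ^ (2 * (k + 1)) = ∑ t ∈ TT, (∏ i, α (t i)) * Ψ z (∏ i, t i) := by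
      intro z
      have := Finset.prod_univ_sum (fun _ : Fin (2 * (k + 1)) => P) (fun _ π => α π * Ψ z π)
      rw [prod_const, card_univ, Fintype.card_fin] at this
      rw [this]
      refine sum_congr rfl fun t _ => ?_
      rw [prod_mul_distrib, map_prod]
    rw [sum_congr rfl (fun z _ => e z), sum_comm]
    refine sum_congr rfl fun t _ => ?_
    rw [mul_sum]
  have h3 : (∑ t ∈ TT, (∏ i, α (t i)) * ∑ z ∈ Z, Ψ z (∏ i, t i)) ^ 2 ≤
      TT.card * ∑ t ∈ TT, (∑ z ∈ Z, Ψ z (∏ i, t i)) ^ 2 := by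
    refine sq_sum_le_card_mul_sum_sq.trans ?_
    refine mul_le_mul_of_nonneg_left (sum_le_sum fun t ht => ?_) (Nat.cast_nonneg _)
    rw [mul_pow]
    have : (∏ i, α (t i)) ^ 2 ≤ 1 := by
      rw [sq_le_one_iff_abs_le_one, abs_prod]
      exact prod_le_one (fun _ _ => abs_nonneg _) (fun i _ => hα _ (Fintype.mem_piFinset.1 ht i))
    calc _ ≤ 1 * (∑ z ∈ Z, Ψ z (∏ i, t i)) ^ 2 := by gcongr
      _ = _ := one_mul _
  have h4 : ∑ t ∈ TT, (∑ z ∈ Z, Ψ z (∏ i, t i)) ^ 2 ≤ R * ∑ W ∈ B, (∑ z ∈ Z, Ψ z W) ^ 2 := by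
    rw [← sum_fiberwise_of_maps_to hB, mul_sum]
    refine sum_le_sum fun W _ => ?_
    rw [sum_congr rfl (g := fun _ => (∑ z ∈ Z, Ψ z W) ^ 2) (fun t ht => by rw [(mem_filter.1 ht).2])]
    rw [sum_const, nsmul_eq_mul]
    have : ((TT.filter (fun t => ∏ i, t i = W)).card : ℝ) ≤ R := by exact_mod_cast hR W
    gcongr
  have h5 : ∑ W ∈ B, (∑ z ∈ Z, Ψ z W) ^ 2 = ∑ z ∈ Z, ∑ z' ∈ Z, ∑ W ∈ B, Ψ z W * Ψ z' W := by
    simp_rw [sq, sum_mul_sum]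
    rw [sum_comm]
    refine sum_congr rfl fun z _ => sum_comm
  rw [h2] at h1
  have hpos : 0 ≤ (∑ z ∈ Z, |∑ π ∈ P, α π * Ψ z π|) ^ (2 * (k + 1)) := by positivity
  calc (∑ z ∈ Z, |∑ π ∈ P, α π * Ψ z π|) ^ (4 * (k + 1)) = ((∑ z ∈ Z, |∑ π ∈ P, α π * Ψ z π|) ^ (2 * (k + 1))) ^ 2 := by
        rw [← pow_mul]; congr 1; ring
    _ ≤ ((Z.card : ℝ) ^ (2 * k + 1) * ∑ t ∈ TT, (∏ i, α (t i)) * ∑ z ∈ Z, Ψ z (∏ i, t i)) ^ 2 := by gcongr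
    _ = (Z.card : ℝ) ^ (2 * (2 * k + 1)) * (∑ t ∈ TT, (∏ i, α (t i)) * ∑ z ∈ Z, Ψ z (∏ i, t i)) ^ 2 := by ring
    _ ≤ _ := by
        rw [← h5, ← hcard]
        gcongr
        refine h3.trans ?_
        gcongr

/-- fibres of the product map -/
theorem fiber_card {P : Finset (ℤ√2)} (hP : ∀ π ∈ P, Red π ∧ ∃ m : ℕ, m.Prime ∧ π.norm = m) (K : ℕ) (W : ℤ√2) :
    ((Fintype.piFinset (fun _ : Fin K => P)).filter (fun t => ∏ i, t i = W)).card ≤ K ^ K := by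
  rcases ((Fintype.piFinset (fun _ : Fin K => P)).filter (fun t => ∏ i, t i = W)).eq_empty_or_nonempty with h | ⟨t0, h0⟩
  · rw [h]; simp
  · rw [mem_filter] at h0
    have hsub : (Fintype.piFinset (fun _ : Fin K => P)).filter (fun t => ∏ i, t i = W) ⊆
        Fintype.piFinset (fun _ : Fin K => univ.image t0) := by
      intro t ht
      rw [mem_filter] at ht
      rw [Fintype.mem_piFinset]
      intro i
      rw [mem_image]
      have hti := hP _ (Fintype.mem_piFinset.1 ht.1 i)
      obtain ⟨h1, m, hm, hn⟩ := hti
      have hd : t i ∣ ∏ j, t0 j := by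
        rw [h0.2, ← ht.2]; exact dvd_prod_of_mem _ (mem_univ i)
      obtain ⟨j, _, hj⟩ := (prime_of_norm hm hn).exists_mem_finset_dvd hd
      refine ⟨j, mem_univ _, ?_⟩
      obtain ⟨h1', m', hm', hn'⟩ := hP _ (Fintype.mem_piFinset.1 h0.1 j)
      obtain ⟨e, he⟩ := hj
      have hN := congrArg Zsqrtd.norm he
      rw [Zsqrtd.norm_mul, hn, hn'] at hN
      have hdv : m ∣ m' := Int.natCast_dvd_natCast.1 ⟨_, hN⟩
      have hmm : m = m' := ((Nat.dvd_prime hm').1 hdv).resolve_left hm.ne_one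
      have he1 : e.norm = 1 := by
        rw [hmm] at hN
        have h0 : (m' : ℤ) ≠ 0 := by exact_mod_cast hm'.ne_zero
        have : (m' : ℤ) * e.norm = m' * 1 := by rw [← hN, mul_one]
        exact mul_left_cancel₀ h0 this
      exact red_eq_of_unit he1 h1' h1 (by rw [he, mul_comm])
    refine (card_le_card hsub).trans ?_
    rw [Fintype.card_piFinset]
    simp only [prod_const, card_univ, Fintype.card_fin]
    exact Nat.pow_le_pow_left ((card_image_le).trans (by simp)) _

/-- size -/
def size (w : ℤ√2) : ℤ := |w.re| + 2 * |w.im|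

theorem size_mul (w z : ℤ√2) : size (w * z) ≤ size w * size z := by
  rw [mul_eq']; unfold size; dsimp only
  have h1 : |w.re * z.re + 2 * w.im * z.im| ≤ |w.re| * |z.re| + 2 * (|w.im| * |z.im|) := by
    refine (abs_add_le _ _).trans ?_
    rw [abs_mul, abs_mul, abs_mul]; simp; linarith
  have h2 : |w.re * z.im + w.im * z.re| ≤ |w.re| * |z.im| + |w.im| * |z.re| := by
    refine (abs_add_le _ _).trans ?_
    rw [abs_mul, abs_mul]
  nlinarith [mul_nonneg (abs_nonneg w.im) (abs_nonneg z.im)]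

theorem size_nonneg (w : ℤ√2) : 0 ≤ size w := by unfold size; positivity

theorem size_prod_sq {K : ℕ} {C : ℤ} (t : Fin K → ℤ√2) (h : ∀ i, size (t i) ^ 2 ≤ C) : size (∏ i, t i) ^ 2 ≤ C ^ K := by
  have h1 : ∀ s : Finset (Fin K), size (∏ i ∈ s, t i) ≤ ∏ i ∈ s, size (t i) := by
    intro s
    induction s using Finset.induction_on with
    | empty => simp [size]
    | insert a s ha ih =>
      rw [prod_insert ha, prod_insert ha]
      exact (size_mul _ _).trans (mul_le_mul_of_nonneg_left ih (size_nonneg _))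
  calc size (∏ i, t i) ^ 2 ≤ (∏ i, size (t i)) ^ 2 := pow_le_pow_left₀ (size_nonneg _) (h1 _) 2
    _ = ∏ i, size (t i) ^ 2 := (prod_pow _ _ _).symm
    _ ≤ ∏ _i : Fin K, C := prod_le_prod (fun _ _ => by positivity) (fun i _ => h i)
    _ = C ^ K := by simp

theorem Red.size_sq {w : ℤ√2} (h : Red w) : size w ^ 2 ≤ 8 * w.norm := by
  have h1 := h.sq
  have h2 : size w ≤ 2 * w.re := by
    unfold size; unfold Red at h
    rw [abs_of_pos h1.2]; linarith
  have h3 := size_nonneg w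
  rw [nrm]
  nlinarith

/-- the character attached to a primitive element -/
theorem exists_theta {z : ℤ√2} (hodd : z.norm % 2 = 1) (hcd : IsCoprime z.re z.im) :
    ∃ θ : ℤ, z.norm ∣ θ ^ 2 - 2 ∧ ∀ w : ℤ√2, J((w * z).re | z.norm.natAbs) = J(z.re | z.norm.natAbs) * J(w.re + w.im * θ | z.norm.natAbs) := by
  obtain ⟨h1, h2⟩ := cop_of_prim hodd hcd (nrm z).symm
  obtain ⟨x, y, hxy⟩ := h1
  have hn := nrm z
  refine ⟨2 * z.im * x, ?_, ?_⟩
  · refine ⟨-2 * x ^ 2 + 2 * (y ^ 2 * z.norm - 2 * y), ?_⟩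
    have e : x * z.re = 1 - y * z.norm := by linear_combination hxy
    have e2 : (x * z.re) ^ 2 = (1 - y * z.norm) ^ 2 := by rw [e]
    have e3 : 2 * z.im ^ 2 = z.re ^ 2 - z.norm := by linear_combination hn
    linear_combination (2 * x ^ 2) * e3 + 2 * e2
  · intro w
    rw [← jacobiSym.mul_left]
    apply jac_dvd
    rw [mul_eq']; dsimp only
    refine ⟨w.im * 2 * z.im * y, ?_⟩
    linear_combination (-2 * w.im * z.im) * hxy

/-- the character as a monoid hom -/
noncomputable def psi (n : ℕ) (θ : ℤ) (h : (n : ℤ) ∣ θ ^ 2 - 2) : ℤ√2 →* ℝ where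
  toFun w := (J(w.re + w.im * θ | n) : ℝ)
  map_one' := by simp
  map_mul' w z := by
    rw [← Int.cast_mul, ← jacobiSym.mul_left]
    congr 1
    have := jac_dvd (a := (w * z).re + (w * z).im * θ) (b := (w.re + w.im * θ) * (z.re + z.im * θ)) (n := (n : ℤ)) (by
      rw [mul_eq']; dsimp only
      obtain ⟨x, hx⟩ := h
      exact ⟨- (w.im * z.im * x), by linear_combination (- w.im * z.im) * hx⟩)
    simpa using this

/-- number of square partners -/
theorem sq_partners {n : ℕ} (hn : 0 < n) (N : ℕ) :
    ((Icc 1 N).filter (fun n' => IsSquare (n * n'))).card ≤ Nat.sqrt N := by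
  obtain ⟨a, b, h1, h2⟩ := Nat.sq_mul_squarefree n
  have ha0 : 0 < a := Nat.pos_of_ne_zero h2.ne_zero
  have hb0 : 0 < b := by rcases Nat.eq_zero_or_pos b with h | h; · subst h; simp at h1; omega
                         · exact h
  have hsub : (Icc 1 N).filter (fun n' => IsSquare (n * n')) ⊆ (Icc 1 (Nat.sqrt N)).image (fun f => a * f ^ 2) := by
    intro n' h
    rw [mem_filter, mem_Icc] at h
    obtain ⟨⟨h3, h4⟩, s, hs⟩ := h
    rw [mem_image]
    have hbs : b ^ 2 ∣ s ^ 2 := ⟨a * n', by rw [pow_two s, ← hs, ← h1]; ring⟩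
    obtain ⟨s', rfl⟩ := (Nat.pow_dvd_pow_iff two_ne_zero).1 hbs
    have e1 : a * n' = s' ^ 2 := by
      have : b ^ 2 * (a * n') = b ^ 2 * s' ^ 2 := by rw [← mul_assoc, h1, hs]; ring
      exact Nat.eq_of_mul_eq_mul_left (by positivity) this
    have has : a ∣ s' := (h2.dvd_pow_iff_dvd two_ne_zero).1 ⟨n', e1.symm⟩
    obtain ⟨f, rfl⟩ := has
    have e2 : n' = a * f ^ 2 := by
      have : a * n' = a * (a * f ^ 2) := by rw [e1]; ring
      exact Nat.eq_of_mul_eq_mul_left ha0 this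
    refine ⟨f, ?_, e2.symm⟩
    rw [mem_Icc]
    constructor
    · rcases Nat.eq_zero_or_pos f with h | h
      · subst h; simp at e2; omega
      · exact h
    · rw [Nat.le_sqrt]
      calc f * f = 1 * f ^ 2 := by ring
        _ ≤ a * f ^ 2 := Nat.mul_le_mul_right _ ha0
        _ ≤ N := by omega
  refine (card_le_card hsub).trans (card_image_le.trans ?_)
  simp

/-- the bilinear estimate -/
theorem bilin (M N T k : ℕ) (P Z : Finset (ℤ√2))
    (hP : ∀ π ∈ P, Red π ∧ ∃ m : ℕ, m.Prime ∧ π.norm = m ∧ m ≤ M)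
    (hZ : ∀ z ∈ Z, Red z ∧ IsCoprime z.re z.im ∧ ∃ n : ℕ, z.norm = n ∧ n % 2 = 1 ∧ n ≤ N)
    (hT : ∀ n ≤ N, n % 2 = 1 → (fset n).card ≤ T) (α : ℤ√2 → ℝ) (hα : ∀ π ∈ P, |α π| ≤ 1) :
    (∑ z ∈ Z, |∑ π ∈ P, α π * (J((π * z).re | z.norm.natAbs) : ℝ)|) ^ (4 * (k + 1)) ≤
      (Z.card : ℝ) ^ (2 * (2 * k + 1)) * ((P.card : ℝ) ^ (2 * (k + 1)) *
        (((2 * (k + 1)) ^ (2 * (k + 1)) : ℕ) * (Z.card * (Nat.sqrt N * T * (2 * (8 * M) ^ (k + 1) + 1 : ℕ) ^ 2)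
          + Z.card ^ 2 * (2 * N ^ 2 * (2 * (8 * M) ^ (k + 1) + 1 : ℕ))))) := by
  classical
  have hth : ∀ z : ℤ√2, ∃ θ : ℤ, z ∈ Z → (z.norm ∣ θ ^ 2 - 2 ∧ ∀ w : ℤ√2, J((w * z).re | z.norm.natAbs) = J(z.re | z.norm.natAbs) * J(w.re + w.im * θ | z.norm.natAbs)) := by
    intro z
    by_cases hz : z ∈ Z
    · obtain ⟨h1, h2, n, h3, h4, h5⟩ := hZ z hz
      obtain ⟨θ, h6⟩ := exists_theta (z := z) (by rw [h3]; omega) h2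
      exact ⟨θ, fun _ => h6⟩
    · exact ⟨0, fun h => absurd h hz⟩
  choose θ hθ using hth
  let Ψ : ℤ√2 → (ℤ√2 →* ℝ) := fun z => if h : ((z.norm.natAbs : ℤ) ∣ θ z ^ 2 - 2) then psi z.norm.natAbs (θ z) h else 1
  have hΨ : ∀ z ∈ Z, ∀ w, Ψ z w = (J(w.re + w.im * θ z | z.norm.natAbs) : ℝ) := by
    intro z hz w
    have h : (z.norm.natAbs : ℤ) ∣ θ z ^ 2 - 2 := Int.natAbs_dvd.2 (hθ z hz).1
    simp only [Ψ, dif_pos h]; rfl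
  set L : ℕ := (8 * M) ^ (k + 1) with hL
  set l : ℕ := 2 * L + 1 with hl
  let e : ℕ × ℕ → ℤ√2 := fun t => ⟨-L + t.1, -L + t.2⟩
  have he : Function.Injective e := by
    rintro ⟨x, y⟩ ⟨x', y'⟩ h
    simp only [e, Zsqrtd.ext_iff] at h
    ext <;> simp <;> omega
  set B := (range l ×ˢ range l).image e with hB
  have step0 : ∑ z ∈ Z, |∑ π ∈ P, α π * (J((π * z).re | z.norm.natAbs) : ℝ)| ≤ ∑ z ∈ Z, |∑ π ∈ P, α π * Ψ z π| := by
    refine sum_le_sum fun z hz => ?_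
    have : ∑ π ∈ P, α π * (J((π * z).re | z.norm.natAbs) : ℝ) = (J(z.re | z.norm.natAbs) : ℝ) * ∑ π ∈ P, α π * Ψ z π := by
      rw [mul_sum]
      refine sum_congr rfl fun π _ => ?_
      rw [hΨ z hz, (hθ z hz).2]; push_cast; ring
    rw [this, abs_mul]
    exact mul_le_of_le_one_left (abs_nonneg _) (jac_abs _ _)
  have step1 := holder_step Z Ψ P α hα k ((2 * (k + 1)) ^ (2 * (k + 1))) B (by
      intro t ht
      have h1 := size_prod_sq (C := 8 * M) t (fun i => by
        obtain ⟨h1, m, h2, h3, h4⟩ := hP _ (Fintype.mem_piFinset.1 ht i)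
        refine h1.size_sq.trans ?_
        rw [h3]
        exact_mod_cast Nat.mul_le_mul_left 8 h4)
      have h2 : size (∏ i, t i) ≤ L := by
        have : ((8 * M : ℤ)) ^ (2 * (k + 1)) = (L : ℤ) ^ 2 := by rw [hL]; push_cast; ring
        rw [this] at h1
        exact abs_le_of_sq_le_sq' h1 (by positivity) |>.2
      rw [hB, mem_image]
      unfold size at h2
      have a1 := abs_nonneg (∏ i, t i).re
      have a2 := abs_nonneg (∏ i, t i).im
      have b1 := abs_le.1 (show |(∏ i, t i).re| ≤ L by omega)
      have b2 := abs_le.1 (show |(∏ i, t i).im| ≤ L by omega)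
      refine ⟨(((∏ i, t i).re + L).toNat, ((∏ i, t i).im + L).toNat), ?_, ?_⟩
      · rw [mem_product, mem_range, mem_range]; constructor <;> dsimp only <;> omega
      · simp only [e]
        ext <;> dsimp only <;> omega)
    (fiber_card (fun π h => by obtain ⟨h1, m, h2, h3, h4⟩ := hP π h; exact ⟨h1, m, h2, h3⟩) _)
  have hl0 : (0 : ℝ) ≤ l := Nat.cast_nonneg _
  have habs : ∀ z ∈ Z, ∀ w, |Ψ z w| ≤ 1 := fun z hz w => by rw [hΨ z hz]; exact jac_abs _ _
  have habs2 : ∀ z ∈ Z, ∀ z' ∈ Z, ∀ w, |Ψ z w * Ψ z' w| ≤ 1 := fun z hz z' hz' w => by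
    rw [abs_mul]; exact mul_le_one₀ (habs z hz w) (abs_nonneg _) (habs z' hz' w)
  have pair1 : ∀ z ∈ Z, ∀ z' ∈ Z, ∑ W ∈ B, Ψ z W * Ψ z' W ≤ (l : ℝ) ^ 2 := by
    intro z hz z' hz'
    calc _ ≤ ∑ W ∈ B, (1 : ℝ) := sum_le_sum fun W _ => (le_abs_self _).trans (habs2 z hz z' hz' W)
      _ = (B.card : ℝ) := by simp
      _ ≤ ((l * l : ℕ) : ℝ) := by
          norm_cast
          exact card_image_le.trans (by rw [card_product, card_range])
      _ = _ := by push_cast; ring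
  have pair2 : ∀ z ∈ Z, ∀ z' ∈ Z, ¬ IsSquare (z.norm.natAbs * z'.norm.natAbs) → ∑ W ∈ B, Ψ z W * Ψ z' W ≤ 2 * (N : ℝ) ^ 2 * l := by
    intro z hz z' hz' hs
    obtain ⟨-, -, n, h3, h4, h5⟩ := hZ z hz
    obtain ⟨-, -, n', h3', h4', h5'⟩ := hZ z' hz'
    have en : z.norm.natAbs = n := by rw [h3]; rfl
    have en' : z'.norm.natAbs = n' := by rw [h3']; rfl
    rw [hB, sum_image (fun _ _ _ _ h => he h), sum_product]
    have hf : ∀ x y : ℕ, Ψ z (e (x, y)) * Ψ z' (e (x, y)) = (J((-(L : ℤ) + x) + (-(L : ℤ) + y) * θ z | n) : ℝ) * J((-(L : ℤ) + x) + (-(L : ℤ) + y) * θ z' | n') := by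
      intro x y; rw [hΨ z hz, hΨ z' hz', en, en']
    simp only [hf]
    rw [en, en'] at hs
    have hper : ∀ (m : ℕ) (a b : ℤ), ((m : ℤ) ∣ a - b) → (J(a | m) : ℤ) = J(b | m) := by
      intro m a b h
      have := jac_dvd h
      simpa using this
    have := box_sum (q := n * n') (by
        rcases Nat.eq_zero_or_pos (n * n') with h | h
        · rcases Nat.mul_eq_zero.1 h with h | h <;> omega
        · exact h)
      (f := fun x y => (J((-(L : ℤ) + x) + (-(L : ℤ) + y) * θ z | n) : ℝ) * J((-(L : ℤ) + x) + (-(L : ℤ) + y) * θ z' | n'))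
      (fun x y => by
        rw [hper n _ _ (⟨n', by push_cast; ring⟩ : (n : ℤ) ∣ ((-(L : ℤ) + (x + n * n' : ℕ)) + (-(L : ℤ) + y) * θ z) - ((-(L : ℤ) + x) + (-(L : ℤ) + y) * θ z)),
          hper n' _ _ (⟨n, by push_cast; ring⟩ : (n' : ℤ) ∣ ((-(L : ℤ) + (x + n * n' : ℕ)) + (-(L : ℤ) + y) * θ z') - ((-(L : ℤ) + x) + (-(L : ℤ) + y) * θ z'))])
      (fun x y => by
        rw [hper n _ _ (⟨n' * θ z, by push_cast; ring⟩ : (n : ℤ) ∣ ((-(L : ℤ) + x) + (-(L : ℤ) + (y + n * n' : ℕ)) * θ z) - ((-(L : ℤ) + x) + (-(L : ℤ) + y) * θ z)),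
          hper n' _ _ (⟨n * θ z', by push_cast; ring⟩ : (n' : ℤ) ∣ ((-(L : ℤ) + x) + (-(L : ℤ) + (y + n * n' : ℕ)) * θ z') - ((-(L : ℤ) + x) + (-(L : ℤ) + y) * θ z'))])
      (fun x y => by
        rw [abs_mul]; exact mul_le_one₀ (jac_abs _ _) (abs_nonneg _) (jac_abs _ _))
      (complete_zero h4 h4' hs _ _ _ _) l
    refine (le_abs_self _).trans (this.trans ?_)
    have : ((n * n' : ℕ) : ℝ) ≤ (N : ℝ) ^ 2 := by
      rw [pow_two]; exact_mod_cast Nat.mul_le_mul h5 h5'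
    gcongr
  have inner : ∀ z ∈ Z, ∑ z' ∈ Z, ∑ W ∈ B, Ψ z W * Ψ z' W ≤ Nat.sqrt N * T * (l : ℝ) ^ 2 + Z.card * (2 * N ^ 2 * l) := by
    intro z hz
    rw [← sum_filter_add_sum_filter_not Z (fun z' => IsSquare (z.norm.natAbs * z'.norm.natAbs))]
    refine add_le_add ?_ ?_
    · have hc : (Z.filter (fun z' => IsSquare (z.norm.natAbs * z'.norm.natAbs))).card ≤ Nat.sqrt N * T := by
        have hsub : Z.filter (fun z' => IsSquare (z.norm.natAbs * z'.norm.natAbs)) ⊆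
            (((Icc 1 N).filter (fun n' => n' % 2 = 1)).filter (fun n' => IsSquare (z.norm.natAbs * n'))).biUnion fset := by
          intro z' hz'
          rw [mem_filter] at hz'
          obtain ⟨h1, h2, n', h3, h4, h5⟩ := hZ z' hz'.1
          have en' : z'.norm.natAbs = n' := by rw [h3]; rfl
          rw [mem_biUnion]
          refine ⟨n', ?_, mem_fset.2 ⟨h3, h1⟩⟩
          rw [mem_filter, mem_filter, mem_Icc]
          exact ⟨⟨⟨by omega, h5⟩, h4⟩, by rw [← en']; exact hz'.2⟩
        refine (card_le_card hsub).trans (card_biUnion_le.trans ?_)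
        obtain ⟨-, -, n, h3, h4, h5⟩ := hZ z hz
        have en : z.norm.natAbs = n := by rw [h3]; rfl
        calc _ ≤ ∑ n' ∈ ((Icc 1 N).filter (fun n' => n' % 2 = 1)).filter (fun n' => IsSquare (z.norm.natAbs * n')), T := by
              refine sum_le_sum fun n' hn' => ?_
              rw [mem_filter, mem_filter, mem_Icc] at hn'
              exact hT n' hn'.1.1.2 hn'.1.2
          _ = _ := by rw [sum_const, smul_eq_mul]
          _ ≤ Nat.sqrt N * T := by
              refine Nat.mul_le_mul_right _ ((card_le_card ?_).trans (sq_partners (n := z.norm.natAbs) (by omega) N))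
              exact filter_subset_filter _ (filter_subset _ _)
      have hcR : ((Z.filter (fun z' => IsSquare (z.norm.natAbs * z'.norm.natAbs))).card : ℝ) ≤ Nat.sqrt N * T := by exact_mod_cast hc
      calc _ ≤ ∑ z' ∈ Z.filter (fun z' => IsSquare (z.norm.natAbs * z'.norm.natAbs)), (l : ℝ) ^ 2 :=
            sum_le_sum fun z' hz' => pair1 z hz z' (mem_filter.1 hz').1
        _ = _ := by rw [sum_const, nsmul_eq_mul]
        _ ≤ _ := by gcongr
    · calc _ ≤ ∑ z' ∈ Z.filter (fun z' => ¬ IsSquare (z.norm.natAbs * z'.norm.natAbs)), 2 * (N : ℝ) ^ 2 * l :=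
            sum_le_sum fun z' hz' => pair2 z hz z' (mem_filter.1 hz').1 (mem_filter.1 hz').2
        _ = _ := by rw [sum_const, nsmul_eq_mul]
        _ ≤ _ := by
            have : ((Z.filter (fun z' => ¬ IsSquare (z.norm.natAbs * z'.norm.natAbs))).card : ℝ) ≤ Z.card := by
              exact_mod_cast card_le_card (filter_subset _ _)
            gcongr
  have tot : ∑ z ∈ Z, ∑ z' ∈ Z, ∑ W ∈ B, Ψ z W * Ψ z' W ≤ Z.card * (Nat.sqrt N * T * (l : ℝ) ^ 2) + Z.card ^ 2 * (2 * N ^ 2 * l) := by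
    refine (sum_le_sum inner).trans (le_of_eq ?_)
    rw [sum_const, nsmul_eq_mul]; ring
  calc _ ≤ (∑ z ∈ Z, |∑ π ∈ P, α π * Ψ z π|) ^ (4 * (k + 1)) := by
        refine pow_le_pow_left₀ (sum_nonneg fun _ _ => abs_nonneg _) step0 _
    _ ≤ _ := step1
    _ ≤ _ := by
      refine mul_le_mul_of_nonneg_left (mul_le_mul_of_nonneg_left (mul_le_mul_of_nonneg_left tot (Nat.cast_nonneg _)) (by positivity)) (by positivity)

end QB

end

section

open scoped NumberTheorySymbols
open Finset

namespace QB

/-- the Jacobi character on `ZMod q` -/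
noncomputable def chi (q : ℕ) (x : ZMod q) : ℝ := (J((x.val : ℤ) | q) : ℝ)

theorem chi_cast (q : ℕ) [NeZero q] (a : ℤ) : chi q (a : ZMod q) = (J(a | q) : ℝ) := by
  unfold chi
  have hx : (q : ℤ) ∣ ((a : ZMod q).val : ℤ) - a := by
    rw [← ZMod.intCast_zmod_eq_zero_iff_dvd]; push_cast; rw [ZMod.natCast_zmod_val, sub_self]
  have := jac_dvd hx
  rw [Int.natAbs_natCast] at this
  rw [this]

theorem chi_mul (q : ℕ) [NeZero q] (x y : ZMod q) : chi q (x * y) = chi q x * chi q y := by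
  obtain ⟨x, rfl⟩ := ZMod.intCast_surjective x
  obtain ⟨y, rfl⟩ := ZMod.intCast_surjective y
  rw [← Int.cast_mul, chi_cast, chi_cast, chi_cast, jacobiSym.mul_left]; push_cast; rfl

theorem chi_abs (q : ℕ) (x : ZMod q) : |chi q x| ≤ 1 := jac_abs _ _

theorem chi_one (q : ℕ) [NeZero q] : chi q 1 = 1 := by
  have := chi_cast q 1
  simpa using this

theorem chi_unit_sq (q : ℕ) [NeZero q] {x : ZMod q} (hx : IsUnit x) : chi q x ^ 2 = 1 := by
  obtain ⟨y, hy⟩ := hx.exists_right_inv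
  have h1 : chi q x * chi q y = 1 := by rw [← chi_mul, hy, chi_one]
  have h2 := chi_abs q x
  have h3 := chi_abs q y
  have h4 : |chi q x| * |chi q y| = 1 := by rw [← abs_mul, h1, abs_one]
  rw [← sq_abs]
  have : |chi q x| = 1 := by nlinarith [abs_nonneg (chi q x), abs_nonneg (chi q y)]
  rw [this]; norm_num

theorem unit_of_jac {q : ℕ} [NeZero q] {s : ℤ} (hs : J(s | q) = -1) : IsUnit (s : ZMod q) := by
  apply isUnit_of_coprime_int
  by_contra hc
  obtain ⟨l, hl, h1, h2⟩ := exists_prime_of_not_coprime hc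
  rw [jac_zero hl (NeZero.ne q) h1 h2] at hs
  norm_num at hs

theorem chi_line_zero (q : ℕ) [NeZero q] {k s : ℤ} (hs : J(s | q) = -1) (hk : (Int.gcd k q : ℤ) ∣ s - 1) (x : ZMod q) :
    ∑ t : ZMod q, chi q (x + t * k) = 0 := by
  obtain ⟨c, hc⟩ := hk
  have hsk : (s : ZMod q) = 1 + k * ((k.gcdA q * c : ℤ) : ZMod q) := by
    have h1 : s = 1 + k * (k.gcdA q * c) + q * (k.gcdB q * c) := by
      have := Int.gcd_eq_gcd_ab k q
      rw [this] at hc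
      linear_combination hc
    have := congrArg (Int.cast : ℤ → ZMod q) h1
    push_cast at this ⊢
    rw [this, ZMod.natCast_self]; ring
  have hsu := unit_of_jac hs
  set e : ZMod q := ((k.gcdA q * c : ℤ) : ZMod q)
  have h1 : chi q s * ∑ t : ZMod q, chi q (x + t * k) = ∑ t : ZMod q, chi q (x + t * k) := by
    rw [mul_sum]
    rw [Fintype.sum_equiv (hsu.unit.mulLeft.trans (Equiv.addLeft (e * x))) _ (fun t => chi q (x + t * k))]
    intro t
    rw [← chi_mul]
    simp only [Equiv.trans_apply, Units.mulLeft_apply, Equiv.coe_addLeft, IsUnit.unit_spec]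
    congr 1
    rw [mul_add]
    conv_lhs => rw [hsk]
    rw [hsk]; ring
  rw [chi_cast, hs] at h1
  push_cast at h1
  linarith

theorem moment {q H : ℕ} [NeZero q]
    (hgood : ∀ k : ℤ, k ≠ 0 → k.natAbs < H → ∃ s : ℤ, J(s | q) = -1 ∧ (Int.gcd k q : ℤ) ∣ s - 1)
    {D : ZMod q} (hD : IsUnit D) :
    ∑ x : ZMod q, (∑ h ∈ range H, chi q (x + D * h)) ^ 2 ≤ q.divisors.card * H * q := by
  let V : ZMod q → ℝ := fun t => ∑ x : ZMod q, (∑ h ∈ range H, chi q (x + t * h)) ^ 2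
  have hV0 : ∀ t, 0 ≤ V t := fun t => sum_nonneg fun _ _ => sq_nonneg _
  have hVu : ∀ t, IsUnit t → V t = V 1 := by
    intro t ht
    have : ∀ x, (∑ h ∈ range H, chi q (t * x + t * h)) ^ 2 = (∑ h ∈ range H, chi q (x + 1 * h)) ^ 2 := by
      intro x
      have e : ∀ h : ℕ, chi q (t * x + t * h) = chi q t * chi q (x + 1 * h) := by
        intro h; rw [← chi_mul]; congr 1; ring
      rw [sum_congr rfl (fun h _ => e h), ← mul_sum, mul_pow, chi_unit_sq q ht, one_mul]
    simp only [V]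
    rw [← Fintype.sum_equiv ht.unit.mulLeft (fun x => (∑ h ∈ range H, chi q (t * x + t * h)) ^ 2) _ (fun x => rfl)]
    exact sum_congr rfl fun x _ => this x
  have hcq : (Fintype.card (ZMod q)) = q := ZMod.card q
  have htot : ∑ t, V t ≤ H * (q : ℝ) ^ 2 := by
    have e1 : ∑ t, V t = ∑ h ∈ range H, ∑ h' ∈ range H, ∑ t : ZMod q, ∑ x : ZMod q, chi q (x + t * h) * chi q (x + t * h') := by
      simp only [V, sq, sum_mul_sum]
      have : ∀ t : ZMod q, ∑ x : ZMod q, ∑ h ∈ range H, ∑ h' ∈ range H, chi q (x + t * h) * chi q (x + t * h') =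
          ∑ h ∈ range H, ∑ h' ∈ range H, ∑ x : ZMod q, chi q (x + t * h) * chi q (x + t * h') := by
        intro t
        rw [sum_comm]
        exact sum_congr rfl fun h _ => sum_comm
      rw [sum_congr rfl fun t _ => this t, sum_comm]
      exact sum_congr rfl fun h _ => sum_comm
    rw [e1]
    have e2 : ∀ h ∈ range H, ∀ h' ∈ range H, ∑ t : ZMod q, ∑ x : ZMod q, chi q (x + t * h) * chi q (x + t * h') ≤ if h' = h then (q : ℝ) ^ 2 else 0 := by
      intro h hh h' hh'
      rw [mem_range] at hh hh'
      split_ifs with heq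
      · calc _ ≤ ∑ t : ZMod q, ∑ x : ZMod q, (1 : ℝ) := by
              refine sum_le_sum fun t _ => sum_le_sum fun x _ => ?_
              refine (le_abs_self _).trans ?_
              rw [abs_mul]; exact mul_le_one₀ (chi_abs _ _) (abs_nonneg _) (chi_abs _ _)
          _ = _ := by simp [hcq]; ring
      · obtain ⟨s, hs1, hs2⟩ := hgood ((h' : ℤ) - h) (by omega) (by omega)
        apply le_of_eq
        have : ∀ t : ZMod q, ∑ x : ZMod q, chi q (x + t * h) * chi q (x + t * h') = ∑ x : ZMod q, chi q x * chi q (x + t * (((h' : ℤ) - h : ℤ) : ZMod q)) := by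
          intro t
          rw [Fintype.sum_equiv (Equiv.addRight (t * (h : ZMod q))) _ (fun x => chi q x * chi q (x + t * (((h' : ℤ) - h : ℤ) : ZMod q)))]
          intro x
          simp only [Equiv.coe_addRight]
          congr 2
          push_cast; ring
        rw [sum_congr rfl fun t _ => this t, sum_comm]
        apply sum_eq_zero
        intro x _
        rw [← mul_sum, chi_line_zero q hs1 hs2, mul_zero]
    calc _ ≤ ∑ h ∈ range H, ∑ h' ∈ range H, if h' = h then (q : ℝ) ^ 2 else 0 :=
          sum_le_sum fun h hh => sum_le_sum fun h' hh' => e2 h hh h' hh'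
      _ = ∑ h ∈ range H, (q : ℝ) ^ 2 := by
          refine sum_congr rfl fun h hh => ?_
          rw [sum_ite_eq']; simp [hh]
      _ = _ := by simp
  have hφ : (q.totient : ℝ) * V 1 ≤ H * (q : ℝ) ^ 2 := by
    refine le_trans ?_ htot
    have hcard : (univ.filter (fun t : ZMod q => IsUnit t)).card = q.totient := by
      rw [← ZMod.card_units_eq_totient, ← Finset.card_univ, ← card_map ⟨fun u : (ZMod q)ˣ => (u : ZMod q), Units.val_injective⟩]
      congr 1
      ext t
      simp only [mem_filter, mem_univ, true_and, mem_map, Function.Embedding.coeFn_mk]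
      rfl
    calc (q.totient : ℝ) * V 1 = ∑ t ∈ univ.filter (fun t : ZMod q => IsUnit t), V 1 := by
          rw [sum_const, nsmul_eq_mul, hcard]
      _ = ∑ t ∈ univ.filter (fun t : ZMod q => IsUnit t), V t := sum_congr rfl fun t ht => (hVu t (mem_filter.1 ht).2).symm
      _ ≤ _ := sum_le_sum_of_subset_of_nonneg (filter_subset _ _) (fun t _ _ => hV0 t)
  have hτ : (q : ℝ) ≤ q.divisors.card * q.totient := by
    have : q ≤ q.divisors.card * q.totient := by
      calc q = ∑ d ∈ q.divisors, d.totient := (Nat.sum_totient q).symm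
        _ ≤ ∑ d ∈ q.divisors, q.totient := by
            refine sum_le_sum fun d hd => ?_
            exact Nat.le_of_dvd (Nat.totient_pos.2 (NeZero.pos q)) (Nat.totient_dvd_of_dvd (Nat.dvd_of_mem_divisors hd))
        _ = _ := by rw [sum_const, smul_eq_mul]
    exact_mod_cast this
  have hq0 : (0 : ℝ) < q := by exact_mod_cast NeZero.pos q
  have hfin : (q : ℝ) * V 1 ≤ q * (q.divisors.card * H * q) := by
    calc (q : ℝ) * V 1 ≤ (q.divisors.card * q.totient) * V 1 := mul_le_mul_of_nonneg_right hτ (hV0 1)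
      _ = q.divisors.card * (q.totient * V 1) := by ring
      _ ≤ q.divisors.card * (H * (q : ℝ) ^ 2) := by gcongr
      _ = _ := by ring
  calc _ = V D := rfl
    _ = V 1 := hVu D hD
    _ ≤ _ := le_of_mul_le_mul_left hfin hq0

theorem shift_bound (g : ℤ → ℝ) (hg : ∀ v, |g v| ≤ 1) (n c : ℕ) (a : ℤ) :
    |∑ i ∈ range n, g (a + i) - ∑ i ∈ range n, g (a + i + c)| ≤ 2 * c := by
  induction c with
  | zero => simp
  | succ c ih =>
    have e : ∑ i ∈ range n, g (a + i + c) - ∑ i ∈ range n, g (a + i + (c + 1 : ℕ)) = g (a + c) - g (a + n + c) := by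
      have h1 := sum_range_succ (fun i : ℕ => g (a + i + c)) n
      have h2 := sum_range_succ' (fun i : ℕ => g (a + i + c)) n
      have h3 : ∀ i : ℕ, g (a + (i + 1 : ℕ) + c) = g (a + i + (c + 1 : ℕ)) := by
        intro i; congr 1; push_cast; ring
      rw [sum_congr rfl fun i _ => h3 i] at h2
      simp only [Nat.cast_zero, add_zero] at h2
      linarith
    have e2 : ∑ i ∈ range n, g (a + i) - ∑ i ∈ range n, g (a + i + (c + 1 : ℕ)) =
        (∑ i ∈ range n, g (a + i) - ∑ i ∈ range n, g (a + i + c)) + (g (a + c) - g (a + n + c)) := by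
      rw [← e]; ring
    rw [e2]
    have := abs_sub (g (a + c)) (g (a + n + c))
    have h1 := hg (a + c)
    have h2 := hg (a + n + c)
    refine (abs_add_le _ _).trans ?_
    push_cast
    linarith

theorem interval_sum {q H : ℕ} [NeZero q]
    (hgood : ∀ k : ℤ, k ≠ 0 → k.natAbs < H → ∃ s : ℤ, J(s | q) = -1 ∧ (Int.gcd k q : ℤ) ∣ s - 1)
    {D : ℕ} (hD : IsCoprime (D : ℤ) q) (f : ℤ → ℝ) (hf : ∀ v, |f v| ≤ 1) (hfD : ∀ v, f (v + D) = f v)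
    (a : ℤ) {n : ℕ} (hn : n ≤ q) :
    H * |∑ i ∈ range n, f (a + i) * (J(a + i | q) : ℝ)| ≤ q * √(q.divisors.card * H) + 2 * D * H ^ 2 := by
  let g : ℤ → ℝ := fun v => f v * (J(v | q) : ℝ)
  have hg : ∀ v, |g v| ≤ 1 := fun v => by
    rw [abs_mul]; exact mul_le_one₀ (hf v) (abs_nonneg _) (jac_abs _ _)
  set S := ∑ i ∈ range n, f (a + i) * (J(a + i | q) : ℝ) with hS
  have hfDh : ∀ (h : ℕ) v, f (v + D * h) = f v := by
    intro h v
    induction h with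
    | zero => simp
    | succ h ih => rw [show v + (D : ℤ) * (h + 1 : ℕ) = v + D * h + D by push_cast; ring, hfD, ih]
  have hD' : IsUnit ((D : ℕ) : ZMod q) := by
    have := isUnit_of_coprime_int hD
    simpa using this
  have h1 : ∑ h ∈ range H, ∑ i ∈ range n, g (a + i + (D * h : ℕ)) = ∑ i ∈ range n, f (a + i) * ∑ h ∈ range H, chi q ((a : ZMod q) + i + D * h) := by
    rw [sum_comm]
    refine sum_congr rfl fun i _ => ?_
    rw [mul_sum]
    refine sum_congr rfl fun h _ => ?_
    simp only [g]
    push_cast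
    rw [hfDh]
    congr 1
    rw [← chi_cast]; push_cast; rfl
  have h2 : |H * S - ∑ h ∈ range H, ∑ i ∈ range n, g (a + i + (D * h : ℕ))| ≤ 2 * D * H ^ 2 := by
    have e : H * S - ∑ h ∈ range H, ∑ i ∈ range n, g (a + i + (D * h : ℕ)) = ∑ h ∈ range H, (S - ∑ i ∈ range n, g (a + i + (D * h : ℕ))) := by
      rw [sum_sub_distrib]; simp
    rw [e]
    refine (abs_sum_le_sum_abs _ _).trans ?_
    calc _ ≤ ∑ h ∈ range H, (2 * D * H : ℝ) := by
          refine sum_le_sum fun h hh => ?_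
          refine (shift_bound g hg n (D * h) a).trans ?_
          rw [mem_range] at hh
          have : (h : ℝ) ≤ H := by exact_mod_cast hh.le
          push_cast
          rw [← mul_assoc]
          gcongr
      _ = _ := by simp; ring
  have h3 : |∑ i ∈ range n, f (a + i) * ∑ h ∈ range H, chi q ((a : ZMod q) + i + D * h)| ≤ q * √(q.divisors.card * H) := by
    refine (abs_sum_le_sum_abs _ _).trans ?_
    have e : ∑ i ∈ range n, |f (a + i) * ∑ h ∈ range H, chi q ((a : ZMod q) + i + D * h)| ≤ ∑ i ∈ range q, |∑ h ∈ range H, chi q ((a : ZMod q) + i + D * h)| := by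
      refine le_trans (sum_le_sum fun i _ => ?_) (sum_le_sum_of_subset_of_nonneg (range_mono hn) fun _ _ _ => abs_nonneg _)
      rw [abs_mul]; exact mul_le_of_le_one_left (abs_nonneg _) (hf _)
    refine e.trans ?_
    apply abs_le_of_sq_le_sq' _ (by positivity) |>.2
    refine sq_sum_le_card_mul_sum_sq.trans ?_
    have e2 : ∑ i ∈ range q, |∑ h ∈ range H, chi q ((a : ZMod q) + i + D * h)| ^ 2 = ∑ x : ZMod q, (∑ h ∈ range H, chi q (x + D * h)) ^ 2 := by
      simp_rw [sq_abs]
      rw [sum_range_zmod (fun x : ZMod q => (∑ h ∈ range H, chi q ((a : ZMod q) + x + (D : ZMod q) * (h : ZMod q))) ^ 2)]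
      exact Fintype.sum_equiv (Equiv.addLeft (a : ZMod q)) _ _ (fun x => rfl)
    rw [e2, card_range, mul_pow, Real.sq_sqrt (by positivity)]
    have := moment hgood hD'
    calc (q : ℝ) * _ ≤ q * (q.divisors.card * H * q) := by gcongr
      _ = _ := by ring
  rw [← h1] at h3
  have : (H : ℝ) * |S| = |H * S| := by rw [abs_mul, Nat.abs_cast]
  rw [this]
  have e : (H * S : ℝ) = ∑ h ∈ range H, ∑ i ∈ range n, g (a + i + (D * h : ℕ)) + (H * S - ∑ h ∈ range H, ∑ i ∈ range n, g (a + i + (D * h : ℕ))) := by ring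
  rw [e]
  exact (abs_add_le _ _).trans (add_le_add h3 h2)

theorem good_of_large {q e b H : ℕ} (hq : q % 2 = 1) (hqe : q = b ^ 2 * e) (he : Squarefree e) (hH : H ≤ e) :
    ∀ k : ℤ, k ≠ 0 → k.natAbs < H → ∃ s : ℤ, J(s | q) = -1 ∧ (Int.gcd k q : ℤ) ∣ s - 1 := by
  intro k hk hkH
  have hex : ∃ p, p.Prime ∧ p ∣ e ∧ ¬ p ∣ Int.gcd k q := by
    by_contra hc
    push Not at hc
    have h1 : e ∣ Int.gcd k q := by
      rw [← Nat.prod_primeFactors_of_squarefree he]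
      exact Finset.prod_primes_dvd _ (fun p hp => (Nat.prime_of_mem_primeFactors hp).prime)
        (fun p hp => hc p (Nat.prime_of_mem_primeFactors hp) (Nat.dvd_of_mem_primeFactors hp))
    have h2 : Int.gcd k q ∣ k.natAbs := Int.natCast_dvd_natCast.1 (by rw [Int.dvd_natAbs]; exact Int.gcd_dvd_left _ _)
    have h3 := Nat.le_of_dvd (Int.natAbs_pos.2 hk) (h1.trans h2)
    omega
  obtain ⟨p, hp, hpe, hpg⟩ := hex
  obtain ⟨t, ht, h⟩ := exists_jac_neg hq hqe he hp hpe
  exact ⟨t, ht, h _ (Int.natCast_dvd_natCast.1 (Int.gcd_dvd_right _ _)) hpg⟩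

open Classical in
/-- few `u` have small squarefree part -/
theorem bad_card (R H : ℕ) :
    ((Icc 1 R).filter (fun u => ∃ e b : ℕ, u = b ^ 2 * e ∧ e < H)).card ≤ H * Nat.sqrt R := by
  have hsub : (Icc 1 R).filter (fun u => ∃ e b : ℕ, u = b ^ 2 * e ∧ e < H) ⊆
      (range H ×ˢ Icc 1 (Nat.sqrt R)).image (fun t => t.2 ^ 2 * t.1) := by
    intro u hu
    rw [mem_filter, mem_Icc] at hu
    obtain ⟨⟨h1, h2⟩, e, b, h3, h4⟩ := hu
    rw [mem_image]
    refine ⟨(e, b), ?_, h3.symm⟩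
    rw [mem_product, mem_range, mem_Icc]
    have he : 0 < e := by rcases Nat.eq_zero_or_pos e with h | h
                          · subst h; simp at h3; omega
                          · exact h
    refine ⟨h4, ?_, ?_⟩
    · rcases Nat.eq_zero_or_pos b with h | h
      · subst h; simp at h3; omega
      · exact h
    · dsimp only
      rw [Nat.le_sqrt]
      calc b * b = b ^ 2 * 1 := by ring
        _ ≤ b ^ 2 * e := Nat.mul_le_mul_left _ he
        _ ≤ R := by omega
  refine (card_le_card hsub).trans (card_image_le.trans ?_)
  rw [card_product]; simp

end QB

end

section

open scoped NumberTheorySymbols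
open Finset

namespace QB

theorem convex_sum (S : Finset ℤ) (hS : ∀ a ∈ S, ∀ b ∈ S, ∀ c, a ≤ c → c ≤ b → c ∈ S) :
    ∃ a : ℤ, ∀ g : ℤ → ℝ, ∑ v ∈ S, g v = ∑ i ∈ range S.card, g (a + i) := by
  rcases S.eq_empty_or_nonempty with rfl | hne
  · exact ⟨0, fun g => by simp⟩
  · refine ⟨S.min' hne, fun g => ?_⟩
    have hinj : Function.Injective (fun i : ℕ => S.min' hne + (i : ℤ)) := fun i j h => by
      have : S.min' hne + (i : ℤ) = S.min' hne + j := h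
      omega
    have e : S = (range (S.max' hne - S.min' hne + 1).toNat).image (fun i : ℕ => S.min' hne + (i : ℤ)) := by
      ext v
      rw [mem_image]
      have h1 := S.min'_le_max' hne
      constructor
      · intro hv
        have h2 := S.min'_le v hv
        have h3 := S.le_max' v hv
        exact ⟨(v - S.min' hne).toNat, by rw [mem_range]; omega, by omega⟩
      · rintro ⟨i, hi, rfl⟩
        rw [mem_range] at hi
        exact hS _ (S.min'_mem hne) _ (S.max'_mem hne) _ (by omega) (by omega)
    have hc : S.card = (S.max' hne - S.min' hne + 1).toNat := by
      conv_lhs => rw [e]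
      rw [card_image_of_injective _ hinj, card_range]
    rw [hc]
    conv_lhs => rw [e]
    rw [sum_image fun _ _ _ _ h => hinj h]

/-- weight -/
noncomputable def fw (r d : ℕ) (u v : ℤ) : ℝ :=
  if (u ^ 2 - 2 * v ^ 2) % 32 = r ∧ (d : ℤ) ∣ u ^ 2 - 2 * v ^ 2 then (kap u v : ℝ) else 0

theorem kap_abs (u v : ℤ) : |(kap u v : ℝ)| ≤ 1 := by
  unfold kap; split_ifs <;> simp

theorem fw_abs (r d : ℕ) (u v : ℤ) : |fw r d u v| ≤ 1 := by
  unfold fw; split_ifs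
  · exact kap_abs u v
  · simp

theorem fw_per (r d : ℕ) (u v : ℤ) : fw r d u (v + (32 * d : ℕ)) = fw r d u v := by
  unfold fw
  have h1 : u ^ 2 - 2 * (v + (32 * d : ℕ)) ^ 2 = u ^ 2 - 2 * v ^ 2 + 32 * (-(2 * d * (2 * v + 32 * d))) := by push_cast; ring
  have h1' : u ^ 2 - 2 * (v + (32 * d : ℕ)) ^ 2 = u ^ 2 - 2 * v ^ 2 + d * (-(32 * 2 * (2 * v + 32 * d))) := by push_cast; ring
  have h2 : (u ^ 2 - 2 * (v + (32 * d : ℕ)) ^ 2) % 32 = (u ^ 2 - 2 * v ^ 2) % 32 := by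
    rw [h1]; exact Int.add_mul_emod_self_left _ _ _
  have h3 : (d : ℤ) ∣ u ^ 2 - 2 * (v + (32 * d : ℕ)) ^ 2 ↔ (d : ℤ) ∣ u ^ 2 - 2 * v ^ 2 := by
    rw [h1', dvd_add_left (dvd_mul_right _ _)]
  have h4 : kap u (v + (32 * d : ℕ)) = kap u v := by
    unfold kap
    have : (3 * u + 4 * (v + (32 * d : ℕ))) % 16 = (3 * u + 4 * v) % 16 := by push_cast; omega
    rw [this]
  simp only [h2, h3, h4]

theorem fw_zero {r d : ℕ} (hr : r % 16 = 15) {u : ℕ} (hu : 0 < u) (hc : ¬ IsCoprime ((32 * d : ℕ) : ℤ) u) (v : ℤ) :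
    fw r d u v * (J(v | u) : ℝ) = 0 := by
  unfold fw
  split_ifs with h
  · obtain ⟨h1, h2⟩ := h
    obtain ⟨l, hl, h3, h4⟩ := exists_prime_of_not_coprime hc
    have h5 : ((u : ℤ) ^ 2 - 2 * v ^ 2) % 16 = 15 := by omega
    have h6 := (mod_facts h5).2
    have hl2 : l ≠ 2 := by rintro rfl; omega
    have h7 : l ∣ 32 * d := Int.natCast_dvd_natCast.1 h3
    have hcop : Nat.Coprime l 32 := by
      have : Nat.Coprime l (2 ^ 5) := Nat.Coprime.pow_right _ ((Nat.coprime_primes hl Nat.prime_two).2 hl2)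
      simpa using this
    have h8 : l ∣ d := hcop.dvd_of_dvd_mul_left h7
    have h9 : (l : ℤ) ∣ 2 * v ^ 2 := by
      have := (Int.natCast_dvd_natCast.2 h8).trans h2
      have h10 : (l : ℤ) ∣ (u : ℤ) ^ 2 := h4.trans (dvd_pow_self _ two_ne_zero)
      have := dvd_sub h10 this
      simpa using this
    have hlp : Prime (l : ℤ) := Nat.prime_iff_prime_int.1 hl
    have h11 : (l : ℤ) ∣ v := by
      rcases hlp.dvd_or_dvd h9 with h | h
      · have : l ∣ 2 := by exact_mod_cast h
        exact absurd ((Nat.prime_dvd_prime_iff_eq hl Nat.prime_two).1 this) hl2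
      · exact hlp.dvd_of_dvd_pow h
    rw [jac_zero hl hu.ne' h11 h4]; simp
  · simp

/-- the inner range -/
noncomputable def Su (Y u : ℕ) : Finset ℤ := (Ioo (-(u : ℤ)) u).filter (fun v => 2 * |v| < u ∧ (u : ℤ) ^ 2 - 2 * v ^ 2 ≤ Y)

theorem Su_sum_trivial (Y : ℕ) {u : ℕ} (g : ℤ → ℝ) (hg : ∀ v, |g v| ≤ 1) : |∑ v ∈ Su Y u, g v| ≤ 2 * u := by
  refine (abs_sum_le_sum_abs _ _).trans ?_
  calc _ ≤ ∑ v ∈ Su Y u, (1 : ℝ) := sum_le_sum fun v _ => hg v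
    _ = ((Su Y u).card : ℝ) := by simp
    _ ≤ ((2 * u : ℕ) : ℝ) := by
        norm_cast
        refine (card_filter_le _ _).trans ?_
        rw [Int.card_Ioo]; omega
    _ = _ := by push_cast; rfl

theorem inner_good {r d : ℕ} (hr : r % 16 = 15) (Y : ℕ) {u H : ℕ} (hu : u % 2 = 1)
    (hgood : ∀ k : ℤ, k ≠ 0 → k.natAbs < H → ∃ s : ℤ, J(s | u) = -1 ∧ (Int.gcd k u : ℤ) ∣ s - 1) :
    H * |∑ v ∈ Su Y u, fw r d u v * (J(v | u) : ℝ)| ≤ 2 * (u * √(u.divisors.card * H) + 2 * (32 * d) * H ^ 2) := by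
  by_cases hc : IsCoprime ((32 * d : ℕ) : ℤ) u
  · have : NeZero u := ⟨by omega⟩
    rw [← sum_filter_add_sum_filter_not (Su Y u) (fun v => 0 ≤ v)]
    have key : ∀ S : Finset ℤ, (∀ a ∈ S, ∀ b ∈ S, ∀ c, a ≤ c → c ≤ b → c ∈ S) → S.card ≤ u →
        H * |∑ v ∈ S, fw r d u v * (J(v | u) : ℝ)| ≤ u * √(u.divisors.card * H) + 2 * (32 * d) * H ^ 2 := by
      intro S h1 h2
      obtain ⟨a, ha⟩ := convex_sum S h1
      rw [ha]
      have := interval_sum hgood hc (fw r d u) (fw_abs r d u) (fw_per r d u) a h2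
      push_cast at this ⊢
      exact this
    have k1 := key ((Su Y u).filter (fun v => 0 ≤ v)) (by
      intro a ha b hb c hac hcb
      simp only [Su, mem_filter, mem_Ioo] at ha hb ⊢
      have e1 : |a| = a := abs_of_nonneg ha.2
      have e2 : |b| = b := abs_of_nonneg hb.2
      have e3 : |c| = c := abs_of_nonneg (ha.2.trans hac)
      rw [e1] at ha
      rw [e2] at hb
      rw [e3]
      refine ⟨⟨⟨by omega, by omega⟩, by omega, ?_⟩, by omega⟩
      nlinarith [ha.1.2.2, ha.2]) (by
      refine (card_le_card (t := Ico (0 : ℤ) u) ?_).trans (by simp)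
      intro v hv
      simp only [Su, mem_filter, mem_Ioo] at hv
      rw [mem_Ico]; omega)
    have k2 := key ((Su Y u).filter (fun v => ¬ 0 ≤ v)) (by
      intro a ha b hb c hac hcb
      simp only [Su, mem_filter, mem_Ioo, not_le] at ha hb ⊢
      have e1 : |a| = -a := abs_of_neg ha.2
      have e2 : |b| = -b := abs_of_neg hb.2
      have e3 : |c| = -c := abs_of_neg (hcb.trans_lt hb.2)
      rw [e1] at ha
      rw [e2] at hb
      rw [e3]
      refine ⟨⟨⟨by omega, by omega⟩, by omega, ?_⟩, by omega⟩
      nlinarith [hb.1.2.2, hb.2]) (by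
      refine (card_le_card (t := Ico (-(u : ℤ)) 0) ?_).trans (by simp)
      intro v hv
      simp only [Su, mem_filter, mem_Ioo, not_le] at hv
      rw [mem_Ico]; omega)
    have := abs_add_le (∑ v ∈ (Su Y u).filter (fun v => 0 ≤ v), fw r d u v * (J(v | u) : ℝ)) (∑ v ∈ (Su Y u).filter (fun v => ¬ 0 ≤ v), fw r d u v * (J(v | u) : ℝ))
    have hH : (0 : ℝ) ≤ H := Nat.cast_nonneg _
    calc _ ≤ (H : ℝ) * (|∑ v ∈ (Su Y u).filter (fun v => 0 ≤ v), fw r d u v * (J(v | u) : ℝ)| + |∑ v ∈ (Su Y u).filter (fun v => ¬ 0 ≤ v), fw r d u v * (J(v | u) : ℝ)|) := by gcongr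
      _ ≤ _ := by linarith
  · rw [sum_eq_zero fun v _ => fw_zero hr (by omega) hc v]
    simp only [abs_zero, mul_zero]
    positivity

/-- sums of `F` over multiples of `d` as a double sum -/
theorem F_sum_eq (r d Y : ℕ) :
    ∑ n ∈ (Icc 1 Y).filter (fun n => d ∣ n), F r n = ∑ u ∈ Icc 1 (Nat.sqrt (2 * Y)), ∑ v ∈ Su Y u, fw r d u v * (J(v | u) : ℝ) := by
  have e1 : ∀ n ∈ (Icc 1 Y).filter (fun n => d ∣ n), F r n = ∑ w ∈ fset n, fw r d w.re w.im * (J(w.im | w.re.natAbs) : ℝ) := by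
    intro n hn
    rw [mem_filter] at hn
    unfold F
    split_ifs with h
    · push_cast
      refine sum_congr rfl fun w hw => ?_
      have hw1 := (mem_fset.1 hw).1
      rw [nrm] at hw1
      unfold fw
      rw [if_pos ⟨by rw [hw1]; omega, by rw [hw1]; exact_mod_cast hn.2⟩]
      unfold sym; push_cast; rfl
    · symm
      apply sum_eq_zero
      intro w hw
      have hw1 := (mem_fset.1 hw).1
      rw [nrm] at hw1
      unfold fw
      rw [if_neg, zero_mul]
      rintro ⟨h1, -⟩
      rw [hw1] at h1
      omega
  have e2 : ∑ n ∈ (Icc 1 Y).filter (fun n => d ∣ n), F r n = ∑ n ∈ Icc 1 Y, ∑ w ∈ fset n, fw r d w.re w.im * (J(w.im | w.re.natAbs) : ℝ) := by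
    rw [sum_congr rfl e1, sum_filter]
    refine sum_congr rfl fun n hn => ?_
    split_ifs with h
    · rfl
    · symm
      apply sum_eq_zero
      intro w hw
      have hw1 := (mem_fset.1 hw).1
      rw [nrm] at hw1
      unfold fw
      rw [if_neg, zero_mul]
      rintro ⟨-, h1⟩
      rw [hw1] at h1
      exact h (by exact_mod_cast h1)
  rw [e2, sum_sigma', sum_sigma']
  refine sum_bij' (fun x _ => ⟨x.2.re.toNat, x.2.im⟩) (fun y _ => ⟨(⟨(y.1 : ℤ), y.2⟩ : ℤ√2).norm.toNat, ⟨(y.1 : ℤ), y.2⟩⟩) ?_ ?_ ?_ ?_ ?_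
  · rintro ⟨n, w⟩ hx
    rw [mem_sigma] at hx ⊢
    dsimp only at hx ⊢
    rw [mem_Icc] at hx
    obtain ⟨h1, h2⟩ := mem_fset.1 hx.2
    rw [nrm] at h1
    have h3 := h2.sq
    have e : ((w.re.toNat : ℕ) : ℤ) = w.re := Int.toNat_of_nonneg h3.2.le
    have hR : 2 * |w.im| < w.re := h2
    have ha := abs_nonneg w.im
    have hb := abs_le.1 (le_refl |w.im|)
    constructor
    · rw [mem_Icc, Nat.le_sqrt]
      refine ⟨by omega, ?_⟩
      have : ((w.re.toNat * w.re.toNat : ℕ) : ℤ) ≤ ((2 * Y : ℕ) : ℤ) := by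
        push_cast; rw [e]
        have : (n : ℤ) ≤ Y := by exact_mod_cast hx.1.2
        nlinarith
      exact_mod_cast this
    · simp only [Su, mem_filter, mem_Ioo]
      rw [e]
      refine ⟨⟨by omega, by omega⟩, hR, ?_⟩
      rw [h1]; exact_mod_cast hx.1.2
  · rintro ⟨u, v⟩ hy
    rw [mem_sigma] at hy ⊢
    dsimp only at hy ⊢
    simp only [Su, mem_filter, mem_Ioo] at hy
    have hR : Red (⟨(u : ℤ), v⟩ : ℤ√2) := hy.2.2.1
    have hp := hR.norm_pos
    have hn := nrm (⟨(u : ℤ), v⟩ : ℤ√2)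
    dsimp only at hn
    constructor
    · rw [mem_Icc]; omega
    · rw [mem_fset]; exact ⟨by omega, hR⟩
  · rintro ⟨n, w⟩ hx
    rw [mem_sigma] at hx
    dsimp only at hx ⊢
    obtain ⟨h1, h2⟩ := mem_fset.1 hx.2
    have h3 := h2.sq
    have e : ((w.re.toNat : ℕ) : ℤ) = w.re := Int.toNat_of_nonneg h3.2.le
    have ew : (⟨((w.re.toNat : ℕ) : ℤ), w.im⟩ : ℤ√2) = w := by rw [e]
    rw [ew, h1]
    simp
  · rintro ⟨u, v⟩ hy
    simp
  · rintro ⟨n, w⟩ hx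
    rw [mem_sigma] at hx
    dsimp only at hx ⊢
    obtain ⟨h1, h2⟩ := mem_fset.1 hx.2
    have h3 := h2.sq
    have e : ((w.re.toNat : ℕ) : ℤ) = w.re := Int.toNat_of_nonneg h3.2.le
    have e' : w.re.natAbs = w.re.toNat := by omega
    rw [e, e']

theorem typeI_raw {r d : ℕ} (hr : r % 16 = 15) (Y H : ℕ) (hH : 0 < H) (τ0 : ℝ)
    (hτ : ∀ u ∈ Icc 1 (Nat.sqrt (2 * Y)), (u.divisors.card : ℝ) ≤ τ0) :
    |∑ n ∈ (Icc 1 Y).filter (fun n => d ∣ n), F r n| ≤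
      (Nat.sqrt (2 * Y)) * (2 * (Nat.sqrt (2 * Y) * √(τ0 / H) + 64 * d * H)) + (H * Nat.sqrt (Nat.sqrt (2 * Y))) * (2 * Nat.sqrt (2 * Y)) := by
  classical
  set R := Nat.sqrt (2 * Y)
  have hH0 : (0 : ℝ) < H := by exact_mod_cast hH
  rw [F_sum_eq, ← sum_filter_not_add_sum_filter (Icc 1 R) (fun u => ∃ e b : ℕ, u = b ^ 2 * e ∧ e < H)]
  refine (abs_add_le _ _).trans (add_le_add ?_ ?_)
  · refine (abs_sum_le_sum_abs _ _).trans ?_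
    calc _ ≤ ∑ u ∈ (Icc 1 R).filter (fun u => ¬ ∃ e b : ℕ, u = b ^ 2 * e ∧ e < H), 2 * (R * √(τ0 / H) + 64 * d * H) := by
          refine sum_le_sum fun u hu => ?_
          rw [mem_filter] at hu
          have hτu := hτ u hu.1
          have hτ0 : 0 ≤ τ0 := le_trans (Nat.cast_nonneg _) hτu
          have huR : (u : ℝ) ≤ R := by exact_mod_cast (mem_Icc.1 hu.1).2
          have hu1 := (mem_Icc.1 hu.1).1
          by_cases hodd : u % 2 = 1
          · obtain ⟨e, b, h1, h2⟩ := Nat.sq_mul_squarefree u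
            have he : H ≤ e := by
              by_contra hlt
              exact hu.2 ⟨e, b, h1.symm, by omega⟩
            have := inner_good (d := d) hr Y hodd (good_of_large hodd h1.symm h2 he)
            have h3 : |∑ v ∈ Su Y u, fw r d u v * (J(v | u) : ℝ)| ≤ (2 * (u * √(u.divisors.card * H) + 2 * (32 * d) * H ^ 2)) / H := by
              rw [le_div_iff₀ hH0, mul_comm]; exact this
            refine h3.trans ?_
            rw [div_le_iff₀ hH0]
            have h4 : √(u.divisors.card * H) ≤ √(τ0 / H) * H := by
              have : √(τ0 / H) * H = √(τ0 * H) := by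
                rw [← Real.sqrt_sq hH0.le, ← Real.sqrt_mul (by positivity), Real.sqrt_sq hH0.le]
                congr 1; field_simp
              rw [this]
              apply Real.sqrt_le_sqrt; gcongr
            calc 2 * (u * √(u.divisors.card * H) + 2 * (32 * d) * H ^ 2) ≤ 2 * (R * (√(τ0 / H) * H) + 2 * (32 * d) * H ^ 2) := by gcongr
              _ = _ := by ring
          · rw [sum_eq_zero fun v _ => fw_zero (d := d) hr hu1 (fun hc => ?_) v]
            · simp only [abs_zero]; positivity
            · have h2 : (2 : ℤ) ∣ 1 := by
                obtain ⟨x, y, hxy⟩ := hc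
                rw [← hxy]
                refine dvd_add (Dvd.dvd.mul_left ?_ _) (Dvd.dvd.mul_left ?_ _)
                · push_cast; exact ⟨16 * d, by ring⟩
                · omega
              norm_num at h2
      _ = (((Icc 1 R).filter (fun u => ¬ ∃ e b : ℕ, u = b ^ 2 * e ∧ e < H)).card : ℝ) * (2 * (R * √(τ0 / H) + 64 * d * H)) := by
          rw [sum_const, nsmul_eq_mul]
      _ ≤ _ := by
          have : ((((Icc 1 R).filter (fun u => ¬ ∃ e b : ℕ, u = b ^ 2 * e ∧ e < H)).card : ℕ) : ℝ) ≤ R := by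
            exact_mod_cast (card_filter_le _ _).trans (by simp)
          gcongr
  · refine (abs_sum_le_sum_abs _ _).trans ?_
    calc _ ≤ ∑ u ∈ (Icc 1 R).filter (fun u => ∃ e b : ℕ, u = b ^ 2 * e ∧ e < H), (2 * R : ℝ) := by
          refine sum_le_sum fun u hu => ?_
          rw [mem_filter, mem_Icc] at hu
          have huR : (u : ℝ) ≤ R := by exact_mod_cast hu.1.2
          refine (Su_sum_trivial Y _ (fun v => ?_)).trans (by linarith)
          rw [abs_mul]; exact mul_le_one₀ (fw_abs _ _ _ _) (abs_nonneg _) (jac_abs _ _)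
      _ = (((Icc 1 R).filter (fun u => ∃ e b : ℕ, u = b ^ 2 * e ∧ e < H)).card : ℝ) * (2 * R) := by
          rw [sum_const, nsmul_eq_mul]
      _ ≤ _ := by
          have : ((((Icc 1 R).filter (fun u => ∃ e b : ℕ, u = b ^ 2 * e ∧ e < H)).card : ℕ) : ℝ) ≤ H * Nat.sqrt R := by
            exact_mod_cast bad_card R H
          gcongr

/-- type I estimate -/
theorem typeI {r : ℕ} (hr : r % 16 = 15) : ∃ C : ℝ, 1 ≤ C ∧ ∀ d Y : ℕ, 1 ≤ d → 1 ≤ Y →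
    |∑ n ∈ (Icc 1 Y).filter (fun n => d ∣ n), F r n| ≤ C * d * (Y : ℝ) ^ (31 / 32 : ℝ) := by
  obtain ⟨C0, hC0, hdiv⟩ := divisor_bound (1 / 8) (by norm_num)
  refine ⟨(2 * C0 + 260) * 2, by linarith, fun d Y hd hY => ?_⟩
  set ρ : ℝ := √(2 * Y) with hρ
  have hY1 : (1 : ℝ) ≤ Y := by exact_mod_cast hY
  have hd1 : (1 : ℝ) ≤ d := by exact_mod_cast hd
  have hρ1 : 1 ≤ ρ := by rw [hρ, Real.one_le_sqrt]; linarith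
  have hρ0 : 0 < ρ := by linarith
  have hR : (Nat.sqrt (2 * Y) : ℝ) ≤ ρ := by
    have := Real.nat_sqrt_le_real_sqrt (a := 2 * Y)
    rw [hρ]; push_cast at this; exact this
  have hRR : (Nat.sqrt (Nat.sqrt (2 * Y)) : ℝ) ≤ ρ ^ (1 / 2 : ℝ) := by
    refine (Real.nat_sqrt_le_real_sqrt).trans ?_
    rw [← Real.sqrt_eq_rpow]; exact Real.sqrt_le_sqrt hR
  set H : ℕ := ⌊ρ ^ (1 / 4 : ℝ)⌋₊ + 1 with hHdef
  have hH1 : ρ ^ (1 / 4 : ℝ) ≤ H := by rw [hHdef]; push_cast; exact (Nat.lt_floor_add_one _).le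
  have hq1 : 1 ≤ ρ ^ (1 / 4 : ℝ) := Real.one_le_rpow hρ1 (by norm_num)
  have hH2 : (H : ℝ) ≤ 2 * ρ ^ (1 / 4 : ℝ) := by
    rw [hHdef]; push_cast
    have := Nat.floor_le (a := ρ ^ (1 / 4 : ℝ)) (by positivity)
    linarith
  have key := typeI_raw (d := d) hr Y H (by omega) (C0 * ρ ^ (1 / 8 : ℝ)) (fun u hu => by
    rw [mem_Icc] at hu
    refine (hdiv u hu.1).trans ?_
    have : (u : ℝ) ≤ ρ := le_trans (by exact_mod_cast hu.2) hR
    gcongr)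
  refine key.trans ?_
  have hsq : √(C0 * ρ ^ (1 / 8 : ℝ) / H) ≤ C0 * ρ ^ (-(1 / 16) : ℝ) := by
    apply Real.sqrt_le_iff.2
    refine ⟨by positivity, ?_⟩
    rw [div_le_iff₀ (by linarith)]
    have e : ρ ^ (1 / 8 : ℝ) = (ρ ^ (-(1 / 16) : ℝ)) ^ 2 * ρ ^ (1 / 4 : ℝ) := by
      rw [← Real.rpow_natCast, ← Real.rpow_mul hρ0.le, ← Real.rpow_add hρ0]; norm_num
    rw [e, mul_pow]
    calc C0 * ((ρ ^ (-(1 / 16) : ℝ)) ^ 2 * ρ ^ (1 / 4 : ℝ)) ≤ C0 ^ 2 * ((ρ ^ (-(1 / 16) : ℝ)) ^ 2 * H) := by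
          gcongr; nlinarith
      _ = _ := by ring
  have hexp : ∀ a b : ℝ, a ≤ b → ρ ^ a ≤ ρ ^ b := fun a b h => Real.rpow_le_rpow_of_exponent_le hρ1 h
  have m1 : ρ * (ρ * ρ ^ (-(1 / 16) : ℝ)) = ρ ^ (31 / 16 : ℝ) := by
    nth_rewrite 1 [← Real.rpow_one ρ]
    nth_rewrite 2 [← Real.rpow_one ρ]
    rw [← Real.rpow_add hρ0, ← Real.rpow_add hρ0]; norm_num
  have m2 : ρ * ρ ^ (1 / 4 : ℝ) ≤ ρ ^ (31 / 16 : ℝ) := by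
    nth_rewrite 1 [← Real.rpow_one ρ]
    rw [← Real.rpow_add hρ0]; exact hexp _ _ (by norm_num)
  have m3 : ρ ^ (1 / 4 : ℝ) * ρ ^ (1 / 2 : ℝ) * ρ ≤ ρ ^ (31 / 16 : ℝ) := by
    nth_rewrite 3 [← Real.rpow_one ρ]
    rw [← Real.rpow_add hρ0, ← Real.rpow_add hρ0]; exact hexp _ _ (by norm_num)
  have hfin : ρ ^ (31 / 16 : ℝ) ≤ 2 * (Y : ℝ) ^ (31 / 32 : ℝ) := by
    rw [hρ, Real.sqrt_eq_rpow, ← Real.rpow_mul (by positivity), Real.mul_rpow (by norm_num) (by positivity)]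
    norm_num
    have : (2 : ℝ) ^ (31 / 32 : ℝ) ≤ 2 ^ (1 : ℝ) := Real.rpow_le_rpow_of_exponent_le (by norm_num) (by norm_num)
    rw [Real.rpow_one] at this
    gcongr
  set Q := ρ ^ (31 / 16 : ℝ)
  have hQ : 0 ≤ Q := by positivity
  calc _ ≤ ρ * (2 * (ρ * (C0 * ρ ^ (-(1 / 16) : ℝ)) + 64 * d * (2 * ρ ^ (1 / 4 : ℝ)))) + (2 * ρ ^ (1 / 4 : ℝ) * ρ ^ (1 / 2 : ℝ)) * (2 * ρ) := by gcongr
    _ = 2 * C0 * (ρ * (ρ * ρ ^ (-(1 / 16) : ℝ))) + 256 * d * (ρ * ρ ^ (1 / 4 : ℝ)) + 4 * (ρ ^ (1 / 4 : ℝ) * ρ ^ (1 / 2 : ℝ) * ρ) := by ring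
    _ ≤ 2 * C0 * Q + 256 * d * Q + 4 * Q := by rw [m1]; gcongr
    _ ≤ (2 * C0 + 260) * d * Q := by nlinarith [mul_nonneg hQ (by linarith : (0:ℝ) ≤ d - 1), mul_nonneg (mul_nonneg hQ (by linarith : (0:ℝ) ≤ d - 1)) (by linarith : (0:ℝ) ≤ C0)]
    _ ≤ (2 * C0 + 260) * d * (2 * (Y : ℝ) ^ (31 / 32 : ℝ)) := by gcongr
    _ = _ := by ring

end QB

end

section

open scoped NumberTheorySymbols
open Finset

namespace QB

/-- localized symbol -/
noncomputable def Gs (r : ℕ) (w : ℤ√2) : ℝ := if w.norm % 32 = r then (sym w : ℝ) else 0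

theorem sym_abs (w : ℤ√2) : |(sym w : ℝ)| ≤ 1 := by
  unfold sym; push_cast
  rw [abs_mul]; exact mul_le_one₀ (kap_abs _ _) (abs_nonneg _) (jac_abs _ _)

theorem F_abs (r : ℕ) (n : ℕ) : |F r n| ≤ (fset n).card := by
  unfold F
  split_ifs
  · push_cast
    refine (abs_sum_le_sum_abs _ _).trans ?_
    calc _ ≤ ∑ w ∈ fset n, (1 : ℝ) := sum_le_sum fun w _ => sym_abs w
      _ = _ := by simp
  · simp

theorem F_eq_zero_of_even {r n : ℕ} (hr : r % 16 = 15) (hn : n % 2 = 0) : F r n = 0 := by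
  unfold F; rw [if_neg]; omega

theorem F_mul {r m n : ℕ} (hr : r % 16 = 15) (hm : m.Prime) (hmn : ¬ m ∣ n) {π : ℤ√2} (hπ : π ∈ fset m) :
    F r (m * n) = ∑ z ∈ fset n, Gs r (π * z) + ∑ z ∈ fset n, Gs r (star π * z) := by
  have hn0 : 0 < n := Nat.pos_of_ne_zero (by rintro rfl; simp at hmn)
  have hπn := (mem_fset.1 hπ).1
  by_cases h : (m * n) % 32 = r
  · have e : F r (m * n) = ∑ w ∈ fset (m * n), Gs r w := by
      unfold F; rw [if_pos h]; push_cast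
      refine sum_congr rfl fun w hw => ?_
      unfold Gs; rw [if_pos]
      rw [(mem_fset.1 hw).1]; omega
    rw [e]
    refine orbit_sum hm hn0 (by omega) hmn hπ _ fun w hw hw0 => ?_
    unfold Gs
    rw [norm_E_mul, sym_E (by rw [hw]; omega) (by rw [hw]; exact_mod_cast Nat.mul_pos hm.pos hn0) hw0]
  · unfold F; rw [if_neg h]
    have key : ∀ π' : ℤ√2, π'.norm = m → ∀ z ∈ fset n, Gs r (π' * z) = 0 := by
      intro π' h' z hz
      unfold Gs
      rw [if_neg]
      rw [Zsqrtd.norm_mul, h', (mem_fset.1 hz).1]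
      intro h2; apply h; exact_mod_cast h2
    rw [sum_eq_zero (key π hπn), sum_eq_zero (key (star π) (by rw [Zsqrtd.norm_conj, hπn])), add_zero]

theorem F_mul_zero {r m n : ℕ} (hr : r % 16 = 15) (hm : m.Prime) (hmn : ¬ m ∣ n) (he : fset m = ∅) :
    F r (m * n) = 0 := by
  unfold F
  split_ifs with h
  · rw [sum_eq_zero, Int.cast_zero]
    intro w hw
    exfalso
    have h1 := (mem_fset.1 hw).1
    rw [nrm] at h1
    have hm2 : m ≠ 2 := by rintro rfl; omega
    have : Fact m.Prime := ⟨hm⟩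
    have hmp : Prime (m : ℤ) := Nat.prime_iff_prime_int.1 hm
    have hv : ¬ (m : ℤ) ∣ w.im := by
      intro hv
      have h2 : (m : ℤ) ∣ w.re ^ 2 := by
        have : w.re ^ 2 = m * n + 2 * w.im ^ 2 := by push_cast at h1; linarith
        rw [this]
        exact dvd_add (dvd_mul_right _ _) ((hv.trans (dvd_pow_self _ two_ne_zero)).mul_left _)
      obtain ⟨a, ha⟩ := hmp.dvd_of_dvd_pow h2
      obtain ⟨b, hb⟩ := hv
      rw [ha, hb] at h1
      apply hmn
      have h3 : (m : ℤ) * (m * (a ^ 2 - 2 * b ^ 2)) = m * n := by push_cast at h1; linear_combination h1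
      have h4 := mul_left_cancel₀ hmp.ne_zero h3
      exact Int.natCast_dvd_natCast.1 ⟨_, h4.symm⟩
    have hsq : IsSquare (2 : ZMod m) := by
      have hv' : (w.im : ZMod m) ≠ 0 := by rwa [Ne, ZMod.intCast_zmod_eq_zero_iff_dvd]
      have h2 := congrArg (Int.cast : ℤ → ZMod m) h1
      push_cast at h2
      rw [ZMod.natCast_self, zero_mul] at h2
      refine ⟨(w.re : ZMod m) / w.im, ?_⟩
      field_simp
      linear_combination -h2
    have h8 := (ZMod.exists_sq_eq_two_iff hm2).1 hsq
    have := fset_nonempty hm h8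
    rw [he] at this
    exact Finset.not_nonempty_empty this
  · rfl

/-- right-hand side of the bilinear bound -/
noncomputable def RB (k M N T : ℕ) : ℝ :=
  ((N * T : ℕ) : ℝ) ^ (2 * (2 * k + 1)) * ((M : ℝ) ^ (2 * (k + 1)) *
        (((2 * (k + 1)) ^ (2 * (k + 1)) : ℕ) * ((N * T : ℕ) * (Nat.sqrt N * T * (2 * (8 * M) ^ (k + 1) + 1 : ℕ) ^ 2)
          + ((N * T : ℕ) : ℝ) ^ 2 * (2 * N ^ 2 * (2 * (8 * M) ^ (k + 1) + 1 : ℕ)))))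

theorem cell_main {r : ℕ} {k M N T : ℕ} {β Q : ℝ} {A B : Finset ℕ} {s : ℕ → ℤ√2}
    (hA : ∀ m ∈ A, m.Prime ∧ m ≤ M ∧ s m ∈ fset m) (hB : ∀ n ∈ B, n % 2 = 1 ∧ n ≤ N)
    (hT : ∀ n ≤ N, n % 2 = 1 → (fset n).card ≤ T) {a b : ℕ → ℝ} (ha : ∀ m ∈ A, |a m| ≤ 1) (hb : ∀ n ∈ B, |b n| ≤ β)
    (hβ : 0 ≤ β) (hQ0 : 0 ≤ Q) (hQ : RB k M N T ≤ Q ^ (4 * (k + 1))) :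
    |∑ n ∈ B, ∑ z ∈ fset n, ∑ m ∈ A, a m * b n * ((rho r (cls (s m)) (cls z) : ℝ) *
      ((J((s m).im | (s m).re.natAbs) : ℝ) * J(z.im | z.re.natAbs) * J((s m * z).re | z.norm.natAbs)))| ≤ β * (512 * Q) := by
  classical
  set P := A.image s with hPdef
  have hnorm : ∀ m ∈ A, (s m).norm.natAbs = m := fun m hm => by
    rw [(mem_fset.1 (hA m hm).2.2).1]; rfl
  have hsinj : ∀ m ∈ A, ∀ m' ∈ A, s m = s m' → m = m' := fun m hm m' hm' h => by
    rw [← hnorm m hm, ← hnorm m' hm', h]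
  have hPsum : ∀ g : ℕ → ℤ√2 → ℝ, ∑ m ∈ A, g m (s m) = ∑ π ∈ P, g π.norm.natAbs π := by
    intro g
    rw [hPdef, sum_image hsinj]
    exact sum_congr rfl fun m hm => by rw [hnorm m hm]
  let α : ℤ√2 → ℝ := fun π => a π.norm.natAbs * (J(π.im | π.re.natAbs) : ℝ)
  have hα : ∀ π ∈ P, |α π| ≤ 1 := by
    intro π hπ
    obtain ⟨m, hm, rfl⟩ := mem_image.1 hπ
    simp only [α]
    rw [hnorm m hm, abs_mul]
    exact mul_le_one₀ (ha m hm) (abs_nonneg _) (jac_abs _ _)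
  set Zall := B.biUnion fset with hZall
  set Z := Zall.filter (fun z => IsCoprime z.re z.im) with hZdef
  have hdisj : ∀ x ∈ B, ∀ y ∈ B, x ≠ y → Disjoint (fset x) (fset y) := by
    intro x _ y _ hxy
    rw [disjoint_left]
    intro w h1 h2
    have e1 := (mem_fset.1 h1).1
    have e2 := (mem_fset.1 h2).1
    rw [e1] at e2
    exact hxy (by exact_mod_cast e2)
  -- bound each inner sum
  have hin : ∀ n ∈ B, ∀ z ∈ fset n, |∑ m ∈ A, a m * b n * ((rho r (cls (s m)) (cls z) : ℝ) *
      ((J((s m).im | (s m).re.natAbs) : ℝ) * J(z.im | z.re.natAbs) * J((s m * z).re | z.norm.natAbs)))| ≤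
      if IsCoprime z.re z.im then β * ∑ c ∈ Cls, |∑ π ∈ P.filter (fun π => cls π = c), α π * (J((π * z).re | z.norm.natAbs) : ℝ)| else 0 := by
    intro n hn z hz
    obtain ⟨hz1, hz2⟩ := mem_fset.1 hz
    have hzre := hz2.sq.2
    split_ifs with hc
    · have e : ∑ m ∈ A, a m * b n * ((rho r (cls (s m)) (cls z) : ℝ) *
        ((J((s m).im | (s m).re.natAbs) : ℝ) * J(z.im | z.re.natAbs) * J((s m * z).re | z.norm.natAbs))) =
        b n * J(z.im | z.re.natAbs) * ∑ c ∈ Cls, (rho r c (cls z) : ℝ) * ∑ π ∈ P.filter (fun π => cls π = c), α π * (J((π * z).re | z.norm.natAbs) : ℝ) := by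
        rw [hPsum (fun m π => a m * b n * ((rho r (cls π) (cls z) : ℝ) *
          ((J(π.im | π.re.natAbs) : ℝ) * J(z.im | z.re.natAbs) * J((π * z).re | z.norm.natAbs))))]
        rw [← sum_fiberwise_of_maps_to (s := P) (t := Cls) (g := cls) (fun π _ => cls_mem π), mul_sum]
        refine sum_congr rfl fun c _ => ?_
        rw [mul_sum, mul_sum]
        refine sum_congr rfl fun π hπ => ?_
        rw [(mem_filter.1 hπ).2]
        simp only [α]; ring
      rw [e, abs_mul, abs_mul]
      have h1 : |b n| * |(J(z.im | z.re.natAbs) : ℝ)| ≤ β := by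
        calc _ ≤ β * 1 := mul_le_mul (hb n hn) (jac_abs _ _) (abs_nonneg _) hβ
          _ = β := mul_one _
      refine mul_le_mul h1 ?_ (abs_nonneg _) hβ
      refine (abs_sum_le_sum_abs _ _).trans (sum_le_sum fun c _ => ?_)
      rw [abs_mul]
      refine mul_le_of_le_one_left (abs_nonneg _) ?_
      have := rho_abs r c (cls z)
      exact_mod_cast this
    · have hJ : J(z.im | z.re.natAbs) = 0 := by
        obtain ⟨l, hl, h1, h2⟩ := exists_prime_of_not_coprime hc
        exact jac_zero hl (by omega) h2 (by rw [Int.dvd_natAbs]; exact h1)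
      rw [sum_eq_zero, abs_zero]
      intro m _
      rw [hJ]; simp
  refine (abs_sum_le_sum_abs _ _).trans ?_
  have s1 : ∑ n ∈ B, |∑ z ∈ fset n, ∑ m ∈ A, a m * b n * ((rho r (cls (s m)) (cls z) : ℝ) *
      ((J((s m).im | (s m).re.natAbs) : ℝ) * J(z.im | z.re.natAbs) * J((s m * z).re | z.norm.natAbs)))| ≤
      ∑ n ∈ B, ∑ z ∈ fset n, if IsCoprime z.re z.im then β * ∑ c ∈ Cls, |∑ π ∈ P.filter (fun π => cls π = c), α π * (J((π * z).re | z.norm.natAbs) : ℝ)| else 0 := by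
    refine sum_le_sum fun n hn => (abs_sum_le_sum_abs _ _).trans (sum_le_sum fun z hz => hin n hn z hz)
  refine s1.trans ?_
  rw [← sum_biUnion hdisj, ← hZall, ← sum_filter, ← hZdef, ← mul_sum, sum_comm]
  refine mul_le_mul_of_nonneg_left ?_ hβ
  have hZcard : Z.card ≤ N * T := by
    refine (card_filter_le _ _).trans (card_biUnion_le.trans ?_)
    calc ∑ n ∈ B, (fset n).card ≤ ∑ n ∈ B, T := sum_le_sum fun n hn => hT n (hB n hn).2 (hB n hn).1
      _ = B.card * T := by rw [sum_const, smul_eq_mul]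
      _ ≤ N * T := by
        refine Nat.mul_le_mul_right _ ?_
        have : B ⊆ Icc 1 N := fun n hn => by have := hB n hn; rw [mem_Icc]; omega
        simpa using card_le_card this
  have hPcard : ∀ c, (P.filter (fun π => cls π = c)).card ≤ M := by
    intro c
    refine (card_filter_le _ _).trans (card_image_le.trans ?_)
    have : A ⊆ Icc 1 M := fun m hm => by have := hA m hm; rw [mem_Icc]; exact ⟨this.1.pos, this.2.1⟩
    simpa using card_le_card this
  have hc : ∀ c ∈ Cls, ∑ z ∈ Z, |∑ π ∈ P.filter (fun π => cls π = c), α π * (J((π * z).re | z.norm.natAbs) : ℝ)| ≤ Q := by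
    intro c _
    refine le_of_pow_le_pow_left₀ (n := 4 * (k + 1)) (by omega) hQ0 ?_
    refine (bilin M N T k (P.filter (fun π => cls π = c)) Z ?_ ?_ hT α (fun π hπ => hα π (mem_filter.1 hπ).1)).trans (le_trans ?_ hQ)
    · intro π hπ
      obtain ⟨m, hm, rfl⟩ := mem_image.1 (mem_filter.1 hπ).1
      obtain ⟨h1, h2, h3⟩ := hA m hm
      obtain ⟨h4, h5⟩ := mem_fset.1 h3
      exact ⟨h5, m, h1, h4, h2⟩
    · intro z hz
      rw [hZdef, mem_filter, hZall, mem_biUnion] at hz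
      obtain ⟨⟨n, hn, hzn⟩, hcop⟩ := hz
      obtain ⟨h4, h5⟩ := mem_fset.1 hzn
      exact ⟨h5, hcop, n, h4, (hB n hn).1, (hB n hn).2⟩
    · unfold RB
      have e1 : (Z.card : ℝ) ≤ ((N * T : ℕ) : ℝ) := by exact_mod_cast hZcard
      have e2 : ((P.filter (fun π => cls π = c)).card : ℝ) ≤ M := by exact_mod_cast hPcard c
      gcongr
  calc _ ≤ ∑ c ∈ Cls, Q := sum_le_sum hc
    _ = 512 * Q := by
        rw [sum_const, nsmul_eq_mul]
        have : Cls.card = 512 := by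
          unfold Cls; rw [card_product, card_product]; simp
        rw [this]; norm_num

theorem cell {r : ℕ} (hr : r % 16 = 15) {k M N T : ℕ} {β Q V : ℝ} {A B : Finset ℕ} {s : ℕ → ℤ√2} (hV : 0 < V)
    (hA : ∀ m ∈ A, m.Prime ∧ V < m ∧ m ≤ M ∧ s m ∈ fset m) (hB : ∀ n ∈ B, n % 2 = 1 ∧ n ≤ N)
    (hT : ∀ n ≤ N, n % 2 = 1 → (fset n).card ≤ T) {a b : ℕ → ℝ} (ha : ∀ m ∈ A, |a m| ≤ 1) (hb : ∀ n ∈ B, |b n| ≤ β)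
    (hβ : 0 ≤ β) (hQ0 : 0 ≤ Q) (hQ : RB k M N T ≤ Q ^ (4 * (k + 1))) :
    |∑ m ∈ A, ∑ n ∈ B, a m * b n * (if m ∣ n then 0 else ∑ z ∈ fset n, Gs r (s m * z))| ≤ β * (512 * Q) + M * (N / V * (β * T)) := by
  let h : ℕ → ℤ√2 → ℝ := fun m z => (rho r (cls (s m)) (cls z) : ℝ) *
      ((J((s m).im | (s m).re.natAbs) : ℝ) * J(z.im | z.re.natAbs) * J((s m * z).re | z.norm.natAbs))
  have hh : ∀ m z, |h m z| ≤ 1 := by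
    intro m z
    simp only [h, abs_mul]
    have := rho_abs r (cls (s m)) (cls z)
    refine mul_le_one₀ (by exact_mod_cast this) (by positivity) ?_
    exact mul_le_one₀ (mul_le_one₀ (jac_abs _ _) (abs_nonneg _) (jac_abs _ _)) (abs_nonneg _) (jac_abs _ _)
  have main := cell_main (r := r) (fun m hm => ⟨(hA m hm).1, (hA m hm).2.2⟩) hB hT ha hb hβ hQ0 hQ
  have e1 : ∀ m ∈ A, ∀ n ∈ B, a m * b n * (if m ∣ n then 0 else ∑ z ∈ fset n, Gs r (s m * z)) =
      (∑ z ∈ fset n, a m * b n * h m z) - (if m ∣ n then a m * b n * ∑ z ∈ fset n, h m z else 0) := by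
    intro m hm n hn
    split_ifs with hd
    · rw [mul_sum]; simp
    · rw [mul_sum, sub_zero]
      refine sum_congr rfl fun z hz => ?_
      congr 1
      obtain ⟨h1, h2, h3, h4⟩ := hA m hm
      obtain ⟨h5, h6⟩ := mem_fset.1 h4
      obtain ⟨h7, h8⟩ := mem_fset.1 hz
      have hcop : IsCoprime (s m).norm z.norm := by
        rw [h5, h7, Nat.isCoprime_iff_coprime]
        exact (Nat.Prime.coprime_iff_not_dvd h1).2 hd
      have := sym_mul_rho hr h6 h8 hcop
      unfold Gs
      rw [Zsqrtd.norm_mul]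
      simp only [h]
      rw [← Int.cast_mul, ← Int.cast_mul, ← Int.cast_mul, ← this]
      split_ifs <;> simp
  rw [sum_congr rfl fun m hm => sum_congr rfl fun n hn => e1 m hm n hn]
  simp_rw [sum_sub_distrib]
  have e2 : ∑ m ∈ A, ∑ n ∈ B, ∑ z ∈ fset n, a m * b n * h m z = ∑ n ∈ B, ∑ z ∈ fset n, ∑ m ∈ A, a m * b n * h m z := by
    rw [sum_comm]
    exact sum_congr rfl fun n _ => sum_comm
  rw [e2]
  refine (abs_sub _ _).trans (add_le_add main ?_)
  refine (abs_sum_le_sum_abs _ _).trans ?_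
  have hAc : (A.card : ℝ) ≤ M := by
    have : A ⊆ Icc 1 M := fun m hm => by have := hA m hm; rw [mem_Icc]; exact ⟨this.1.pos, this.2.2.1⟩
    have := card_le_card this
    rw [Nat.card_Icc] at this
    exact_mod_cast (by omega : A.card ≤ M)
  calc _ ≤ ∑ m ∈ A, (N / V * (β * T)) := by
        refine sum_le_sum fun m hm => ?_
        obtain ⟨h1, h2, h3, h4⟩ := hA m hm
        rw [← sum_filter]
        refine (abs_sum_le_sum_abs _ _).trans ?_
        calc _ ≤ ∑ n ∈ B.filter (fun n => m ∣ n), β * T := by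
              refine sum_le_sum fun n hn => ?_
              rw [mem_filter] at hn
              rw [abs_mul, abs_mul]
              have : |∑ z ∈ fset n, h m z| ≤ T := by
                refine (abs_sum_le_sum_abs _ _).trans ?_
                calc _ ≤ ∑ z ∈ fset n, (1 : ℝ) := sum_le_sum fun z _ => hh m z
                  _ = ((fset n).card : ℝ) := by simp
                  _ ≤ T := by exact_mod_cast hT n (hB n hn.1).2 (hB n hn.1).1
              have h5 : |a m| * |b n| ≤ β := by
                calc _ ≤ 1 * β := mul_le_mul (ha m hm) (hb n hn.1) (abs_nonneg _) zero_le_one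
                  _ = β := one_mul _
              exact mul_le_mul h5 this (abs_nonneg _) hβ
          _ = ((B.filter (fun n => m ∣ n)).card : ℝ) * (β * T) := by rw [sum_const, nsmul_eq_mul]
          _ ≤ _ := by
              refine mul_le_mul_of_nonneg_right ?_ (by positivity)
              have hsub : B.filter (fun n => m ∣ n) ⊆ (Ioc 0 N).filter (fun n => m ∣ n) := by
                intro n hn
                rw [mem_filter] at hn ⊢
                have := hB n hn.1
                exact ⟨mem_Ioc.2 (by omega), hn.2⟩
              have h6 := card_le_card hsub
              rw [Nat.Ioc_filter_dvd_card_eq_div] at h6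
              calc ((B.filter (fun n => m ∣ n)).card : ℝ) ≤ ((N / m : ℕ) : ℝ) := by exact_mod_cast h6
                _ ≤ (N : ℝ) / m := Nat.cast_div_le
                _ ≤ N / V := by gcongr
    _ = A.card * (N / V * (β * T)) := by rw [sum_const, nsmul_eq_mul]
    _ ≤ _ := by gcongr

end QB

end

section

open scoped NumberTheorySymbols
open Finset

namespace QB

theorem RB_bound (k : ℕ) {δ : ℝ} (hδ : 0 < δ) (hδ1 : δ ≤ 1) (hk : 3 ≤ δ * (k + 1)) :
    ∃ C : ℝ, 1 ≤ C ∧ ∀ (X : ℝ) (M N T : ℕ), 1 ≤ X → X ^ δ ≤ M → X ^ δ ≤ N → (N : ℝ) ≤ X →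
      RB k M N T ≤ (C * (N * M * T) * X ^ (-(δ / (8 * (k + 1))))) ^ (4 * (k + 1)) := by
  set D : ℝ := (((2 * (k + 1)) ^ (2 * (k + 1)) : ℕ) : ℝ) * (9 * 64 ^ (k + 1) + 6 * 8 ^ (k + 1)) with hD
  have hD0 : 0 ≤ D := by positivity
  refine ⟨1 + D, by linarith, ?_⟩
  intro X M N T hX hM hN hNX
  have hX0 : 0 < X := by linarith
  have hXd : 1 ≤ X ^ δ := Real.one_le_rpow hX hδ.le
  have hM1 : (1 : ℝ) ≤ M := by linarith
  have hN1 : (1 : ℝ) ≤ N := by linarith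
  have hM0 : (0 : ℝ) < M := by linarith
  have hN0 : (0 : ℝ) < N := by linarith
  -- sizes
  have hL : ((2 * (8 * M) ^ (k + 1) + 1 : ℕ) : ℝ) ≤ 3 * (8 ^ (k + 1) * (M : ℝ) ^ (k + 1)) := by
    push_cast
    rw [mul_pow]
    have : (1 : ℝ) ≤ 8 ^ (k + 1) * (M : ℝ) ^ (k + 1) :=
      one_le_mul_of_one_le_of_one_le (one_le_pow₀ (by norm_num)) (one_le_pow₀ hM1)
    linarith
  set E : ℝ := X ^ (-(δ / 2)) with hE
  have hE0 : 0 < E := Real.rpow_pos_of_pos hX0 _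
  have hs : (Nat.sqrt N : ℝ) ≤ N * E := by
    have h1 : (Nat.sqrt N : ℝ) ≤ √(N : ℝ) := Real.nat_sqrt_le_real_sqrt
    refine h1.trans ?_
    have h2 : (1 : ℝ) ≤ √(N : ℝ) * E := by
      rw [Real.sqrt_eq_rpow]
      have : (X ^ δ) ^ ((1 : ℝ) / 2) ≤ (N : ℝ) ^ ((1 : ℝ) / 2) := Real.rpow_le_rpow (by positivity) hN (by norm_num)
      calc (1 : ℝ) = (X ^ δ) ^ ((1 : ℝ) / 2) * E := by
            rw [hE, ← Real.rpow_mul hX0.le, ← Real.rpow_add hX0]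
            rw [show δ * (1 / 2) + -(δ / 2) = 0 by ring, Real.rpow_zero]
        _ ≤ _ := by gcongr
    calc √(N : ℝ) = √(N : ℝ) * 1 := by ring
      _ ≤ √(N : ℝ) * (√(N : ℝ) * E) := by gcongr
      _ = N * E := by rw [← mul_assoc, Real.mul_self_sqrt hN0.le]
  have hn : (N : ℝ) ^ 2 ≤ (M : ℝ) ^ (k + 1) * E := by
    have h1 : (X ^ δ) ^ (k + 1) ≤ (M : ℝ) ^ (k + 1) := by gcongr
    have h2 : X ^ (3 : ℝ) ≤ (X ^ δ) ^ (k + 1) := by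
      rw [← Real.rpow_natCast, ← Real.rpow_mul hX0.le]
      apply Real.rpow_le_rpow_of_exponent_le hX
      push_cast; exact hk
    calc (N : ℝ) ^ 2 ≤ X ^ 2 := by gcongr
      _ = X ^ (2 : ℝ) := by norm_cast
      _ ≤ X ^ (3 + -(δ / 2)) := Real.rpow_le_rpow_of_exponent_le hX (by linarith)
      _ = X ^ (3 : ℝ) * E := by rw [Real.rpow_add hX0]
      _ ≤ _ := by gcongr; exact h2.trans h1
  have key : RB k M N T ≤ (((N * T : ℕ) : ℝ) * M) ^ (4 * (k + 1)) * (D * E) := by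
    unfold RB
    have hA : ((N * T : ℕ) : ℝ) * (Nat.sqrt N * T * ((2 * (8 * M) ^ (k + 1) + 1 : ℕ) : ℝ) ^ 2) ≤
        ((N * T : ℕ) : ℝ) ^ 2 * ((M : ℝ) ^ (2 * (k + 1)) * (9 * 64 ^ (k + 1) * E)) := by
      calc _ ≤ ((N * T : ℕ) : ℝ) * (N * E * T * (3 * (8 ^ (k + 1) * (M : ℝ) ^ (k + 1))) ^ 2) := by gcongr
        _ = _ := by
          push_cast
          rw [show (64 : ℝ) = 8 ^ 2 by norm_num, ← pow_mul]
          ring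
    have hB : ((N * T : ℕ) : ℝ) ^ 2 * (2 * (N : ℝ) ^ 2 * ((2 * (8 * M) ^ (k + 1) + 1 : ℕ) : ℝ)) ≤
        ((N * T : ℕ) : ℝ) ^ 2 * ((M : ℝ) ^ (2 * (k + 1)) * (6 * 8 ^ (k + 1) * E)) := by
      calc _ ≤ ((N * T : ℕ) : ℝ) ^ 2 * (2 * ((M : ℝ) ^ (k + 1) * E) * (3 * (8 ^ (k + 1) * (M : ℝ) ^ (k + 1)))) := by gcongr
        _ = _ := by ring
    calc _ ≤ ((N * T : ℕ) : ℝ) ^ (2 * (2 * k + 1)) * ((M : ℝ) ^ (2 * (k + 1)) * ((((2 * (k + 1)) ^ (2 * (k + 1)) : ℕ) : ℝ) *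
          (((N * T : ℕ) : ℝ) ^ 2 * ((M : ℝ) ^ (2 * (k + 1)) * (9 * 64 ^ (k + 1) * E)) +
          ((N * T : ℕ) : ℝ) ^ 2 * ((M : ℝ) ^ (2 * (k + 1)) * (6 * 8 ^ (k + 1) * E))))) := by gcongr
      _ = _ := by rw [hD]; ring
  refine key.trans ?_
  have e1 : (X ^ (-(δ / (8 * (k + 1))))) ^ (4 * (k + 1)) = E := by
    rw [← Real.rpow_natCast, ← Real.rpow_mul hX0.le, hE]
    congr 1
    push_cast; field_simp; ring
  have e3 : ((1 + D) * (N * M * T) * X ^ (-(δ / (8 * (k + 1))))) ^ (4 * (k + 1)) =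
      (1 + D) ^ (4 * (k + 1)) * (((N * T : ℕ) : ℝ) * M) ^ (4 * (k + 1)) * E := by
    rw [mul_pow, mul_pow, e1]
    congr 3; push_cast; ring
  rw [e3]
  have e2 : D ≤ (1 + D) ^ (4 * (k + 1)) :=
    (by linarith : D ≤ 1 + D).trans (le_self_pow₀ (by linarith) (by omega))
  calc _ = D * (((N * T : ℕ) : ℝ) * M) ^ (4 * (k + 1)) * E := by ring
    _ ≤ (1 + D) ^ (4 * (k + 1)) * (((N * T : ℕ) : ℝ) * M) ^ (4 * (k + 1)) * E := by gcongr

theorem star_mem_fset {m : ℕ} {π : ℤ√2} (h : π ∈ fset m) : star π ∈ fset m := by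
  obtain ⟨h1, h2⟩ := mem_fset.1 h
  exact mem_fset.2 ⟨by rw [Zsqrtd.norm_conj, h1], h2.star⟩

/-- Rectangular bilinear estimate. -/
theorem cell2 {r : ℕ} (hr : r % 16 = 15) {δ : ℝ} (hδ : 0 < δ) (hδ1 : δ ≤ 1) :
    ∃ C ε : ℝ, 1 ≤ C ∧ 0 < ε ∧ ε ≤ δ ∧ ∀ (X : ℝ) (M N T : ℕ) (β : ℝ) (A B : Finset ℕ) (a b : ℕ → ℝ),
      1 ≤ X → X ^ δ ≤ M → X ^ δ ≤ N → (N : ℝ) ≤ X → 0 ≤ β →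
      (∀ m ∈ A, m.Prime ∧ X ^ δ < m ∧ m ≤ M) → (∀ n ∈ B, n ≤ N) →
      (∀ n ≤ N, n % 2 = 1 → (fset n).card ≤ T) → (∀ m ∈ A, |a m| ≤ 1) → (∀ n ∈ B, |b n| ≤ β) →
      |∑ m ∈ A, ∑ n ∈ B, a m * b n * (if m ∣ n then 0 else F r (m * n))| ≤ C * β * T * (M * N) * X ^ (-ε) := by
  classical
  obtain ⟨k, hk⟩ := exists_nat_gt (3 / δ)
  have hk' : 3 ≤ δ * (k + 1) := by
    rw [div_lt_iff₀ hδ] at hk; nlinarith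
  obtain ⟨C, hC, H⟩ := RB_bound k hδ hδ1 hk'
  refine ⟨2 * (512 * C + 1), δ / (8 * (k + 1)), by linarith, by positivity, ?_, ?_⟩
  · apply div_le_self hδ.le
    have : (0 : ℝ) ≤ k := by positivity
    linarith
  intro X M N T β A B a b hX hM hN hNX hβ hA hB hT ha hb
  set Q : ℝ := C * (N * M * T) * X ^ (-(δ / (8 * (k + 1)))) with hQ
  have hX0 : 0 < X := by linarith
  have hQ0 : 0 ≤ Q := by positivity
  have hRB := H X M N T hX hM hN hNX
  set A' := A.filter (fun m => (fset m).Nonempty) with hA'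
  set B' := B.filter (fun n => n % 2 = 1) with hB'
  have hch : ∀ m, ∃ w : ℤ√2, (fset m).Nonempty → w ∈ fset m := by
    intro m
    by_cases h : (fset m).Nonempty
    · exact ⟨h.choose, fun _ => h.choose_spec⟩
    · exact ⟨0, fun h' => absurd h' h⟩
  choose s hs using hch
  have e0 : ∀ m ∈ A, m ∉ A' → ∑ n ∈ B, a m * b n * (if m ∣ n then 0 else F r (m * n)) = 0 := by
    intro m hm hm'
    have he : fset m = ∅ := by
      by_contra h
      exact hm' (mem_filter.2 ⟨hm, nonempty_iff_ne_empty.2 h⟩)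
    refine sum_eq_zero fun n _ => ?_
    split_ifs with hd
    · simp
    · rw [F_mul_zero hr (hA m hm).1 hd he, mul_zero]
  have e1 : ∀ m ∈ A', ∑ n ∈ B, a m * b n * (if m ∣ n then 0 else F r (m * n)) =
      ∑ n ∈ B', a m * b n * (if m ∣ n then 0 else ∑ z ∈ fset n, Gs r (s m * z)) +
      ∑ n ∈ B', a m * b n * (if m ∣ n then 0 else ∑ z ∈ fset n, Gs r (star (s m) * z)) := by
    intro m hm
    obtain ⟨hmA, hne⟩ := mem_filter.1 hm
    rw [← sum_add_distrib]
    rw [← sum_subset (filter_subset (fun n => n % 2 = 1) B)]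
    · refine sum_congr rfl fun n hn => ?_
      split_ifs with hd
      · simp
      · rw [F_mul hr (hA m hmA).1 hd (hs m hne)]; ring
    · intro n hn hn'
      have : n % 2 = 0 := by
        by_contra h
        exact hn' (mem_filter.2 ⟨hn, by omega⟩)
      rw [F_eq_zero_of_even hr (by rw [Nat.mul_mod, this]; simp)]
      simp
  rw [← sum_subset (filter_subset (fun m => (fset m).Nonempty) A) e0, sum_congr rfl e1, sum_add_distrib]
  have hXd : 0 < X ^ δ := by positivity
  have hAs : ∀ m ∈ A', m.Prime ∧ X ^ δ < m ∧ m ≤ M ∧ s m ∈ fset m := fun m hm =>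
    ⟨(hA m (mem_filter.1 hm).1).1, (hA m (mem_filter.1 hm).1).2.1, (hA m (mem_filter.1 hm).1).2.2, hs m (mem_filter.1 hm).2⟩
  have hBs : ∀ n ∈ B', n % 2 = 1 ∧ n ≤ N := fun n hn => ⟨(mem_filter.1 hn).2, hB n (mem_filter.1 hn).1⟩
  have c1 := cell hr hXd hAs hBs hT (a := a) (b := b) (fun m hm => ha m (mem_filter.1 hm).1)
    (fun n hn => hb n (mem_filter.1 hn).1) hβ hQ0 hRB
  have c2 := cell hr (s := fun m => star (s m)) hXd
    (fun m hm => ⟨(hAs m hm).1, (hAs m hm).2.1, (hAs m hm).2.2.1, star_mem_fset (hAs m hm).2.2.2⟩) hBs hT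
    (a := a) (b := b) (fun m hm => ha m (mem_filter.1 hm).1)
    (fun n hn => hb n (mem_filter.1 hn).1) hβ hQ0 hRB
  refine (abs_add_le _ _).trans ((add_le_add c1 c2).trans ?_)
  have hV : (M : ℝ) * (N / X ^ δ * (β * T)) ≤ β * T * (M * N) * X ^ (-(δ / (8 * (k + 1)))) := by
    have : (X ^ δ)⁻¹ ≤ X ^ (-(δ / (8 * (k + 1)))) := by
      rw [← Real.rpow_neg hX0.le]
      apply Real.rpow_le_rpow_of_exponent_le hX
      have : (0 : ℝ) ≤ k := by positivity
      have := div_le_self hδ.le (show (1 : ℝ) ≤ 8 * (k + 1) by linarith)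
      linarith
    calc _ = β * T * (M * N) * (X ^ δ)⁻¹ := by rw [div_eq_mul_inv]; ring
      _ ≤ _ := by gcongr
  rw [hQ]
  calc _ ≤ 2 * (β * (512 * (C * (N * M * T) * X ^ (-(δ / (8 * (k + 1))))))) + 2 * (β * T * (M * N) * X ^ (-(δ / (8 * (k + 1))))) := by linarith
    _ = _ := by ring

end QB

end

section

open scoped NumberTheorySymbols
open Finset

namespace QB

theorem F_le {r : ℕ} (hr : r % 16 = 15) {X T : ℕ} (hT : ∀ n ≤ X, n % 2 = 1 → (fset n).card ≤ T) {w : ℕ} (hw : w ≤ X) :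
    |F r w| ≤ T := by
  rcases Nat.mod_two_eq_zero_or_one w with h | h
  · rw [F_eq_zero_of_even hr h]; simp
  · exact (F_abs r w).trans (by exact_mod_cast hT w hw h)

/-- Pairs whose product lies in a given set of integers. -/
theorem pairs_card {P : Finset (ℕ × ℕ)} {S : Finset ℕ} {T : ℕ} (hP : ∀ x ∈ P, x.1 * x.2 ∈ S)
    (hS : ∀ w ∈ S, 1 ≤ w ∧ w.divisors.card ≤ T) : P.card ≤ S.card * T := by
  classical
  have : P ⊆ S.biUnion (fun w => w.divisorsAntidiagonal) := by
    intro x hx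
    rw [mem_biUnion]
    refine ⟨_, hP x hx, ?_⟩
    rw [Nat.mem_divisorsAntidiagonal]
    exact ⟨rfl, by have := (hS _ (hP x hx)).1; omega⟩
  refine (card_le_card this).trans (card_biUnion_le.trans ?_)
  calc _ ≤ ∑ w ∈ S, T := sum_le_sum fun w hw => by
        rw [← Nat.map_div_right_divisors, card_map]; exact (hS w hw).2
    _ = _ := by simp

theorem hyper {r : ℕ} (hr : r % 16 = 15) {δ : ℝ} (hδ : 0 < δ) (hδ1 : δ ≤ 1) :
    ∃ C ε : ℝ, 1 ≤ C ∧ 0 < ε ∧ ∀ (X T : ℕ) (β : ℝ) (A : Finset ℕ) (a b : ℕ → ℝ), 1 ≤ X → 0 ≤ β →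
      (∀ m ∈ A, m.Prime ∧ (X : ℝ) ^ δ < m ∧ m ≤ X) →
      (∀ n ≤ X, n % 2 = 1 → (fset n).card ≤ T) → (∀ n ≤ X, n.divisors.card ≤ T) →
      (∀ m ∈ A, |a m| ≤ 1) → (∀ n ≤ X, |b n| ≤ β) → (∀ n : ℕ, (n : ℝ) < (X : ℝ) ^ δ → b n = 0) →
      |∑ m ∈ A, ∑ n ∈ Icc 1 X, if m * n ≤ X then a m * b n * (if m ∣ n then 0 else F r (m * n)) else 0| ≤
        C * β * T ^ 2 * (X : ℝ) ^ (1 - ε) := by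
  classical
  obtain ⟨C, ε, hC, hε, hεδ, H⟩ := cell2 hr hδ hδ1
  refine ⟨C * (4 / ε + 1) + 2, ε / 4, ?_, by positivity, ?_⟩
  · have : 0 ≤ C * (4 / ε + 1) := by positivity
    linarith
  intro X T β A a b hX hβ hA hT hT2 ha hb hb0
  have hXr : (1 : ℝ) ≤ X := by exact_mod_cast hX
  have hX0 : (0 : ℝ) < X := by linarith
  have hT1 : (1 : ℝ) ≤ T := by
    have := hT2 1 hX
    simp at this
    exact_mod_cast this
  set K : ℝ := (X : ℝ) ^ (ε / 2) with hK
  have hK1 : 1 ≤ K := Real.one_le_rpow hXr (by positivity)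
  have hK0 : 0 < K := by linarith
  let j : ℕ → ℕ := fun m => ⌊K * Real.log m⌋₊
  let Mj : ℕ → ℕ := fun i => ⌊Real.exp ((i + 1) / K)⌋₊
  let Nj : ℕ → ℕ := fun i => ⌊X * Real.exp (-((i + 1) / K))⌋₊
  set t : ℕ → ℕ → ℝ := fun m n => a m * b n * (if m ∣ n then 0 else F r (m * n)) with ht
  -- facts about cells
  have hj1 : ∀ m : ℕ, 1 ≤ m → Real.exp (j m / K) ≤ m := by
    intro m hm
    have hm' : (1 : ℝ) ≤ m := by exact_mod_cast hm
    have h1 : (j m : ℝ) ≤ K * Real.log m := Nat.floor_le (mul_nonneg hK0.le (Real.log_nonneg hm'))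
    rw [← Real.le_log_iff_exp_le (by linarith), div_le_iff₀ hK0]
    linarith
  have hj2 : ∀ m : ℕ, 1 ≤ m → (m : ℝ) < Real.exp ((j m + 1) / K) := by
    intro m hm
    have hm' : (1 : ℝ) ≤ m := by exact_mod_cast hm
    have h1 : K * Real.log m < j m + 1 := Nat.lt_floor_add_one _
    rw [← Real.log_lt_iff_lt_exp (by linarith), lt_div_iff₀ hK0]
    linarith
  have hMN : ∀ i, (Mj i : ℝ) * Nj i ≤ X := by
    intro i
    have h1 : (Mj i : ℝ) ≤ Real.exp ((i + 1) / K) := Nat.floor_le (Real.exp_pos _).le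
    have h2 : (Nj i : ℝ) ≤ X * Real.exp (-((i + 1) / K)) := Nat.floor_le (by positivity)
    calc (Mj i : ℝ) * Nj i ≤ Real.exp ((i + 1) / K) * (X * Real.exp (-((i + 1) / K))) := by gcongr
      _ = X * (Real.exp ((i + 1) / K) * Real.exp (-((i + 1) / K))) := by ring
      _ = X := by rw [← Real.exp_add]; simp
  have hmM : ∀ m : ℕ, 1 ≤ m → m ≤ Mj (j m) := fun m hm => Nat.le_floor (hj2 m hm).le
  have hNX : ∀ i, Nj i ≤ X := by
    intro i
    refine Nat.floor_le_of_le ?_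
    have : Real.exp (-(((i : ℝ) + 1) / K)) ≤ 1 := by
      rw [Real.exp_le_one_iff]
      have : 0 ≤ ((i : ℝ) + 1) / K := by positivity
      linarith
    nlinarith
  have hA1 : ∀ m ∈ A, 1 ≤ m := fun m hm => (hA m hm).1.one_lt.le
  -- splitting
  have split : ∀ m ∈ A, (∑ n ∈ Icc 1 X, if m * n ≤ X then t m n else 0) =
      ∑ n ∈ Icc 1 (Nj (j m)), t m n + ∑ n ∈ Icc 1 X, if m * n ≤ X ∧ Nj (j m) < n then t m n else 0 := by
    intro m hm
    have e : ∑ n ∈ Icc 1 (Nj (j m)), t m n = ∑ n ∈ Icc 1 X, if n ≤ Nj (j m) then t m n else 0 := by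
      rw [← sum_filter]
      refine sum_congr ?_ fun _ _ => rfl
      ext n
      rw [mem_filter, mem_Icc, mem_Icc]
      have := hNX (j m)
      constructor
      · rintro ⟨h1, h2⟩; exact ⟨⟨h1, h2.trans this⟩, h2⟩
      · rintro ⟨⟨h1, _⟩, h2⟩; exact ⟨h1, h2⟩
    rw [e, ← sum_add_distrib]
    refine sum_congr rfl fun n hn => ?_
    by_cases h : n ≤ Nj (j m)
    · have h2 : m * n ≤ X := by
        have h3 := hMN (j m)
        have h4 := hmM m (hA1 m hm)
        have h5 : m * n ≤ Mj (j m) * Nj (j m) := Nat.mul_le_mul h4 h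
        have h6 : Mj (j m) * Nj (j m) ≤ X := by exact_mod_cast h3
        exact h5.trans h6
      rw [if_pos h2, if_pos h, if_neg (by omega), add_zero]
    · have h' : Nj (j m) < n := by omega
      rw [if_neg h]
      simp only [h', and_true, zero_add]
  rw [sum_congr rfl split, sum_add_distrib]
  -- main part
  set J : ℕ := ⌊K * Real.log X⌋₊ + 1 with hJ
  have hjJ : ∀ m ∈ A, j m ∈ range J := by
    intro m hm
    rw [mem_range, hJ, Nat.lt_succ_iff]
    apply Nat.floor_le_floor
    have := hA1 m hm
    have h2 := (hA m hm).2.2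
    have : (1 : ℝ) ≤ m := by exact_mod_cast this
    gcongr
  have main : |∑ m ∈ A, ∑ n ∈ Icc 1 (Nj (j m)), t m n| ≤ J * (C * β * T * X * (X : ℝ) ^ (-ε)) := by
    rw [← sum_fiberwise_of_maps_to hjJ]
    refine (abs_sum_le_sum_abs _ _).trans ?_
    have : ∀ i ∈ range J, |∑ m ∈ A.filter (fun m => j m = i), ∑ n ∈ Icc 1 (Nj (j m)), t m n| ≤ C * β * T * X * (X : ℝ) ^ (-ε) := by
      intro i _
      have e : ∑ m ∈ A.filter (fun m => j m = i), ∑ n ∈ Icc 1 (Nj (j m)), t m n =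
          ∑ m ∈ A.filter (fun m => j m = i), ∑ n ∈ Icc 1 (Nj i), t m n :=
        sum_congr rfl fun m hm => by rw [(mem_filter.1 hm).2]
      rw [e]
      rcases (A.filter (fun m => j m = i)).eq_empty_or_nonempty with he | ⟨m₀, hm₀⟩
      · rw [he]; simp; positivity
      obtain ⟨hm₀A, hm₀i⟩ := mem_filter.1 hm₀
      have hMlow : (X : ℝ) ^ δ ≤ Mj i := by
        have h1 := (hA m₀ hm₀A).2.1
        have h2 := hmM m₀ (hA1 m₀ hm₀A)
        rw [hm₀i] at h2
        have : (m₀ : ℝ) ≤ Mj i := by exact_mod_cast h2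
        linarith
      by_cases hN : (X : ℝ) ^ δ ≤ Nj i
      · have := H X (Mj i) (Nj i) T β (A.filter (fun m => j m = i)) (Icc 1 (Nj i)) a b hXr hMlow hN
          (by exact_mod_cast hNX i) hβ (fun m hm => by
            obtain ⟨h1, h2⟩ := mem_filter.1 hm
            refine ⟨(hA m h1).1, (hA m h1).2.1, ?_⟩
            have := hmM m (hA1 m h1); rwa [h2] at this)
          (fun n hn => (mem_Icc.1 hn).2) (fun n hn h => hT n (hn.trans (hNX i)) h) (fun m hm => ha m (mem_filter.1 hm).1)
          (fun n hn => hb n ((mem_Icc.1 hn).2.trans (hNX i)))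
        refine this.trans ?_
        have h2 := hMN i
        gcongr
      · have : ∑ m ∈ A.filter (fun m => j m = i), ∑ n ∈ Icc 1 (Nj i), t m n = 0 := by
          refine sum_eq_zero fun m _ => sum_eq_zero fun n hn => ?_
          rw [ht]; simp only
          rw [hb0 n, mul_zero, zero_mul]
          push Not at hN
          refine lt_of_le_of_lt ?_ hN
          exact_mod_cast (mem_Icc.1 hn).2
        rw [this, abs_zero]; positivity
    refine (sum_le_sum this).trans ?_
    rw [sum_const, card_range, nsmul_eq_mul]
  -- leftover
  set W : ℕ := ⌊X * Real.exp (-(1 / K))⌋₊ with hW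
  set P : Finset (ℕ × ℕ) := (A ×ˢ Icc 1 X).filter (fun x => x.1 * x.2 ≤ X ∧ Nj (j x.1) < x.2) with hP
  have hPc : P.card ≤ (Ioc W X).card * T := by
    apply pairs_card
    · intro x hx
      rw [hP, mem_filter, mem_product] at hx
      obtain ⟨⟨h1, h2⟩, h3, h4⟩ := hx
      rw [mem_Ioc]
      refine ⟨?_, h3⟩
      have h5 : (X : ℝ) * Real.exp (-((j x.1 + 1) / K)) < x.2 := Nat.lt_of_floor_lt h4
      have h6 := hj1 x.1 (hA1 _ h1)
      have h7 : (X : ℝ) * Real.exp (-(1 / K)) < x.1 * x.2 := by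
        calc (X : ℝ) * Real.exp (-(1 / K)) = Real.exp (j x.1 / K) * (X * Real.exp (-((j x.1 + 1) / K))) := by
              rw [mul_left_comm, ← Real.exp_add]
              congr 2; ring
          _ < Real.exp (j x.1 / K) * x.2 := by gcongr
          _ ≤ x.1 * x.2 := by gcongr
      have h8 : (W : ℝ) ≤ X * Real.exp (-(1 / K)) := Nat.floor_le (by positivity)
      have : (W : ℝ) < ((x.1 * x.2 : ℕ) : ℝ) := by push_cast; linarith
      exact_mod_cast this
    · intro w hw
      rw [mem_Ioc] at hw
      exact ⟨by omega, hT2 w hw.2⟩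
  have hIoc : ((Ioc W X).card : ℝ) ≤ X / K + 1 := by
    have hWX : W ≤ X := by
      refine Nat.floor_le_of_le ?_
      have : Real.exp (-(1 / K)) ≤ 1 := by
        rw [Real.exp_le_one_iff]
        have : 0 ≤ 1 / K := by positivity
        linarith
      nlinarith
    rw [Nat.card_Ioc, Nat.cast_sub hWX]
    have h1 : (X : ℝ) * Real.exp (-(1 / K)) < W + 1 := Nat.lt_floor_add_one _
    have h2 : -(1 / K) + 1 ≤ Real.exp (-(1 / K)) := Real.add_one_le_exp _
    have h3 : (X : ℝ) * (-(1 / K) + 1) ≤ X * Real.exp (-(1 / K)) := by gcongr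
    have h4 : (X : ℝ) * (-(1 / K) + 1) = X - X / K := by ring
    linarith
  have left : |∑ m ∈ A, ∑ n ∈ Icc 1 X, if m * n ≤ X ∧ Nj (j m) < n then t m n else 0| ≤ (X / K + 1) * T * (β * T) := by
    rw [← sum_product', ← sum_filter]
    refine (abs_sum_le_sum_abs _ _).trans ?_
    have : ∀ x ∈ P, |t x.1 x.2| ≤ β * T := by
      intro x hx
      rw [hP, mem_filter, mem_product, mem_Icc] at hx
      obtain ⟨⟨h1, h2⟩, h3, h4⟩ := hx
      rw [ht]; simp only
      rw [abs_mul, abs_mul]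
      have e1 := ha _ h1
      have e2 := hb _ h2.2
      have e3 : |if x.1 ∣ x.2 then 0 else F r (x.1 * x.2)| ≤ (T : ℝ) := by
        split_ifs
        · simp
        · exact F_le hr hT h3
      calc _ ≤ 1 * β * T := by gcongr
        _ = _ := by ring
    refine (sum_le_sum this).trans ?_
    rw [sum_const, nsmul_eq_mul]
    have : (P.card : ℝ) ≤ (Ioc W X).card * T := by exact_mod_cast hPc
    have h2 : (P.card : ℝ) ≤ (X / K + 1) * T := this.trans (by gcongr)
    gcongr
  refine (abs_add_le _ _).trans ((add_le_add main left).trans ?_)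
  have hJb : (J : ℝ) ≤ (4 / ε + 1) * (X : ℝ) ^ (3 * ε / 4) := by
    have h1 : (J : ℝ) ≤ K * Real.log X + 1 := by
      rw [hJ]; push_cast
      have := Nat.floor_le (mul_nonneg hK0.le (Real.log_nonneg hXr))
      linarith
    have h2 : Real.log X ≤ (X : ℝ) ^ (ε / 4) / (ε / 4) := Real.log_le_rpow_div hX0.le (by positivity)
    have h3 : K * (X : ℝ) ^ (ε / 4) = (X : ℝ) ^ (3 * ε / 4) := by
      rw [hK, ← Real.rpow_add hX0]; congr 1; ring
    have h4 : 1 ≤ (X : ℝ) ^ (3 * ε / 4) := Real.one_le_rpow hXr (by positivity)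
    calc (J : ℝ) ≤ K * ((X : ℝ) ^ (ε / 4) / (ε / 4)) + 1 := h1.trans (by gcongr)
      _ = 4 / ε * (K * (X : ℝ) ^ (ε / 4)) + 1 := by field_simp
      _ ≤ _ := by rw [h3]; linarith
  have hx1 : (X : ℝ) ^ (3 * ε / 4) * (X * (X : ℝ) ^ (-ε)) = (X : ℝ) ^ (1 - ε / 4) := by
    nth_rw 2 [← Real.rpow_one (X : ℝ)]
    rw [← Real.rpow_add hX0, ← Real.rpow_add hX0]; congr 1; ring
  have hx2 : X / K + 1 ≤ 2 * (X : ℝ) ^ (1 - ε / 4) := by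
    by_cases hε4 : ε / 4 ≤ 1
    · have h1 : X / K ≤ (X : ℝ) ^ (1 - ε / 4) := by
        rw [hK]
        nth_rw 1 [← Real.rpow_one (X : ℝ)]
        rw [← Real.rpow_sub hX0]
        apply Real.rpow_le_rpow_of_exponent_le hXr; linarith
      have h2 : 1 ≤ (X : ℝ) ^ (1 - ε / 4) := Real.one_le_rpow hXr (by linarith)
      linarith
    · linarith
  calc (J : ℝ) * (C * β * T * X * (X : ℝ) ^ (-ε)) + (X / K + 1) * T * (β * T)
      ≤ ((4 / ε + 1) * (X : ℝ) ^ (3 * ε / 4)) * (C * β * T * X * (X : ℝ) ^ (-ε)) + (2 * (X : ℝ) ^ (1 - ε / 4)) * T * (β * T) := by gcongr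
    _ = C * (4 / ε + 1) * β * T * ((X : ℝ) ^ (3 * ε / 4) * (X * (X : ℝ) ^ (-ε))) + 2 * β * T ^ 2 * (X : ℝ) ^ (1 - ε / 4) := by ring
    _ ≤ C * (4 / ε + 1) * β * T ^ 2 * (X : ℝ) ^ (1 - ε / 4) + 2 * β * T ^ 2 * (X : ℝ) ^ (1 - ε / 4) := by
        rw [hx1]
        have : (T : ℝ) ≤ T ^ 2 := by nlinarith
        gcongr
    _ = _ := by ring

end QB

end

section

open scoped NumberTheorySymbols
open Finset

namespace QB

theorem conv_sum (f g : ArithmeticFunction ℝ) (H : ℕ → ℝ) (X : ℕ) :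
    ∑ n ∈ Icc 1 X, (f * g) n * H n =
      ∑ d ∈ Icc 1 X, ∑ k ∈ Icc 1 X, if d * k ≤ X then f d * g k * H (d * k) else 0 := by
  rw [← sum_product', ← sum_filter]
  have hm : ∀ x ∈ (Icc 1 X ×ˢ Icc 1 X).filter (fun x => x.1 * x.2 ≤ X), x.1 * x.2 ∈ Icc 1 X := by
    intro x hx
    rw [mem_filter, mem_product, mem_Icc, mem_Icc] at hx
    rw [mem_Icc]
    exact ⟨Nat.mul_pos hx.1.1.1 hx.1.2.1, hx.2⟩
  rw [← sum_fiberwise_of_maps_to hm]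
  refine sum_congr rfl fun n hn => ?_
  rw [mem_Icc] at hn
  rw [ArithmeticFunction.mul_apply, sum_mul]
  refine sum_congr ?_ ?_
  · ext x
    rw [Nat.mem_divisorsAntidiagonal, mem_filter, mem_filter, mem_product, mem_Icc, mem_Icc]
    constructor
    · rintro ⟨h1, h2⟩
      have h3 : 0 < x.1 := Nat.pos_of_ne_zero (by rintro h; rw [h] at h1; omega)
      have h4 : 0 < x.2 := Nat.pos_of_ne_zero (by rintro h; rw [h] at h1; omega)
      refine ⟨⟨⟨⟨h3, ?_⟩, h4, ?_⟩, by omega⟩, h1⟩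
      · nlinarith
      · nlinarith
    · rintro ⟨_, h⟩
      exact ⟨h, by omega⟩
  · intro x hx
    rw [(mem_filter.1 hx).2]

theorem abel_mono {w g : ℕ → ℝ} {W B : ℝ} {n : ℕ} (hn : 0 < n) (hw : Monotone w) (hw0 : ∀ i, 0 ≤ w i) (hW : ∀ i < n, w i ≤ W)
    (hB : ∀ k ≤ n, |∑ i ∈ range k, g i| ≤ B) : |∑ i ∈ range n, w i * g i| ≤ 2 * (W * B) := by
  have hB0 : 0 ≤ B := (abs_nonneg _).trans (hB 0 (by omega))
  have := sum_range_by_parts w g n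
  simp only [smul_eq_mul] at this
  rw [this]
  refine (abs_sub _ _).trans ?_
  have h1 : |w (n - 1) * ∑ i ∈ range n, g i| ≤ W * B := by
    rw [abs_mul, abs_of_nonneg (hw0 _)]
    exact mul_le_mul (hW _ (by omega)) (hB n le_rfl) (abs_nonneg _) ((hw0 _).trans (hW (n - 1) (by omega)))
  have h2 : |∑ i ∈ range (n - 1), (w (i + 1) - w i) * ∑ i ∈ range (i + 1), g i| ≤ W * B := by
    refine (abs_sum_le_sum_abs _ _).trans ?_
    calc _ ≤ ∑ i ∈ range (n - 1), (w (i + 1) - w i) * B := by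
          refine sum_le_sum fun i hi => ?_
          rw [mem_range] at hi
          have h0 : 0 ≤ w (i + 1) - w i := sub_nonneg.2 (hw (Nat.le_succ i))
          rw [abs_mul, abs_of_nonneg h0]
          exact mul_le_mul_of_nonneg_left (hB _ (by omega)) h0
      _ = (w (n - 1) - w 0) * B := by rw [← sum_mul, sum_range_sub]
      _ ≤ W * B := by
          gcongr
          have := hW (n - 1) (by omega); have := hw0 0; linarith
  linarith

theorem typeI_w {r : ℕ} (hr : r % 16 = 15) : ∃ C : ℝ, 1 ≤ C ∧ ∀ (d X : ℕ) (w : ℕ → ℝ) (W : ℝ), 1 ≤ d → 1 ≤ X →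
    Monotone w → (∀ i, 0 ≤ w i) → (∀ i ≤ X, w i ≤ W) →
    |∑ k ∈ Icc 1 X, if d * k ≤ X then w k * F r (d * k) else 0| ≤ 2 * (W * (C * d * (X : ℝ) ^ (31 / 32 : ℝ))) := by
  obtain ⟨C, hC, H⟩ := typeI hr
  refine ⟨C, hC, ?_⟩
  intro d X w W hd hX hw hw0 hW
  have hXr : (1 : ℝ) ≤ X := by exact_mod_cast hX
  have e : (∑ k ∈ Icc 1 X, if d * k ≤ X then w k * F r (d * k) else 0) =
      ∑ n ∈ range (X + 1), w (n / d) * (if 1 ≤ n ∧ d ∣ n then F r n else 0) := by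
    simp_rw [mul_ite, mul_zero]
    rw [← sum_filter, ← sum_filter]
    refine sum_nbij' (fun k => d * k) (fun n => n / d) ?_ ?_ ?_ ?_ ?_
    · intro k hk
      rw [mem_filter, mem_Icc] at hk
      rw [mem_filter, mem_range]
      exact ⟨by omega, Nat.mul_pos hd hk.1.1, dvd_mul_right _ _⟩
    · intro n hn
      rw [mem_filter, mem_range] at hn
      obtain ⟨h1, h2, k, rfl⟩ := hn
      rw [Nat.mul_div_cancel_left _ hd, mem_filter, mem_Icc]
      have : 0 < k := Nat.pos_of_mul_pos_left h2
      refine ⟨⟨this, ?_⟩, by omega⟩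
      nlinarith
    · intro k _
      exact Nat.mul_div_cancel_left _ hd
    · intro n hn
      exact Nat.mul_div_cancel' (mem_filter.1 hn).2.2
    · intro k _
      rw [Nat.mul_div_cancel_left _ hd]
  rw [e]
  apply abel_mono (w := fun n => w (n / d)) (Nat.succ_pos X)
  · intro a b hab
    exact hw (Nat.div_le_div_right hab)
  · intro i; exact hw0 _
  · intro i hi
    exact hW _ ((Nat.div_le_self _ _).trans (by omega))
  · intro k hk
    rw [← sum_filter]
    rcases Nat.lt_or_ge k 2 with h | h
    · have : (range k).filter (fun n => 1 ≤ n ∧ d ∣ n) = ∅ := by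
        rw [filter_eq_empty_iff]
        intro n hn
        rw [mem_range] at hn
        omega
      rw [this]; simp; positivity
    · have : (range k).filter (fun n => 1 ≤ n ∧ d ∣ n) = (Icc 1 (k - 1)).filter (fun n => d ∣ n) := by
        ext n
        rw [mem_filter, mem_filter, mem_range, mem_Icc]
        constructor
        · rintro ⟨h1, h2, h3⟩; exact ⟨⟨h2, by omega⟩, h3⟩
        · rintro ⟨⟨h1, h2⟩, h3⟩; exact ⟨by omega, h1, h3⟩
      rw [this]
      refine (H d (k - 1) hd (by omega)).trans ?_
      have : ((k - 1 : ℕ) : ℝ) ≤ X := by exact_mod_cast (by omega)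
      gcongr

open Classical in
/-- integers with a large square divisor -/
noncomputable def badset (X : ℕ) (Y : ℝ) : Finset ℕ :=
  (Icc 1 X).filter (fun w => ∃ s : ℕ, Y < (s : ℝ) ^ 3 ∧ s ^ 2 ∣ w)

theorem badset_card {X : ℕ} (hX : 1 ≤ X) {δ : ℝ} :
    ((badset X ((X : ℝ) ^ δ)).card : ℝ) ≤ 2 * (X : ℝ) ^ (1 - δ / 3) := by
  classical
  have hXr : (1 : ℝ) ≤ X := by exact_mod_cast hX
  have hX0 : (0 : ℝ) < X := by linarith
  set z : ℝ := (X : ℝ) ^ (δ / 3) with hz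
  have hz0 : 0 < z := by positivity
  have hz3 : z ^ 3 = (X : ℝ) ^ δ := by
    rw [hz, ← Real.rpow_natCast, ← Real.rpow_mul hX0.le]; congr 1; push_cast; ring
  set k := ⌊z⌋₊ with hk
  have hsub : badset X ((X : ℝ) ^ δ) ⊆ (Ioo k (X + 1)).biUnion (fun s => (Ioc 0 X).filter (fun w => s ^ 2 ∣ w)) := by
    intro w hw
    unfold badset at hw
    rw [mem_filter, mem_Icc] at hw
    obtain ⟨⟨h1, h2⟩, s, h3, h4⟩ := hw
    rw [mem_biUnion]
    have hs : z < s := by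
      rw [← hz3] at h3
      exact lt_of_pow_lt_pow_left₀ 3 (by positivity) h3
    refine ⟨s, mem_Ioo.2 ⟨?_, ?_⟩, mem_filter.2 ⟨mem_Ioc.2 ⟨by omega, h2⟩, h4⟩⟩
    · rw [hk]; exact (Nat.floor_lt hz0.le).2 hs
    · have := Nat.le_of_dvd (by omega) h4
      have : s ≤ s ^ 2 := Nat.le_self_pow (by norm_num) s
      omega
  have h1 : ((badset X ((X : ℝ) ^ δ)).card : ℝ) ≤ ∑ s ∈ Ioo k (X + 1), (X : ℝ) * ((s : ℝ) ^ 2)⁻¹ := by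
    have := (card_le_card hsub).trans card_biUnion_le
    calc _ ≤ ((∑ s ∈ Ioo k (X + 1), ((Ioc 0 X).filter (fun w => s ^ 2 ∣ w)).card : ℕ) : ℝ) := by exact_mod_cast this
      _ ≤ _ := by
        push_cast
        refine sum_le_sum fun s _ => ?_
        rw [Nat.Ioc_filter_dvd_card_eq_div]
        have := @Nat.cast_div_le ℝ _ _ _ X (s ^ 2)
        rw [← div_eq_mul_inv]; push_cast at this; exact this
  refine h1.trans ?_
  rw [← mul_sum]
  have h2 : ∑ s ∈ Ioo k (X + 1), ((s : ℝ) ^ 2)⁻¹ ≤ 2 / (k + 1) := sum_Ioo_inv_sq_le k (X + 1)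
  have h3 : z < k + 1 := Nat.lt_floor_add_one z
  calc _ ≤ (X : ℝ) * (2 / (k + 1)) := by gcongr
    _ ≤ X * (2 / z) := by gcongr
    _ = 2 * (X : ℝ) ^ (1 - δ / 3) := by
      rw [Real.rpow_sub hX0, Real.rpow_one, ← hz]; ring

theorem pp_sq {m : ℕ} (hm : IsPrimePow m) (hm' : ¬ m.Prime) : ∃ s : ℕ, s ^ 2 ∣ m ∧ m ≤ s ^ 3 := by
  obtain ⟨p, k, hp, hk, rfl⟩ := (isPrimePow_nat_iff m).1 hm
  have hk2 : 2 ≤ k := by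
    by_contra h
    have : k = 1 := by omega
    subst this
    rw [pow_one] at hm'; exact hm' hp
  refine ⟨p ^ (k / 2), ?_, ?_⟩
  · rw [← pow_mul]; exact pow_dvd_pow _ (by omega)
  · rw [← pow_mul]; exact Nat.pow_le_pow_right hp.pos (by omega)

theorem exists_T {ε : ℝ} (hε : 0 < ε) : ∃ C : ℝ, 1 ≤ C ∧ ∀ X : ℕ, 1 ≤ X → ∃ T : ℕ, 1 ≤ T ∧ (T : ℝ) ≤ C * (X : ℝ) ^ ε ∧
    (∀ n ≤ X, n % 2 = 1 → (fset n).card ≤ T) ∧ (∀ n ≤ X, n.divisors.card ≤ T) := by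
  obtain ⟨C, hC, H⟩ := divisor_bound (ε / 2) (by positivity)
  refine ⟨C ^ 2, one_le_pow₀ hC, ?_⟩
  intro X hX
  have hXr : (1 : ℝ) ≤ X := by exact_mod_cast hX
  have hX0 : (0 : ℝ) < X := by linarith
  have hB : 1 ≤ C ^ 2 * (X : ℝ) ^ ε := one_le_mul_of_one_le_of_one_le (one_le_pow₀ hC) (Real.one_le_rpow hXr hε.le)
  have e : C ^ 2 * (X : ℝ) ^ ε = (C * (X : ℝ) ^ (ε / 2)) ^ 2 := by
    rw [mul_pow, ← Real.rpow_natCast ((X : ℝ) ^ (ε / 2)), ← Real.rpow_mul hX0.le]; congr 2; push_cast; ring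
  have hd : ∀ n ≤ X, 1 ≤ n → (n.divisors.card : ℝ) ≤ C * (X : ℝ) ^ (ε / 2) := by
    intro n hn hn1
    refine (H n hn1).trans ?_
    have : (n : ℝ) ≤ X := by exact_mod_cast hn
    gcongr
  refine ⟨⌊C ^ 2 * (X : ℝ) ^ ε⌋₊, Nat.le_floor (by exact_mod_cast hB), Nat.floor_le (by positivity), ?_, ?_⟩
  · intro n hn h2
    refine (card_fset_le h2).trans (Nat.le_floor ?_)
    rw [e]; push_cast
    exact pow_le_pow_left₀ (by positivity) (hd n hn (by omega)) 2
  · intro n hn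
    rcases Nat.eq_zero_or_pos n with rfl | h
    · simp
    · refine Nat.le_floor ((hd n hn h).trans ?_)
      rw [e]
      refine le_self_pow₀ ?_ (by norm_num)
      exact one_le_mul_of_one_le_of_one_le hC (Real.one_le_rpow hXr (by positivity))

end QB

end

section

open scoped NumberTheorySymbols
open Finset

namespace QB

open ArithmeticFunction in
/-- truncation of an arithmetic function -/
noncomputable def trunc (f : ArithmeticFunction ℝ) (V : ℕ) : ArithmeticFunction ℝ :=
  ⟨fun n => if n ≤ V then f n else 0, by simp⟩

theorem trunc_apply (f : ArithmeticFunction ℝ) (V n : ℕ) : trunc f V n = if n ≤ V then f n else 0 := rfl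

open ArithmeticFunction in
theorem vaughan (V : ℕ) : (vonMangoldt : ArithmeticFunction ℝ) = trunc vonMangoldt V +
    trunc (moebius : ArithmeticFunction ℝ) V * ArithmeticFunction.log
    - (trunc vonMangoldt V * trunc (moebius : ArithmeticFunction ℝ) V) * (zeta : ArithmeticFunction ℝ)
    + (vonMangoldt - trunc vonMangoldt V) * ((zeta : ArithmeticFunction ℝ) * ((moebius : ArithmeticFunction ℝ) - trunc (moebius : ArithmeticFunction ℝ) V)) := by
  have h1 : (vonMangoldt : ArithmeticFunction ℝ) * (zeta : ArithmeticFunction ℝ) = ArithmeticFunction.log := vonMangoldt_mul_zeta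
  have h2 : (moebius : ArithmeticFunction ℝ) * (zeta : ArithmeticFunction ℝ) = 1 := coe_moebius_mul_coe_zeta
  rw [← h1]
  linear_combination (trunc vonMangoldt V - vonMangoldt) * h2

open ArithmeticFunction in
theorem moebius_real_abs (n : ℕ) : |((moebius : ArithmeticFunction ℝ) n)| ≤ 1 := by
  rw [intCoe_apply]
  have := @abs_moebius_le_one n
  exact_mod_cast this

open ArithmeticFunction in
theorem vonMangoldt_le_L {n X : ℕ} (hn : n ≤ X) : (vonMangoldt n : ℝ) ≤ Real.log X + 1 := by
  rcases Nat.eq_zero_or_pos n with rfl | h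
  · have : 0 ≤ Real.log X := Real.log_natCast_nonneg X
    simp; linarith
  · have h1 : (vonMangoldt n : ℝ) ≤ Real.log n := vonMangoldt_le_log
    have h2 : Real.log n ≤ Real.log X := Real.log_le_log (by exact_mod_cast h) (by exact_mod_cast hn)
    linarith

open ArithmeticFunction in
theorem part1 {r : ℕ} (hr : r % 16 = 15) {X T V : ℕ} (hT : ∀ n ≤ X, n % 2 = 1 → (fset n).card ≤ T) :
    |∑ n ∈ Icc 1 X, trunc vonMangoldt V n * F r n| ≤ V * ((Real.log X + 1) * T) := by
  have hL : 0 ≤ Real.log X := Real.log_natCast_nonneg X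
  simp_rw [trunc_apply, ite_mul, zero_mul]
  rw [← sum_filter]
  refine (abs_sum_le_sum_abs _ _).trans ?_
  have hc : ((Icc 1 X).filter (fun n => n ≤ V)).card ≤ V := by
    have : (Icc 1 X).filter (fun n => n ≤ V) ⊆ Icc 1 V := by
      intro n hn
      rw [mem_filter, mem_Icc] at hn
      exact mem_Icc.2 ⟨hn.1.1, hn.2⟩
    simpa using card_le_card this
  calc _ ≤ ∑ n ∈ (Icc 1 X).filter (fun n => n ≤ V), (Real.log X + 1) * T := by
        refine sum_le_sum fun n hn => ?_
        rw [mem_filter, mem_Icc] at hn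
        rw [abs_mul, abs_of_nonneg vonMangoldt_nonneg]
        exact mul_le_mul (vonMangoldt_le_L hn.1.2) (F_le hr hT hn.1.2) (abs_nonneg _) (by positivity)
    _ = ((Icc 1 X).filter (fun n => n ≤ V)).card * ((Real.log X + 1) * T) := by rw [sum_const, nsmul_eq_mul]
    _ ≤ _ := by gcongr

/-- Type I sums. -/
theorem partI {r : ℕ} (hr : r % 16 = 15) : ∃ C : ℝ, 1 ≤ C ∧ ∀ (X D : ℕ) (f g : ArithmeticFunction ℝ) (A W : ℝ), 1 ≤ X →
    0 ≤ A → 0 ≤ W →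
    (∀ d, D < d → f d = 0) → (∀ d ≤ X, |f d| ≤ A) → (Monotone fun n => if n = 0 then 0 else g n) →
    (∀ i, 0 ≤ g i) → (∀ i ≤ X, g i ≤ W) →
    |∑ n ∈ Icc 1 X, (f * g) n * F r n| ≤ C * A * W * (D : ℝ) ^ 2 * (X : ℝ) ^ (31 / 32 : ℝ) := by
  obtain ⟨C, hC, H⟩ := typeI_w hr
  refine ⟨2 * C, by linarith, ?_⟩
  intro X D f g A W hX hA hW hD hf hg hg0 hgW
  rw [conv_sum]
  refine (abs_sum_le_sum_abs _ _).trans ?_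
  have hterm : ∀ d ∈ Icc 1 X, |∑ k ∈ Icc 1 X, if d * k ≤ X then f d * g k * F r (d * k) else 0| ≤
      if d ≤ D then A * (2 * (W * (C * D * (X : ℝ) ^ (31 / 32 : ℝ)))) else 0 := by
    intro d hd
    rw [mem_Icc] at hd
    have e : (∑ k ∈ Icc 1 X, if d * k ≤ X then f d * g k * F r (d * k) else 0) =
        f d * ∑ k ∈ Icc 1 X, if d * k ≤ X then (if k = 0 then 0 else g k) * F r (d * k) else 0 := by
      rw [mul_sum]
      refine sum_congr rfl fun k hk => ?_
      rw [mem_Icc] at hk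
      rw [if_neg (show k ≠ 0 by omega), mul_ite, mul_zero, mul_assoc]
    rw [e, abs_mul]
    split_ifs with h
    · have h1 := H d X (fun n => if n = 0 then 0 else g n) W hd.1 hX hg (by intro i; split_ifs; exact le_rfl; exact hg0 i)
        (by intro i hi; split_ifs; exact hW; exact hgW i hi)
      refine mul_le_mul (hf d hd.2) (h1.trans ?_) (abs_nonneg _) hA
      have : (d : ℝ) ≤ D := by exact_mod_cast h
      gcongr
    · rw [hD d (by omega)]; simp
  refine (sum_le_sum hterm).trans ?_
  rw [← sum_filter, sum_const, nsmul_eq_mul]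
  have hc : ((Icc 1 X).filter (fun n => n ≤ D)).card ≤ D := by
    have : (Icc 1 X).filter (fun n => n ≤ D) ⊆ Icc 1 D := by
      intro n hn
      rw [mem_filter, mem_Icc] at hn
      exact mem_Icc.2 ⟨hn.1.1, hn.2⟩
    simpa using card_le_card this
  calc _ ≤ (D : ℝ) * (A * (2 * (W * (C * D * (X : ℝ) ^ (31 / 32 : ℝ))))) := by gcongr
    _ = _ := by ring

open ArithmeticFunction in
theorem part2 {r : ℕ} (hr : r % 16 = 15) : ∃ C : ℝ, 1 ≤ C ∧ ∀ (X V : ℕ), 1 ≤ X →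
    |∑ n ∈ Icc 1 X, (trunc (moebius : ArithmeticFunction ℝ) V * ArithmeticFunction.log) n * F r n| ≤
      C * (Real.log X + 1) * (V : ℝ) ^ 2 * (X : ℝ) ^ (31 / 32 : ℝ) := by
  obtain ⟨C, hC, H⟩ := partI hr
  refine ⟨C, hC, ?_⟩
  intro X V hX
  have hL : 0 ≤ Real.log X := Real.log_natCast_nonneg X
  have := H X V (trunc (moebius : ArithmeticFunction ℝ) V) ArithmeticFunction.log 1 (Real.log X + 1) hX (by norm_num) (by linarith)
    (by intro d hd; rw [trunc_apply, if_neg (by omega)])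
    (by intro d _; rw [trunc_apply]; split_ifs; exact moebius_real_abs d; simp)
    (by
      intro a b hab
      simp only
      rcases Nat.eq_zero_or_pos a with rfl | ha
      · simp only [if_true]
        split_ifs
        · exact le_rfl
        · rw [log_apply]; exact Real.log_natCast_nonneg _
      · rw [if_neg (by omega), if_neg (by omega), log_apply, log_apply]
        exact Real.log_le_log (by exact_mod_cast ha) (by exact_mod_cast hab))
    (by intro i; rw [log_apply]; exact Real.log_natCast_nonneg _)
    (by
      intro i hi
      rw [log_apply]
      rcases Nat.eq_zero_or_pos i with rfl | h
      · simp; linarith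
      · have h2 : Real.log i ≤ Real.log X := Real.log_le_log (by exact_mod_cast h) (by exact_mod_cast hi)
        linarith)
  simpa using this

open ArithmeticFunction in
theorem part3 {r : ℕ} (hr : r % 16 = 15) : ∃ C : ℝ, 1 ≤ C ∧ ∀ (X V : ℕ), 1 ≤ X →
    |∑ n ∈ Icc 1 X, ((trunc vonMangoldt V * trunc (moebius : ArithmeticFunction ℝ) V) * (zeta : ArithmeticFunction ℝ)) n * F r n| ≤
      C * (Real.log X + 1) * (V : ℝ) ^ 4 * (X : ℝ) ^ (31 / 32 : ℝ) := by
  obtain ⟨C, hC, H⟩ := partI hr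
  refine ⟨C, hC, ?_⟩
  intro X V hX
  have hL : 0 ≤ Real.log X := Real.log_natCast_nonneg X
  have := H X (V ^ 2) (trunc vonMangoldt V * trunc (moebius : ArithmeticFunction ℝ) V) (zeta : ArithmeticFunction ℝ) (Real.log X + 1) 1 hX (by linarith) (by norm_num)
    (by
      intro d hd
      rw [mul_apply]
      refine sum_eq_zero fun x hx => ?_
      rw [Nat.mem_divisorsAntidiagonal] at hx
      rw [trunc_apply, trunc_apply]
      by_cases h1 : x.1 ≤ V
      · by_cases h2 : x.2 ≤ V
        · exfalso
          have := Nat.mul_le_mul h1 h2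
          nlinarith [hx.1]
        · rw [if_neg h2, mul_zero]
      · rw [if_neg h1, zero_mul])
    (by
      intro d hd
      rw [mul_apply]
      refine (abs_sum_le_sum_abs _ _).trans ?_
      calc _ ≤ ∑ x ∈ d.divisorsAntidiagonal, (vonMangoldt x.1 : ℝ) := by
            refine sum_le_sum fun x _ => ?_
            rw [abs_mul, trunc_apply, trunc_apply]
            have h1 : |if x.1 ≤ V then (vonMangoldt x.1 : ℝ) else 0| ≤ vonMangoldt x.1 := by
              split_ifs
              · rw [abs_of_nonneg vonMangoldt_nonneg]
              · simp
            have h2 : |if x.2 ≤ V then (moebius : ArithmeticFunction ℝ) x.2 else 0| ≤ 1 := by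
              split_ifs
              · exact moebius_real_abs _
              · simp
            calc _ ≤ (vonMangoldt x.1 : ℝ) * 1 := mul_le_mul h1 h2 (abs_nonneg _) vonMangoldt_nonneg
              _ = _ := mul_one _
        _ = Real.log d := by rw [Nat.sum_divisorsAntidiagonal (fun i _ => (vonMangoldt i : ℝ)), vonMangoldt_sum]
        _ ≤ Real.log X + 1 := by
          rcases Nat.eq_zero_or_pos d with rfl | h
          · simp; linarith
          · have h2 : Real.log d ≤ Real.log X := Real.log_le_log (by exact_mod_cast h) (by exact_mod_cast hd)
            linarith)
    (by
      intro a b hab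
      simp only [natCoe_apply, zeta_apply]
      split_ifs <;> simp <;> omega)
    (by intro i; simp only [natCoe_apply]; positivity)
    (by intro i _; simp only [natCoe_apply, zeta_apply]; split_ifs <;> simp)
  refine this.trans (le_of_eq ?_)
  push_cast; ring

end QB

end

section

open scoped NumberTheorySymbols
open Finset

namespace QB

theorem af_sub (f g : ArithmeticFunction ℝ) (n : ℕ) : (f - g) n = f n - g n := by
  have := congrArg (fun h : ArithmeticFunction ℝ => h n) (sub_add_cancel f g)
  simp only [ArithmeticFunction.add_apply] at this
  linarith

open ArithmeticFunction in
theorem part4 {r : ℕ} (hr : r % 16 = 15) {δ : ℝ} (hδ : 0 < δ) (hδ1 : δ ≤ 1) : ∃ C ε : ℝ, 1 ≤ C ∧ 0 < ε ∧ ∀ (X T : ℕ), 1 ≤ X → 1 ≤ T →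
    (∀ n ≤ X, n % 2 = 1 → (fset n).card ≤ T) → (∀ n ≤ X, n.divisors.card ≤ T) →
    |∑ n ∈ Icc 1 X, ((vonMangoldt - trunc vonMangoldt ⌊(X : ℝ) ^ δ⌋₊) * ((zeta : ArithmeticFunction ℝ) * ((moebius : ArithmeticFunction ℝ) - trunc (moebius : ArithmeticFunction ℝ) ⌊(X : ℝ) ^ δ⌋₊))) n * F r n| ≤
      C * (Real.log X + 1) * (T : ℝ) ^ 3 * ((X : ℝ) ^ (1 - ε) + (X : ℝ) ^ (1 - δ / 3)) := by
  classical
  obtain ⟨C, ε, hC, hε, H⟩ := hyper hr hδ hδ1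
  refine ⟨C + 2, ε, by linarith, hε, ?_⟩
  intro X T hX hT1 hT hT2
  set V : ℕ := ⌊(X : ℝ) ^ δ⌋₊ with hV
  have hXr : (1 : ℝ) ≤ X := by exact_mod_cast hX
  have hTr : (1 : ℝ) ≤ T := by exact_mod_cast hT1
  have hX0 : (0 : ℝ) < X := by linarith
  have hL0 : 0 ≤ Real.log X := Real.log_natCast_nonneg X
  set L : ℝ := Real.log X + 1 with hL
  have hL1 : 0 < L := by linarith
  set Λ2 : ArithmeticFunction ℝ := vonMangoldt - trunc vonMangoldt V with hΛ2
  set b : ArithmeticFunction ℝ := (zeta : ArithmeticFunction ℝ) * ((moebius : ArithmeticFunction ℝ) - trunc (moebius : ArithmeticFunction ℝ) V) with hb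
  have hΛ2a : ∀ m, Λ2 m = if V < m then (vonMangoldt m : ℝ) else 0 := by
    intro m
    rw [hΛ2, af_sub, trunc_apply]
    split_ifs <;> first | omega | simp
  have hμ2 : ∀ m, ((moebius : ArithmeticFunction ℝ) - trunc (moebius : ArithmeticFunction ℝ) V) m = if V < m then (moebius : ArithmeticFunction ℝ) m else 0 := by
    intro m
    rw [af_sub, trunc_apply]
    split_ifs <;> first | omega | simp
  have hba : ∀ n, b n = ∑ i ∈ n.divisors, if V < i then (moebius : ArithmeticFunction ℝ) i else 0 := by
    intro n
    rw [hb, coe_zeta_mul_apply]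
    exact sum_congr rfl fun i _ => hμ2 i
  have hbT : ∀ n ≤ X, |b n| ≤ T := by
    intro n hn
    rw [hba]
    refine (abs_sum_le_sum_abs _ _).trans ?_
    calc _ ≤ ∑ i ∈ n.divisors, (1 : ℝ) := sum_le_sum fun i _ => by
          split_ifs
          · exact moebius_real_abs i
          · simp
      _ = n.divisors.card := by simp
      _ ≤ T := by exact_mod_cast hT2 n hn
  have hb0 : ∀ n : ℕ, (n : ℝ) < (X : ℝ) ^ δ → b n = 0 := by
    intro n hn
    rw [hba]
    refine sum_eq_zero fun i hi => ?_
    rw [if_neg]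
    rw [not_lt, hV]
    refine Nat.le_floor ?_
    have : (i : ℝ) ≤ n := by exact_mod_cast Nat.divisor_le hi
    linarith
  have hΛL : ∀ m ≤ X, |Λ2 m| ≤ L := by
    intro m hm
    rw [hΛ2a]
    split_ifs
    · rw [abs_of_nonneg vonMangoldt_nonneg]; exact vonMangoldt_le_L hm
    · simp; exact hL1.le
  set A : Finset ℕ := (Icc 1 X).filter (fun m => m.Prime ∧ V < m) with hA
  set P : Finset (ℕ × ℕ) := (Icc 1 X ×ˢ Icc 1 X).filter
    (fun x => x.1 * x.2 ≤ X ∧ V < x.1 ∧ IsPrimePow x.1 ∧ ¬ (x.1.Prime ∧ ¬ x.1 ∣ x.2)) with hP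
  have hdec : ∑ n ∈ Icc 1 X, (Λ2 * b) n * F r n =
      L * (∑ m ∈ A, ∑ n ∈ Icc 1 X, if m * n ≤ X then (vonMangoldt m / L) * b n * (if m ∣ n then 0 else F r (m * n)) else 0) +
      ∑ x ∈ P, Λ2 x.1 * b x.2 * F r (x.1 * x.2) := by
    rw [conv_sum, hA, sum_filter, hP, sum_filter, sum_product, mul_sum, ← sum_add_distrib]
    refine sum_congr rfl fun m _ => ?_
    by_cases hm : m.Prime ∧ V < m
    · rw [if_pos hm, mul_sum, ← sum_add_distrib]
      refine sum_congr rfl fun n _ => ?_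
      simp only
      rw [hΛ2a, if_pos hm.2]
      by_cases h1 : m * n ≤ X
      · rw [if_pos h1, if_pos h1]
        by_cases h2 : m ∣ n
        · rw [if_pos h2, if_pos ⟨h1, hm.2, hm.1.isPrimePow, by tauto⟩]; ring
        · rw [if_neg h2, if_neg (by tauto)]; field_simp; ring
      · rw [if_neg h1, if_neg h1, if_neg (by tauto)]; ring
    · rw [if_neg hm, mul_zero, zero_add]
      refine sum_congr rfl fun n _ => ?_
      simp only
      by_cases h1 : m * n ≤ X
      · rw [if_pos h1]
        split_ifs with h2
        · rfl
        · have : Λ2 m = 0 := by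
            rw [hΛ2a]
            split_ifs with h3
            · rw [vonMangoldt_eq_zero_iff]
              intro h4; apply h2; tauto
            · rfl
          rw [this]; ring
      · rw [if_neg h1, if_neg (by tauto)]
  rw [hdec]
  have hm1 : |∑ m ∈ A, ∑ n ∈ Icc 1 X, if m * n ≤ X then (vonMangoldt m / L) * b n * (if m ∣ n then 0 else F r (m * n)) else 0| ≤
      C * T * T ^ 2 * (X : ℝ) ^ (1 - ε) := by
    apply H X T T A (fun m => vonMangoldt m / L) b hX (by positivity) ?_ hT hT2 ?_ hbT hb0
    · intro m hm
      rw [hA, mem_filter, mem_Icc] at hm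
      exact ⟨hm.2.1, Nat.lt_of_floor_lt hm.2.2, hm.1.2⟩
    · intro m hm
      rw [hA, mem_filter, mem_Icc] at hm
      rw [abs_of_nonneg (div_nonneg vonMangoldt_nonneg hL1.le), div_le_one hL1]
      exact vonMangoldt_le_L hm.1.2
  have hPc : (P.card : ℝ) ≤ 2 * (X : ℝ) ^ (1 - δ / 3) * T := by
    have h1 : P.card ≤ (badset X ((X : ℝ) ^ δ)).card * T := by
      apply pairs_card
      · intro x hx
        rw [hP, mem_filter, mem_product, mem_Icc, mem_Icc] at hx
        obtain ⟨⟨h1, h2⟩, h3, h4, h5, h6⟩ := hx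
        unfold badset
        rw [mem_filter, mem_Icc]
        refine ⟨⟨Nat.mul_pos h1.1 h2.1, h3⟩, ?_⟩
        have h7 : (X : ℝ) ^ δ < x.1 := Nat.lt_of_floor_lt h4
        by_cases hp : x.1.Prime
        · have hd : x.1 ∣ x.2 := by tauto
          refine ⟨x.1, lt_of_lt_of_le h7 ?_, ?_⟩
          · exact_mod_cast Nat.le_self_pow (by norm_num) x.1
          · rw [pow_two]; exact Nat.mul_dvd_mul_left _ hd
        · obtain ⟨s, hs1, hs2⟩ := pp_sq h5 hp
          refine ⟨s, lt_of_lt_of_le h7 (by exact_mod_cast hs2), hs1.trans (dvd_mul_right _ _)⟩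
      · intro w hw
        unfold badset at hw
        rw [mem_filter, mem_Icc] at hw
        exact ⟨hw.1.1, hT2 w hw.1.2⟩
    calc (P.card : ℝ) ≤ (badset X ((X : ℝ) ^ δ)).card * T := by exact_mod_cast h1
      _ ≤ _ := by gcongr; exact badset_card hX
  have hm2 : |∑ x ∈ P, Λ2 x.1 * b x.2 * F r (x.1 * x.2)| ≤ 2 * (X : ℝ) ^ (1 - δ / 3) * T * (L * T * T) := by
    refine (abs_sum_le_sum_abs _ _).trans ?_
    calc _ ≤ ∑ x ∈ P, L * T * T := by
          refine sum_le_sum fun x hx => ?_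
          rw [hP, mem_filter, mem_product, mem_Icc, mem_Icc] at hx
          rw [abs_mul, abs_mul]
          have e1 := hΛL x.1 hx.1.1.2
          have e2 := hbT x.2 hx.1.2.2
          have e3 := F_le hr hT hx.2.1
          gcongr
      _ = P.card * (L * T * T) := by rw [sum_const, nsmul_eq_mul]
      _ ≤ _ := by gcongr
  refine (abs_add_le _ _).trans ?_
  rw [abs_mul, abs_of_pos hL1]
  have e1 : 0 ≤ (X : ℝ) ^ (1 - ε) := by positivity
  have e2 : 0 ≤ (X : ℝ) ^ (1 - δ / 3) := by positivity
  calc _ ≤ L * (C * T * T ^ 2 * (X : ℝ) ^ (1 - ε)) + 2 * (X : ℝ) ^ (1 - δ / 3) * T * (L * T * T) := by gcongr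
    _ = L * T ^ 3 * (C * (X : ℝ) ^ (1 - ε) + 2 * (X : ℝ) ^ (1 - δ / 3)) := by ring
    _ ≤ L * T ^ 3 * ((C + 2) * (X : ℝ) ^ (1 - ε) + (C + 2) * (X : ℝ) ^ (1 - δ / 3)) := by
        gcongr <;> linarith
    _ = _ := by ring

open ArithmeticFunction in
theorem psi_bound {r : ℕ} (hr : r % 16 = 15) : ∃ C η : ℝ, 1 ≤ C ∧ 0 < η ∧ η ≤ 1 / 2000 ∧ ∀ X : ℕ, 1 ≤ X →
    |∑ n ∈ Icc 1 X, vonMangoldt n * F r n| ≤ C * (X : ℝ) ^ (1 - η) := by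
  obtain ⟨C4, ε, hC4, hε, H4⟩ := part4 hr (δ := 1 / 256) (by norm_num) (by norm_num)
  obtain ⟨C2, hC2, H2⟩ := part2 hr
  obtain ⟨C3, hC3, H3⟩ := part3 hr
  set η : ℝ := min ε (1 / 1000) with hη
  have hη0 : 0 < η := lt_min hε (by norm_num)
  have hηε : η ≤ ε := min_le_left _ _
  have hη1 : η ≤ 1 / 1000 := min_le_right _ _
  obtain ⟨CT, hCT, HT⟩ := exists_T (ε := η / 8) (by positivity)
  refine ⟨(1 + C2 + C3 + 2 * C4) * ((8 / η + 1) * CT ^ 3), η / 2, ?_, by positivity, by linarith, ?_⟩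
  · have : 0 < 8 / η := by positivity
    exact one_le_mul_of_one_le_of_one_le (by linarith) (one_le_mul_of_one_le_of_one_le (by linarith) (one_le_pow₀ hCT))
  intro X hX
  obtain ⟨T, hT1, hTC, hT, hT2⟩ := HT X hX
  have hXr : (1 : ℝ) ≤ X := by exact_mod_cast hX
  have hTr : (1 : ℝ) ≤ T := by exact_mod_cast hT1
  have hX0 : (0 : ℝ) < X := by linarith
  have hL0 : 0 ≤ Real.log X := Real.log_natCast_nonneg X
  have hmono : ∀ {a b : ℝ}, a ≤ b → (X : ℝ) ^ a ≤ (X : ℝ) ^ b := fun h => Real.rpow_le_rpow_of_exponent_le hXr h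
  set V : ℕ := ⌊(X : ℝ) ^ (1 / 256 : ℝ)⌋₊ with hV
  have hVX : (V : ℝ) ≤ (X : ℝ) ^ (1 / 256 : ℝ) := Nat.floor_le (by positivity)
  set L : ℝ := Real.log X + 1 with hL
  have hL1 : 1 ≤ L := by linarith
  have p1 := part1 hr (V := V) hT
  have p2 := H2 X V hX
  have p3 := H3 X V hX
  have p4 := H4 X T hX hT1 hT hT2
  rw [← hV] at p4
  rw [← hL] at p1 p2 p3 p4
  have hsum : ∑ n ∈ Icc 1 X, vonMangoldt n * F r n = ∑ n ∈ Icc 1 X, trunc vonMangoldt V n * F r n +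
      ∑ n ∈ Icc 1 X, (trunc (moebius : ArithmeticFunction ℝ) V * ArithmeticFunction.log) n * F r n -
      ∑ n ∈ Icc 1 X, ((trunc vonMangoldt V * trunc (moebius : ArithmeticFunction ℝ) V) * (zeta : ArithmeticFunction ℝ)) n * F r n +
      ∑ n ∈ Icc 1 X, ((vonMangoldt - trunc vonMangoldt V) * ((zeta : ArithmeticFunction ℝ) * ((moebius : ArithmeticFunction ℝ) - trunc (moebius : ArithmeticFunction ℝ) V))) n * F r n := by
    rw [← sum_add_distrib, ← sum_sub_distrib, ← sum_add_distrib]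
    refine sum_congr rfl fun n _ => ?_
    rw [← add_mul, ← sub_mul, ← add_mul, ← ArithmeticFunction.add_apply, ← af_sub, ← ArithmeticFunction.add_apply, ← vaughan V]
  set Y : ℝ := (X : ℝ) ^ (1 - η) with hY
  have hY0 : 0 < Y := by positivity
  have hT3 : (1 : ℝ) ≤ T ^ 3 := one_le_pow₀ hTr
  have hTT3 : (T : ℝ) ≤ T ^ 3 := le_self_pow₀ hTr (by norm_num)
  have q1 : (V : ℝ) * (L * T) ≤ L * T ^ 3 * Y := by
    have : (V : ℝ) ≤ Y := hVX.trans (hmono (by linarith))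
    calc (V : ℝ) * (L * T) ≤ Y * (L * T ^ 3) := by gcongr
      _ = _ := by ring
  have q2 : C2 * L * (V : ℝ) ^ 2 * (X : ℝ) ^ (31 / 32 : ℝ) ≤ C2 * (L * T ^ 3 * Y) := by
    have : (V : ℝ) ^ 2 * (X : ℝ) ^ (31 / 32 : ℝ) ≤ Y := by
      calc _ ≤ ((X : ℝ) ^ (1 / 256 : ℝ)) ^ 2 * (X : ℝ) ^ (31 / 32 : ℝ) := by gcongr
        _ = (X : ℝ) ^ (1 / 256 * 2 + 31 / 32 : ℝ) := by
          rw [← Real.rpow_natCast, ← Real.rpow_mul hX0.le, ← Real.rpow_add hX0]; norm_num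
        _ ≤ Y := hmono (by linarith)
    calc _ = C2 * (L * 1 * ((V : ℝ) ^ 2 * (X : ℝ) ^ (31 / 32 : ℝ))) := by ring
      _ ≤ _ := by gcongr
  have q3 : C3 * L * (V : ℝ) ^ 4 * (X : ℝ) ^ (31 / 32 : ℝ) ≤ C3 * (L * T ^ 3 * Y) := by
    have : (V : ℝ) ^ 4 * (X : ℝ) ^ (31 / 32 : ℝ) ≤ Y := by
      calc _ ≤ ((X : ℝ) ^ (1 / 256 : ℝ)) ^ 4 * (X : ℝ) ^ (31 / 32 : ℝ) := by gcongr
        _ = (X : ℝ) ^ (1 / 256 * 4 + 31 / 32 : ℝ) := by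
          rw [← Real.rpow_natCast, ← Real.rpow_mul hX0.le, ← Real.rpow_add hX0]; norm_num
        _ ≤ Y := hmono (by linarith)
    calc _ = C3 * (L * 1 * ((V : ℝ) ^ 4 * (X : ℝ) ^ (31 / 32 : ℝ))) := by ring
      _ ≤ _ := by gcongr
  have q4 : C4 * L * (T : ℝ) ^ 3 * ((X : ℝ) ^ (1 - ε) + (X : ℝ) ^ (1 - 1 / 256 / 3 : ℝ)) ≤ 2 * C4 * (L * T ^ 3 * Y) := by
    have a1 : (X : ℝ) ^ (1 - ε) ≤ Y := hmono (by linarith)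
    have a2 : (X : ℝ) ^ (1 - 1 / 256 / 3 : ℝ) ≤ Y := hmono (by linarith)
    calc _ ≤ C4 * L * (T : ℝ) ^ 3 * (Y + Y) := by gcongr
      _ = _ := by ring
  have hLb : L ≤ (8 / η + 1) * (X : ℝ) ^ (η / 8) := by
    have h2 : Real.log X ≤ (X : ℝ) ^ (η / 8) / (η / 8) := Real.log_le_rpow_div hX0.le (by positivity)
    have h3 : 1 ≤ (X : ℝ) ^ (η / 8) := Real.one_le_rpow hXr (by positivity)
    have h4 : (X : ℝ) ^ (η / 8) / (η / 8) = 8 / η * (X : ℝ) ^ (η / 8) := by field_simp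
    rw [hL]; linarith
  have htot : L * T ^ 3 * Y ≤ (8 / η + 1) * CT ^ 3 * (X : ℝ) ^ (1 - η / 2) := by
    calc L * T ^ 3 * Y ≤ ((8 / η + 1) * (X : ℝ) ^ (η / 8)) * (CT * (X : ℝ) ^ (η / 8)) ^ 3 * Y := by gcongr
      _ = (8 / η + 1) * CT ^ 3 * ((X : ℝ) ^ (η / 8) * ((X : ℝ) ^ (η / 8)) ^ 3 * Y) := by ring
      _ = _ := by
        congr 1
        rw [hY, ← Real.rpow_natCast, ← Real.rpow_mul hX0.le, ← Real.rpow_add hX0, ← Real.rpow_add hX0]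
        congr 1; push_cast; ring
  rw [hsum]
  refine (abs_add_le _ _).trans ((add_le_add ((abs_sub _ _).trans (add_le_add (abs_add_le _ _) le_rfl)) le_rfl).trans ?_)
  calc _ ≤ L * T ^ 3 * Y + C2 * (L * T ^ 3 * Y) + C3 * (L * T ^ 3 * Y) + 2 * C4 * (L * T ^ 3 * Y) := by
        gcongr
        · exact p1.trans q1
        · exact p2.trans q2
        · exact p3.trans q3
        · exact p4.trans q4
    _ = (1 + C2 + C3 + 2 * C4) * (L * T ^ 3 * Y) := by ring
    _ ≤ (1 + C2 + C3 + 2 * C4) * ((8 / η + 1) * CT ^ 3 * (X : ℝ) ^ (1 - η / 2)) := by gcongr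
    _ = _ := by ring

end QB

end

section

open scoped NumberTheorySymbols
open Finset

namespace QB

open ArithmeticFunction in
theorem theta_bound {r : ℕ} (hr : r % 16 = 15) : ∃ C η : ℝ, 1 ≤ C ∧ 0 < η ∧ η ≤ 1 ∧ ∀ X : ℕ, 1 ≤ X →
    |∑ n ∈ Icc 1 X, (if n.Prime then Real.log n * F r n else 0)| ≤ C * (X : ℝ) ^ (1 - η) := by
  classical
  obtain ⟨C, η, hC, hη, hη1, H⟩ := psi_bound hr
  obtain ⟨CT, hCT, HT⟩ := exists_T (ε := 1 / 24) (by norm_num)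
  refine ⟨C + 3 * (25 * CT), η, by linarith, hη, by linarith, ?_⟩
  intro X hX
  obtain ⟨T, hT1, hTC, hT, hT2⟩ := HT X hX
  have hXr : (1 : ℝ) ≤ X := by exact_mod_cast hX
  have hX0 : (0 : ℝ) < X := by linarith
  have hL0 : 0 ≤ Real.log X := Real.log_natCast_nonneg X
  set L : ℝ := Real.log X + 1 with hL
  have hmono : ∀ {a b : ℝ}, a ≤ b → (X : ℝ) ^ a ≤ (X : ℝ) ^ b := fun h => Real.rpow_le_rpow_of_exponent_le hXr h
  set V : ℕ := ⌊(X : ℝ) ^ (1 / 2 : ℝ)⌋₊ with hV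
  set R : Finset ℕ := (Icc 1 X).filter (fun n => IsPrimePow n ∧ ¬ n.Prime) with hR
  have hsplit : ∑ n ∈ Icc 1 X, (if n.Prime then Real.log n * F r n else 0) =
      ∑ n ∈ Icc 1 X, vonMangoldt n * F r n - ∑ n ∈ R, vonMangoldt n * F r n := by
    rw [hR, sum_filter, ← sum_sub_distrib]
    refine sum_congr rfl fun n _ => ?_
    by_cases hp : n.Prime
    · rw [if_pos hp, if_neg (by tauto), vonMangoldt_apply_prime hp, sub_zero]
    · rw [if_neg hp]
      split_ifs with h
      · ring
      · have : (vonMangoldt n : ℝ) = 0 := by rw [vonMangoldt_eq_zero_iff]; tauto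
        rw [this]; ring
  have hRc : (R.card : ℝ) ≤ 3 * (X : ℝ) ^ (5 / 6 : ℝ) := by
    have hsub : R ⊆ Icc 1 V ∪ badset X ((X : ℝ) ^ (1 / 2 : ℝ)) := by
      intro n hn
      rw [hR, mem_filter, mem_Icc] at hn
      rw [mem_union]
      rcases Nat.lt_or_ge V n with h | h
      · right
        unfold badset
        rw [mem_filter, mem_Icc]
        obtain ⟨s, hs1, hs2⟩ := pp_sq hn.2.1 hn.2.2
        refine ⟨hn.1, s, lt_of_lt_of_le (Nat.lt_of_floor_lt h) (by exact_mod_cast hs2), hs1⟩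
      · left; exact mem_Icc.2 ⟨hn.1.1, h⟩
    have h1 := (card_le_card hsub).trans (card_union_le _ _)
    rw [Nat.card_Icc] at h1
    have h2 : (R.card : ℝ) ≤ V + (badset X ((X : ℝ) ^ (1 / 2 : ℝ))).card := by exact_mod_cast h1
    have h3 : (V : ℝ) ≤ (X : ℝ) ^ (1 / 2 : ℝ) := Nat.floor_le (by positivity)
    have h4 : (X : ℝ) ^ (1 / 2 : ℝ) ≤ (X : ℝ) ^ (5 / 6 : ℝ) := hmono (by norm_num)
    have h5 := badset_card hX (δ := 1 / 2)
    rw [show (1 - 1 / 2 / 3 : ℝ) = 5 / 6 by norm_num] at h5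
    linarith
  have hRs : |∑ n ∈ R, vonMangoldt n * F r n| ≤ 3 * (X : ℝ) ^ (5 / 6 : ℝ) * (L * T) := by
    refine (abs_sum_le_sum_abs _ _).trans ?_
    calc _ ≤ ∑ n ∈ R, L * T := by
          refine sum_le_sum fun n hn => ?_
          rw [hR, mem_filter, mem_Icc] at hn
          rw [abs_mul, abs_of_nonneg vonMangoldt_nonneg]
          exact mul_le_mul (vonMangoldt_le_L hn.1.2) (F_le hr hT hn.1.2) (abs_nonneg _) (by linarith)
      _ = R.card * (L * T) := by rw [sum_const, nsmul_eq_mul]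
      _ ≤ _ := by gcongr
  have hLb : L ≤ 25 * (X : ℝ) ^ (1 / 24 : ℝ) := by
    have h2 : Real.log X ≤ (X : ℝ) ^ (1 / 24 : ℝ) / (1 / 24) := Real.log_le_rpow_div hX0.le (by norm_num)
    have h3 : 1 ≤ (X : ℝ) ^ (1 / 24 : ℝ) := Real.one_le_rpow hXr (by norm_num)
    rw [hL]; linarith
  have hfin : 3 * (X : ℝ) ^ (5 / 6 : ℝ) * (L * T) ≤ 3 * (25 * CT) * (X : ℝ) ^ (1 - η) := by
    calc _ ≤ 3 * (X : ℝ) ^ (5 / 6 : ℝ) * ((25 * (X : ℝ) ^ (1 / 24 : ℝ)) * (CT * (X : ℝ) ^ (1 / 24 : ℝ))) := by gcongr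
      _ = 3 * (25 * CT) * ((X : ℝ) ^ (5 / 6 : ℝ) * (X : ℝ) ^ (1 / 24 : ℝ) * (X : ℝ) ^ (1 / 24 : ℝ)) := by ring
      _ = 3 * (25 * CT) * (X : ℝ) ^ (5 / 6 + 1 / 24 + 1 / 24 : ℝ) := by
        rw [← Real.rpow_add hX0, ← Real.rpow_add hX0]
      _ ≤ _ := by
        gcongr 3 * (25 * CT) * ?_
        exact hmono (by linarith)
  rw [hsplit]
  refine (abs_sub _ _).trans ?_
  have := H X hX
  calc _ ≤ C * (X : ℝ) ^ (1 - η) + 3 * (25 * CT) * (X : ℝ) ^ (1 - η) := add_le_add this (hRs.trans hfin)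
    _ = _ := by ring

/-- Power saving for the sum over primes. -/
theorem prime_bound {r : ℕ} (hr : r % 16 = 15) : ∃ C η : ℝ, 1 ≤ C ∧ 0 < η ∧ η ≤ 1 ∧ ∀ X : ℕ, 1 ≤ X →
    |∑ n ∈ (Icc 1 X).filter Nat.Prime, F r n| ≤ C * (X : ℝ) ^ (1 - η) := by
  obtain ⟨C, η, hC, hη, hη1, H⟩ := theta_bound hr
  have hl2 : 0 < Real.log 2 := Real.log_pos (by norm_num)
  have hl2' : Real.log 2 < 1 := by have := Real.log_two_lt_d9; linarith
  set c : ℝ := 1 / Real.log 2 with hc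
  have hc1 : 1 ≤ c := by rw [hc, le_div_iff₀ hl2]; linarith
  refine ⟨c * C + 2 * (c * C), η, by nlinarith, hη, hη1, ?_⟩
  intro X hX
  have hXr : (1 : ℝ) ≤ X := by exact_mod_cast hX
  set g : ℕ → ℝ := fun n => if n.Prime then Real.log n * F r n else 0 with hg
  set w : ℕ → ℝ := fun n => c - 1 / Real.log ((max n 2 : ℕ) : ℝ) with hw
  have hlm : ∀ n : ℕ, Real.log 2 ≤ Real.log ((max n 2 : ℕ) : ℝ) := fun n =>
    Real.log_le_log (by norm_num) (by exact_mod_cast le_max_right n 2)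
  have hB : ∀ k ≤ X + 1, |∑ i ∈ range k, g i| ≤ C * (X : ℝ) ^ (1 - η) := by
    intro k hk
    have e : ∑ i ∈ range k, g i = ∑ i ∈ Icc 1 (k - 1), g i := by
      symm
      refine sum_subset ?_ ?_
      · intro i hi; rw [mem_Icc] at hi; rw [mem_range]; omega
      · intro i hi hi'
        rw [mem_range] at hi; rw [mem_Icc] at hi'
        have : i = 0 := by omega
        subst this; simp [hg, Nat.not_prime_zero]
    rw [e]
    rcases Nat.lt_or_ge k 2 with h | h
    · have : Icc 1 (k - 1) = ∅ := by rw [Icc_eq_empty]; omega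
      rw [this]; simp; positivity
    · refine (H (k - 1) (by omega)).trans ?_
      have : ((k - 1 : ℕ) : ℝ) ≤ X := by exact_mod_cast (by omega)
      have : 0 ≤ 1 - η := by linarith
      gcongr
  have hab := abel_mono (w := w) (g := g) (W := c) (B := C * (X : ℝ) ^ (1 - η)) (Nat.succ_pos X)
    (by
      intro a b hab
      simp only [hw]
      have h1 : 1 / Real.log ((max b 2 : ℕ) : ℝ) ≤ 1 / Real.log ((max a 2 : ℕ) : ℝ) := by
        apply one_div_le_one_div_of_le (lt_of_lt_of_le hl2 (hlm a))
        apply Real.log_le_log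
        · have : 0 < max a 2 := by omega
          exact_mod_cast this
        · exact_mod_cast max_le_max_right 2 hab
      linarith)
    (by
      intro i
      simp only [hw]
      have := one_div_le_one_div_of_le hl2 (hlm i)
      linarith)
    (by
      intro i _
      simp only [hw]
      have : 0 < 1 / Real.log ((max i 2 : ℕ) : ℝ) := one_div_pos.2 (lt_of_lt_of_le hl2 (hlm i))
      linarith) hB
  have e : ∑ n ∈ (Icc 1 X).filter Nat.Prime, F r n = c * (∑ i ∈ range (X + 1), g i) - ∑ i ∈ range (X + 1), w i * g i := by
    rw [mul_sum, ← sum_sub_distrib, sum_filter]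
    have : ∀ i, c * g i - w i * g i = if i.Prime then F r i else 0 := by
      intro i
      simp only [hw, hg]
      split_ifs with hp
      · rw [max_eq_left hp.two_le]
        have : 0 < Real.log i := Real.log_pos (by exact_mod_cast hp.one_lt)
        field_simp; ring
      · ring
    simp_rw [this]
    refine sum_subset ?_ ?_
    · intro i hi; rw [mem_Icc] at hi; rw [mem_range]; omega
    · intro i hi hi'
      rw [mem_range] at hi; rw [mem_Icc] at hi'
      have : i = 0 := by omega
      subst this; simp [Nat.not_prime_zero]
  rw [e]
  refine (abs_sub _ _).trans ?_
  rw [abs_mul, abs_of_pos (by linarith : 0 < c)]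
  have h1 := hB (X + 1) le_rfl
  calc _ ≤ c * (C * (X : ℝ) ^ (1 - η)) + 2 * (c * (C * (X : ℝ) ^ (1 - η))) := by gcongr
    _ = _ := by ring

end QB

end

section

open Finset

namespace QB

open ArithmeticFunction ArithmeticFunction.vonMangoldt Complex LSeries in
theorem resid_series {q : ℕ} [NeZero q] {a : ZMod q} (ha : IsUnit a) {x : ℝ} (hx : 1 < x) :
    ∑' n, residueClass a n / (n : ℝ) ^ x =
      (LFunctionResidueClassAux a x).re + (q.totient : ℝ)⁻¹ / (x - 1) := by
  refine ofReal_injective ?_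
  simp only [ofReal_tsum, ofReal_div, ofReal_cpow (Nat.cast_nonneg _), ofReal_natCast,
    ofReal_add, ofReal_inv, ofReal_sub, ofReal_one]
  simp_rw [← LFunctionResidueClassAux_real ha hx,
    eqOn_LFunctionResidueClassAux ha <| Set.mem_ofPred.mpr (ofReal_re x ▸ hx), sub_add_cancel,
    LSeries, term]
  refine tsum_congr fun n ↦ ?_
  split_ifs with hn
  · simp only [hn, residueClass_apply_zero, ofReal_zero, zero_div]
  · rfl

open ArithmeticFunction ArithmeticFunction.vonMangoldt LSeries in
theorem resid_summable {q : ℕ} [NeZero q] (a : ZMod q) {x : ℝ} (hx : 1 < x) :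
    Summable fun n : ℕ => residueClass a n / (n : ℝ) ^ x :=
  summable_real_of_abscissaOfAbsConv_lt <|
        (abscissaOfAbsConv_residueClass_le_one a).trans_lt <| mod_cast hx

open ArithmeticFunction ArithmeticFunction.vonMangoldt Filter Topology in
theorem resid_tendsto {q : ℕ} [NeZero q] {a : ZMod q} (ha : IsUnit a) (k : ℕ) :
    Tendsto (fun σ : ℝ => σ * ∑' n, residueClass a n / (n : ℝ) ^ (1 + (k + 1) * σ)) (𝓝[>] 0)
      (𝓝 ((q.totient : ℝ)⁻¹ / (k + 1))) := by
  have hc : ContinuousOn (fun x : ℝ ↦ (LFunctionResidueClassAux a x).re) (Set.Ici 1) :=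
    Complex.continuous_re.continuousOn.comp (t := Set.univ) (continuousOn_LFunctionResidueClassAux a)
      (fun ⦃x⦄ a ↦ trivial) |>.comp Complex.continuous_ofReal.continuousOn fun x hx ↦ by
        simpa only [Set.mem_ofPred_eq, Complex.ofReal_re] using Set.mem_Ici.1 hx
  have hk : (0 : ℝ) < k + 1 := by positivity
  have h1 : Tendsto (fun σ : ℝ => 1 + (k + 1) * σ) (𝓝[>] 0) (𝓝[≥] 1) := by
    refine tendsto_nhdsWithin_iff.2 ⟨?_, ?_⟩
    · have : Tendsto (fun σ : ℝ => 1 + ((k : ℝ) + 1) * σ) (𝓝 0) (𝓝 (1 + (k + 1) * 0)) := by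
        apply Continuous.tendsto; fun_prop
      rw [mul_zero, add_zero] at this
      exact this.mono_left nhdsWithin_le_nhds
    · filter_upwards [self_mem_nhdsWithin] with σ hσ
      have : (0 : ℝ) < σ := hσ
      simp only [Set.mem_Ici]; nlinarith
  have h2 := ((hc 1 (by simp)).tendsto).comp h1
  have h3 : Tendsto (fun σ : ℝ => σ) (𝓝[>] 0) (𝓝 0) := tendsto_id.mono_left nhdsWithin_le_nhds
  have h4 := (h3.mul h2).add_const ((q.totient : ℝ)⁻¹ / (k + 1))
  rw [zero_mul, zero_add] at h4
  refine h4.congr' ?_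
  filter_upwards [self_mem_nhdsWithin] with σ hσ
  have hσ0 : (0 : ℝ) < σ := hσ
  rw [resid_series ha (by nlinarith)]
  simp only [Function.comp]
  rw [mul_add]
  congr 1
  field_simp
  ring

open ArithmeticFunction ArithmeticFunction.vonMangoldt in
theorem term_mono {q : ℕ} [NeZero q] (a : ZMod q) (k : ℕ) (b σ : ℝ) (n : ℕ) :
    residueClass a n / n * ((n : ℝ) ^ (-σ) * (Polynomial.monomial k b).eval ((n : ℝ) ^ (-σ))) =
      b * (residueClass a n / (n : ℝ) ^ (1 + (k + 1) * σ)) := by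
  rcases Nat.eq_zero_or_pos n with rfl | hn
  · simp [residueClass_apply_zero]
  · have hn0 : (0 : ℝ) < n := by exact_mod_cast hn
    rw [Polynomial.eval_monomial, Real.rpow_add hn0, Real.rpow_one, Real.rpow_neg hn0.le,
      show ((k : ℝ) + 1) * σ = σ * ((k + 1 : ℕ) : ℝ) by push_cast; ring, Real.rpow_mul hn0.le,
      Real.rpow_natCast]
    have : (0 : ℝ) < (n : ℝ) ^ σ := by positivity
    rw [pow_succ, inv_pow]
    field_simp

open ArithmeticFunction ArithmeticFunction.vonMangoldt Filter Topology in
theorem resid_poly {q : ℕ} [NeZero q] {a : ZMod q} (ha : IsUnit a) (Q : Polynomial ℝ) :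
    (∀ σ : ℝ, 0 < σ → Summable fun n : ℕ =>
      residueClass a n / n * ((n : ℝ) ^ (-σ) * Q.eval ((n : ℝ) ^ (-σ)))) ∧
    Tendsto (fun σ : ℝ => σ * ∑' n : ℕ,
      residueClass a n / n * ((n : ℝ) ^ (-σ) * Q.eval ((n : ℝ) ^ (-σ)))) (𝓝[>] 0)
      (𝓝 ((q.totient : ℝ)⁻¹ * ∫ t in (0 : ℝ)..1, Q.eval t)) := by
  induction Q using Polynomial.induction_on' with
  | add P R hP hR =>
    refine ⟨fun σ hσ => ?_, ?_⟩
    · refine ((hP.1 σ hσ).add (hR.1 σ hσ)).congr fun n => ?_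
      rw [Polynomial.eval_add]; ring
    · have h := hP.2.add hR.2
      have e : (q.totient : ℝ)⁻¹ * ∫ t in (0 : ℝ)..1, (P + R).eval t =
          (q.totient : ℝ)⁻¹ * (∫ t in (0 : ℝ)..1, P.eval t) + (q.totient : ℝ)⁻¹ * ∫ t in (0 : ℝ)..1, R.eval t := by
        simp only [Polynomial.eval_add]
        rw [intervalIntegral.integral_add (P.continuous.intervalIntegrable _ _)
          (R.continuous.intervalIntegrable _ _)]
        ring
      rw [e]
      refine h.congr' ?_
      filter_upwards [self_mem_nhdsWithin] with σ hσ
      rw [← mul_add, ← (hP.1 σ hσ).tsum_add (hR.1 σ hσ)]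
      congr 1
      refine tsum_congr fun n => ?_
      rw [Polynomial.eval_add]; ring
  | monomial k b =>
    simp only [term_mono]
    refine ⟨fun σ hσ => (resid_summable a (by
      have : (0 : ℝ) < (k + 1) * σ := by positivity
      linarith)).mul_left b, ?_⟩
    have h := (resid_tendsto ha k).const_mul b
    have e : ∫ t in (0 : ℝ)..1, (Polynomial.monomial k b).eval t = b * (1 / (k + 1)) := by
      simp only [Polynomial.eval_monomial]
      rw [intervalIntegral.integral_const_mul, integral_pow]
      simp
    rw [e]
    have e2 : (q.totient : ℝ)⁻¹ * (b * (1 / ((k : ℝ) + 1))) = b * ((q.totient : ℝ)⁻¹ / (k + 1)) := by ring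
    rw [e2]
    refine h.congr fun σ => ?_
    rw [tsum_mul_left]; ring

theorem exists_peak {t0 ρ : ℝ} (hρ : 0 < ρ) (h0 : 0 < t0 - ρ) (h1 : t0 + ρ < 1) :
    ∃ Q : Polynomial ℝ, (∀ t, 0 ≤ t → t ≤ 1 → Q.eval t ≤ 1) ∧
      (∀ t, 0 ≤ t → t ≤ 1 → ρ ≤ |t - t0| → Q.eval t ≤ 0) ∧ 0 < ∫ t in (0 : ℝ)..1, Q.eval t := by
  have hρ1 : ρ < 1 / 2 := by linarith
  have hA : 0 < 1 - ρ ^ 2 := by nlinarith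
  have hB : 0 < 1 - ρ ^ 2 / 4 := by nlinarith
  obtain ⟨N, hN⟩ := exists_pow_lt_of_lt_one hρ
    (show (1 - ρ ^ 2) / (1 - ρ ^ 2 / 4) < 1 by rw [div_lt_one hB]; nlinarith)
  rw [div_pow, div_lt_iff₀ (by positivity)] at hN
  have hev : ∀ t : ℝ, ((1 - (Polynomial.X - Polynomial.C t0) ^ 2) ^ N - Polynomial.C ((1 - ρ ^ 2) ^ N)).eval t
      = (1 - (t - t0) ^ 2) ^ N - (1 - ρ ^ 2) ^ N := by intro t; simp
  have hb : ∀ t, 0 ≤ t → t ≤ 1 → 0 ≤ 1 - (t - t0) ^ 2 := by intro t h h'; nlinarith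
  refine ⟨(1 - (Polynomial.X - Polynomial.C t0) ^ 2) ^ N - Polynomial.C ((1 - ρ ^ 2) ^ N), ?_, ?_, ?_⟩
  · intro t ht ht'
    rw [hev]
    have := pow_le_one₀ (n := N) (hb t ht ht') (by nlinarith [sq_nonneg (t - t0)])
    have := pow_pos hA N
    linarith
  · intro t ht ht' h
    rw [hev, sub_nonpos]
    refine pow_le_pow_left₀ (hb t ht ht') ?_ N
    have : ρ ^ 2 ≤ |t - t0| ^ 2 := pow_le_pow_left₀ hρ.le h 2
    rw [sq_abs] at this
    linarith
  · simp only [hev]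
    have hc : Continuous fun t : ℝ => (1 - (t - t0) ^ 2) ^ N := by fun_prop
    rw [intervalIntegral.integral_sub (hc.intervalIntegrable _ _) (by simp)]
    have i1 : ∫ t in (t0 - ρ / 2)..(t0 + ρ / 2), (1 - (t - t0) ^ 2) ^ N ≤ ∫ t in (0 : ℝ)..1, (1 - (t - t0) ^ 2) ^ N := by
      refine intervalIntegral.integral_mono_interval (by linarith) (by linarith) (by linarith) ?_
        (hc.intervalIntegrable _ _)
      rw [Filter.EventuallyLE, MeasureTheory.ae_restrict_iff' measurableSet_Ioc]
      filter_upwards with t ht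
      exact pow_nonneg (hb t ht.1.le ht.2) N
    have i2 : ∫ t in (t0 - ρ / 2)..(t0 + ρ / 2), (1 - ρ ^ 2 / 4) ^ N ≤
        ∫ t in (t0 - ρ / 2)..(t0 + ρ / 2), (1 - (t - t0) ^ 2) ^ N := by
      refine intervalIntegral.integral_mono_on (by linarith) (by simp) (hc.intervalIntegrable _ _) ?_
      intro t ht
      refine pow_le_pow_left₀ hB.le ?_ N
      nlinarith [ht.1, ht.2]
    rw [intervalIntegral.integral_const, smul_eq_mul] at i2
    rw [intervalIntegral.integral_const, smul_eq_mul]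
    nlinarith

open ArithmeticFunction ArithmeticFunction.vonMangoldt Filter Topology in
theorem psi_lower {q : ℕ} [NeZero q] {a : ZMod q} (ha : IsUnit a) {ε : ℝ} (hε : 0 < ε) (hε1 : ε < 1) :
    ∃ c : ℝ, 0 < c ∧ ∀ᶠ X : ℕ in atTop,
      c * (X : ℝ) ^ (1 - ε) * Real.log X ≤ ∑ n ∈ Icc 1 X, residueClass a n := by
  have hlt : Real.exp (-1) < Real.exp (-(1 - ε)) := Real.exp_lt_exp.2 (by linarith)
  have hl1 : Real.exp (-(1 - ε)) < 1 := by rw [Real.exp_lt_one_iff]; linarith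
  have hl0 := Real.exp_pos (-1)
  set u := Real.exp (-1) with hu
  set v := Real.exp (-(1 - ε)) with hv
  obtain ⟨Q, hQ1, hQ0, hQi⟩ := exists_peak (t0 := (u + v) / 2) (ρ := (v - u) / 2) (by linarith)
    (by linarith) (by linarith)
  obtain ⟨hs, hT⟩ := resid_poly ha Q
  have hq : 0 < (q.totient : ℝ)⁻¹ := inv_pos.mpr (mod_cast q.totient.pos_of_neZero)
  set I := (q.totient : ℝ)⁻¹ * ∫ t in (0 : ℝ)..1, Q.eval t with hI
  have hI0 : 0 < I := mul_pos hq hQi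
  refine ⟨I / 2, by linarith, ?_⟩
  have hσ : Tendsto (fun X : ℕ => 1 / Real.log X) atTop (𝓝[>] 0) := by
    have h1 : Tendsto (fun X : ℕ => Real.log X) atTop atTop :=
      Real.tendsto_log_atTop.comp tendsto_natCast_atTop_atTop
    simp only [one_div]
    exact tendsto_inv_atTop_nhdsGT_zero.comp h1
  have hev := (hT.comp hσ).eventually (lt_mem_nhds (show I / 2 < I by linarith))
  filter_upwards [hev, eventually_ge_atTop 3] with X hX hX3
  simp only [Function.comp] at hX
  have hXr : (3 : ℝ) ≤ X := by exact_mod_cast hX3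
  have hX0 : (0 : ℝ) < X := by linarith
  have hL : 0 < Real.log X := Real.log_pos (by linarith)
  set σ := 1 / Real.log X with hσd
  have hσ0 : 0 < σ := by positivity
  have hP : 0 < (X : ℝ) ^ (1 - ε) := by positivity
  have hle : ∑' n : ℕ, residueClass a n / n * ((n : ℝ) ^ (-σ) * Q.eval ((n : ℝ) ^ (-σ))) ≤
      ∑ n ∈ Icc 1 X, residueClass a n / (X : ℝ) ^ (1 - ε) := by
    have hg : ∀ n ∉ Icc 1 X, (if n ∈ Icc 1 X then residueClass a n / (X : ℝ) ^ (1 - ε) else 0) = 0 := by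
      intro n hn; rw [if_neg hn]
    have e : ∑ n ∈ Icc 1 X, residueClass a n / (X : ℝ) ^ (1 - ε) =
        ∑' n, (if n ∈ Icc 1 X then residueClass a n / (X : ℝ) ^ (1 - ε) else 0) := by
      rw [tsum_eq_sum hg]
      refine sum_congr rfl fun n hn => ?_
      rw [if_pos hn]
    rw [e]
    refine Summable.tsum_le_tsum (fun n => ?_) (hs σ hσ0) (summable_of_ne_finset_zero hg)
    have hr0 := residueClass_nonneg a n
    have hrhs : 0 ≤ (if n ∈ Icc 1 X then residueClass a n / (X : ℝ) ^ (1 - ε) else 0) := by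
      split_ifs <;> positivity
    rcases Nat.eq_zero_or_pos n with rfl | hn
    · simp
    have hn0 : (0 : ℝ) < n := by exact_mod_cast hn
    have hn1 : (1 : ℝ) ≤ n := by exact_mod_cast hn
    have ht0 : 0 < (n : ℝ) ^ (-σ) := by positivity
    have ht1 : (n : ℝ) ^ (-σ) ≤ 1 := Real.rpow_le_one_of_one_le_of_nonpos hn1 (by linarith)
    have hte : (n : ℝ) ^ (-σ) = Real.exp (-(Real.log n / Real.log X)) := by
      rw [Real.rpow_def_of_pos hn0, hσd]; congr 1; ring
    by_cases hin : u < (n : ℝ) ^ (-σ) ∧ (n : ℝ) ^ (-σ) < v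
    · have h1 : Real.log n / Real.log X < 1 := by
        have := hin.1
        rw [hte, hu, Real.exp_lt_exp] at this; linarith
      have h2 : 1 - ε < Real.log n / Real.log X := by
        have := hin.2
        rw [hte, hv, Real.exp_lt_exp] at this; linarith
      rw [div_lt_one hL] at h1
      rw [lt_div_iff₀ hL] at h2
      have h3 : (n : ℝ) < X := (Real.log_lt_log_iff hn0 hX0).1 h1
      have h4 : (X : ℝ) ^ (1 - ε) < n := by
        rw [Real.rpow_def_of_pos hX0, ← Real.lt_log_iff_exp_lt hn0]; linarith
      rw [if_pos (mem_Icc.2 ⟨hn, by exact_mod_cast h3.le⟩)]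
      calc _ ≤ residueClass a n / n * 1 := by
            refine mul_le_mul_of_nonneg_left ?_ (by positivity)
            have := hQ1 _ ht0.le ht1
            nlinarith
        _ = residueClass a n / n := mul_one _
        _ ≤ _ := by gcongr
    · refine le_trans ?_ hrhs
      refine mul_nonpos_of_nonneg_of_nonpos (by positivity) ?_
      refine mul_nonpos_of_nonneg_of_nonpos ht0.le (hQ0 _ ht0.le ht1 ?_)
      rcases le_or_gt ((n : ℝ) ^ (-σ)) u with h | h
      · rw [le_abs]; right; linarith
      · have : v ≤ (n : ℝ) ^ (-σ) := by
          by_contra h'; exact hin ⟨h, not_le.1 h'⟩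
        rw [le_abs]; left; linarith
  rw [← sum_div] at hle
  have h5 := hX.trans_le (mul_le_mul_of_nonneg_left hle hσ0.le)
  rw [hσd, one_div, inv_mul_eq_div, lt_div_iff₀ hL, lt_div_iff₀ hP] at h5
  linarith

theorem nonprime_card {X : ℕ} (hX : 1 ≤ X) :
    (((Icc 1 X).filter (fun n => IsPrimePow n ∧ ¬ n.Prime)).card : ℝ) ≤ 3 * (X : ℝ) ^ (5 / 6 : ℝ) := by
  classical
  have hXr : (1 : ℝ) ≤ X := by exact_mod_cast hX
  set V : ℕ := ⌊(X : ℝ) ^ (1 / 2 : ℝ)⌋₊ with hV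
  have hsub : (Icc 1 X).filter (fun n => IsPrimePow n ∧ ¬ n.Prime) ⊆
      Icc 1 V ∪ badset X ((X : ℝ) ^ (1 / 2 : ℝ)) := by
    intro n hn
    rw [mem_filter, mem_Icc] at hn
    rw [mem_union]
    rcases Nat.lt_or_ge V n with h | h
    · right
      unfold badset
      rw [mem_filter, mem_Icc]
      obtain ⟨s, hs1, hs2⟩ := pp_sq hn.2.1 hn.2.2
      refine ⟨hn.1, s, lt_of_lt_of_le (Nat.lt_of_floor_lt h) (by exact_mod_cast hs2), hs1⟩
    · left; exact mem_Icc.2 ⟨hn.1.1, h⟩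
  have h1 := (card_le_card hsub).trans (card_union_le _ _)
  rw [Nat.card_Icc] at h1
  have h2 : (((Icc 1 X).filter (fun n => IsPrimePow n ∧ ¬ n.Prime)).card : ℝ) ≤
    V + (badset X ((X : ℝ) ^ (1 / 2 : ℝ))).card := by exact_mod_cast h1
  have h3 : (V : ℝ) ≤ (X : ℝ) ^ (1 / 2 : ℝ) := Nat.floor_le (by positivity)
  have h4 : (X : ℝ) ^ (1 / 2 : ℝ) ≤ (X : ℝ) ^ (5 / 6 : ℝ) :=
    Real.rpow_le_rpow_of_exponent_le hXr (by norm_num)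
  have h5 := badset_card hX (δ := 1 / 2)
  rw [show (1 - 1 / 2 / 3 : ℝ) = 5 / 6 by norm_num] at h5
  linarith

open ArithmeticFunction ArithmeticFunction.vonMangoldt Filter Topology in
theorem pi_lower {r : ℕ} (hr : r = 15 ∨ r = 31) {ε : ℝ} (hε : 0 < ε) (hε1 : ε < 1 / 6) :
    ∃ c : ℝ, 0 < c ∧ ∀ᶠ X : ℕ in atTop,
      c * (X : ℝ) ^ (1 - ε) ≤ ((Icc 1 X).filter (fun p => p.Prime ∧ p % 32 = r)).card := by
  classical
  have ha : IsUnit ((r : ℕ) : ZMod 32) := by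
    rw [ZMod.isUnit_iff_coprime]
    rcases hr with rfl | rfl <;> decide
  have hr32 : r < 32 := by omega
  obtain ⟨c, hc, H⟩ := psi_lower ha hε (by linarith)
  refine ⟨c / 4, by linarith, ?_⟩
  have ht : Tendsto (fun X : ℕ => (X : ℝ) ^ (1 / 6 - ε)) atTop atTop :=
    (tendsto_rpow_atTop (by linarith)).comp tendsto_natCast_atTop_atTop
  filter_upwards [H, eventually_ge_atTop 3, ht.eventually_ge_atTop (12 / c)] with X hX hX3 hX6
  have hXr : (3 : ℝ) ≤ X := by exact_mod_cast hX3
  have hX0 : (0 : ℝ) < X := by linarith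
  have hL : 1 < Real.log X := by
    rw [Real.lt_log_iff_exp_lt hX0]
    linarith [Real.exp_one_lt_d9]
  set P := (Icc 1 X).filter (fun p => p.Prime ∧ p % 32 = r) with hP
  set R := (Icc 1 X).filter (fun n => IsPrimePow n ∧ ¬ n.Prime) with hR
  have hRc : (R.card : ℝ) ≤ 3 * (X : ℝ) ^ (5 / 6 : ℝ) := nonprime_card (by omega)
  have h1 : ∑ n ∈ Icc 1 X, residueClass ((r : ℕ) : ZMod 32) n ≤
      ∑ n ∈ P ∪ R, (Real.log X + 1) := by
    have hsub : P ∪ R ⊆ Icc 1 X := union_subset (filter_subset _ _) (filter_subset _ _)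
    rw [← sum_subset hsub (f := fun n => residueClass ((r : ℕ) : ZMod 32) n)]
    · refine sum_le_sum fun n hn => (residueClass_le _ n).trans (vonMangoldt_le_L (mem_Icc.1 (hsub hn)).2)
    · intro n hn hn'
      rw [mem_union, hP, hR, mem_filter, mem_filter] at hn'
      simp only [residueClass, Set.indicator_apply, Set.mem_ofPred_eq]
      split_ifs with h
      · rw [vonMangoldt_eq_zero_iff]
        rw [ZMod.natCast_eq_natCast_iff, Nat.ModEq, Nat.mod_eq_of_lt hr32] at h
        tauto
      · rfl
  rw [sum_const, nsmul_eq_mul] at h1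
  have h2 : (((P ∪ R).card : ℕ) : ℝ) ≤ P.card + R.card := by exact_mod_cast card_union_le _ _
  have h3 : 12 * (X : ℝ) ^ (5 / 6 : ℝ) ≤ c * (X : ℝ) ^ (1 - ε) := by
    rw [show 1 - ε = 5 / 6 + (1 / 6 - ε) by ring, Real.rpow_add hX0]
    rw [div_le_iff₀ hc] at hX6
    have : 0 < (X : ℝ) ^ (5 / 6 : ℝ) := by positivity
    nlinarith
  have h4 : c * (X : ℝ) ^ (1 - ε) * Real.log X ≤ (P.card + R.card : ℝ) * 2 * Real.log X := by
    refine (hX.trans h1).trans ?_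
    calc _ ≤ (P.card + R.card : ℝ) * (Real.log X + 1) := by gcongr
      _ ≤ (P.card + R.card : ℝ) * (2 * Real.log X) := by gcongr; linarith
      _ = _ := by ring
  have h5 := le_of_mul_le_mul_right h4 (by linarith)
  linarith

end QB

end

section

open Finset

namespace QB

open Filter Topology in
theorem density_main (h : ℕ → ℕ)
    (hclass : ∀ p : ℕ, p.Prime → p % 8 = 7 →
      ∀ (F : Type) [Field F] [NumberField F],
        Nonempty (F ≃ₐ[ℚ] AdjoinRoot (Polynomial.X ^ 2 + Polynomial.C (2 * p : ℚ))) →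
          h p = NumberField.classNumber F)
    {r : ℕ} (hr : r = 15 ∨ r = 31) :
    Tendsto
      (fun X : ℕ =>
        (Nat.card {p : ℕ | p ≤ X ∧ p.Prime ∧ p % 32 = r ∧ 8 ∣ h p ∧ ¬ 16 ∣ h p} : ℝ) /
          (Nat.card {p : ℕ | p ≤ X ∧ p.Prime ∧ p % 32 = r} : ℝ))
      atTop (𝓝 (1 / 2)) := by
  classical
  have hr16 : r % 16 = 15 := by omega
  obtain ⟨C, η, hC, hη, hη1, H⟩ := prime_bound hr16
  obtain ⟨c, hc, Hc⟩ := pi_lower hr (ε := η / 12) (by linarith) (by linarith)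
  have key : ∀ X : ℕ, ∑ n ∈ (Icc 1 X).filter Nat.Prime, F r n =
      2 * (((Icc 1 X).filter (fun p => p.Prime ∧ p % 32 = r)).card : ℝ) -
        4 * (((Icc 1 X).filter (fun p => p.Prime ∧ p % 32 = r ∧ 8 ∣ h p ∧ ¬ 16 ∣ h p)).card : ℝ) := by
    intro X
    rw [card_filter, card_filter, sum_filter]
    push_cast
    rw [mul_sum, mul_sum, ← sum_sub_distrib]
    refine sum_congr rfl fun n _ => ?_
    by_cases hp : n.Prime
    · by_cases hn : n % 32 = r
      · obtain ⟨h8, hF⟩ := F_prime h hclass hp hn hr16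
        rw [hF]
        by_cases h16 : 16 ∣ h n
        · simp [hp, hn, h16]
        · simp [hp, hn, h16, h8]; norm_num
      · have : F r n = 0 := by unfold F; exact if_neg hn
        simp [hn, this]
    · simp [hp]
  have cc : ∀ (X : ℕ) (P : ℕ → Prop) [DecidablePred P], Nat.card {p : ℕ | p ≤ X ∧ p.Prime ∧ P p} =
      ((Icc 1 X).filter (fun p => p.Prime ∧ P p)).card := by
    intro X P _
    rw [Nat.card_coe_set_eq, ← Set.ncard_coe_finset]
    congr 1
    ext p
    simp only [Set.mem_ofPred_eq, coe_filter, mem_Icc]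
    constructor
    · rintro ⟨h1, h2, h3⟩; exact ⟨⟨h2.one_lt.le, h1⟩, h2, h3⟩
    · rintro ⟨⟨_, h1⟩, h2, h3⟩; exact ⟨h1, h2, h3⟩
  have hz : Tendsto (fun X : ℕ => C / (4 * c) * (X : ℝ) ^ (-(η * 11 / 12))) atTop (𝓝 0) := by
    have := (tendsto_rpow_neg_atTop (show 0 < η * 11 / 12 by linarith)).comp
      (tendsto_natCast_atTop_atTop (R := ℝ))
    simpa using this.const_mul (C / (4 * c))
  rw [tendsto_iff_norm_sub_tendsto_zero]
  refine squeeze_zero' (Eventually.of_forall fun _ => norm_nonneg _) ?_ hz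
  filter_upwards [Hc, eventually_ge_atTop 1] with X hX hX1
  rw [cc X (fun p => p % 32 = r), cc X (fun p => p % 32 = r ∧ 8 ∣ h p ∧ ¬ 16 ∣ h p)]
  have hk := key X
  have hb := H X hX1
  have hX0 : (0 : ℝ) < X := by exact_mod_cast hX1
  set S := ∑ n ∈ (Icc 1 X).filter Nat.Prime, F r n
  set A : ℝ := (((Icc 1 X).filter (fun p => p.Prime ∧ p % 32 = r)).card : ℝ)
  set B : ℝ := (((Icc 1 X).filter (fun p => p.Prime ∧ p % 32 = r ∧ 8 ∣ h p ∧ ¬ 16 ∣ h p)).card : ℝ)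
  have hy : 0 < c * (X : ℝ) ^ (1 - η / 12) := by positivity
  have hA : 0 < A := by linarith
  have e : B / A - 1 / 2 = -(S / (4 * A)) := by
    rw [hk]; field_simp; ring
  rw [e, norm_neg, Real.norm_eq_abs, abs_div, abs_of_pos (show 0 < 4 * A by linarith)]
  calc |S| / (4 * A) ≤ (C * (X : ℝ) ^ (1 - η)) / (4 * (c * (X : ℝ) ^ (1 - η / 12))) := by gcongr
    _ = C / (4 * c) * ((X : ℝ) ^ (1 - η) / (X : ℝ) ^ (1 - η / 12)) := by
      field_simp
    _ = _ := by
      rw [← Real.rpow_sub hX0]; congr 2; ring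

end QB

end

open Polynomial NumberField Filter

/-- Writing `h p` for the class number of the imaginary quadratic field
`ℚ(√(-2p)) = ℚ[x]/(x² + 2p)`, the primes with `8 ∥ h(-2p)` have relative density `1/2`
among primes `p ≡ 15 (mod 32)`, and likewise relative density `1/2` among primes
`p ≡ 31 (mod 32)`. -/
theorem density_eight_exactly_divides_classNumber_neg_two_p
    (h : ℕ → ℕ)
    (hclass : ∀ p : ℕ, p.Prime → p % 8 = 7 →
      ∀ (F : Type) [Field F] [NumberField F],
        Nonempty (F ≃ₐ[ℚ] AdjoinRoot (X ^ 2 + C (2 * p : ℚ))) → h p = classNumber F) :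
    Tendsto
      (fun X : ℕ =>
        (Nat.card {p : ℕ | p ≤ X ∧ p.Prime ∧ p % 32 = 15 ∧ 8 ∣ h p ∧ ¬ 16 ∣ h p} : ℝ) /
          (Nat.card {p : ℕ | p ≤ X ∧ p.Prime ∧ p % 32 = 15} : ℝ))
      atTop (nhds (1 / 2)) ∧
    Tendsto
      (fun X : ℕ =>
        (Nat.card {p : ℕ | p ≤ X ∧ p.Prime ∧ p % 32 = 31 ∧ 8 ∣ h p ∧ ¬ 16 ∣ h p} : ℝ) /
          (Nat.card {p : ℕ | p ≤ X ∧ p.Prime ∧ p % 32 = 31} : ℝ))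
      atTop (nhds (1 / 2)) := by
  exact ⟨QB.density_main h hclass (Or.inl rfl), QB.density_main h hclass (Or.inr rfl)⟩
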